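/- Let G(1) = (8/9) ∏_{p ≡ 1 mod 4} p³(p+2) / ( (p−1)(p+1)³ ) · ∏_{p ≡ 3 mod 4} p⁴/(p⁴ − 1), let g = −(1/3) log 2 − 6 ∑_{p ≡ 1 mod 4} (log p)/( (p+1)(p−1)(p+2) ) − 4 ∑_{p ≡ 3 mod 4} (log p)/(p⁴ − 1) (products and sums over rational primes), let Cat = L(2, χ₋₄) = ∑_{j≥0} (−1)^j (2j+1)^{-2} be Catalan's constant, and let χ₋₄ be the nontrivial Dirichlet character modulo 4. Then, as x → ∞, #{ (u, v, w) ∈ ℤ³ : u² + v² = w³, w ≤ x } = A x log x + B x + O( x^{1/2} (log x)^3 (log log x)² ), where A = 9 G(1) / ( π² Cat ) and B = A · ( 8 L′(1, χ₋₄)/π − 1 + 2γ + g − 2 L′(2, χ₋₄)/Cat − 24 ζ′(2)/π² ), with γ the Euler–Mascheroni constant. -/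

import Mathlib

open Complex hiding cos exp exp_add exp_log exp_nat_mul exp_neg exp_sum log log_mul
open Filter hiding pi
open Asymptotics MeasureTheory Topology ComplexConjugate
open Real (add_one_le_exp cos div_rpow exp exp_add exp_le_exp exp_log exp_mul exp_nat_mul exp_neg
  exp_pos exp_sum log log_div log_le_log log_mul log_nonneg log_pos log_pow mul_rpow
  mul_self_sqrt norm_eq_abs norm_of_nonneg one_le_rpow pi pi_gt_three pi_ne_zero pi_pos rpow_add
  rpow_def_of_pos rpow_le_rpow rpow_le_rpow_of_exponent_le rpow_le_rpow_of_nonpos rpow_mul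
  rpow_natCast rpow_neg rpow_neg_one rpow_one rpow_two sqrt_div sqrt_eq_rpow sqrt_le_iff
  sqrt_le_sqrt sqrt_mul sqrt_sq)
open Finset (Icc Ico Ioc mem_Icc mem_Ico mem_Ioc mem_filter mem_range mul_sum range
  sum_add_distrib sum_congr sum_const sum_le_sum sum_range_succ)
open Set (Ioi indicator_of_notMem mem_ofPred_eq)

/-- The nontrivial character modulo 4 as an integer valued arithmetic function. -/
def chiArith : ArithmeticFunction ℤ := ⟨fun n => ZMod.χ₄ n, by decide⟩

/-- `∑_{d ∣ n} χ₄ d`. -/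
def rr : ArithmeticFunction ℤ := (ArithmeticFunction.zeta : ArithmeticFunction ℤ) * chiArith

lemma chiArith_apply (n : ℕ) : chiArith n = ZMod.χ₄ n := rfl

lemma chiArith_isMultiplicative : chiArith.IsMultiplicative := by
  refine ⟨by simp only [chiArith_apply, Nat.cast_one, map_one], fun {m n} _ => ?_⟩
  simp only [chiArith_apply, Nat.cast_mul, map_mul]

lemma rr_isMultiplicative : rr.IsMultiplicative :=
  (ArithmeticFunction.isMultiplicative_zeta.natCast).mul chiArith_isMultiplicative

lemma rr_one : rr 1 = 1 := rr_isMultiplicative.1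

lemma rr_prime_pow {p : ℕ} (hp : p.Prime) (a : ℕ) :
    rr (p ^ a) = ∑ i ∈ range (a + 1), (ZMod.χ₄ p) ^ i := by
  rw [rr, ArithmeticFunction.coe_zeta_mul_apply, Nat.divisors_prime_pow hp, Finset.sum_map]
  simp only [chiArith_apply, Nat.cast_pow, map_pow, Function.Embedding.coeFn_mk]

lemma rr_hecke {p : ℕ} (hp : p.Prime) {n : ℕ} (hn : n ≠ 0) :
    rr (p * n) = (1 + ZMod.χ₄ p) * rr n - ZMod.χ₄ p * (if p ∣ n then rr (n / p) else 0) := by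
  obtain ⟨a, m, hm, rfl⟩ := Nat.exists_eq_pow_mul_and_not_dvd hn p hp.ne_one
  have hc : ∀ k, (p ^ k).Coprime m := fun k => ((Nat.Prime.coprime_iff_not_dvd hp).2 hm).pow_left k
  rw [← mul_assoc, ← pow_succ', rr_isMultiplicative.2 (hc _), rr_isMultiplicative.2 (hc _)]
  rcases a with _ | a
  · simp only [pow_zero, one_mul, if_neg hm, rr_one, rr_prime_pow hp]
    simp [sum_range_succ]
  · have h1 : p ∣ p ^ (a + 1) * m := Dvd.dvd.mul_right (dvd_pow_self p (by omega)) m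
    have h2 : p ^ (a + 1) * m / p = p ^ a * m := by
      rw [pow_succ', mul_assoc]; exact Nat.mul_div_cancel_left _ hp.pos
    rw [if_pos h1, h2, rr_isMultiplicative.2 (hc _), rr_prime_pow hp, rr_prime_pow hp, rr_prime_pow hp]
    rw [sum_range_succ _ (a + 1 + 1), sum_range_succ _ (a + 1)]
    ring

namespace GaussianInt

/-- Gaussian integers of a given norm. -/
def normSet (n : ℤ) : Set GaussianInt := {z | z.norm = n}

lemma mem_normSet {n : ℤ} {z : GaussianInt} : z ∈ normSet n ↔ z.re ^ 2 + z.im ^ 2 = n := by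
  simp only [normSet, mem_ofPred_eq, Zsqrtd.norm_def]
  constructor <;> intro h <;> linarith

lemma finite_normSet (n : ℤ) : (normSet n).Finite := by
  have : (normSet n) ⊆ (fun q : ℤ × ℤ => (⟨q.1, q.2⟩ : GaussianInt)) ''
      ((Set.Icc (-n) n) ×ˢ (Set.Icc (-n) n)) := by
    rintro z hz
    have h := mem_normSet.1 hz
    have h1 : ∀ a b : ℤ, a ^ 2 + b ^ 2 = n → a ∈ Set.Icc (-n) n := by
      intro a b hab
      have : |a| ≤ a ^ 2 := by
        rw [← sq_abs]; exact Int.le_self_sq |a|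
      rw [Set.mem_Icc, ← abs_le]
      nlinarith [sq_nonneg b]
    exact ⟨(z.re, z.im), ⟨h1 z.re z.im h, h1 z.im z.re (by linarith)⟩, rfl⟩
  exact (Set.Finite.image _ ((Set.finite_Icc _ _).prod (Set.finite_Icc _ _))).subset this

lemma image_mul_normSet {q : GaussianInt} (hq : q ≠ 0) (n : ℤ) :
    (q * ·) '' normSet n = {z | z ∈ normSet (q.norm * n) ∧ q ∣ z} := by
  ext z
  constructor
  · rintro ⟨w, hw, rfl⟩
    refine ⟨?_, dvd_mul_right _ _⟩
    simp only [normSet, mem_ofPred_eq] at hw ⊢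
    simp [hw]
  · rintro ⟨hz, w, rfl⟩
    refine ⟨w, ?_, rfl⟩
    simp only [normSet, mem_ofPred_eq, Zsqrtd.norm_mul] at hz ⊢
    exact mul_left_cancel₀ (by simpa using hq) hz

lemma ncard_image_mul {q : GaussianInt} (hq : q ≠ 0) (n : ℤ) :
    {z | z ∈ normSet (q.norm * n) ∧ q ∣ z}.ncard = (normSet n).ncard := by
  rw [← image_mul_normSet hq]
  exact Set.ncard_image_of_injective _ (mul_right_injective₀ hq)

lemma ncard_dvd_nat {p : ℕ} (hp : p.Prime) (n : ℕ) :
    ({z | z ∈ normSet ((p : ℤ) * n) ∧ (p : GaussianInt) ∣ z}.ncard : ℤ) =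
      if p ∣ n then ((normSet (n / p : ℕ)).ncard : ℤ) else 0 := by
  split_ifs with h
  · obtain ⟨m, rfl⟩ := h
    have h0 : (p : GaussianInt) ≠ 0 := by exact_mod_cast hp.ne_zero
    rw [Nat.mul_div_cancel_left _ hp.pos, ← ncard_image_mul h0]
    have : Zsqrtd.norm (p : GaussianInt) = (p : ℤ) * p := by simp [Zsqrtd.norm_natCast]
    rw [this]; push_cast; rw [mul_assoc]
  · rw [Set.ncard_eq_zero (((finite_normSet _).subset (fun z hz => hz.1)))|>.2]
    · simp
    rw [Set.eq_empty_iff_forall_notMem]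
    rintro z ⟨hz, w, rfl⟩
    apply h
    simp only [normSet, mem_ofPred_eq, Zsqrtd.norm_mul, Zsqrtd.norm_natCast] at hz
    have : (p : ℤ) ≠ 0 := by exact_mod_cast hp.ne_zero
    have := mul_left_cancel₀ this (by rw [← hz]; ring : (p : ℤ) * (p * w.norm) = p * n)
    exact Int.natCast_dvd_natCast.1 ⟨_, this.symm⟩

lemma hecke {p : ℕ} (hp : p.Prime) (n : ℕ) :
    ((normSet ((p : ℤ) * n)).ncard : ℤ) = (1 + ZMod.χ₄ p) * (normSet n).ncard
      - ZMod.χ₄ p * (if p ∣ n then ((normSet (n / p : ℕ)).ncard : ℤ) else 0) := by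
  have h0 : (p : GaussianInt) ≠ 0 := by exact_mod_cast hp.ne_zero
  have hfin := finite_normSet ((p : ℤ) * n)
  by_cases h3 : p % 4 = 3
  · have hχ : ZMod.χ₄ p = -1 := ZMod.χ₄_nat_three_mod_four h3
    have : Fact p.Prime := ⟨hp⟩
    have hpr := GaussianInt.prime_of_nat_prime_of_mod_four_eq_three p h3
    rw [hχ, ← ncard_dvd_nat hp]
    have : {z | z ∈ normSet ((p : ℤ) * n) ∧ (p : GaussianInt) ∣ z} = normSet ((p : ℤ) * n) := by
      ext z
      refine ⟨fun h => h.1, fun h => ⟨h, ?_⟩⟩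
      have h1 : (p : GaussianInt) ∣ z * star z := by
        have : z * star z = ((z.norm : ℤ) : GaussianInt) := (Zsqrtd.norm_eq_mul_conj z).symm
        rw [this, show z.norm = _ from h]
        push_cast; exact dvd_mul_right _ _
      rcases hpr.dvd_or_dvd h1 with h | ⟨w, hw⟩
      · exact h
      · refine ⟨star w, ?_⟩
        rw [← star_star z, hw]; simp
    rw [this]; ring
  · have : Fact p.Prime := ⟨hp⟩
    obtain ⟨a, b, hab⟩ := Nat.Prime.sq_add_sq h3
    set q : GaussianInt := ⟨a, b⟩ with hq
    have hnq : q.norm = p := by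
      rw [Zsqrtd.norm_def]; simp only [hq]; rw [← hab]; push_cast; ring
    have hnq' : (star q).norm = p := by rw [Zsqrtd.norm_conj]; exact hnq
    have hqp : q * star q = p := by
      rw [← Zsqrtd.norm_eq_mul_conj, hnq]; simp
    have hq0 : q ≠ 0 := by rintro h; rw [h] at hqp; simp at hqp; exact h0 hqp.symm
    have hq0' : star q ≠ 0 := by rintro h; rw [h] at hqp; simp at hqp; exact h0 hqp.symm
    have hprime : Prime q := by
      apply Irreducible.prime
      refine ⟨fun hu => ?_, fun {u v} huv => ?_⟩
      · rw [← Zsqrtd.norm_eq_one_iff, hnq] at hu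
        simp at hu; exact hp.one_lt.ne' hu
      · have h5 : u.norm.natAbs * v.norm.natAbs = p := by
          rw [← Int.natAbs_mul, ← Zsqrtd.norm_mul, ← huv, hnq]; simp
        rw [← Zsqrtd.norm_eq_one_iff, ← Zsqrtd.norm_eq_one_iff]
        rcases (Nat.dvd_prime hp).1 (Dvd.intro _ h5) with h6 | h6
        · exact Or.inl h6
        · right
          rw [h6] at h5
          exact Nat.eq_of_mul_eq_mul_left hp.pos (by rw [h5, mul_one])
    have key : ∀ z ∈ normSet ((p : ℤ) * n), q ∣ z ∨ star q ∣ z := by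
      intro z hz
      have h1 : q ∣ z * star z := by
        have : z * star z = ((z.norm : ℤ) : GaussianInt) := (Zsqrtd.norm_eq_mul_conj z).symm
        rw [this, show z.norm = _ from hz]
        push_cast; rw [← hqp, mul_assoc]; exact dvd_mul_right _ _
      rcases hprime.dvd_or_dvd h1 with h | ⟨w, hw⟩
      · exact Or.inl h
      · refine Or.inr ⟨star w, ?_⟩
        rw [← star_star z, hw]; simp [mul_comm]
    set S := {z | z ∈ normSet ((p : ℤ) * n) ∧ q ∣ z}
    set S' := {z | z ∈ normSet ((p : ℤ) * n) ∧ star q ∣ z}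
    have hU : S ∪ S' = normSet ((p : ℤ) * n) := by
      ext z
      constructor
      · rintro (h | h) <;> exact h.1
      · intro h
        rcases key z h with h' | h'
        · exact Or.inl ⟨h, h'⟩
        · exact Or.inr ⟨h, h'⟩
    have hS : S.ncard = (normSet n).ncard := by rw [← ncard_image_mul hq0, hnq]
    have hS' : S'.ncard = (normSet n).ncard := by rw [← ncard_image_mul hq0', hnq']
    have hfS : S.Finite := hfin.subset fun z hz => hz.1
    have hfS' : S'.Finite := hfin.subset fun z hz => hz.1
    have hie := Set.ncard_union_add_ncard_inter S S' hfS hfS'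
    rw [hU, hS, hS'] at hie
    rcases hp.eq_two_or_odd with h2 | h2
    · have hχ : ZMod.χ₄ (p : ZMod 4) = 0 := by rw [h2]; decide
      have hass : S = S' := by
        have ha1 : a = 1 := by
          have : a ≤ 1 := by nlinarith
          have : b ≤ 1 := by nlinarith
          interval_cases a <;> interval_cases b <;> omega
        have hb1 : b = 1 := by
          have : b ≤ 1 := by nlinarith
          rw [ha1, h2] at hab; interval_cases b <;> omega
        have hs1 : star q = q * ⟨0, -1⟩ := by
          rw [hq, ha1, hb1]; decide
        have hs2 : q = star q * ⟨0, 1⟩ := by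
          rw [hq, ha1, hb1]; decide
        ext z
        exact ⟨fun h => ⟨h.1, (Dvd.intro _ hs2.symm).trans h.2⟩,
          fun h => ⟨h.1, (Dvd.intro _ hs1.symm).trans h.2⟩⟩
      rw [hχ, show normSet ((p : ℤ) * n) = S' by rw [← hU, hass, Set.union_self], hS']
      ring
    · have hχ : ZMod.χ₄ (p : ZMod 4) = 1 := ZMod.χ₄_nat_one_mod_four (by omega)
      have hI : S ∩ S' = {z | z ∈ normSet ((p : ℤ) * n) ∧ (p : GaussianInt) ∣ z} := by
        ext z
        constructor
        · rintro ⟨⟨hz, w, hw⟩, _, h⟩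
          refine ⟨hz, ?_⟩
          have hprime' : Prime (star q) := by
            have := (MulEquiv.prime_iff (starMulAut : GaussianInt ≃* GaussianInt)).2 hprime
            simpa using this
          rw [hw] at h ⊢
          rcases hprime'.dvd_or_dvd h with h | ⟨v, hv⟩
          · exfalso
            have h7 : star q ∣ ((2 * a : ℕ) : GaussianInt) := by
              have : ((2 * a : ℕ) : GaussianInt) = q + star q := by
                rw [hq]; ext <;> simp [two_mul]
              rw [this]; exact dvd_add h dvd_rfl
            obtain ⟨v, hv⟩ := h7
            have h8 := congrArg Zsqrtd.norm hv
            rw [Zsqrtd.norm_mul, hnq', Zsqrtd.norm_natCast] at h8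
            have h9 : p ∣ (2 * a) * (2 * a) := by
              apply Int.natCast_dvd_natCast.1
              exact ⟨_, by push_cast at h8 ⊢; exact h8⟩
            have h10 : p ∣ 2 * a := by
              rcases hp.dvd_mul.1 h9 with h | h <;> exact h
            rcases hp.dvd_mul.1 h10 with h | h
            · have := Nat.le_of_dvd (by norm_num) h
              have := hp.two_le
              have : p = 2 := by omega
              omega
            · rcases Nat.eq_zero_or_pos a with h0 | h0
              · rw [h0] at hab
                exact (Nat.prime_iff.1 hp).irreducible.not_isSquare ⟨b, by rw [← hab]; ring⟩
              · have := Nat.le_of_dvd h0 h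
                nlinarith [hp.two_le]
          · rw [hv, ← mul_assoc, hqp]; exact dvd_mul_right _ _
        · rintro ⟨hz, h⟩
          exact ⟨⟨hz, (Dvd.intro _ hqp).trans h⟩, hz, (Dvd.intro_left _ hqp).trans h⟩
      rw [hχ, ← ncard_dvd_nat hp, ← hI]
      have : ((normSet ((p : ℤ) * n)).ncard : ℤ) + (S ∩ S').ncard = (normSet n).ncard + (normSet n).ncard := by
        exact_mod_cast hie
      linarith

lemma ncard_normSet_one : (normSet 1).ncard = 4 := by
  have : normSet 1 = (({⟨1, 0⟩, ⟨-1, 0⟩, ⟨0, 1⟩, ⟨0, -1⟩} : Finset GaussianInt) : Set GaussianInt) := by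
    ext z
    obtain ⟨x, y⟩ := z
    simp only [mem_normSet, Finset.coe_insert, Finset.coe_singleton, Set.mem_insert_iff,
      Set.mem_singleton_iff, Zsqrtd.mk.injEq]
    constructor
    · intro h
      have h1 : x ≤ 1 := by nlinarith [sq_nonneg y]
      have h2 : -1 ≤ x := by nlinarith [sq_nonneg y]
      have h3 : y ≤ 1 := by nlinarith [sq_nonneg x]
      have h4 : -1 ≤ y := by nlinarith [sq_nonneg x]
      interval_cases x <;> interval_cases y <;> simp_all
    · rintro (h | h | h | h) <;> rw [h.1, h.2] <;> norm_num
  rw [this, Set.ncard_coe_finset]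
  decide

/-- Jacobi's two-square theorem. -/
lemma ncard_normSet (n : ℕ) (hn : n ≠ 0) : ((normSet n).ncard : ℤ) = 4 * rr n := by
  induction n using Nat.strong_induction_on with
  | _ n ih =>
  rcases eq_or_ne n 1 with rfl | h1
  · rw [rr_one, Nat.cast_one, ncard_normSet_one]; norm_num
  · obtain ⟨p, hp, m, rfl⟩ := Nat.exists_prime_and_dvd h1
    have hm : m ≠ 0 := by rintro rfl; simp at hn
    have hlt : m < p * m := by
      have := hp.two_le
      have := Nat.pos_of_ne_zero hm
      nlinarith
    rw [Nat.cast_mul, hecke hp, rr_hecke hp hm, ih m hlt hm]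
    split_ifs with h
    · have : m / p ≠ 0 := by
        obtain ⟨k, rfl⟩ := h
        rw [Nat.mul_div_cancel_left _ hp.pos]
        rintro rfl; simp at hm
      rw [ih (m / p) ((Nat.div_le_self _ _).trans_lt hlt) this]; ring
    · ring

end GaussianInt

/-- The coefficient `r(n³)`. -/
def aa : ArithmeticFunction ℤ := ⟨fun n => rr (n ^ 3), by simp⟩

lemma aa_apply (n : ℕ) : aa n = rr (n ^ 3) := rfl

lemma rr_nonneg (n : ℕ) : 0 ≤ rr n := by
  rcases eq_or_ne n 0 with rfl | hn
  · simp
  · have := GaussianInt.ncard_normSet n hn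
    omega

lemma aa_nonneg (n : ℕ) : 0 ≤ aa n := rr_nonneg _

lemma card_solutions (x : ℝ) (hx : 0 ≤ x) :
    ((Nat.card {t : ℤ × ℤ × ℤ // t.1 ^ 2 + t.2.1 ^ 2 = t.2.2 ^ 3 ∧ (t.2.2 : ℝ) ≤ x} : ℕ) : ℤ)
      = 1 + 4 * ∑ w ∈ Icc 1 ⌊x⌋₊, aa w := by
  set f : GaussianInt × ℕ → ℤ × ℤ × ℤ := fun q => (q.1.re, q.1.im, (q.2 : ℤ)) with hf
  have hfinj : Function.Injective f := by
    rintro ⟨⟨a, b⟩, n⟩ ⟨⟨c, d⟩, m⟩ h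
    simp only [hf, Prod.mk.injEq, Nat.cast_inj] at h
    rw [h.1, h.2.1, h.2.2]
  have hset : {t : ℤ × ℤ × ℤ | t.1 ^ 2 + t.2.1 ^ 2 = t.2.2 ^ 3 ∧ (t.2.2 : ℝ) ≤ x}
      = f '' ((range (⌊x⌋₊ + 1)).biUnion fun w =>
          ((GaussianInt.finite_normSet ((w ^ 3 : ℕ) : ℤ)).toFinset ×ˢ {w}) : Finset _) := by
    ext ⟨u, v, w⟩
    simp only [mem_ofPred_eq, Finset.coe_biUnion, Set.mem_image, Set.mem_iUnion,
      Finset.coe_product, Set.mem_prod, Set.Finite.coe_toFinset, Finset.coe_singleton,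
      Set.mem_singleton_iff, GaussianInt.mem_normSet, Finset.coe_range, Set.mem_Iio, hf]
    constructor
    · rintro ⟨h, hw⟩
      have hw0 : 0 ≤ w := by
        by_contra hneg
        push Not at hneg
        have : w ^ 3 < 0 := by
          have := mul_pos_of_neg_of_neg hneg hneg
          nlinarith
        nlinarith [sq_nonneg u, sq_nonneg v]
      obtain ⟨n, rfl⟩ := Int.eq_ofNat_of_zero_le hw0
      refine ⟨(⟨u, v⟩, n), ⟨n, ?_, ?_, rfl⟩, rfl⟩
      · have : n ≤ ⌊x⌋₊ := Nat.le_floor (by exact_mod_cast hw)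
        omega
      · push_cast; exact h
    · rintro ⟨⟨z, n⟩, ⟨m, hm, h, h'⟩, h2⟩
      simp only [Prod.mk.injEq] at h2 h' h
      obtain ⟨rfl, rfl, rfl⟩ := h2
      subst h'
      refine ⟨by push_cast at h; exact h, ?_⟩
      have : (n : ℝ) ≤ ⌊x⌋₊ := by exact_mod_cast Nat.lt_succ_iff.1 hm
      push_cast
      exact this.trans (Nat.floor_le hx)
  have h1 : Nat.card {t : ℤ × ℤ × ℤ // t.1 ^ 2 + t.2.1 ^ 2 = t.2.2 ^ 3 ∧ (t.2.2 : ℝ) ≤ x}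
      = {t : ℤ × ℤ × ℤ | t.1 ^ 2 + t.2.1 ^ 2 = t.2.2 ^ 3 ∧ (t.2.2 : ℝ) ≤ x}.ncard := rfl
  rw [h1, hset, Set.ncard_image_of_injective _ hfinj, Set.ncard_coe_finset, Finset.card_biUnion]
  · push_cast
    rw [Finset.sum_range_succ', add_comm]
    congr 1
    · simp only [Finset.card_product, Finset.card_singleton, mul_one]
      rw [← Set.ncard_eq_toFinset_card _ (GaussianInt.finite_normSet _)]
      have : GaussianInt.normSet (((0 : ℕ) : ℤ) ^ 3) = {0} := by
        ext z
        simp [GaussianInt.normSet]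
      rw [this]; simp
    · rw [mul_sum, ← Finset.Ico_add_one_right_eq_Icc, Finset.sum_Ico_eq_sum_range]
      refine sum_congr rfl fun k hk => ?_
      obtain ⟨w, hw⟩ : ∃ w, w = k + 1 := ⟨_, rfl⟩
      rw [add_comm 1 k, ← hw]
      have hw0 : w ≠ 0 := by omega
      simp only [Finset.card_product, Finset.card_singleton, mul_one]
      rw [← Set.ncard_eq_toFinset_card _ (GaussianInt.finite_normSet _), aa_apply,
        ← GaussianInt.ncard_normSet _ (pow_ne_zero 3 hw0), Nat.cast_pow]
  · intro a _ b _ hab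
    rw [Function.onFun, Finset.disjoint_left]
    rintro ⟨z, n⟩ h h'
    simp only [Finset.mem_product, Finset.mem_singleton] at h h'
    exact hab (h.2.symm.trans h'.2)

section EulerProducts

lemma natCast_pow_cpow_neg (p e : ℕ) (s : ℂ) :
    ((p ^ e : ℕ) : ℂ) ^ (-s) = ((p : ℂ) ^ (-s)) ^ e := by
  rw [← cpow_nat_mul, natCast_cpow_natCast_mul, Nat.cast_pow]

lemma natCast_pow_rpow_neg (p e : ℕ) (s : ℝ) :
    ((p ^ e : ℕ) : ℝ) ^ (-s) = ((p : ℝ) ^ (-s)) ^ e := by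
  rw [← rpow_natCast, ← rpow_mul (by positivity), Nat.cast_pow, ← rpow_natCast,
    ← rpow_mul (by positivity), mul_comm]

lemma lseries_eulerProduct (f : ArithmeticFunction ℤ) (hf : f.IsMultiplicative) {s : ℂ}
    (hs : LSeriesSummable (fun n => (f n : ℂ)) s) :
    HasProd (fun p : Nat.Primes => ∑' e : ℕ, (f ((p : ℕ) ^ e) : ℂ) * ((p : ℂ) ^ (-s)) ^ e)
      (LSeries (fun n => (f n : ℂ)) s) := by
  have h0 : ∀ n, LSeries.term (fun n => (f n : ℂ)) s n = (f n : ℂ) * (n : ℂ) ^ (-s) := by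
    intro n
    rcases eq_or_ne n 0 with rfl | hn
    · simp
    · rw [LSeries.term_of_ne_zero hn, cpow_neg, div_eq_mul_inv]
  have := EulerProduct.eulerProduct_hasProd (f := LSeries.term (fun n => (f n : ℂ)) s)
    (by rw [h0]; simp [hf.1]) (fun {m n} h => by
      rw [h0, h0, h0, hf.2 h, Nat.cast_mul, natCast_mul_natCast_cpow]; push_cast; ring) hs.norm (by simp)
  simp only [h0, natCast_pow_cpow_neg] at this
  rw [LSeries]
  simpa only [h0] using this

lemma lseriesSummable_of_prime_pow (f : ArithmeticFunction ℤ) (hf : f.IsMultiplicative) (σ : ℝ)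
    (g : ℕ → ℝ) (hg : Summable g) (hg0 : ∀ n, 0 ≤ g n)
    (h1 : ∀ p : ℕ, p.Prime → Summable fun k : ℕ => |(f (p ^ (k + 1)) : ℝ)| * ((p : ℝ) ^ (-σ)) ^ (k + 1))
    (h2 : ∀ p : ℕ, p.Prime → ∑' k : ℕ, |(f (p ^ (k + 1)) : ℝ)| * ((p : ℝ) ^ (-σ)) ^ (k + 1) ≤ g p)
    {s : ℂ} (hs : s.re = σ) :
    LSeriesSummable (fun n => (f n : ℂ)) s := by
  set F : ℕ → ℝ := fun n => |(f n : ℝ)| * (n : ℝ) ^ (-σ) with hF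
  have hFnn : ∀ n, 0 ≤ F n := fun n => by positivity
  have hFp : ∀ p k : ℕ, F (p ^ k) = |(f (p ^ k) : ℝ)| * ((p : ℝ) ^ (-σ)) ^ k := fun p k => by
    simp only [hF, natCast_pow_rpow_neg]
  have hF1 : F 1 = 1 := by simp [hF, hf.1]
  have hFm : ∀ {m n : ℕ}, m.Coprime n → F (m * n) = F m * F n := by
    intro m n h
    simp only [hF, hf.2 h]
    push_cast
    rw [abs_mul, mul_rpow (by positivity) (by positivity)]; ring
  have hFs : ∀ {p : ℕ}, p.Prime → Summable fun k => ‖F (p ^ k)‖ := by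
    intro p hp
    simp only [norm_of_nonneg (hFnn _)]
    rw [← summable_nat_add_iff 1]
    simpa only [hFp] using h1 p hp
  have hsum : Summable F := by
    refine summable_of_sum_range_le hFnn (c := F 0 + exp (∑' n, g n)) fun N => ?_
    obtain ⟨ha, hb⟩ := EulerProduct.summable_and_hasSum_smoothNumbers_prod_primesBelow_tsum hF1 hFm hFs N
    have h3 : ∑ i ∈ (range N).erase 0, F i ≤ ∏ p ∈ N.primesBelow, ∑' n : ℕ, F (p ^ n) := by
      rw [← hb.tsum_eq]
      have : ∑ i ∈ (range N).erase 0, F i =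
          ∑ i ∈ ((range N).erase 0).attach.image (fun i => (⟨i.1, by
            have := i.2
            rw [Finset.mem_erase, mem_range] at this
            exact Nat.mem_smoothNumbers_of_lt (Nat.pos_of_ne_zero this.1) this.2⟩ : N.smoothNumbers)),
            F (i : ℕ) := by
        rw [Finset.sum_image (by intro a _ b _ h; exact Subtype.ext (congrArg (fun z => (z.1 : ℕ)) h))]
        exact (Finset.sum_attach _ F).symm
      rw [this]
      exact hb.summable.sum_le_tsum _ fun i _ => hFnn _
    have h4 : ∏ p ∈ N.primesBelow, ∑' n : ℕ, F (p ^ n) ≤ exp (∑' n, g n) := by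
      calc ∏ p ∈ N.primesBelow, ∑' n : ℕ, F (p ^ n) ≤ ∏ p ∈ N.primesBelow, exp (g p) := by
            refine Finset.prod_le_prod (fun p _ => tsum_nonneg fun n => hFnn _) fun p hp => ?_
            have hp := Nat.prime_of_mem_primesBelow hp
            have hs := hFs hp
            simp only [norm_of_nonneg (hFnn _)] at hs
            rw [hs.tsum_eq_zero_add, pow_zero, hF1]
            simp only [hFp]
            linarith [h2 p hp, add_one_le_exp (g p)]
        _ = exp (∑ p ∈ N.primesBelow, g p) := (exp_sum _ _).symm
        _ ≤ _ := exp_le_exp.2 (hg.sum_le_tsum _ fun i _ => hg0 i)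
    rcases Nat.eq_zero_or_pos N with rfl | hN
    · simp only [Finset.range_zero, Finset.sum_empty]; have := hFnn 0; positivity
    · rw [← Finset.add_sum_erase _ _ (mem_range.2 hN)]
      linarith
  refine Summable.of_norm (hsum.of_nonneg_of_le (fun _ => norm_nonneg _) fun n => ?_)
  rw [LSeries.norm_term_eq, hs]
  split_ifs with h
  · exact hFnn _
  · simp only [hF, norm_intCast]
    rw [rpow_neg (by positivity), div_eq_mul_inv]

/-- The multiplicative function with prescribed values `c p k` at `p ^ k`. -/
def ofPrimePow (c : ℕ → ℕ → ℤ) : ArithmeticFunction ℤ :=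
  ⟨fun n => if n = 0 then 0 else n.factorization.prod c, by simp⟩

lemma ofPrimePow_isMultiplicative (c : ℕ → ℕ → ℤ) : (ofPrimePow c).IsMultiplicative := by
  rw [ArithmeticFunction.IsMultiplicative.iff_ne_zero]
  refine ⟨by simp [ofPrimePow], fun {m n} hm hn h => ?_⟩
  simp only [ofPrimePow, ArithmeticFunction.coe_mk, hm, hn, mul_eq_zero, or_self, if_false]
  rw [Nat.factorization_mul_of_coprime h, Finsupp.prod_add_index_of_disjoint]
  simpa using h.disjoint_primeFactors

lemma ofPrimePow_prime_pow (c : ℕ → ℕ → ℤ) {p : ℕ} (hp : p.Prime) (hc : c p 0 = 1) (k : ℕ) :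
    ofPrimePow c (p ^ k) = c p k := by
  simp only [ofPrimePow, ArithmeticFunction.coe_mk, pow_ne_zero k hp.ne_zero, if_false]
  rw [hp.factorization_pow, Finsupp.prod_single_index hc]

end EulerProducts

/-- Coefficients of the local factor `hpoly p`. -/
def hcoef (p k : ℕ) : ℤ :=
  if k = 0 then 1 else if p = 2 then (if k = 1 then -1 else 0)
  else if k = 2 then -(2 + chiArith p) else if k = 3 then 1 + chiArith p else 0

/-- The coefficients of `HH`. -/
def hArith : ArithmeticFunction ℤ := ofPrimePow hcoef

lemma hArith_isMultiplicative : hArith.IsMultiplicative := ofPrimePow_isMultiplicative _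

lemma hArith_prime_pow {p : ℕ} (hp : p.Prime) (k : ℕ) : hArith (p ^ k) = hcoef p k :=
  ofPrimePow_prime_pow _ hp (by simp [hcoef]) k

/-- The local factor of `HH` at `p`, as a function of `t = p ^ (-s)`. -/
noncomputable def hpoly (p : ℕ) (t : ℂ) : ℂ :=
  if p = 2 then 1 - t else 1 - (2 + (chiArith p : ℤ)) * t ^ 2 + (1 + (chiArith p : ℤ)) * t ^ 3

lemma tsum_hArith {p : ℕ} (hp : p.Prime) (t : ℂ) :
    ∑' e : ℕ, (hArith (p ^ e) : ℂ) * t ^ e = hpoly p t := by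
  rw [tsum_eq_sum (s := range 4)]
  · simp only [hArith_prime_pow hp, sum_range_succ, hcoef, hpoly]
    by_cases h2 : p = 2
    · simp [h2]; ring
    · simp [h2]; ring
  · intro e he
    have : 4 ≤ e := by simpa using he
    rw [hArith_prime_pow hp, hcoef]
    split_ifs <;> first | omega | simp

lemma prime_cases {p : ℕ} (hp : p.Prime) :
    (p = 2 ∧ chiArith p = 0) ∨ (p ≠ 2 ∧ p % 4 = 1 ∧ chiArith p = 1) ∨
      (p ≠ 2 ∧ p % 4 = 3 ∧ chiArith p = -1) := by
  rcases hp.eq_two_or_odd with h | h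
  · left; exact ⟨h, by rw [h, chiArith_apply]; decide⟩
  · have : p ≠ 2 := by rintro rfl; omega
    have : p % 4 = 1 ∨ p % 4 = 3 := by omega
    rcases this with h | h
    · exact Or.inr (Or.inl ⟨‹_›, h, ZMod.χ₄_nat_one_mod_four h⟩)
    · exact Or.inr (Or.inr ⟨‹_›, h, ZMod.χ₄_nat_three_mod_four h⟩)

lemma aa_isMultiplicative : aa.IsMultiplicative := by
  refine ⟨by simp [aa_apply, rr_one], fun {m n} h => ?_⟩
  rw [aa_apply, mul_pow, rr_isMultiplicative.2 (h.pow 3 3)]; rfl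

lemma aa_prime_pow {p : ℕ} (hp : p.Prime) (e : ℕ) :
    aa (p ^ e) = ∑ i ∈ range (3 * e + 1), (chiArith p) ^ i := by
  rw [aa_apply, ← pow_mul, rr_prime_pow hp, mul_comm]; rfl

lemma abs_aa_prime_pow_le {p : ℕ} (hp : p.Prime) (e : ℕ) : |aa (p ^ e)| ≤ 3 * e + 1 := by
  rw [aa_prime_pow hp]
  refine (Finset.abs_sum_le_sum_abs _ _).trans ?_
  calc _ ≤ ∑ i ∈ range (3 * e + 1), (1 : ℤ) := by
        refine sum_le_sum fun i _ => ?_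
        rw [abs_pow]
        refine pow_le_one₀ (abs_nonneg _) ?_
        rcases prime_cases hp with ⟨-, h⟩ | ⟨-, -, h⟩ | ⟨-, -, h⟩ <;> rw [h] <;> simp
    _ = _ := by simp

lemma prime_rpow_neg_le_half {p : ℕ} (hp : p.Prime) {σ : ℝ} (hσ : 1 < σ) :
    (p : ℝ) ^ (-σ) ≤ 1 / 2 := by
  have h2 : (2 : ℝ) ≤ p := by exact_mod_cast hp.two_le
  calc (p : ℝ) ^ (-σ) ≤ (p : ℝ) ^ (-1 : ℝ) :=
        rpow_le_rpow_of_exponent_le (by linarith) (by linarith)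
    _ = (p : ℝ)⁻¹ := rpow_neg_one _
    _ ≤ _ := by rw [one_div]; exact inv_anti₀ (by norm_num) h2

lemma lseriesSummable_aa {s : ℂ} (hs : 1 < s.re) : LSeriesSummable (fun n => (aa n : ℂ)) s := by
  have hsum : Summable fun k : ℕ => (3 * (k : ℝ) + 4) * (1 / 2 : ℝ) ^ k := by
    have h1 := summable_pow_mul_geometric_of_norm_lt_one 1 (r := (1 / 2 : ℝ)) (by norm_num)
    have h2 := summable_geometric_of_lt_one (r := (1 / 2 : ℝ)) (by norm_num) (by norm_num)
    refine ((h1.mul_left 3).add (h2.mul_left 4)).congr fun k => by ring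
  set C := ∑' k : ℕ, (3 * (k : ℝ) + 4) * (1 / 2 : ℝ) ^ k
  have key : ∀ p : ℕ, p.Prime → ∀ k : ℕ, |(aa (p ^ (k + 1)) : ℝ)| * ((p : ℝ) ^ (-s.re)) ^ (k + 1) ≤
      (3 * (k : ℝ) + 4) * (1 / 2 : ℝ) ^ k * (p : ℝ) ^ (-s.re) := by
    intro p hp k
    have h1 : |(aa (p ^ (k + 1)) : ℝ)| ≤ 3 * k + 4 := by
      have := abs_aa_prime_pow_le hp (k + 1)
      have : |(aa (p ^ (k + 1)) : ℝ)| ≤ 3 * ((k + 1 : ℕ) : ℝ) + 1 := by exact_mod_cast this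
      push_cast at this; linarith
    have h2 := prime_rpow_neg_le_half hp hs
    rw [pow_succ ((p : ℝ) ^ (-s.re)), ← mul_assoc]
    gcongr
  refine lseriesSummable_of_prime_pow aa aa_isMultiplicative s.re (fun n => C * (n : ℝ) ^ (-s.re))
    ((Real.summable_nat_rpow.2 (by linarith)).mul_left C) (fun n => by positivity) ?_ ?_ rfl
  · intro p hp
    exact (hsum.mul_right _).of_nonneg_of_le (fun k => by positivity) (key p hp)
  · intro p hp
    rw [← tsum_mul_right]
    exact Summable.tsum_le_tsum (key p hp)
      ((hsum.mul_right _).of_nonneg_of_le (fun k => by positivity) (key p hp)) (hsum.mul_right _)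

lemma abs_chi_le_one {p : ℕ} (hp : p.Prime) : |chiArith p| ≤ 1 := by
  rcases prime_cases hp with ⟨-, h⟩ | ⟨-, -, h⟩ | ⟨-, -, h⟩ <;> rw [h] <;> simp

lemma hArith_bound {p : ℕ} (hp : p.Prime) {σ : ℝ} (hσ : 0 < σ) :
    (Summable fun k : ℕ => |(hArith (p ^ (k + 1)) : ℝ)| * ((p : ℝ) ^ (-σ)) ^ (k + 1)) ∧
    ∑' k : ℕ, |(hArith (p ^ (k + 1)) : ℝ)| * ((p : ℝ) ^ (-σ)) ^ (k + 1) ≤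
      5 * (p : ℝ) ^ (-(2 * σ)) + (if p = 2 then 1 else 0) := by
  have h0 : ∀ k ∉ range 3, |(hArith (p ^ (k + 1)) : ℝ)| * ((p : ℝ) ^ (-σ)) ^ (k + 1) = 0 := by
    intro k hk
    have : 3 ≤ k := by simpa using hk
    rw [hArith_prime_pow hp, hcoef, if_neg (by omega), if_neg (by omega : ¬ (k + 1 = 1)),
      if_neg (by omega : ¬ (k + 1 = 2)), if_neg (by omega : ¬ (k + 1 = 3))]
    simp
  refine ⟨summable_of_ne_finset_zero h0, ?_⟩
  rw [tsum_eq_sum h0]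
  set u := (p : ℝ) ^ (-σ) with hu
  have hu0 : 0 ≤ u := by positivity
  have hu1 : u ≤ 1 := by
    rw [hu]
    exact Real.rpow_le_one_of_one_le_of_nonpos (by exact_mod_cast hp.one_lt.le) (by linarith)
  have hu2 : (p : ℝ) ^ (-(2 * σ)) = u ^ 2 := by
    rw [hu, ← rpow_natCast, ← rpow_mul (by positivity)]; congr 1; push_cast; ring
  rw [hu2]
  simp only [sum_range_succ, Finset.sum_range_zero, hArith_prime_pow hp, hcoef]
  by_cases h2 : p = 2
  · simp [h2]; nlinarith
  · have hχ := abs_le.1 (abs_chi_le_one hp)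
    have h3 : |(-(2 + (chiArith p : ℤ)) : ℝ)| ≤ 3 := by
      rw [abs_le]; constructor <;> norm_cast <;> omega
    have h4 : |((1 + (chiArith p : ℤ)) : ℝ)| ≤ 2 := by
      rw [abs_le]; constructor <;> norm_cast <;> omega
    simp only [h2, if_false]
    norm_num
    norm_num at h3
    have h5 : u ^ 3 ≤ u ^ 2 := pow_le_pow_of_le_one hu0 hu1 (by norm_num)
    have h6 : 0 ≤ u ^ 3 := by positivity
    nlinarith [mul_le_mul_of_nonneg_right h3 (by positivity : (0:ℝ) ≤ u ^ 2),
      mul_le_mul_of_nonneg_right h4 h6]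

lemma lseriesSummable_hArith {s : ℂ} (hs : 1 / 2 < s.re) :
    LSeriesSummable (fun n => (hArith n : ℂ)) s := by
  refine lseriesSummable_of_prime_pow hArith hArith_isMultiplicative s.re
    (fun n => 5 * (n : ℝ) ^ (-(2 * s.re)) + (if n = 2 then 1 else 0)) ?_ ?_
    (fun p hp => (hArith_bound hp (by linarith)).1) (fun p hp => (hArith_bound hp (by linarith)).2) rfl
  · refine ((Real.summable_nat_rpow.2 (by linarith)).mul_left 5).add ?_
    exact summable_of_ne_finset_zero (s := {2}) fun n hn => by simpa using hn
  · intro n; positivity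

/-- The function `HH` with `F = (ζ L)² HH`. -/
noncomputable def HH (s : ℂ) : ℂ := LSeries (fun n => (hArith n : ℂ)) s

lemma HH_hasProd {s : ℂ} (hs : 1 / 2 < s.re) :
    HasProd (fun p : Nat.Primes => hpoly p ((p : ℂ) ^ (-s))) (HH s) := by
  have := lseries_eulerProduct hArith hArith_isMultiplicative (lseriesSummable_hArith hs)
  exact (funext fun p : Nat.Primes => tsum_hArith p.2 ((p : ℂ) ^ (-s))) ▸ this

lemma HH_analyticAt {s : ℂ} (hs : 1 / 2 < s.re) : AnalyticAt ℂ HH s := by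
  refine LSeries_analyticOnNhd _ s ?_
  have : LSeries.abscissaOfAbsConv (fun n => (hArith n : ℂ)) ≤ ((1 / 2 : ℝ) : EReal) :=
    LSeries.abscissaOfAbsConv_le_of_forall_lt_LSeriesSummable fun y hy =>
      lseriesSummable_hArith (by simpa using hy)
  exact this.trans_lt (by exact_mod_cast hs)

/-- The nontrivial complex character modulo 4. -/
noncomputable def chiC : DirichletCharacter ℂ 4 := ZMod.χ₄.ringHomComp (Int.castRingHom ℂ)

lemma chiC_apply (n : ZMod 4) : chiC n = (ZMod.χ₄ n : ℂ) := rfl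

/-- The `L`-function of `chiC`. -/
noncomputable def LL (s : ℂ) : ℂ := DirichletCharacter.LFunction chiC s

/-- The Dedekind zeta function of `ℚ(i)`. -/
noncomputable def zK (s : ℂ) : ℂ := riemannZeta s * LL s

lemma zeta_hasProd {s : ℂ} (hs : 1 < s.re) :
    HasProd (fun p : Nat.Primes => (1 - (p : ℂ) ^ (-s))⁻¹) (riemannZeta s) :=
  riemannZeta_eulerProduct_hasProd hs

lemma LL_hasProd {s : ℂ} (hs : 1 < s.re) :
    HasProd (fun p : Nat.Primes => (1 - (chiArith (p : ℕ) : ℤ) * (p : ℂ) ^ (-s))⁻¹) (LL s) := by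
  have := DirichletCharacter.LSeries_eulerProduct_hasProd chiC hs
  rw [LL, DirichletCharacter.LFunction_eq_LSeries _ hs]
  exact this

lemma norm_prime_cpow {p : ℕ} (hp : p.Prime) (s : ℂ) : ‖(p : ℂ) ^ (-s)‖ = (p : ℝ) ^ (-s.re) := by
  rw [norm_natCast_cpow_of_pos hp.pos]; simp

lemma tsum_aa {p : ℕ} (hp : p.Prime) {t : ℂ} (ht : ‖t‖ < 1) :
    ∑' e : ℕ, (aa (p ^ e) : ℂ) * t ^ e
      = ((1 - t)⁻¹ * (1 - (chiArith p : ℤ) * t)⁻¹) ^ 2 * hpoly p t := by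
  have h1 : 1 - t ≠ 0 := by
    intro h
    rw [sub_eq_zero] at h
    rw [← h] at ht; simp at ht
  have h2 : 1 + t ≠ 0 := by
    intro h
    have : t = -1 := by linear_combination h
    rw [this] at ht; simp at ht
  have hgeo := hasSum_geometric_of_norm_lt_one ht
  rcases prime_cases hp with ⟨h, hχ⟩ | ⟨h, -, hχ⟩ | ⟨h, -, hχ⟩
  · have : ∀ e : ℕ, aa (p ^ e) = 1 := fun e => by
      rw [aa_prime_pow hp, hχ, Finset.sum_range_succ']; simp
    simp only [this, hχ, hpoly, if_pos h]
    simp only [Int.cast_one, one_mul, hgeo.tsum_eq]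
    simp; field_simp
  · have : ∀ e : ℕ, aa (p ^ e) = 3 * e + 1 := fun e => by
      rw [aa_prime_pow hp, hχ]; simp
    simp only [this, hχ, hpoly, h]
    have h3 := (hasSum_coe_mul_geometric_of_norm_lt_one ht)
    have h4 := (h3.mul_left 3).add hgeo
    push_cast
    have h5 : ∀ e : ℕ, (3 * (e : ℂ) + 1) * t ^ e = 3 * (e * t ^ e) + t ^ e := fun e => by ring
    simp only [h5]
    rw [h4.tsum_eq]
    simp
    field_simp
    ring
  · have ha : ∀ e : ℕ, aa (p ^ (2 * e)) = 1 := fun e => by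
      rw [aa_prime_pow hp, hχ, sum_range_succ, show 3 * (2 * e) = 2 * (3 * e) by ring]
      have : ∀ k, ∑ i ∈ range (2 * k), (-1 : ℤ) ^ i = 0 := fun k => by
        induction k with
        | zero => simp
        | succ k ih =>
          rw [show 2 * (k + 1) = 2 * k + 1 + 1 by ring, sum_range_succ,
            sum_range_succ, ih, pow_succ]; ring
      rw [this]; simp [pow_mul]
    have hb : ∀ e : ℕ, aa (p ^ (2 * e + 1)) = 0 := fun e => by
      rw [aa_prime_pow hp, hχ, show 3 * (2 * e + 1) + 1 = 2 * (3 * e + 2) by ring]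
      generalize 3 * e + 2 = k
      induction k with
        | zero => simp
        | succ k ih =>
          rw [show 2 * (k + 1) = 2 * k + 1 + 1 by ring, sum_range_succ,
            sum_range_succ, ih, pow_succ]; ring
    have ht2 : ‖t ^ 2‖ < 1 := by
      rw [norm_pow]; exact pow_lt_one₀ (norm_nonneg _) ht (by norm_num)
    have h6 := hasSum_geometric_of_norm_lt_one ht2
    have h7 : HasSum (fun e : ℕ => (aa (p ^ e) : ℂ) * t ^ e) ((1 - t ^ 2)⁻¹ + 0) := by
      refine HasSum.even_add_odd ?_ ?_
      · simpa only [ha, pow_mul t 2, Int.cast_one, one_mul] using h6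
      · simp [hb]
    rw [h7.tsum_eq, hχ, hpoly, hχ, if_neg h]
    have h8 : 1 - t ^ 2 ≠ 0 := by
      have : 1 - t ^ 2 = (1 - t) * (1 + t) := by ring
      rw [this]; exact mul_ne_zero h1 h2
    push_cast
    have h9 : 1 - -1 * t = 1 + t := by ring
    rw [h9]
    field_simp
    ring

lemma lseries_aa {s : ℂ} (hs : 1 < s.re) :
    LSeries (fun n => (aa n : ℂ)) s = zK s ^ 2 * HH s := by
  have h1 := lseries_eulerProduct aa aa_isMultiplicative (lseriesSummable_aa hs)
  have h2 := ((((zeta_hasProd hs).mul (LL_hasProd hs)).mul ((zeta_hasProd hs).mul (LL_hasProd hs))).mul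
    (HH_hasProd (s := s) (by linarith)))
  refine (h1.unique ?_).trans (by rw [zK, sq])
  convert h2 using 2 with p
  rw [tsum_aa p.2, sq]
  rw [norm_prime_cpow p.2]
  have := prime_rpow_neg_le_half p.2 hs
  linarith

lemma dirichletCharacter_four_eq {χ : DirichletCharacter ℂ 4} (hχ : χ ≠ 1) : χ = chiC := by
  have key : ∀ u : (ZMod 4)ˣ, u = 1 ∨ (u : ZMod 4) = 3 := by decide
  have h3 : χ 3 = -1 := by
    have h9 : χ 3 ^ 2 = 1 := by
      rw [← map_pow, show (3 : ZMod 4) ^ 2 = 1 by decide, map_one]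
    rcases mul_eq_zero.mp (show (χ 3 - 1) * (χ 3 + 1) = 0 by linear_combination h9) with h | h
    rotate_left
    · exact eq_neg_of_add_eq_zero_left h
    · replace h := sub_eq_zero.mp h
      exfalso
      refine hχ (MulChar.ext fun u => ?_)
      rcases key u with rfl | hu
      · simp
      · rw [hu, h]; exact (MulChar.one_apply (by rw [← hu]; exact u.isUnit)).symm
  refine MulChar.ext fun u => ?_
  rcases key u with rfl | hu
  · simp
  · rw [hu, h3, chiC_apply, show ZMod.χ₄ 3 = -1 by decide]; simp

lemma chiC_ne_one : chiC ≠ 1 := by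
  intro h
  have h3 := chiC_apply 3
  rw [h, MulChar.one_apply (by decide : IsUnit (3 : ZMod 4)), show ZMod.χ₄ 3 = -1 by decide] at h3
  norm_num at h3

lemma LL_differentiable : Differentiable ℂ LL :=
  DirichletCharacter.differentiable_LFunction chiC_ne_one

lemma chiC_odd (j : ℕ) : chiC ((2 * j + 1 : ℕ) : ZMod 4) = (-1) ^ j := by
  rw [chiC_apply, ZMod.χ₄_nat_eq_if_mod_four]
  rcases Nat.even_or_odd' j with ⟨k, rfl | rfl⟩
  · simp [pow_mul, show (2 * (2 * k) + 1) % 2 = 1 by omega, show (2 * (2 * k) + 1) % 4 = 1 by omega]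
  · simp [pow_mul, pow_add, show (2 * (2 * k + 1) + 1) % 2 = 1 by omega,
      show (2 * (2 * k + 1) + 1) % 4 = 3 by omega]

lemma chiC_even (j : ℕ) : chiC ((2 * j : ℕ) : ZMod 4) = 0 := by
  rw [chiC_apply, ZMod.χ₄_nat_eq_if_mod_four]
  simp

lemma LL_hasSum {s : ℂ} (hs : 1 < s.re) :
    HasSum (fun j : ℕ => (-1 : ℂ) ^ j * (2 * j + 1 : ℂ) ^ (-s)) (LL s) := by
  have h0 : LSeriesSummable (fun n : ℕ => chiC n) s :=
    DirichletCharacter.LSeriesSummable_of_one_lt_re chiC hs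
  have h1 : HasSum (LSeries.term (fun n : ℕ => chiC n) s) (LL s) := by
    rw [LL, DirichletCharacter.LFunction_eq_LSeries chiC hs]
    exact h0.hasSum
  have hinj : Function.Injective (fun j : ℕ => 2 * j + 1) := fun a b h => by
    simpa using h
  have h2 := (hinj.hasSum_iff (f := LSeries.term (fun n : ℕ => chiC n) s) (a := LL s) (by
    intro n hn
    rcases Nat.even_or_odd' n with ⟨k, rfl | rfl⟩
    · rcases Nat.eq_zero_or_pos k with rfl | hk
      · simp
      · rw [LSeries.term_of_ne_zero (by omega), chiC_even, zero_div]
    · exact absurd ⟨k, rfl⟩ hn)).mpr h1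
  refine h2.congr_fun fun j => ?_
  simp only [Function.comp]
  rw [LSeries.term_of_ne_zero (by omega), chiC_odd, cpow_neg, div_eq_mul_inv]
  push_cast; ring

lemma LL_two : LL 2 = ((∑' j : ℕ, (-1 : ℝ) ^ j / (2 * (j : ℝ) + 1) ^ 2 : ℝ) : ℂ) := by
  rw [← (LL_hasSum (s := 2) (by norm_num)).tsum_eq, ofReal_tsum]
  refine tsum_congr fun j => ?_
  push_cast
  rw [cpow_neg, div_eq_mul_inv]
  norm_cast

lemma pair_rpow_bound (m : ℕ) {s : ℝ} (hs : 1 ≤ s) (hs2 : s ≤ 2) :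
    ‖((4 * m + 1 : ℝ)) ^ (-s) - (4 * m + 3 : ℝ) ^ (-s)‖ ≤ 4 / ((4 * m + 1) * (4 * m + 3)) := by
  have ha : (0 : ℝ) < 4 * m + 1 := by linarith
  have hb : (0 : ℝ) < 4 * m + 3 := by linarith
  have h1 : (4 * m + 3 : ℝ) ^ (-s) ≤ (4 * m + 1 : ℝ) ^ (-s) :=
    rpow_le_rpow_of_nonpos ha (by linarith) (by linarith)
  have h2 := one_add_mul_self_le_rpow_one_add (s := -2 / (4 * m + 3 : ℝ))
    (by rw [le_div_iff₀ hb]; linarith) hs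
  have h3 : (4 * m + 3 : ℝ) ^ (-s) =
      (4 * m + 1 : ℝ) ^ (-s) * (1 + -2 / (4 * m + 3 : ℝ)) ^ s := by
    have : (1 + -2 / (4 * m + 3 : ℝ)) = (4 * m + 1) / (4 * m + 3) := by field_simp; ring
    rw [this, div_rpow ha.le hb.le, rpow_neg ha.le, rpow_neg hb.le]
    have := Real.rpow_pos_of_pos ha s
    field_simp
  have h4 : (4 * m + 1 : ℝ) ^ (-s) ≤ (4 * m + 1 : ℝ)⁻¹ := by
    rw [← rpow_neg_one]
    exact rpow_le_rpow_of_exponent_le (by linarith) (by linarith)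
  rw [norm_of_nonneg (by linarith), h3]
  have h5 : 1 - (1 + -2 / (4 * m + 3 : ℝ)) ^ s ≤ 4 / (4 * m + 3) := by
    have : s * (-2 / (4 * m + 3 : ℝ)) ≥ -(4 / (4 * m + 3)) := by
      rw [mul_div_assoc', ge_iff_le, ← neg_div, div_le_div_iff_of_pos_right hb]; linarith
    linarith
  calc _ = (4 * m + 1 : ℝ) ^ (-s) * (1 - (1 + -2 / (4 * m + 3 : ℝ)) ^ s) := by ring
    _ ≤ (4 * m + 1 : ℝ)⁻¹ * (4 / (4 * m + 3)) := by
        apply (mul_le_mul_of_nonneg_left h5 (by positivity)).trans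
        exact mul_le_mul_of_nonneg_right h4 (by positivity)
    _ = _ := by field_simp

lemma summable_pair_bound : Summable (fun m : ℕ => (4 : ℝ) / ((4 * m + 1) * (4 * m + 3))) := by
  have h : Summable (fun m : ℕ => 4 * (1 / (((m + 1 : ℕ) : ℝ)) ^ 2)) :=
    ((summable_nat_add_iff 1).mpr (Real.summable_one_div_nat_pow.mpr (by norm_num : 1 < 2))).mul_left 4
  refine Summable.of_nonneg_of_le (fun m => by positivity) (fun m => ?_) h
  rw [mul_one_div]
  apply div_le_div_of_nonneg_left (by norm_num) (by positivity)
  push_cast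
  nlinarith

lemma LL_real {s : ℝ} (hs : 1 < s) :
    LL s = ((∑' m : ℕ, ((4 * m + 1 : ℝ) ^ (-s) - (4 * m + 3 : ℝ) ^ (-s)) : ℝ) : ℂ) := by
  have h := LL_hasSum (s := s) (by simpa using hs)
  have hi0 : Function.Injective (fun k : ℕ => 2 * k) := fun a b h => by simpa using h
  have hi1 : Function.Injective (fun k : ℕ => 2 * k + 1) := fun a b h => by simpa using h
  set f : ℕ → ℂ := fun j => (-1 : ℂ) ^ j * (2 * j + 1 : ℂ) ^ (-(s : ℂ)) with hf
  have h1 : Summable (fun k => f (2 * k)) := h.summable.comp_injective hi0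
  have h2 : Summable (fun k => f (2 * k + 1)) := h.summable.comp_injective hi1
  rw [← h.tsum_eq, ← tsum_even_add_odd (f := f) h1 h2, ofReal_tsum, ← h1.tsum_add h2]
  clear_value f
  refine tsum_congr fun m => ?_
  have e1 : (2 * (2 * m : ℕ) + 1 : ℂ) = ((4 * m + 1 : ℝ) : ℂ) := by push_cast; ring
  have e2 : (2 * (2 * m + 1 : ℕ) + 1 : ℂ) = ((4 * m + 3 : ℝ) : ℂ) := by push_cast; ring
  have e3 : (-1 : ℂ) ^ (2 * m) = 1 := by rw [pow_mul]; simp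
  rw [hf]
  simp only []
  rw [e1, e2, pow_succ, e3, ofReal_sub, ofReal_cpow (by positivity),
    ofReal_cpow (by positivity), ofReal_neg]
  ring

lemma tsum_pair_one :
    ∑' m : ℕ, ((4 * m + 1 : ℝ) ^ (-(1:ℝ)) - (4 * m + 3 : ℝ) ^ (-(1:ℝ))) = pi / 4 := by
  have hs : Summable (fun m : ℕ => ((4 * m + 1 : ℝ) ^ (-(1:ℝ)) - (4 * m + 3 : ℝ) ^ (-(1:ℝ)))) :=
    Summable.of_norm_bounded summable_pair_bound fun m => pair_rpow_bound m le_rfl (by norm_num)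
  refine tendsto_nhds_unique hs.hasSum.tendsto_sum_nat ?_
  have h := Real.tendsto_sum_pi_div_four
  have h2 : Tendsto (fun n : ℕ => 2 * n) atTop atTop :=
    tendsto_id.const_mul_atTop' (by norm_num)
  refine (h.comp h2).congr fun n => ?_
  simp only [Function.comp]
  induction n with
  | zero => simp
  | succ n ih =>
    rw [mul_add, mul_one, sum_range_succ, sum_range_succ, ih, sum_range_succ]
    have e3 : (-1 : ℝ) ^ (2 * n) = 1 := by rw [pow_mul]; simp
    rw [pow_succ, e3, rpow_neg_one, rpow_neg_one]
    push_cast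
    have e1 : (2 * (2 * (n : ℝ)) + 1) = 4 * n + 1 := by ring
    have e2 : (2 * (2 * (n : ℝ) + 1) + 1) = 4 * n + 3 := by ring
    rw [e1, e2]
    norm_num
    ring

lemma LL_one : LL 1 = ((pi / 4 : ℝ) : ℂ) := by
  have h1 : Tendsto (fun s : ℝ => LL s) (nhdsWithin 1 (Ioi 1)) (nhds (LL 1)) := by
    have : ContinuousAt (fun s : ℝ => LL s) 1 :=
      (LL_differentiable.continuous.comp continuous_ofReal).continuousAt
    have h := this.tendsto
    simp only [ofReal_one] at h
    exact h.mono_left nhdsWithin_le_nhds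
  refine tendsto_nhds_unique h1 ?_
  rw [← tsum_pair_one]
  have h2 : Tendsto (fun s : ℝ => ∑' m : ℕ, ((4 * m + 1 : ℝ) ^ (-s) - (4 * m + 3 : ℝ) ^ (-s)))
      (nhdsWithin 1 (Ioi 1))
      (nhds (∑' m : ℕ, ((4 * m + 1 : ℝ) ^ (-(1:ℝ)) - (4 * m + 3 : ℝ) ^ (-(1:ℝ))))) := by
    refine tendsto_tsum_of_dominated_convergence summable_pair_bound (fun m => ?_) ?_
    · refine Tendsto.mono_left ?_ nhdsWithin_le_nhds
      have : ContinuousAt (fun s : ℝ => (4 * m + 1 : ℝ) ^ (-s) - (4 * m + 3 : ℝ) ^ (-s)) 1 := by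
        refine ContinuousAt.sub ?_ ?_
        · exact (Real.continuousAt_const_rpow (by linarith)).comp continuousAt_neg
        · exact (Real.continuousAt_const_rpow (by linarith)).comp continuousAt_neg
      exact this.tendsto
    · filter_upwards [Ioo_mem_nhdsGT (show (1:ℝ) < 2 by norm_num)] with s hs m
      exact pair_rpow_bound m hs.1.le hs.2.le
  refine ((continuous_ofReal.tendsto _).comp h2).congr' ?_
  filter_upwards [self_mem_nhdsWithin] with s hs
  exact (LL_real hs).symm

/-- Local factor of `HH s * ζ(2 s) ^ 2 * L(2 s)` as a function of `t = p ^ (-s)`. -/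
noncomputable def gfun (p : ℕ) (t : ℂ) : ℂ :=
  if p = 2 then (1 - t) / (1 - t ^ 2) ^ 2
  else if p % 4 = 1 then (1 + 2 * t) / ((1 - t) * (1 + t) ^ 3) else 1 / (1 - t ^ 4)

noncomputable def GG (s : ℂ) : ℂ := HH s * riemannZeta (2 * s) ^ 2 * LL (2 * s)

lemma one_add_ne_zero_of_norm {t : ℂ} (ht : ‖t‖ < 1) : 1 + t ≠ 0 := by
  intro h
  have : t = -1 := by linear_combination h
  rw [this] at ht; simp at ht

lemma one_sub_ne_zero_of_norm {t : ℂ} (ht : ‖t‖ < 1) : 1 - t ≠ 0 := by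
  have := one_add_ne_zero_of_norm (t := -t) (by simpa using ht)
  rwa [← sub_eq_add_neg] at this

lemma norm_pow_lt_one {t : ℂ} (ht : ‖t‖ < 1) {n : ℕ} (hn : n ≠ 0) : ‖t ^ n‖ < 1 := by
  rw [norm_pow]; exact pow_lt_one₀ (norm_nonneg _) ht hn

lemma gfun_eq {p : ℕ} (hp : p.Prime) {t : ℂ} (ht : ‖t‖ < 1) :
    gfun p t = hpoly p t * ((1 - t ^ 2)⁻¹) ^ 2 * (1 - (chiArith p : ℂ) * t ^ 2)⁻¹ := by
  have h1 := one_add_ne_zero_of_norm ht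
  have h2 := one_sub_ne_zero_of_norm ht
  have h3 := one_add_ne_zero_of_norm (norm_pow_lt_one ht two_ne_zero)
  have h4 : 1 - t ^ 2 ≠ 0 := one_sub_ne_zero_of_norm (norm_pow_lt_one ht two_ne_zero)
  rcases prime_cases hp with ⟨h, hc⟩ | ⟨h, h', hc⟩ | ⟨h, h', hc⟩
  · subst h
    rw [gfun, hpoly, if_pos rfl, if_pos rfl, hc]; simp [div_eq_mul_inv]
  · rw [gfun, if_neg h, if_pos h', hpoly, if_neg h, hc, show (1 - t ^ 2) = (1 - t) * (1 + t) by ring]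
    push_cast
    rw [one_mul, show (1 - t ^ 2) = (1 - t) * (1 + t) by ring]
    field_simp
    ring
  · rw [gfun, if_neg h, if_neg (by omega), hpoly, if_neg h, hc]
    push_cast
    rw [show (1 - t ^ 4) = (1 - t ^ 2) * (1 + t ^ 2) by ring, show 1 - -1 * t ^ 2 = 1 + t ^ 2 by ring]
    field_simp
    ring

lemma norm_prime_cpow_lt_one (p : Nat.Primes) {s : ℂ} (hs : 0 < s.re) :
    ‖(p : ℂ) ^ (-s)‖ < 1 := by
  rw [norm_prime_cpow p.2]
  exact Real.rpow_lt_one_of_one_lt_of_neg (by exact_mod_cast p.2.one_lt) (by linarith)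

lemma prime_cpow_two_mul (p : Nat.Primes) (s : ℂ) :
    (p : ℂ) ^ (-(2 * s)) = ((p : ℂ) ^ (-s)) ^ 2 := by
  rw [← cpow_nat_mul]; congr 1; push_cast; ring

lemma GG_hasProd {s : ℂ} (hs : 1 / 2 < s.re) :
    HasProd (fun p : Nat.Primes => gfun p ((p : ℂ) ^ (-s))) (GG s) := by
  have h2 : 1 < (2 * s).re := by simp; linarith
  have h := ((HH_hasProd hs).mul ((zeta_hasProd h2).pow 2)).mul (LL_hasProd h2)
  refine h.congr_fun fun p => ?_
  rw [gfun_eq p.2 (norm_prime_cpow_lt_one p (by linarith))]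
  simp only [prime_cpow_two_mul]

lemma gfun_ne_zero (p : ℕ) {t : ℂ} (ht : ‖t‖ ≤ 1 / 2) (hp : p ≠ 2 → ‖t‖ < 1 / 2) : gfun p t ≠ 0 := by
  have ht' : ‖t‖ < 1 := by linarith
  have h1 := one_add_ne_zero_of_norm ht'
  have h2 := one_sub_ne_zero_of_norm ht'
  have h4 : 1 - t ^ 2 ≠ 0 := one_sub_ne_zero_of_norm (norm_pow_lt_one ht' two_ne_zero)
  have h5 : 1 - t ^ 4 ≠ 0 := one_sub_ne_zero_of_norm (norm_pow_lt_one ht' (by norm_num))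
  unfold gfun
  split_ifs with h
  · positivity
  · have : 1 + 2 * t ≠ 0 := one_add_ne_zero_of_norm (by
      rw [norm_mul]; simp; linarith [hp h])
    exact div_ne_zero this (mul_ne_zero h2 (pow_ne_zero _ h1))
  · exact one_div_ne_zero h5

lemma norm_gfun_sub_one_le {p : ℕ} (hp : p ≠ 2) {t : ℂ} (ht : ‖t‖ ≤ 3 / 5) :
    ‖gfun p t - 1‖ ≤ 200 * ‖t‖ ^ 3 := by
  have ht' : ‖t‖ < 1 := by linarith
  have h1 := one_add_ne_zero_of_norm ht'
  have h2 := one_sub_ne_zero_of_norm ht'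
  have h5 : 1 - t ^ 4 ≠ 0 := one_sub_ne_zero_of_norm (norm_pow_lt_one ht' (by norm_num))
  have n1 : 2 / 5 ≤ ‖1 + t‖ := by
    have := norm_sub_norm_le (1 : ℂ) (-t); simp at this; linarith
  have n2 : 2 / 5 ≤ ‖1 - t‖ := by
    have := norm_sub_norm_le (1 : ℂ) t; simp at this; linarith
  have n4 : ‖t‖ ^ 4 ≤ ‖t‖ ^ 3 := by
    have := pow_le_pow_of_le_one (norm_nonneg t) ht'.le (show 3 ≤ 4 by norm_num); exact this
  rw [gfun, if_neg hp]
  split_ifs with h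
  · have e : (1 + 2 * t) / ((1 - t) * (1 + t) ^ 3) - 1 =
        (2 * t ^ 3 + t ^ 4) / ((1 - t) * (1 + t) ^ 3) := by field_simp; ring
    rw [e, norm_div, div_le_iff₀ (norm_pos_iff.mpr (mul_ne_zero h2 (pow_ne_zero _ h1)))]
    have a1 : ‖2 * t ^ 3 + t ^ 4‖ ≤ 3 * ‖t‖ ^ 3 := by
      refine (norm_add_le _ _).trans ?_
      simp only [norm_mul, norm_pow, norm_ofNat]; linarith
    have a2 : (2 / 5 : ℝ) * (2 / 5) ^ 3 ≤ ‖(1 - t) * (1 + t) ^ 3‖ := by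
      rw [norm_mul, norm_pow]; gcongr
    have : 0 ≤ ‖t‖ ^ 3 := by positivity
    nlinarith
  · have e : 1 / (1 - t ^ 4) - 1 = t ^ 4 / (1 - t ^ 4) := by field_simp; ring
    rw [e, norm_div, div_le_iff₀ (by positivity), norm_pow]
    have a2 : (2 / 5 : ℝ) ≤ ‖1 - t ^ 4‖ := by
      have := norm_sub_norm_le (1 : ℂ) (t ^ 4)
      rw [norm_pow] at this; simp at this
      have : ‖t‖ ^ 4 ≤ ‖t‖ := by
        simpa using pow_le_pow_of_le_one (norm_nonneg t) ht'.le (show 1 ≤ 4 by norm_num)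
      linarith
    have : 0 ≤ ‖t‖ ^ 3 := by positivity
    nlinarith

/-- Logarithmic derivative of `gfun p` in `t`. -/
noncomputable def gfunLog (p : ℕ) (t : ℂ) : ℂ :=
  if p = 2 then -1 / (1 - t) + 4 * t / (1 - t ^ 2)
  else if p % 4 = 1 then 2 / (1 + 2 * t) + 1 / (1 - t) - 3 / (1 + t) else 4 * t ^ 3 / (1 - t ^ 4)

lemma gfun_differentiableAt (p : ℕ) {t : ℂ} (ht : ‖t‖ < 1) : DifferentiableAt ℂ (gfun p) t := by
  have h1 := one_add_ne_zero_of_norm ht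
  have h2 := one_sub_ne_zero_of_norm ht
  have h4 : 1 - t ^ 2 ≠ 0 := one_sub_ne_zero_of_norm (norm_pow_lt_one ht two_ne_zero)
  have h5 : 1 - t ^ 4 ≠ 0 := one_sub_ne_zero_of_norm (norm_pow_lt_one ht (by norm_num))
  unfold gfun
  split_ifs with h h'
  · exact DifferentiableAt.div (by fun_prop) (by fun_prop) (by positivity)
  · exact DifferentiableAt.div (by fun_prop) (by fun_prop) (by positivity)
  · exact DifferentiableAt.div (by fun_prop) (by fun_prop) (by positivity)

lemma logDeriv_gfun (p : ℕ) {t : ℂ} (ht : ‖t‖ ≤ 1 / 2) (hp : p ≠ 2 → ‖t‖ < 1 / 2) :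
    logDeriv (gfun p) t = gfunLog p t := by
  have ht' : ‖t‖ < 1 := by linarith
  have h1 := one_add_ne_zero_of_norm ht'
  have h2 := one_sub_ne_zero_of_norm ht'
  have h4 : 1 - t ^ 2 ≠ 0 := one_sub_ne_zero_of_norm (norm_pow_lt_one ht' two_ne_zero)
  have h5 : 1 - t ^ 4 ≠ 0 := one_sub_ne_zero_of_norm (norm_pow_lt_one ht' (by norm_num))
  unfold gfun gfunLog
  split_ifs with h h'
  · have e : HasDerivAt (fun t : ℂ => (1 - t) / (1 - t ^ 2) ^ 2) _ t :=
      ((hasDerivAt_id t).const_sub 1).div (((hasDerivAt_pow 2 t).const_sub 1).pow 2) (by positivity)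
    rw [logDeriv_apply, e.deriv]
    simp only [id]
    field_simp
    push_cast
    ring
  · have h6 : 1 + 2 * t ≠ 0 := one_add_ne_zero_of_norm (by
      rw [norm_mul]; simp; linarith [hp h])
    have e : HasDerivAt (fun t : ℂ => (1 + 2 * t) / ((1 - t) * (1 + t) ^ 3)) _ t :=
      (((hasDerivAt_id t).const_mul 2).const_add 1).div
        (((hasDerivAt_id t).const_sub 1).mul (((hasDerivAt_id t).const_add 1).pow 3)) (by positivity)
    rw [logDeriv_apply, e.deriv]
    simp only [id]
    field_simp
    push_cast
    ring
  · have e : HasDerivAt (fun t : ℂ => 1 / (1 - t ^ 4)) _ t :=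
      (hasDerivAt_const t (1:ℂ)).div ((hasDerivAt_pow 4 t).const_sub 1) h5
    rw [logDeriv_apply, e.deriv]
    field_simp
    push_cast
    ring

lemma prime_cpow_neg_one (p : Nat.Primes) : (p : ℂ) ^ (-(1 : ℂ)) = (p : ℂ)⁻¹ := by
  rw [cpow_neg_one]

lemma norm_inv_prime_le (p : Nat.Primes) : ‖(p : ℂ)⁻¹‖ ≤ 1 / 2 := by
  rw [norm_inv, Complex.norm_natCast, one_div]
  exact inv_anti₀ (by norm_num) (by exact_mod_cast p.2.two_le)

lemma norm_inv_prime_lt (p : Nat.Primes) (h : (p : ℕ) ≠ 2) : ‖(p : ℂ)⁻¹‖ < 1 / 2 := by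
  rw [norm_inv, Complex.norm_natCast, one_div]
  have : 2 < (p : ℕ) := lt_of_le_of_ne p.2.two_le (Ne.symm h)
  exact inv_strictAnti₀ (by norm_num) (by exact_mod_cast this)

lemma gfun_multipliableLocallyUniformlyOn :
    MultipliableLocallyUniformlyOn
      (fun (p : Nat.Primes) (s : ℂ) => gfun p ((p : ℂ) ^ (-s))) {s : ℂ | 3 / 4 < s.re} := by
  have hopen : IsOpen {s : ℂ | 3 / 4 < s.re} := isOpen_lt continuous_const continuous_re
  have hu : Summable (fun p : Nat.Primes => 200 * (p : ℝ) ^ (-(9 / 4) : ℝ)) :=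
    (Nat.Primes.summable_rpow.mpr (by norm_num)).mul_left 200
  have h := hu.multipliableLocallyUniformlyOn_one_add (K := {s : ℂ | 3 / 4 < s.re})
    (f := fun (p : Nat.Primes) (s : ℂ) => gfun p ((p : ℂ) ^ (-s)) - 1) hopen ?_ ?_
  · simpa using h
  · have hfin : ∀ᶠ p : Nat.Primes in cofinite, p ≠ ⟨2, Nat.prime_two⟩ := by
      filter_upwards [(Set.finite_singleton
        (⟨2, Nat.prime_two⟩ : Nat.Primes)).eventually_cofinite_notMem] with p hp using hp
    filter_upwards [hfin] with p hp s hs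
    have hp2 : (p : ℕ) ≠ 2 := fun h => hp (Subtype.ext h)
    have hs' : 3 / 4 < s.re := hs
    have h3 : (3 : ℝ) ≤ (p : ℕ) := by
      have : 2 < (p : ℕ) := lt_of_le_of_ne p.2.two_le (Ne.symm hp2)
      exact_mod_cast this
    have hle : ‖(p : ℂ) ^ (-s)‖ ≤ (p : ℝ) ^ (-(3 / 4) : ℝ) := by
      rw [norm_prime_cpow p.2]
      exact rpow_le_rpow_of_exponent_le (by linarith) (by linarith)
    have h35 : (p : ℝ) ^ (-(3 / 4) : ℝ) ≤ 3 / 5 := by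
      calc (p : ℝ) ^ (-(3 / 4) : ℝ) ≤ (3 : ℝ) ^ (-(3 / 4) : ℝ) :=
            rpow_le_rpow_of_nonpos (by norm_num) h3 (by norm_num)
        _ ≤ (3 : ℝ) ^ (-(1 / 2) : ℝ) :=
            rpow_le_rpow_of_exponent_le (by norm_num) (by norm_num)
        _ ≤ 3 / 5 := by
            rw [rpow_neg (by norm_num), ← sqrt_eq_rpow, inv_le_comm₀ (by positivity) (by norm_num)]
            apply Real.le_sqrt_of_sq_le; norm_num
    refine (norm_gfun_sub_one_le hp2 (hle.trans h35)).trans ?_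
    have h4 : ‖(p : ℂ) ^ (-s)‖ ^ 3 ≤ ((p : ℝ) ^ (-(3 / 4) : ℝ)) ^ 3 := by gcongr
    rw [← rpow_natCast ((p : ℝ) ^ (-(3 / 4) : ℝ)), ← rpow_mul (by linarith)] at h4
    norm_num at h4 ⊢
    linarith
  · intro p s hs
    have hs' : 3 / 4 < s.re := hs
    refine ContinuousWithinAt.sub ?_ continuousWithinAt_const
    have hc : ContinuousAt (fun s : ℂ => (p : ℂ) ^ (-s)) s :=
      (continuousAt_const_cpow (by exact_mod_cast p.2.ne_zero)).comp continuousAt_neg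
    exact (ContinuousAt.comp (g := gfun p) (f := fun s : ℂ => (p : ℂ) ^ (-s)) (x := s)
      (gfun_differentiableAt p (norm_prime_cpow_lt_one p (by linarith))).continuousAt hc).continuousWithinAt

lemma logDeriv_GG_one_eq_tsum
    (hsum : Summable fun p : Nat.Primes =>
      -(log (p : ℕ) : ℂ) * (p : ℂ)⁻¹ * gfunLog p (p : ℂ)⁻¹) (h0 : GG 1 ≠ 0) :
    logDeriv GG 1 = ∑' p : Nat.Primes,
      -(log (p : ℕ) : ℂ) * (p : ℂ)⁻¹ * gfunLog p (p : ℂ)⁻¹ := by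
  have hopen : IsOpen {s : ℂ | 3 / 4 < s.re} := isOpen_lt continuous_const continuous_re
  have hmem : (1 : ℂ) ∈ {s : ℂ | 3 / 4 < s.re} := by
    simp only [mem_ofPred_eq, one_re]; norm_num
  have hld : ∀ p : Nat.Primes, logDeriv (fun s : ℂ => gfun p ((p : ℂ) ^ (-s))) 1 =
      -(log (p : ℕ) : ℂ) * (p : ℂ)⁻¹ * gfunLog p (p : ℂ)⁻¹ := by
    intro p
    have hp0 : (p : ℂ) ≠ 0 := by exact_mod_cast p.2.ne_zero
    have hd : HasDerivAt (fun s : ℂ => (p : ℂ) ^ (-s)) _ 1 :=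
      (hasDerivAt_neg (1 : ℂ)).const_cpow (Or.inl hp0)
    have := logDeriv_comp (f := gfun p) (g := fun s : ℂ => (p : ℂ) ^ (-s)) (x := 1)
      (gfun_differentiableAt p (norm_prime_cpow_lt_one p (by simp))) hd.differentiableAt
    rw [Function.comp_def] at this
    rw [this, hd.deriv, prime_cpow_neg_one, logDeriv_gfun p (norm_inv_prime_le p)
      (norm_inv_prime_lt p), natCast_log]
    ring
  have key := logDeriv_tprod_eq_tsum hopen hmem
    (f := fun (p : Nat.Primes) (s : ℂ) => gfun p ((p : ℂ) ^ (-s))) ?_ ?_ ?_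
    gfun_multipliableLocallyUniformlyOn ?_
  · rw [← tsum_congr hld, ← key]
    have : GG =ᶠ[nhds 1] fun s => ∏' p : Nat.Primes, gfun p ((p : ℂ) ^ (-s)) := by
      filter_upwards [hopen.mem_nhds hmem] with s hs
      exact (GG_hasProd (by linarith)).tprod_eq.symm
    rw [logDeriv_apply, logDeriv_apply, this.deriv_eq, this.self_of_nhds]
  · intro p
    rw [prime_cpow_neg_one]
    exact gfun_ne_zero p (norm_inv_prime_le p) (norm_inv_prime_lt p)
  · intro p s (hs : 3 / 4 < s.re)
    have hp0 : (p : ℂ) ≠ 0 := by exact_mod_cast p.2.ne_zero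
    have hd : DifferentiableAt ℂ (fun s : ℂ => (p : ℂ) ^ (-s)) s :=
      ((hasDerivAt_neg s).const_cpow (Or.inl hp0)).differentiableAt
    exact (DifferentiableAt.comp (g := gfun p) s
      (gfun_differentiableAt p (norm_prime_cpow_lt_one p (by linarith))) hd).differentiableWithinAt
  · simpa only [hld] using hsum
  · rw [(GG_hasProd (s := 1) (by norm_num)).tprod_eq]; exact h0

lemma summable_primes_inv_sq (c : ℝ) : Summable (fun p : Nat.Primes => c / (p : ℝ) ^ 2) := by
  have := (Nat.Primes.summable_rpow (r := -2)).mpr (by norm_num)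
  refine (this.mul_left c).congr fun p => ?_
  rw [rpow_neg (by positivity), div_eq_mul_inv]; norm_num

lemma prime_indicator_split (p : Nat.Primes) :
    ((p : ℕ) = 2 ∧ (p : ℕ) % 4 ≠ 1 ∧ (p : ℕ) % 4 ≠ 3) ∨
      ((p : ℕ) ≠ 2 ∧ (p : ℕ) % 4 = 1 ∧ (p : ℕ) % 4 ≠ 3) ∨
      ((p : ℕ) ≠ 2 ∧ (p : ℕ) % 4 ≠ 1 ∧ (p : ℕ) % 4 = 3) := by
  rcases prime_cases p.2 with ⟨h, _⟩ | ⟨h, h', _⟩ | ⟨h, h', _⟩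
  · left; rw [h]; simp
  · right; left; refine ⟨h, h', ?_⟩; omega
  · right; right; refine ⟨h, ?_, h'⟩; omega

lemma tprod_primes_split {q : Nat.Primes} (hq : (q : ℕ) = 2) (f : Nat.Primes → ℝ) (hf : Summable fun p => f p - 1) :
    ∏' p, f p = f q *
      (∏' p : {p : Nat.Primes // p.1 % 4 = 1}, f p.1) *
      (∏' p : {p : Nat.Primes // p.1 % 4 = 3}, f p.1) := by
  have hm : ∀ S : Set Nat.Primes, Multipliable (S.mulIndicator f) := by
    intro S
    refine (Real.multipliable_one_add_of_summable (hf.indicator S)).congr fun p => ?_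
    by_cases h : p ∈ S <;> simp [h]
  have e1 := tprod_subtype {p : Nat.Primes | p.1 % 4 = 1} f
  have e3 := tprod_subtype {p : Nat.Primes | p.1 % 4 = 3} f
  have e2 : f q = ∏' p, ({q} : Set Nat.Primes).mulIndicator f p := by
    rw [tprod_eq_mulSingle q (by
      intro p hp; rw [Set.mulIndicator_of_notMem]; simpa using hp)]
    simp
  change _ = _ * (∏' p : ↑{p : Nat.Primes | p.1 % 4 = 1}, f p) *
    (∏' p : ↑{p : Nat.Primes | p.1 % 4 = 3}, f p)
  rw [e1, e2, e3, ← (hm _).tprod_mul (hm _), ← ((hm _).mul (hm _)).tprod_mul (hm _)]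
  refine tprod_congr fun p => ?_
  rcases prime_indicator_split p with ⟨h2, h1, h3⟩ | ⟨h2, h1, h3⟩ | ⟨h2, h1, h3⟩
  · have : p = q := Subtype.ext (h2.trans hq.symm)
    subst this
    simp [Set.mulIndicator, h1, h3]
  · have : p ≠ q := fun h => h2 (h ▸ hq)
    simp [Set.mulIndicator, h1, this]
  · have : p ≠ q := fun h => h2 (h ▸ hq)
    simp [Set.mulIndicator, h3, this]

lemma tsum_primes_split {q : Nat.Primes} (hq : (q : ℕ) = 2) (f : Nat.Primes → ℝ) (hf : Summable f) :
    ∑' p, f p = f q +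
      (∑' p : {p : Nat.Primes // p.1 % 4 = 1}, f p.1) +
      (∑' p : {p : Nat.Primes // p.1 % 4 = 3}, f p.1) := by
  have hm : ∀ S : Set Nat.Primes, Summable (S.indicator f) := fun S => hf.indicator S
  have e1 := tsum_subtype {p : Nat.Primes | p.1 % 4 = 1} f
  have e3 := tsum_subtype {p : Nat.Primes | p.1 % 4 = 3} f
  have e2 : f q = ∑' p, ({q} : Set Nat.Primes).indicator f p := by
    rw [tsum_eq_single q (by
      intro p hp; rw [indicator_of_notMem]; simpa using hp)]
    simp
  change _ = _ + (∑' p : ↑{p : Nat.Primes | p.1 % 4 = 1}, f p) +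
    (∑' p : ↑{p : Nat.Primes | p.1 % 4 = 3}, f p)
  rw [e1, e2, e3, ← (hm _).tsum_add (hm _), ← ((hm _).add (hm _)).tsum_add (hm _)]
  refine tsum_congr fun p => ?_
  rcases prime_indicator_split p with ⟨h2, h1, h3⟩ | ⟨h2, h1, h3⟩ | ⟨h2, h1, h3⟩
  · have : p = q := Subtype.ext (h2.trans hq.symm)
    subst this
    simp [Set.indicator, h1, h3]
  · have : p ≠ q := fun h => h2 (h ▸ hq)
    simp [Set.indicator, h1, this]
  · have : p ≠ q := fun h => h2 (h ▸ hq)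
    simp [Set.indicator, h3, this]

noncomputable def gReal (p : ℕ) : ℝ :=
  if p = 2 then 8 / 9
  else if p % 4 = 1 then (p : ℝ) ^ 3 * (p + 2) / ((p - 1) * (p + 1) ^ 3) else (p : ℝ) ^ 4 / (p ^ 4 - 1)

lemma gReal_pos (p : Nat.Primes) : 0 < gReal p := by
  have h2 : (2 : ℝ) ≤ (p : ℕ) := by exact_mod_cast p.2.two_le
  have h1 : (0 : ℝ) < (p : ℕ) - 1 := by linarith
  have h4 : (0 : ℝ) < (p : ℝ) ^ 4 - 1 := by
    have : (1:ℝ) < (p : ℝ) ^ 4 := one_lt_pow₀ (by linarith) (by norm_num)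
    linarith
  unfold gReal
  split_ifs <;> positivity

lemma gfun_inv_prime (p : Nat.Primes) : gfun p (p : ℂ)⁻¹ = (gReal p : ℂ) := by
  have h2 : (2 : ℝ) ≤ (p : ℕ) := by exact_mod_cast p.2.two_le
  have h1 : (p : ℂ) - 1 ≠ 0 := by
    have : ((p : ℝ) - 1) ≠ 0 := by linarith
    exact_mod_cast this
  have h1' : (p : ℂ) + 1 ≠ 0 := by
    have : ((p : ℝ) + 1) ≠ 0 := by linarith
    exact_mod_cast this
  have h0 : (p : ℂ) ≠ 0 := by exact_mod_cast p.2.ne_zero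
  have h4 : (p : ℂ) ^ 4 - 1 ≠ 0 := by
    have : (1:ℝ) < (p : ℝ) ^ 4 := one_lt_pow₀ (by linarith) (by norm_num)
    have : (p : ℝ) ^ 4 - 1 ≠ 0 := by linarith
    exact_mod_cast this
  unfold gfun gReal
  split_ifs with h h'
  · rw [h]; norm_num
  · push_cast
    rw [show 1 - (p : ℂ)⁻¹ = ((p : ℂ) - 1) / (p : ℕ) by field_simp,
      show 1 + (p : ℂ)⁻¹ = ((p : ℂ) + 1) / (p : ℕ) by field_simp]
    field_simp
  · push_cast
    rw [show 1 - ((p : ℂ)⁻¹) ^ 4 = ((p : ℂ) ^ 4 - 1) / (p : ℕ) ^ 4 by field_simp]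
    field_simp

lemma summable_gReal_sub_one : Summable (fun p : Nat.Primes => gReal p - 1) := by
  refine Summable.of_norm_bounded (summable_primes_inv_sq 100) fun p => ?_
  have h : (gReal p - 1 : ℝ) = ((gfun p (p : ℂ)⁻¹ - 1)).re := by
    rw [gfun_inv_prime]; simp
  by_cases hp : (p : ℕ) = 2
  · rw [gReal, if_pos hp, hp]; norm_num
  · rw [h, norm_eq_abs]
    refine (abs_re_le_norm _).trans ?_
    refine (norm_gfun_sub_one_le hp ((norm_inv_prime_le p).trans (by norm_num))).trans ?_
    have h1 := norm_inv_prime_le p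
    have h2 : ‖(p : ℂ)⁻¹‖ ^ 2 = 1 / (p : ℝ) ^ 2 := by
      rw [norm_inv, Complex.norm_natCast]; simp
    rw [pow_succ, h2]
    have : 0 ≤ 1 / (p : ℝ) ^ 2 := by positivity
    rw [show (100 : ℝ) / (p : ℝ) ^ 2 = 100 * (1 / (p : ℝ) ^ 2) by ring]
    nlinarith

lemma GG_one_eq_tprod : GG 1 = ((∏' p : Nat.Primes, gReal p : ℝ) : ℂ) := by
  have hm : Multipliable (fun p : Nat.Primes => gReal p) := by
    simpa using Real.multipliable_one_add_of_summable summable_gReal_sub_one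
  have h := hm.hasProd.map ofRealHom continuous_ofReal
  refine (GG_hasProd (s := 1) (by norm_num)).unique (HasProd.congr_fun h fun p => ?_)
  rw [prime_cpow_neg_one, gfun_inv_prime]; rfl

lemma GG_one_ne_zero : GG 1 ≠ 0 := by
  rw [GG_one_eq_tprod, ofReal_ne_zero]
  have : ∏' p : Nat.Primes, (1 + (gReal p - 1)) ≠ 0 := tprod_one_add_ne_zero_of_summable
    (fun p => by simpa using (gReal_pos p).ne') summable_gReal_sub_one.norm
  simpa using this

lemma GG_one : GG 1 = ((8 / 9 *
      (∏' p : {p : Nat.Primes // p.1 % 4 = 1},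
        (p.1.1 : ℝ) ^ 3 * ((p.1.1 : ℝ) + 2) /
          (((p.1.1 : ℝ) - 1) * ((p.1.1 : ℝ) + 1) ^ 3)) *
      (∏' p : {p : Nat.Primes // p.1 % 4 = 3},
        (p.1.1 : ℝ) ^ 4 / ((p.1.1 : ℝ) ^ 4 - 1)) : ℝ) : ℂ) := by
  rw [GG_one_eq_tprod, tprod_primes_split (q := ⟨2, Nat.prime_two⟩) rfl _ summable_gReal_sub_one]
  have e1 : ∀ p : {p : Nat.Primes // p.1 % 4 = 1}, gReal p.1 = (p.1.1 : ℝ) ^ 3 * ((p.1.1 : ℝ) + 2) /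
          (((p.1.1 : ℝ) - 1) * ((p.1.1 : ℝ) + 1) ^ 3) := fun p => by
    have := p.2
    have h : (p.1 : ℕ) % 4 = 1 := this
    rw [gReal, if_neg (by omega), if_pos h]
  have e3 : ∀ p : {p : Nat.Primes // p.1 % 4 = 3}, gReal p.1 =
      (p.1.1 : ℝ) ^ 4 / ((p.1.1 : ℝ) ^ 4 - 1) := fun p => by
    rw [gReal, if_neg (by omega), if_neg (by omega)]
  rw [tprod_congr e1, tprod_congr e3]
  congr 3

noncomputable def gLogReal (p : ℕ) : ℝ :=
  if p = 2 then -(1 / 3) * log 2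
  else if p % 4 = 1 then -6 * (log p / ((p + 1) * (p - 1) * (p + 2)))
  else -4 * (log p / (p ^ 4 - 1))

lemma gfunLog_inv_prime (p : Nat.Primes) :
    -(log (p : ℕ) : ℂ) * (p : ℂ)⁻¹ * gfunLog p (p : ℂ)⁻¹ = (gLogReal p : ℂ) := by
  have h2 : (2 : ℝ) ≤ (p : ℕ) := by exact_mod_cast p.2.two_le
  have h1 : (p : ℂ) - 1 ≠ 0 := by
    have : ((p : ℝ) - 1) ≠ 0 := by linarith
    exact_mod_cast this
  have h1' : (p : ℂ) + 1 ≠ 0 := by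
    have : ((p : ℝ) + 1) ≠ 0 := by linarith
    exact_mod_cast this
  have h1'' : (p : ℂ) + 2 ≠ 0 := by
    have : ((p : ℝ) + 2) ≠ 0 := by linarith
    exact_mod_cast this
  have h0 : (p : ℂ) ≠ 0 := by exact_mod_cast p.2.ne_zero
  have h4 : (p : ℂ) ^ 4 - 1 ≠ 0 := by
    have : (1:ℝ) < (p : ℝ) ^ 4 := one_lt_pow₀ (by linarith) (by norm_num)
    have : (p : ℝ) ^ 4 - 1 ≠ 0 := by linarith
    exact_mod_cast this
  unfold gfunLog gLogReal
  split_ifs with h h'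
  · rw [h]; push_cast; norm_num; ring
  · push_cast
    rw [show 1 - (p : ℂ)⁻¹ = ((p : ℂ) - 1) / (p : ℕ) by field_simp,
      show 1 + (p : ℂ)⁻¹ = ((p : ℂ) + 1) / (p : ℕ) by field_simp,
      show 1 + 2 * (p : ℂ)⁻¹ = ((p : ℂ) + 2) / (p : ℕ) by field_simp]
    field_simp
    ring
  · push_cast
    rw [show 1 - ((p : ℂ)⁻¹) ^ 4 = ((p : ℂ) ^ 4 - 1) / (p : ℕ) ^ 4 by field_simp]
    field_simp

lemma summable_gLogReal : Summable (fun p : Nat.Primes => gLogReal p) := by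
  refine Summable.of_norm_bounded (summable_primes_inv_sq 6) fun p => ?_
  have h2 : (2 : ℝ) ≤ (p : ℕ) := by exact_mod_cast p.2.two_le
  have hl0 : 0 ≤ log (p : ℕ) := log_nonneg (by linarith)
  have hl : log (p : ℕ) ≤ (p : ℕ) := (Real.log_le_sub_one_of_pos (by linarith)).trans (by linarith)
  set q : ℝ := (p : ℝ) with hq
  have hq3 : 0 < q ^ 3 := by positivity
  have e : q / q ^ 3 = 1 / q ^ 2 := by field_simp
  unfold gLogReal
  split_ifs with h h'
  · rw [hq, h]
    have h3 : log 2 ≤ 1 := by have := Real.log_two_lt_d9; linarith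
    have h4 : 0 ≤ log 2 := log_nonneg (by norm_num)
    rw [norm_mul, norm_of_nonneg h4]; norm_num; linarith
  · have a : log q / ((q + 1) * (q - 1) * (q + 2)) ≤ q / q ^ 3 :=
      div_le_div₀ (by linarith) hl hq3 (by nlinarith)
    have b : 0 ≤ log q / ((q + 1) * (q - 1) * (q + 2)) := by
      have : 0 < q - 1 := by linarith
      positivity
    rw [norm_mul, norm_of_nonneg b, e] at *
    norm_num
    rw [div_eq_mul_one_div 6]; linarith
  · have hq4 : q ^ 3 ≤ q ^ 4 - 1 := by nlinarith [sq_nonneg q, mul_pos hq3 (by linarith : (0:ℝ) < q)]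
    have a : log q / (q ^ 4 - 1) ≤ q / q ^ 3 := div_le_div₀ (by linarith) hl hq3 hq4
    have b : 0 ≤ log q / (q ^ 4 - 1) := div_nonneg hl0 (by linarith)
    rw [norm_mul, norm_of_nonneg b, e] at *
    norm_num
    rw [div_eq_mul_one_div 6]
    have : 0 ≤ 1 / q ^ 2 := by positivity
    linarith

lemma logDeriv_GG_one : logDeriv GG 1 = ((-(1 / 3) * log 2
      - 6 * (∑' p : {p : Nat.Primes // p.1 % 4 = 1},
          log (p.1.1 : ℝ) / (((p.1.1 : ℝ) + 1) * ((p.1.1 : ℝ) - 1) * ((p.1.1 : ℝ) + 2)))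
      - 4 * (∑' p : {p : Nat.Primes // p.1 % 4 = 3},
          log (p.1.1 : ℝ) / ((p.1.1 : ℝ) ^ 4 - 1)) : ℝ) : ℂ) := by
  have hs : Summable (fun p : Nat.Primes => (gLogReal p : ℂ)) :=
    summable_gLogReal.map ofRealHom continuous_ofReal
  rw [logDeriv_GG_one_eq_tsum (by simpa only [gfunLog_inv_prime] using hs) GG_one_ne_zero]
  simp only [gfunLog_inv_prime]
  rw [← ofReal_tsum, tsum_primes_split (q := ⟨2, Nat.prime_two⟩) rfl _ summable_gLogReal]
  congr 1
  rw [sub_eq_add_neg, sub_eq_add_neg, ← neg_mul, ← neg_mul, ← tsum_mul_left, ← tsum_mul_left]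
  have e1 : ∀ p : {p : Nat.Primes // p.1 % 4 = 1}, gLogReal p.1 = -6 * (log (p.1.1 : ℝ) /
      (((p.1.1 : ℝ) + 1) * ((p.1.1 : ℝ) - 1) * ((p.1.1 : ℝ) + 2))) := fun p => by
    have h : (p.1 : ℕ) % 4 = 1 := p.2
    rw [gLogReal, if_neg (by omega), if_pos h]
  have e3 : ∀ p : {p : Nat.Primes // p.1 % 4 = 3}, gLogReal p.1 =
      -4 * (log (p.1.1 : ℝ) / ((p.1.1 : ℝ) ^ 4 - 1)) := fun p => by
    rw [gLogReal, if_neg (by omega), if_neg (by omega)]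
  rw [tsum_congr e1, tsum_congr e3]
  rfl

lemma GG_one_ne_zero_factors : HH 1 ≠ 0 ∧ LL 2 ≠ 0 := by
  have h := GG_one_ne_zero
  rw [GG, mul_one] at h
  exact ⟨left_ne_zero_of_mul (left_ne_zero_of_mul h), right_ne_zero_of_mul h⟩

lemma GG_one_expand : GG 1 = HH 1 * ((pi : ℂ) ^ 2 / 6) ^ 2 * LL 2 := by
  rw [GG, mul_one, riemannZeta_two]

lemma logDeriv_HH_one : deriv HH 1 / HH 1 = logDeriv GG 1
    - 24 * deriv riemannZeta 2 / (pi : ℂ) ^ 2 - 2 * deriv LL 2 / LL 2 := by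
  obtain ⟨h1, h2⟩ := GG_one_ne_zero_factors
  have hpi : (pi : ℂ) ≠ 0 := by exact_mod_cast pi_ne_zero
  have e1 : HasDerivAt HH (deriv HH 1) 1 :=
    (HH_analyticAt (s := 1) (by norm_num)).differentiableAt.hasDerivAt
  have e0 : HasDerivAt (fun s : ℂ => 2 * s) 2 1 := by
    simpa using (hasDerivAt_id (1 : ℂ)).const_mul 2
  have e2 : HasDerivAt (fun s : ℂ => riemannZeta (2 * s)) (deriv riemannZeta 2 * 2) 1 := by
    refine HasDerivAt.comp (h₂ := riemannZeta) 1 ?_ e0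
    rw [mul_one]
    exact (differentiableAt_riemannZeta (by norm_num)).hasDerivAt
  have e3 : HasDerivAt (fun s : ℂ => LL (2 * s)) (deriv LL 2 * 2) 1 := by
    refine HasDerivAt.comp (h₂ := LL) 1 ?_ e0
    rw [mul_one]
    exact LL_differentiable.differentiableAt.hasDerivAt
  have e := (e1.mul (e2.pow 2)).mul e3
  have hGG : HasDerivAt GG _ 1 := e
  rw [logDeriv_apply, hGG.deriv, GG_one_expand]
  simp only [mul_one, riemannZeta_two, Pi.mul_apply, Pi.pow_apply]
  field_simp
  push_cast
  ring

lemma norm_one_add_le_exp (z : ℂ) : ‖1 + z‖ ≤ exp (z.re + ‖z‖ ^ 2 / 2) := by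
  have h : ‖1 + z‖ ^ 2 ≤ exp (z.re + ‖z‖ ^ 2 / 2) ^ 2 := by
    rw [← exp_nat_mul, Complex.sq_norm, normSq_apply]
    have h2 := add_one_le_exp (2 * (z.re + ‖z‖ ^ 2 / 2))
    rw [Complex.sq_norm, normSq_apply] at *
    simp only [add_re, one_re, add_im, one_im]
    push_cast
    nlinarith
  exact (sq_le_sq₀ (norm_nonneg _) (exp_pos _).le).mp h

/-- `2 + χ₋₄(p)`. -/
noncomputable def bcoef (p : ℕ) : ℝ := 2 + (chiArith p : ℝ)

lemma bcoef_nonneg {p : ℕ} (hp : p.Prime) : 0 ≤ bcoef p ∧ 1 ≤ bcoef p ∧ bcoef p ≤ 3 := by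
  rcases prime_cases hp with ⟨_, h⟩ | ⟨_, _, h⟩ | ⟨_, _, h⟩ <;> rw [bcoef, h] <;> norm_num

lemma norm_hpoly_le {p : ℕ} (hp : p.Prime) {t : ℂ} (ht : ‖t‖ ^ 2 ≤ 1 / 2) :
    ‖hpoly p t‖ ≤
      exp (-((bcoef p : ℂ) * t ^ 2).re + 15 * ‖t‖ ^ 3 + (if p = 2 then 2 else 0)) := by
  have ht0 := norm_nonneg t
  have ht1 : ‖t‖ ≤ 1 := by nlinarith
  have hb := bcoef_nonneg hp
  have hre : ((bcoef p : ℂ) * t ^ 2).re ≤ bcoef p * ‖t‖ ^ 2 := by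
    refine (re_le_norm _).trans ?_
    rw [norm_mul, norm_pow, Complex.norm_of_nonneg hb.1]
  by_cases h2 : p = 2
  · have hb2 : bcoef p = 2 := by rw [bcoef, h2, chiArith_apply]; simp
    rw [hpoly, if_pos h2, if_pos h2]
    have h3 : ‖1 - t‖ ≤ 2 := (norm_sub_le _ _).trans (by simp; linarith)
    refine h3.trans ?_
    have h4 := add_one_le_exp (1 : ℝ)
    refine (show (2 : ℝ) ≤ exp 1 by linarith).trans (exp_le_exp.mpr ?_)
    rw [hb2] at hre ⊢
    have : 0 ≤ 15 * ‖t‖ ^ 3 := by positivity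
    linarith
  · rw [hpoly, if_neg h2, if_neg h2]
    set a : ℝ := bcoef p with ha
    have e : 1 - (2 + ((chiArith p : ℤ) : ℂ)) * t ^ 2 + (1 + ((chiArith p : ℤ) : ℂ)) * t ^ 3 =
        1 + (-(a * t ^ 2) + ((a - 1 : ℝ) : ℂ) * t ^ 3) := by
      rw [ha, bcoef]; push_cast; ring
    rw [e]
    refine (norm_one_add_le_exp _).trans (exp_le_exp.mpr ?_)
    have n1 : ‖((a - 1 : ℝ) : ℂ) * t ^ 3‖ ≤ 2 * ‖t‖ ^ 3 := by
      rw [norm_mul, norm_pow, Complex.norm_of_nonneg (by linarith)]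
      gcongr; linarith
    have n2 : ‖(a : ℂ) * t ^ 2‖ ≤ 3 * ‖t‖ ^ 2 := by
      rw [norm_mul, norm_pow, Complex.norm_of_nonneg hb.1]
      gcongr; linarith
    have n32 : ‖t‖ ^ 3 ≤ ‖t‖ ^ 2 := pow_le_pow_of_le_one ht0 ht1 (by norm_num)
    have n43 : ‖t‖ ^ 4 ≤ ‖t‖ ^ 3 := pow_le_pow_of_le_one ht0 ht1 (by norm_num)
    have n3 : ‖-((a : ℂ) * t ^ 2) + ((a - 1 : ℝ) : ℂ) * t ^ 3‖ ≤ 5 * ‖t‖ ^ 2 := by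
      refine (norm_add_le _ _).trans ?_
      rw [norm_neg]; linarith
    have n4 : ‖-((a : ℂ) * t ^ 2) + ((a - 1 : ℝ) : ℂ) * t ^ 3‖ ^ 2 ≤ 25 * ‖t‖ ^ 4 := by
      calc _ ≤ (5 * ‖t‖ ^ 2) ^ 2 := by gcongr
        _ = _ := by ring
    rw [add_re, neg_re]
    have := (re_le_norm _).trans n1
    have : 0 ≤ ‖t‖ ^ 3 := by positivity
    linarith

lemma tprod_le_exp_tsum {ι : Type*} {f : ι → ℂ} {F : ℂ} {a : ι → ℝ} (hf : HasProd f F)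
    (ha : Summable a) (h : ∀ i, ‖f i‖ ≤ exp (a i)) : ‖F‖ ≤ exp (∑' i, a i) := by
  have h1 : Tendsto (fun s : Finset ι => ‖∏ i ∈ s, f i‖) atTop (nhds ‖F‖) :=
    (continuous_norm.tendsto F).comp hf
  have h2 : Tendsto (fun s : Finset ι => exp (∑ i ∈ s, a i)) atTop (nhds (exp (∑' i, a i))) :=
    (Real.continuous_exp.tendsto _).comp ha.hasSum
  refine le_of_tendsto_of_tendsto' h1 h2 fun s => ?_
  rw [norm_prod, exp_sum]
  exact Finset.prod_le_prod (fun i _ => norm_nonneg _) fun i _ => h i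

lemma summable_bcoef {s : ℂ} (hs : 1 < s.re) :
    Summable fun p : Nat.Primes => (bcoef p : ℂ) * (p : ℂ) ^ (-s) := by
  refine Summable.of_norm_bounded (((Nat.Primes.summable_rpow (r := -s.re)).mpr
    (by linarith)).mul_left 3) fun p => ?_
  have hb := bcoef_nonneg p.2
  rw [norm_mul, norm_prime_cpow p.2, Complex.norm_of_nonneg hb.1]
  gcongr; exact hb.2.2

/-- `∑ (2 + χ(p)) p ^ (-s)` over primes. -/
noncomputable def PB (s : ℂ) : ℂ := ∑' p : Nat.Primes, (bcoef p : ℂ) * (p : ℂ) ^ (-s)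

lemma norm_HH_le : ∃ C : ℝ, 0 < C ∧ ∀ s : ℂ, 1 / 2 < s.re →
    ‖HH s‖ ≤ C * exp (-(PB (2 * s)).re) := by
  have hs3 : Summable fun p : Nat.Primes => (p : ℝ) ^ (-(3 / 2) : ℝ) :=
    Nat.Primes.summable_rpow.mpr (by norm_num)
  have hs2 : Summable fun p : Nat.Primes => (if (p : ℕ) = 2 then (2 : ℝ) else 0) := by
    obtain ⟨q, hq⟩ : ∃ q : Nat.Primes, (q : ℕ) = 2 := ⟨⟨2, Nat.prime_two⟩, rfl⟩
    refine summable_of_ne_finset_zero (s := {q}) fun p hp => ?_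
    refine if_neg fun h => hp ?_
    rw [Finset.mem_singleton]; exact Subtype.ext (h.trans hq.symm)
  refine ⟨exp (15 * (∑' p : Nat.Primes, (p : ℝ) ^ (-(3 / 2) : ℝ)) +
    ∑' p : Nat.Primes, (if (p : ℕ) = 2 then (2 : ℝ) else 0)), exp_pos _, fun s hs => ?_⟩
  have h2 : 1 < (2 * s).re := by simp; linarith
  have hre := hasSum_re (summable_bcoef h2).hasSum
  have hsum := (hre.neg.add (hs3.hasSum.mul_left 15)).add hs2.hasSum
  refine (tprod_le_exp_tsum (HH_hasProd hs) hsum.summable fun p => ?_).trans ?_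
  · have hp0 : (0 : ℝ) < (p : ℕ) := by exact_mod_cast p.2.pos
    have hp1 : (1 : ℝ) ≤ (p : ℕ) := by exact_mod_cast p.2.one_le
    have hp2 : (2 : ℝ) ≤ (p : ℕ) := by exact_mod_cast p.2.two_le
    have hn : ‖(p : ℂ) ^ (-s)‖ ≤ (p : ℝ) ^ (-(1 / 2) : ℝ) := by
      rw [norm_prime_cpow p.2]
      exact rpow_le_rpow_of_exponent_le hp1 (by linarith)
    have hn2 : ‖(p : ℂ) ^ (-s)‖ ^ 2 ≤ 1 / 2 := by
      calc _ ≤ ((p : ℝ) ^ (-(1 / 2) : ℝ)) ^ 2 := by gcongr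
        _ = (p : ℝ)⁻¹ := by
            rw [← rpow_natCast, ← rpow_mul hp0.le, ← rpow_neg_one]; norm_num
        _ ≤ 1 / 2 := by rw [one_div]; exact inv_anti₀ (by norm_num) hp2
    have hn3 : ‖(p : ℂ) ^ (-s)‖ ^ 3 ≤ (p : ℝ) ^ (-(3 / 2) : ℝ) := by
      calc _ ≤ ((p : ℝ) ^ (-(1 / 2) : ℝ)) ^ 3 := by gcongr
        _ = _ := by rw [← rpow_natCast, ← rpow_mul hp0.le]; norm_num
    refine (norm_hpoly_le p.2 hn2).trans (exp_le_exp.mpr ?_)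
    rw [prime_cpow_two_mul]
    linarith
  · rw [hsum.tsum_eq, ← exp_add, PB]
    apply le_of_eq
    congr 1; ring

/-- The entire function `(s - 1) ζ(s)`. -/
noncomputable def zz : ℂ → ℂ := Function.update (fun s => (s - 1) * riemannZeta s) 1 1

lemma zz_of_ne {s : ℂ} (hs : s ≠ 1) : zz s = (s - 1) * riemannZeta s := by
  rw [zz, Function.update_of_ne hs]

lemma zz_one : zz 1 = 1 := by rw [zz, Function.update_self]

lemma zz_hasDerivAt_one : HasDerivAt zz (Real.eulerMascheroniConstant : ℂ) 1 := by
  rw [hasDerivAt_iff_tendsto_slope]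
  refine tendsto_riemannZeta_sub_one_div.congr' ?_
  filter_upwards [self_mem_nhdsWithin] with s hs
  have hs' : s - 1 ≠ 0 := sub_ne_zero.mpr hs
  rw [slope_def_field, zz_one, zz_of_ne hs]
  field_simp

lemma zz_differentiable : Differentiable ℂ zz := by
  intro s
  by_cases hs : s = 1
  · rw [hs]; exact zz_hasDerivAt_one.differentiableAt
  · have : zz =ᶠ[nhds s] fun s => (s - 1) * riemannZeta s := by
      filter_upwards [isOpen_ne.mem_nhds hs] with z hz using zz_of_ne hz
    exact (((differentiableAt_id.sub_const 1).mul
      (differentiableAt_riemannZeta hs)).congr_of_eventuallyEq this)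

lemma exp_tsum_le_tprod {ι : Type*} {f : ι → ℂ} {F : ℂ} {a : ι → ℝ} (hf : HasProd f F)
    (ha : Summable a) (h : ∀ i, exp (a i) ≤ ‖f i‖) : exp (∑' i, a i) ≤ ‖F‖ := by
  have h1 : Tendsto (fun s : Finset ι => ‖∏ i ∈ s, f i‖) atTop (nhds ‖F‖) :=
    (continuous_norm.tendsto F).comp hf
  have h2 : Tendsto (fun s : Finset ι => exp (∑ i ∈ s, a i)) atTop (nhds (exp (∑' i, a i))) :=
    (Real.continuous_exp.tendsto _).comp ha.hasSum
  refine le_of_tendsto_of_tendsto' h2 h1 fun s => ?_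
  rw [norm_prod, exp_sum]
  exact Finset.prod_le_prod (fun i _ => (exp_pos _).le) fun i _ => h i

lemma exists_bound_zz_LL : ∃ C : ℝ, 1 ≤ C ∧ ∀ ε : ℝ, 0 ≤ ε → ε ≤ 1 →
    ‖zz (1 + ε)‖ ≤ C ∧ ‖LL (1 + ε)‖ ≤ C := by
  have hc : IsCompact (Set.Icc (0 : ℝ) 1) := isCompact_Icc
  obtain ⟨C1, h1⟩ := hc.exists_bound_of_continuousOn (f := fun ε : ℝ => zz (1 + ε))
    (zz_differentiable.continuous.comp (by fun_prop)).continuousOn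
  obtain ⟨C2, h2⟩ := hc.exists_bound_of_continuousOn (f := fun ε : ℝ => LL (1 + ε))
    (LL_differentiable.continuous.comp (by fun_prop)).continuousOn
  exact ⟨max 1 (max C1 C2), le_max_left _ _, fun ε h0 h => ⟨(h1 ε ⟨h0, h⟩).trans (by simp),
    (h2 ε ⟨h0, h⟩).trans (by simp)⟩⟩

/-- `∑ (2 + χ(p)) p ^ (-σ)` over primes, as a real number. -/
noncomputable def RB (σ : ℝ) : ℝ := ∑' p : Nat.Primes, bcoef p * (p : ℝ) ^ (-σ)

lemma summable_bcoef_real {σ : ℝ} (hσ : 1 < σ) :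
    Summable fun p : Nat.Primes => bcoef p * (p : ℝ) ^ (-σ) := by
  refine Summable.of_nonneg_of_le (fun p => mul_nonneg (bcoef_nonneg p.2).1 (by positivity))
    (fun p => ?_) ((Nat.Primes.summable_rpow (r := -σ)).mpr (by linarith) |>.mul_left 3)
  have hb := bcoef_nonneg p.2
  gcongr; exact hb.2.2

lemma exp_le_inv_one_sub {x : ℝ} (hx : x < 1) : exp x ≤ (1 - x)⁻¹ := by
  have h := Real.one_sub_le_exp_neg x
  rw [exp_neg] at h
  rw [← inv_inv (exp x)]
  exact inv_anti₀ (by linarith) h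

lemma exp_RB_le {σ : ℝ} (hσ : 1 < σ) :
    exp (RB σ) ≤ ‖riemannZeta σ‖ ^ 2 * ‖LL σ‖ := by
  have hs : 1 < (σ : ℂ).re := by simpa using hσ
  have h := ((zeta_hasProd hs).pow 2).mul (LL_hasProd hs)
  have := exp_tsum_le_tprod h (summable_bcoef_real hσ) fun p => ?_
  · rwa [norm_mul, norm_pow] at this
  · have hp0 : (0 : ℝ) < (p : ℕ) := by exact_mod_cast p.2.pos
    have e : (p : ℂ) ^ (-(σ : ℂ)) = (((p : ℝ) ^ (-σ) : ℝ) : ℂ) := by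
      rw [ofReal_cpow hp0.le]; push_cast; rfl
    have hx1 : (p : ℝ) ^ (-σ) < 1 :=
      Real.rpow_lt_one_of_one_lt_of_neg (by exact_mod_cast p.2.one_lt) (by linarith)
    have hx0 : 0 < (p : ℝ) ^ (-σ) := Real.rpow_pos_of_pos hp0 _
    rw [e]
    set x : ℝ := (p : ℝ) ^ (-σ)
    have hc : ((chiArith p : ℤ) : ℝ) * x < 1 := by
      rcases prime_cases p.2 with ⟨_, h⟩ | ⟨_, _, h⟩ | ⟨_, _, h⟩ <;> rw [h] <;> push_cast <;> linarith
    have e2 : (((1 - (x : ℂ))⁻¹) ^ 2 * (1 - ((chiArith p : ℤ) : ℂ) * x)⁻¹) =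
        ((((1 - x)⁻¹) ^ 2 * (1 - ((chiArith p : ℤ) : ℝ) * x)⁻¹ : ℝ) : ℂ) := by push_cast; rfl
    rw [e2, Complex.norm_of_nonneg (mul_nonneg (sq_nonneg _) (inv_nonneg.mpr (by linarith)))]
    rw [show bcoef p * x = x + x + ((chiArith p : ℤ) : ℝ) * x by rw [bcoef]; ring, exp_add, exp_add,
      ← sq]
    have a1 := exp_le_inv_one_sub hx1
    have a2 := exp_le_inv_one_sub hc
    gcongr

lemma RB_le : ∃ C : ℝ, 0 ≤ C ∧ ∀ ε : ℝ, 0 < ε → ε ≤ 1 → RB (1 + ε) ≤ 2 * log (1 / ε) + C := by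
  obtain ⟨C, hC1, hC⟩ := exists_bound_zz_LL
  refine ⟨3 * log C, by have := log_nonneg hC1; linarith, fun ε h0 h1 => ?_⟩
  have h := exp_RB_le (σ := 1 + ε) (by linarith)
  obtain ⟨hz, hl⟩ := hC ε h0.le h1
  have hne : (1 + (ε : ℂ)) ≠ 1 := by
    intro h; rw [add_eq_left] at h; exact h0.ne' (by exact_mod_cast h)
  rw [zz_of_ne hne, norm_mul, add_sub_cancel_left, Complex.norm_of_nonneg h0.le] at hz
  push_cast at h
  have hz' : ‖riemannZeta (1 + ε)‖ ≤ C * (1 / ε) := by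
    rw [mul_one_div, le_div_iff₀ h0]; linarith
  have h2 : exp (RB (1 + ε)) ≤ (C * (1 / ε)) ^ 2 * C := h.trans (by gcongr)
  rw [← Real.le_log_iff_exp_le (by positivity)] at h2
  rw [log_mul (by positivity) (by positivity), log_pow, log_mul (by positivity) (by positivity)] at h2
  push_cast at h2
  linarith

lemma norm_PB_le {s : ℂ} (hs : 1 < s.re) : ‖PB s‖ ≤ RB s.re := by
  refine tsum_of_norm_bounded (summable_bcoef_real hs).hasSum fun p => ?_
  rw [norm_mul, norm_prime_cpow p.2, Complex.norm_of_nonneg (bcoef_nonneg p.2).1]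

/-- The trivial bound for `HH` near the line `Re s = 1 / 2`. -/
lemma norm_HH_le_trivial : ∃ C : ℝ, 0 < C ∧ ∀ δ t : ℝ, 0 < δ → δ ≤ 1 / 2 →
    ‖HH (1 / 2 + δ + t * I)‖ ≤ C / δ ^ 2 := by
  obtain ⟨C, hC0, hC⟩ := norm_HH_le
  obtain ⟨D, hD0, hD⟩ := RB_le
  refine ⟨C * exp D, by positivity, fun δ t h0 h1 => ?_⟩
  have hre : (1 / 2 + δ + t * I : ℂ).re = 1 / 2 + δ := by simp
  refine (hC _ (by rw [hre]; linarith)).trans ?_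
  have h2 : (2 * (1 / 2 + δ + t * I : ℂ)).re = 1 + 2 * δ := by
    rw [two_mul, add_re, hre]; ring
  have h3 := norm_PB_le (s := 2 * (1 / 2 + δ + t * I : ℂ)) (by rw [h2]; linarith)
  rw [h2] at h3
  have h4 := hD (2 * δ) (by linarith) (by linarith)
  have h5 := (abs_re_le_norm (PB (2 * (1 / 2 + δ + t * I)))).trans (h3.trans h4)
  have h6 := (neg_le_abs _).trans h5
  rw [mul_div_assoc]
  refine mul_le_mul_of_nonneg_left ?_ hC0.le
  calc _ ≤ exp (2 * log (1 / δ) + D) := by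
        refine exp_le_exp.mpr (h6.trans ?_)
        have : log (1 / (2 * δ)) ≤ log (1 / δ) :=
          log_le_log (by positivity) (one_div_le_one_div_of_le h0 (by linarith))
        linarith
    _ = _ := by
        rw [exp_add, show 2 * log (1 / δ) = ((2 : ℕ) : ℝ) * log (1 / δ) by norm_num,
          exp_nat_mul, exp_log (by positivity)]
        field_simp

/-- `∑_{p ≤ N} log p / p ≤ 2 log N`. -/
lemma sum_log_div_prime_le (N : ℕ) (hN : 1 ≤ N) :
    ∑ p ∈ (Icc 1 N).filter Nat.Prime, log p / p ≤ 2 * log N := by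
  have hN0 : (0 : ℝ) < N := by exact_mod_cast hN
  have h1 : ∀ n ∈ Icc 1 N, ∑ p ∈ (Icc 1 N).filter Nat.Prime,
      (if p ∣ n then log p else 0) ≤ log N := by
    intro n hn
    rw [mem_Icc] at hn
    have e : ∑ p ∈ (Icc 1 N).filter Nat.Prime, (if p ∣ n then log p else 0) =
        ∑ p ∈ n.primeFactors, log p := by
      rw [← Finset.sum_filter]
      refine sum_congr ?_ fun _ _ => rfl
      ext p
      simp only [mem_filter, mem_Icc, Nat.mem_primeFactors]
      constructor
      · rintro ⟨⟨_, hp⟩, hd⟩; exact ⟨hp, hd, by omega⟩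
      · rintro ⟨hp, hd, h0⟩
        exact ⟨⟨⟨hp.one_le, (Nat.le_of_dvd (by omega) hd).trans hn.2⟩, hp⟩, hd⟩
    rw [e, ← Real.log_prod (fun p hp => by
      have := (Nat.prime_of_mem_primeFactors hp).ne_zero; exact_mod_cast this)]
    have h2 : (∏ p ∈ n.primeFactors, p) ≤ N :=
      (Nat.le_of_dvd (by omega) (Nat.prod_primeFactors_dvd n)).trans hn.2
    rw [← Nat.cast_prod]
    refine log_le_log ?_ (by exact_mod_cast h2)
    have := Finset.prod_pos fun p (hp : p ∈ n.primeFactors) => (Nat.prime_of_mem_primeFactors hp).pos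
    exact_mod_cast this
  have h2 := sum_le_sum h1
  rw [Finset.sum_comm, sum_const, Nat.card_Icc, nsmul_eq_mul] at h2
  have h3 : ∀ p ∈ (Icc 1 N).filter Nat.Prime,
      N / 2 * (log p / p) ≤ ∑ n ∈ Icc 1 N, (if p ∣ n then log p else 0) := by
    intro p hp
    rw [mem_filter, mem_Icc] at hp
    have hp0 : (0 : ℝ) < p := by exact_mod_cast hp.2.pos
    rw [← Finset.sum_filter, sum_const, nsmul_eq_mul]
    have hc : ((Icc 1 N).filter (fun n => p ∣ n)).card = N / p := by
      rw [show Icc 1 N = Ioc 0 N from rfl]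
      exact Nat.Ioc_filter_dvd_card_eq_div N p
    rw [hc]
    have hd : 1 ≤ N / p := (Nat.one_le_div_iff hp.2.pos).mpr hp.1.2
    have hd2 : N < p * (N / p + 1) := Nat.lt_mul_div_succ N hp.2.pos
    have hd3 : (N : ℝ) < p * ((N / p : ℕ) + 1) := by exact_mod_cast hd2
    have hd4 : (1 : ℝ) ≤ (N / p : ℕ) := by exact_mod_cast hd
    have : (N : ℝ) / 2 / p ≤ (N / p : ℕ) := by
      rw [div_le_iff₀ hp0]; nlinarith
    calc (N : ℝ) / 2 * (log p / p) = (N : ℝ) / 2 / p * log p := by ring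
      _ ≤ _ := by gcongr
  have h4 := sum_le_sum h3
  rw [← mul_sum] at h4
  have h5 := h4.trans h2
  rw [Nat.add_sub_cancel] at h5
  by_contra hcon
  push Not at hcon
  nlinarith

lemma sum_bcoef_div_prime_le : ∃ C : ℝ, 0 ≤ C ∧ ∀ N : ℕ, 3 ≤ N →
    ∑ p ∈ (Icc 1 N).filter Nat.Prime, bcoef p / p ≤ 2 * log (log N) + C := by
  obtain ⟨C, hC0, hC⟩ := RB_le
  refine ⟨C + 6, by linarith, fun N hN => ?_⟩
  have hN3 : (3 : ℝ) ≤ N := by exact_mod_cast hN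
  have hl : 1 ≤ log N := by
    rw [Real.le_log_iff_exp_le (by linarith)]
    have := Real.exp_one_lt_d9; linarith
  set ε := 1 / log N with hε
  have hε0 : 0 < ε := by positivity
  have hε1 : ε ≤ 1 := by rw [hε, div_le_one (by linarith)]; exact hl
  have h1 : ∀ p ∈ (Icc 1 N).filter Nat.Prime,
      bcoef p / p ≤ bcoef p * (p : ℝ) ^ (-(1 + ε)) + 3 * ε * (log p / p) := by
    intro p hp
    rw [mem_filter] at hp
    have hp0 : (0 : ℝ) < p := by exact_mod_cast hp.2.pos
    have hb := bcoef_nonneg hp.2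
    have e : (p : ℝ) ^ (-(1 + ε)) = (p : ℝ)⁻¹ * exp (-(ε * log p)) := by
      rw [neg_add, rpow_add hp0, rpow_neg_one, rpow_def_of_pos hp0 (-ε)]
      congr 2; ring
    have h2 := Real.one_sub_le_exp_neg (ε * log p)
    have h3 : (p : ℝ)⁻¹ * (1 - ε * log p) ≤ (p : ℝ) ^ (-(1 + ε)) := by
      rw [e]; gcongr
    have h4 : 0 ≤ ε * (log p / p) := by positivity
    have h5 : bcoef p * ((p : ℝ)⁻¹ * (1 - ε * log p)) =
        bcoef p / p - bcoef p * (ε * (log p / p)) := by field_simp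
    nlinarith [mul_le_mul_of_nonneg_left h3 hb.1]
  refine (sum_le_sum h1).trans ?_
  rw [sum_add_distrib, ← mul_sum]
  have h2 := sum_log_div_prime_le N (by omega)
  have h3 : ∑ p ∈ (Icc 1 N).filter Nat.Prime, bcoef p * (p : ℝ) ^ (-(1 + ε)) ≤ RB (1 + ε) := by
    have hsum := summable_bcoef_real (σ := 1 + ε) (by linarith)
    have e : ∑ p ∈ (Icc 1 N).filter Nat.Prime, bcoef p * (p : ℝ) ^ (-(1 + ε)) =
        ∑ p ∈ (Icc 1 N).subtype Nat.Prime, bcoef p.1 * (p.1 : ℝ) ^ (-(1 + ε)) := by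
      rw [← Finset.sum_subtype_eq_sum_filter]
    rw [e]
    exact Summable.sum_le_tsum (f := fun p : Nat.Primes => bcoef p * (p : ℝ) ^ (-(1 + ε)))
      _ (fun p _ => mul_nonneg (bcoef_nonneg p.2).1 (by positivity)) hsum
  have h4 := hC ε hε0 hε1
  rw [hε, one_div_one_div] at h4
  have h5 : 3 * ε * (2 * log N) = 6 := by rw [hε]; field_simp; norm_num
  have h6 : 3 * ε * ∑ p ∈ (Icc 1 N).filter Nat.Prime, log p / p ≤ 3 * ε * (2 * log N) := by
    gcongr
  linarith

/-- The additive character `x ↦ exp (2 π i x)`. -/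
noncomputable def ee (x : ℝ) : ℂ := Complex.exp ((2 * pi * x : ℝ) * I)

lemma norm_ee (x : ℝ) : ‖ee x‖ = 1 := by rw [ee, norm_exp_ofReal_mul_I]

lemma ee_add (x y : ℝ) : ee (x + y) = ee x * ee y := by
  rw [ee, ee, ee, ← Complex.exp_add]; push_cast; ring_nf

lemma ee_int (m : ℤ) : ee m = 1 := by
  rw [ee, exp_eq_one_iff]; exact ⟨m, by push_cast; ring⟩

lemma ee_sub_int (x : ℝ) (m : ℤ) : ee (x - m) = ee x := by
  have := ee_add (x - m) m
  rw [sub_add_cancel, ee_int, mul_one] at this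
  exact this.symm

lemma ee_conj (x : ℝ) : conj (ee x) = ee (-x) := by
  rw [ee, ee, ← exp_conj, map_mul, conj_ofReal, conj_I]; push_cast; ring_nf

lemma ee_kernel {θ : ℝ} (h : Real.sin (pi * θ) ≠ 0) :
    (-(1 / 2) - I / 2 * ((cos (pi * θ) / Real.sin (pi * θ) : ℝ) : ℂ)) * (ee θ - 1) = 1 := by
  have e : ee θ = ((2 * cos (pi * θ) ^ 2 - 1 : ℝ) : ℂ) +
      ((2 * Real.sin (pi * θ) * cos (pi * θ) : ℝ) : ℂ) * I := by
    rw [← Real.cos_two_mul, ← Real.sin_two_mul, ee, exp_mul_I, ofReal_cos,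
      ofReal_sin]
    push_cast; ring_nf
  have hs : ((Real.sin (pi * θ) : ℝ) : ℂ) ≠ 0 := by exact_mod_cast h
  have h1 : ((Real.sin (pi * θ) : ℝ) : ℂ) ^ 2 + ((cos (pi * θ) : ℝ) : ℂ) ^ 2 = 1 := by
    exact_mod_cast Real.sin_sq_add_cos_sq (pi * θ)
  rw [e]
  push_cast at hs h1 ⊢
  field_simp
  linear_combination (-(Complex.cos (pi * θ) * I * 2 )) * h1
   - (2 * sin (pi * θ) * Complex.cos (pi * θ) ^ 2) * I_sq

lemma cot_le_cot {x y : ℝ} (hx : 0 < x) (hxy : x ≤ y) (hy : y < 1) :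
    cos (pi * y) / Real.sin (pi * y) ≤ cos (pi * x) / Real.sin (pi * x) := by
  have hp := pi_pos
  have sx : 0 < Real.sin (pi * x) := Real.sin_pos_of_pos_of_lt_pi (by positivity) (by nlinarith)
  have sy : 0 < Real.sin (pi * y) :=
    Real.sin_pos_of_pos_of_lt_pi (mul_pos hp (by linarith)) (by nlinarith)
  rw [div_le_div_iff₀ sy sx]
  have : 0 ≤ Real.sin (pi * y - pi * x) :=
    Real.sin_nonneg_of_nonneg_of_le_pi (by nlinarith) (by nlinarith)
  rw [Real.sin_sub] at this
  linarith

lemma sin_lower {δ x : ℝ} (h1 : δ ≤ x) (h2 : x ≤ 1 - δ) (hδ : 0 < δ) :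
    2 * δ ≤ Real.sin (pi * x) := by
  have hp := pi_pos
  rcases le_total x (1 / 2) with h | h
  · have := Real.mul_le_sin (x := pi * x) (by apply mul_nonneg <;> linarith) (by nlinarith)
    have e : 2 / pi * (pi * x) = 2 * x := by field_simp
    linarith
  · have := Real.mul_le_sin (x := pi * (1 - x)) (by apply mul_nonneg <;> linarith) (by nlinarith)
    have e : 2 / pi * (pi * (1 - x)) = 2 * (1 - x) := by field_simp
    rw [show pi * (1 - x) = pi - pi * x by ring, Real.sin_pi_sub] at this
    rw [show pi - pi * x = pi * (1 - x) by ring] at this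
    linarith

/-- The discrete Kusmin-Landau inequality. -/
lemma kusmin_landau_zero (f : ℕ → ℝ) (a b : ℕ) (δ : ℝ) (hδ : 0 < δ)
    (h1 : ∀ n, a ≤ n → n < b → δ ≤ f (n + 1) - f n ∧ f (n + 1) - f n ≤ 1 - δ)
    (h2 : ∀ n, a ≤ n → n + 1 < b → f (n + 1) - f n ≤ f (n + 2) - f (n + 1)) :
    ‖∑ n ∈ Ico a b, ee (f n)‖ ≤ 1 / δ := by
  set C : ℕ → ℝ := fun n => cos (pi * (f (n + 1) - f n)) / Real.sin (pi * (f (n + 1) - f n))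
    with hC
  set c : ℕ → ℂ := fun n => -(1 / 2) - I / 2 * (C n : ℂ) with hc
  have hsin : ∀ n, a ≤ n → n < b → 2 * δ ≤ Real.sin (pi * (f (n + 1) - f n)) := fun n ha hb =>
    sin_lower (h1 n ha hb).1 (h1 n ha hb).2 hδ
  have hCb : ∀ n, a ≤ n → n < b → |C n| ≤ 1 / (2 * δ) := by
    intro n ha hb
    have := hsin n ha hb
    rw [hC]; dsimp only
    rw [abs_div, abs_of_pos (a := Real.sin _) (by linarith)]
    exact div_le_div₀ zero_le_one (Real.abs_cos_le_one _) (by positivity) this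
  have hker : ∀ n, a ≤ n → n < b → c n * (ee (f (n + 1)) - ee (f n)) = ee (f n) := by
    intro n ha hb
    have h0 := hsin n ha hb
    have := ee_kernel (θ := f (n + 1) - f n) (by linarith)
    have e : ee (f (n + 1)) = ee (f (n + 1) - f n) * ee (f n) := by rw [← ee_add, sub_add_cancel]
    rw [e]
    calc _ = (c n * (ee (f (n + 1) - f n) - 1)) * ee (f n) := by ring
      _ = _ := by rw [hc]; dsimp only; rw [this, one_mul]
  have hcb : ∀ n, a ≤ n → n < b → ‖c n‖ ≤ 1 / (4 * δ) := by
    intro n ha hb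
    have h0 := hsin n ha hb
    have h3 := congrArg norm (hker n ha hb)
    have hs0 : 0 < Real.sin (pi * (f (n + 1) - f n)) := by linarith
    have hs : (‖c n‖) ^ 2 = (1 / (2 * Real.sin (pi * (f (n + 1) - f n)))) ^ 2 := by
      rw [Complex.sq_norm, normSq_apply]
      have : (c n).re = -(1 / 2) ∧ (c n).im = - (C n / 2) := by
        rw [hc]; constructor <;> simp; ring
      rw [this.1, this.2, hC]; dsimp only
      have := Real.sin_sq_add_cos_sq (pi * (f (n + 1) - f n))
      field_simp
      linarith
    rw [sq_eq_sq₀ (norm_nonneg _) (by positivity)] at hs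
    rw [hs]
    exact one_div_le_one_div_of_le (by positivity) (by linarith)
  have key : ∀ k, a + k < b → ‖∑ n ∈ Ico a (a + k + 1), ee (f n) - c (a + k) * ee (f (a + k + 1))‖
      ≤ 1 / (4 * δ) + (C a - C (a + k)) / 2 := by
    intro k
    induction k with
    | zero =>
      intro hb
      rw [add_zero, Finset.sum_Ico_succ_top (le_refl a), Finset.Ico_self, Finset.sum_empty, zero_add]
      have h3 := hker a le_rfl hb
      have : ee (f a) - c a * ee (f (a + 1)) = - (c a * ee (f a)) := by linear_combination -h3
      rw [this, norm_neg, norm_mul, norm_ee, mul_one]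
      have := hcb a le_rfl hb
      linarith
    | succ k ih =>
      intro hb
      have ih := ih (by omega)
      have h3 := hker (a + k + 1) (by omega) (by omega)
      rw [← add_assoc, Finset.sum_Ico_succ_top (by omega)]
      have e : ∑ n ∈ Ico a (a + k + 1), ee (f n) + ee (f (a + k + 1)) -
          c (a + k + 1) * ee (f (a + k + 1 + 1)) =
          (∑ n ∈ Ico a (a + k + 1), ee (f n) - c (a + k) * ee (f (a + k + 1))) +
          (c (a + k) - c (a + k + 1)) * ee (f (a + k + 1)) := by linear_combination -h3
      rw [e]
      refine (norm_add_le _ _).trans ?_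
      have hm : C (a + k + 1) ≤ C (a + k) := by
        have q1 := h1 (a + k) (by omega) (by omega)
        have q2 := h1 (a + k + 1) (by omega) (by omega)
        exact cot_le_cot (by linarith) (h2 (a + k) (by omega) (by omega)) (by linarith)
      have e2 : c (a + k) - c (a + k + 1) = I / 2 * ((C (a + k + 1) - C (a + k) : ℝ) : ℂ) := by
        rw [hc]; push_cast; ring
      have e3 : ‖(c (a + k) - c (a + k + 1)) * ee (f (a + k + 1))‖ = (C (a + k) - C (a + k + 1)) / 2 := by
        rw [norm_mul, norm_ee, mul_one, e2, norm_mul, norm_real, Real.norm_of_nonpos (by linarith)]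
        simp; ring
      rw [e3]
      linarith
  rcases Nat.lt_or_ge a b with hab | hab
  · obtain ⟨k, rfl⟩ : ∃ k, b = a + k + 1 := ⟨b - a - 1, by omega⟩
    have h3 := key k (by omega)
    have h4 := hcb (a + k) (by omega) (by omega)
    have h5 := abs_le.mp (hCb a le_rfl (by omega))
    have h6 := abs_le.mp (hCb (a + k) (by omega) (by omega))
    have h7 : ‖∑ n ∈ Ico a (a + k + 1), ee (f n)‖ ≤
        ‖∑ n ∈ Ico a (a + k + 1), ee (f n) - c (a + k) * ee (f (a + k + 1))‖ +
        ‖c (a + k) * ee (f (a + k + 1))‖ := by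
      simpa using norm_add_le (∑ n ∈ Ico a (a + k + 1), ee (f n) - c (a + k) * ee (f (a + k + 1)))
        (c (a + k) * ee (f (a + k + 1)))
    rw [norm_mul, norm_ee, mul_one] at h7
    have e1 : 1 / (4 * δ) = 1 / δ / 4 := by field_simp
    have e2 : 1 / (2 * δ) = 1 / δ / 2 := by field_simp
    rw [e1] at h3 h4; rw [e2] at h5 h6
    linarith [h5.1, h5.2, h6.1, h6.2]
  · rw [Finset.Ico_eq_empty (by omega)]; simp; positivity

/-- The Kusmin-Landau inequality with phase increments in any unit interval. -/
lemma kusmin_landau (f : ℕ → ℝ) (a b : ℕ) (δ : ℝ) (m : ℤ) (hδ : 0 < δ)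
    (h1 : ∀ n, a ≤ n → n < b → m + δ ≤ f (n + 1) - f n ∧ f (n + 1) - f n ≤ m + 1 - δ)
    (h2 : ∀ n, a ≤ n → n + 1 < b → f (n + 1) - f n ≤ f (n + 2) - f (n + 1)) :
    ‖∑ n ∈ Ico a b, ee (f n)‖ ≤ 1 / δ := by
  have := kusmin_landau_zero (fun n => f n - ((m * n : ℤ) : ℝ)) a b δ hδ
    (fun n ha hb => by
      have := h1 n ha hb
      push_cast; constructor <;> linarith [this.1, this.2])
    (fun n ha hb => by
      have := h2 n ha hb
      push_cast; linarith)
  simpa only [ee_sub_int] using this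

lemma filter_Ico_eq_Ico (θ : ℕ → ℝ) (a b : ℕ) (u v : ℝ)
    (h : ∀ i j, a ≤ i → i ≤ j → j < b → θ i ≤ θ j) :
    ∃ a' b', a ≤ a' ∧ b' ≤ b ∧ (Ico a b).filter (fun n => u ≤ θ n ∧ θ n ≤ v) = Ico a' b' := by
  set s := (Ico a b).filter (fun n => u ≤ θ n ∧ θ n ≤ v) with hs
  rcases s.eq_empty_or_nonempty with he | hne
  · exact ⟨a + b, b, by omega, le_rfl, by rw [he, Finset.Ico_eq_empty (by omega)]⟩
  · have hmin := s.min'_mem hne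
    have hmax := s.max'_mem hne
    have hmem : ∀ n, n ∈ s ↔ (a ≤ n ∧ n < b) ∧ u ≤ θ n ∧ θ n ≤ v := fun n => by
      rw [hs, mem_filter, mem_Ico]
    have h1 := (hmem _).mp hmin
    have h2 := (hmem _).mp hmax
    refine ⟨s.min' hne, s.max' hne + 1, h1.1.1, h2.1.2, ?_⟩
    ext n
    rw [mem_Ico]
    constructor
    · intro hn
      exact ⟨s.min'_le n hn, Nat.lt_succ_of_le (s.le_max' n hn)⟩
    · rintro ⟨hn1, hn2⟩
      rw [hmem]
      have hn3 : n ≤ s.max' hne := by omega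
      exact ⟨⟨by omega, by omega⟩, h1.2.1.trans (h _ _ h1.1.1 hn1 (by omega)),
        (h _ _ (by omega) hn3 h2.1.2).trans h2.2.2⟩

lemma increments_le (θ : ℕ → ℝ) (a b : ℕ) (l : ℝ)
    (h : ∀ n, a ≤ n → n + 1 < b → l ≤ θ (n + 1) - θ n) (i k : ℕ) (hi : a ≤ i) (hk : i + k < b) :
    l * k ≤ θ (i + k) - θ i := by
  induction k with
  | zero => simp
  | succ k ih =>
    have := ih (by omega)
    have h2 := h (i + k) (by omega) (by omega)
    rw [← add_assoc]; push_cast; linarith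

lemma le_increments (θ : ℕ → ℝ) (a b : ℕ) (l : ℝ)
    (h : ∀ n, a ≤ n → n + 1 < b → θ (n + 1) - θ n ≤ l) (i k : ℕ) (hi : a ≤ i) (hk : i + k < b) :
    θ (i + k) - θ i ≤ l * k := by
  induction k with
  | zero => simp
  | succ k ih =>
    have := ih (by omega)
    have h2 := h (i + k) (by omega) (by omega)
    rw [← add_assoc]; push_cast; linarith

lemma card_filter_le (θ : ℕ → ℝ) (a b : ℕ) (l u d : ℝ) (hl : 0 < l) (hd : 0 ≤ d)
    (h : ∀ n, a ≤ n → n + 1 < b → l ≤ θ (n + 1) - θ n) :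
    (((Ico a b).filter (fun n => u ≤ θ n ∧ θ n ≤ u + d)).card : ℝ) ≤ d / l + 1 := by
  have hm : ∀ i j, a ≤ i → i ≤ j → j < b → θ i ≤ θ j := by
    intro i j hi hij hj
    obtain ⟨k, rfl⟩ := Nat.exists_eq_add_of_le hij
    have := increments_le θ a b l h i k hi hj
    have : 0 ≤ l * k := by positivity
    linarith
  obtain ⟨a', b', ha, hb, e⟩ := filter_Ico_eq_Ico θ a b u (u + d) hm
  rw [e, Nat.card_Ico]
  rcases Nat.lt_or_ge a' b' with hab | hab
  · obtain ⟨k, rfl⟩ : ∃ k, b' = a' + k + 1 := ⟨b' - a' - 1, by omega⟩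
    have m1 : a' ∈ (Ico a b).filter (fun n => u ≤ θ n ∧ θ n ≤ u + d) := by
      rw [e, mem_Ico]; omega
    have m2 : a' + k ∈ (Ico a b).filter (fun n => u ≤ θ n ∧ θ n ≤ u + d) := by
      rw [e, mem_Ico]; omega
    rw [mem_filter] at m1 m2
    have := increments_le θ a b l h a' k ha (by omega)
    rw [show a' + k + 1 - a' = k + 1 by omega]
    push_cast
    have : (k : ℝ) ≤ d / l := by
      rw [le_div_iff₀ hl]; linarith [m1.2.1, m2.2.2]
    linarith
  · rw [show b' - a' = 0 by omega]; push_cast; positivity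

lemma norm_sum_ee_le (f : ℕ → ℝ) (s : Finset ℕ) : ‖∑ n ∈ s, ee (f n)‖ ≤ s.card := by
  refine (norm_sum_le _ _).trans ?_
  simp [norm_ee]

/-- The discrete second derivative test. -/
lemma second_difference_test (f : ℕ → ℝ) (a b : ℕ) (l h : ℝ) (hl : 0 < l) (hh : 1 ≤ h)
    (h1 : ∀ n, a ≤ n → n < b → l ≤ f (n + 2) - 2 * f (n + 1) + f n ∧
      f (n + 2) - 2 * f (n + 1) + f n ≤ h * l) :
    ‖∑ n ∈ Ico a b, ee (f n)‖ ≤ 5 * (h * √l * (b - a : ℕ) + 2 / √l) := by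
  have hsq : 0 < √l := Real.sqrt_pos.mpr hl
  rcases le_or_gt l 1 with hl1 | hl1
  swap
  · have h2 := norm_sum_ee_le f (Ico a b)
    rw [Nat.card_Ico] at h2
    have h3 : 1 ≤ √l := Real.one_le_sqrt.mpr hl1.le
    have h4 : 1 ≤ h * √l := one_le_mul_of_one_le_of_one_le hh h3
    have h6 : 0 < 2 / √l := by positivity
    nlinarith
  rcases Nat.lt_or_ge a b with hab | hab
  swap
  · rw [Finset.Ico_eq_empty (by omega)]; simp; positivity
  set θ : ℕ → ℝ := fun n => f (n + 1) - f n with hθ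
  have hθ1 : ∀ n, a ≤ n → n + 1 < b → l ≤ θ (n + 1) - θ n := fun n ha hb => by
    have := (h1 n ha (by omega)).1
    rw [hθ]; dsimp only; linarith
  have hθ2 : ∀ n, a ≤ n → n + 1 < b → θ (n + 1) - θ n ≤ h * l := fun n ha hb => by
    have := (h1 n ha (by omega)).2
    rw [hθ]; dsimp only; linarith
  have hm : ∀ i j, a ≤ i → i ≤ j → j < b → θ i ≤ θ j := by
    intro i j hi hij hj
    obtain ⟨k, rfl⟩ := Nat.exists_eq_add_of_le hij
    have := increments_le θ a b l hθ1 i k hi hj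
    have : 0 ≤ l * k := by positivity
    linarith
  set m0 := ⌊θ a⌋
  set m1 := ⌊θ (b - 1)⌋
  have hsum : ∑ n ∈ Ico a b, ee (f n) =
      ∑ m ∈ Icc m0 m1, ∑ n ∈ (Ico a b).filter (fun n => ⌊θ n⌋ = m), ee (f n) := by
    rw [Finset.sum_fiberwise_of_maps_to]
    intro n hn
    rw [mem_Ico] at hn
    rw [mem_Icc]
    exact ⟨Int.floor_le_floor (hm a n le_rfl hn.1 hn.2),
      Int.floor_le_floor (hm n (b - 1) hn.1 (by omega) (by omega))⟩
  have hpiece : ∀ m ∈ Icc m0 m1,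
      ‖∑ n ∈ (Ico a b).filter (fun n => ⌊θ n⌋ = m), ee (f n)‖ ≤ 5 / √l := by
    intro m _
    set s := (Ico a b).filter (fun n => ⌊θ n⌋ = m) with hs
    set mid := (Ico a b).filter (fun n => m + √l ≤ θ n ∧ θ n ≤ m + 1 - √l) with hmid
    have hsub : mid ⊆ s := by
      intro n hn
      rw [hmid, mem_filter] at hn
      rw [hs, mem_filter, Int.floor_eq_iff]
      exact ⟨hn.1, by linarith [hn.2.1], by linarith [hn.2.2]⟩
    rw [← Finset.sum_sdiff hsub]
    refine (norm_add_le _ _).trans ?_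
    have b1 : ‖∑ n ∈ mid, ee (f n)‖ ≤ 1 / √l := by
      obtain ⟨a', b', ha, hb, e⟩ := filter_Ico_eq_Ico θ a b (m + √l) (m + 1 - √l) hm
      rw [hmid, e]
      refine kusmin_landau f a' b' (√l) m hsq (fun n ha' hb' => ?_) fun n ha' hb' => ?_
      · have : n ∈ mid := by rw [hmid, e, mem_Ico]; omega
        rw [hmid, mem_filter] at this
        exact this.2
      · have := hθ1 n (by omega) (by omega)
        rw [hθ] at this; dsimp only at this; linarith
    have b2 : ‖∑ n ∈ s \ mid, ee (f n)‖ ≤ 4 / √l := by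
      refine (norm_sum_ee_le f _).trans ?_
      have hss : s \ mid ⊆ (Ico a b).filter (fun n => (m : ℝ) ≤ θ n ∧ θ n ≤ m + √l) ∪
          (Ico a b).filter (fun n => m + 1 - √l ≤ θ n ∧ θ n ≤ m + 1 - √l + √l) := by
        intro n hn
        rw [Finset.mem_sdiff, hs, hmid, mem_filter, mem_filter, Int.floor_eq_iff] at hn
        rw [Finset.mem_union, mem_filter, mem_filter]
        by_cases hc : θ n ≤ m + √l
        · left; exact ⟨hn.1.1, hn.1.2.1, hc⟩
        · right
          refine ⟨hn.1.1, ?_, by linarith [hn.1.2.2]⟩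
          by_contra hc2
          exact hn.2 ⟨hn.1.1, by linarith, by linarith⟩
      have c1 := card_filter_le θ a b l m (√l) hl hsq.le hθ1
      have c2 := card_filter_le θ a b l (m + 1 - √l) (√l) hl hsq.le hθ1
      have c3 : ((s \ mid).card : ℝ) ≤ (((Ico a b).filter
          (fun n => (m : ℝ) ≤ θ n ∧ θ n ≤ m + √l)).card : ℝ) + (((Ico a b).filter
          (fun n => m + 1 - √l ≤ θ n ∧ θ n ≤ m + 1 - √l + √l)).card : ℝ) := by
        exact_mod_cast (Finset.card_le_card hss).trans (Finset.card_union_le _ _)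
      have e1 : √l / l = 1 / √l := by
        rw [div_eq_div_iff hl.ne' hsq.ne', mul_self_sqrt hl.le, one_mul]
      have e2 : 1 ≤ 1 / √l := by
        rw [le_div_iff₀ hsq, one_mul]; exact Real.sqrt_le_one.mpr hl1
      have e3 : 4 / √l = 4 * (1 / √l) := by ring
      rw [e1] at c1 c2
      linarith
    have e4 : 5 / √l = 1 / √l + 4 / √l := by ring
    linarith
  rw [hsum]
  refine (norm_sum_le _ _).trans ((sum_le_sum hpiece).trans ?_)
  rw [sum_const, nsmul_eq_mul, Int.card_Icc]
  have hcard : (((m1 + 1 - m0).toNat : ℕ) : ℝ) ≤ h * l * (b - a : ℕ) + 2 := by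
    have g1 : ((m1 + 1 - m0).toNat : ℤ) = m1 + 1 - m0 := by
      apply Int.toNat_of_nonneg
      have := Int.floor_le_floor (hm a (b - 1) le_rfl (by omega) (by omega))
      omega
    have g2 : (((m1 + 1 - m0).toNat : ℕ) : ℝ) = m1 + 1 - m0 := by exact_mod_cast g1
    have g3 := le_increments θ a b (h * l) hθ2 a (b - 1 - a) le_rfl (by omega)
    rw [show a + (b - 1 - a) = b - 1 by omega] at g3
    have g4 := Int.floor_le (θ (b - 1))
    have g5 := Int.lt_floor_add_one (θ a)
    have g6 : ((b - 1 - a : ℕ) : ℝ) ≤ (b - a : ℕ) := by exact_mod_cast (by omega : b - 1 - a ≤ b - a)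
    have g7 : h * l * ((b - 1 - a : ℕ) : ℝ) ≤ h * l * (b - a : ℕ) := by gcongr
    rw [g2]; linarith
  calc _ ≤ (h * l * (b - a : ℕ) + 2) * (5 / √l) := by gcongr
    _ = _ := by
      have : l = √l * √l := (mul_self_sqrt hl.le).symm
      nth_rewrite 1 [this]
      field_simp

lemma sum_abs_shift_le (B : ℕ → ℝ) (H h : ℕ) (hh : h < H) (hB : ∀ l, l < H → 0 ≤ B l) :
    ∑ h' ∈ range H, (if h ≤ h' then B (h' - h) else B (h - h')) ≤ 2 * ∑ l ∈ range H, B l := by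
  rw [Finset.sum_ite]
  have h1 : ∑ h' ∈ (range H).filter (fun h' => h ≤ h'), B (h' - h) ≤ ∑ l ∈ range H, B l := by
    rw [← Finset.sum_image (f := B) (g := fun h' => h' - h)]
    · refine Finset.sum_le_sum_of_subset_of_nonneg ?_ fun l hl _ => hB l (mem_range.mp hl)
      intro l hl
      simp only [Finset.mem_image, mem_filter, mem_range] at hl ⊢
      obtain ⟨x, hx, rfl⟩ := hl
      omega
    · intro x hx y hy hxy
      simp only [Finset.coe_filter, mem_ofPred_eq, mem_range] at hx hy hxy
      omega
  have h2 : ∑ h' ∈ (range H).filter (fun h' => ¬ h ≤ h'), B (h - h') ≤ ∑ l ∈ range H, B l := by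
    rw [← Finset.sum_image (f := B) (g := fun h' => h - h')]
    · refine Finset.sum_le_sum_of_subset_of_nonneg ?_ fun l hl _ => hB l (mem_range.mp hl)
      intro l hl
      simp only [Finset.mem_image, mem_filter, mem_range] at hl ⊢
      obtain ⟨x, hx, rfl⟩ := hl
      omega
    · intro x hx y hy hxy
      simp only [Finset.coe_filter, mem_ofPred_eq, mem_range] at hx hy hxy
      omega
  linarith

/-- The Weyl-van der Corput inequality. -/
lemma weyl_van_der_corput (u : ℕ → ℂ) (M H : ℕ) (hH : 1 ≤ H) (hHM : H ≤ M) (B : ℕ → ℝ)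
    (hB : ∀ l, l < H → ‖∑ n ∈ range (M - l), u n * conj (u (n + l))‖ ≤ B l) :
    ‖∑ n ∈ range M, u n‖ ^ 2 ≤ 4 * M / H * ∑ l ∈ range H, B l := by
  have hB0 : ∀ l, l < H → 0 ≤ B l := fun l hl => (norm_nonneg _).trans (hB l hl)
  set y : ℕ → ℂ := fun n => if H ≤ n ∧ n < H + M then u (n - H) else 0 with hy
  have hy0 : ∀ n, ¬ (H ≤ n ∧ n < H + M) → y n = 0 := fun n hn => by rw [hy]; exact if_neg hn
  have hy1 : ∀ n, n < M → y (H + n) = u n := fun n hn => by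
    rw [hy]; dsimp only; rw [if_pos (by omega), Nat.add_sub_cancel_left]
  have hS : ∀ h ∈ range H, ∑ m ∈ range (M + H), y (h + 1 + m) = ∑ n ∈ range M, u n := by
    intro h hh
    rw [mem_range] at hh
    have e1 : ∑ m ∈ range (M + H), y (h + 1 + m) = ∑ m ∈ Ico (h + 1) (h + 1 + (M + H)), y m := by
      rw [Finset.sum_Ico_eq_sum_range, Nat.add_sub_cancel_left]
    have e2 : ∑ n ∈ range M, u n = ∑ n ∈ Ico H (H + M), y n := by
      rw [Finset.sum_Ico_eq_sum_range, Nat.add_sub_cancel_left]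
      exact sum_congr rfl fun n hn => (hy1 n (mem_range.mp hn)).symm
    rw [e1, e2]
    symm
    refine Finset.sum_subset ?_ fun n _ hn => hy0 n (by rwa [mem_Ico] at hn)
    intro n hn
    rw [mem_Ico] at hn ⊢
    omega
  have hpair : ∀ h h', h ≤ h' → h' < H → ‖∑ m ∈ range (M + H),
      y (h + 1 + m) * conj (y (h' + 1 + m))‖ ≤ B (h' - h) := by
    intro h h' hhh hh'
    obtain ⟨l, rfl⟩ := Nat.exists_eq_add_of_le hhh
    rw [Nat.add_sub_cancel_left]
    have e1 : ∑ m ∈ range (M + H), y (h + 1 + m) * conj (y (h + l + 1 + m)) =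
        ∑ m ∈ Ico (h + 1) (h + 1 + (M + H)), y m * conj (y (m + l)) := by
      rw [Finset.sum_Ico_eq_sum_range, Nat.add_sub_cancel_left]
      refine sum_congr rfl fun m _ => ?_
      rw [show h + l + 1 + m = h + 1 + m + l by ring]
    have e2 : ∑ n ∈ range (M - l), u n * conj (u (n + l)) =
        ∑ n ∈ Ico H (H + (M - l)), y n * conj (y (n + l)) := by
      rw [Finset.sum_Ico_eq_sum_range, Nat.add_sub_cancel_left]
      refine sum_congr rfl fun n hn => ?_
      rw [mem_range] at hn
      rw [hy1 n (by omega), add_assoc, hy1 (n + l) (by omega)]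
    have e3 : ∑ m ∈ Ico (h + 1) (h + 1 + (M + H)), y m * conj (y (m + l)) =
        ∑ n ∈ Ico H (H + (M - l)), y n * conj (y (n + l)) := by
      symm
      refine Finset.sum_subset ?_ fun n _ hn => ?_
      · intro n hn
        rw [mem_Ico] at hn ⊢
        omega
      · rw [mem_Ico] at hn
        by_cases hc : H ≤ n
        · rw [hy0 (n + l) (by omega), map_zero, mul_zero]
        · rw [hy0 n (by omega), zero_mul]
    rw [e1, e3, ← e2]
    exact hB l (by omega)
  have hpair' : ∀ h h', h < H → h' < H → ‖∑ m ∈ range (M + H),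
      y (h + 1 + m) * conj (y (h' + 1 + m))‖ ≤ if h ≤ h' then B (h' - h) else B (h - h') := by
    intro h h' hh hh'
    split_ifs with hc
    · exact hpair h h' hc hh'
    · have := hpair h' h (by omega) hh
      rw [← RCLike.norm_conj, map_sum] at this
      refine le_trans (le_of_eq ?_) this
      congr 1
      refine sum_congr rfl fun m _ => ?_
      rw [map_mul, conj_conj, mul_comm]
  set w : ℕ → ℂ := fun m => ∑ h ∈ range H, y (h + 1 + m) with hw
  have hw1 : ∑ m ∈ range (M + H), w m = H * ∑ n ∈ range M, u n := by
    rw [hw, Finset.sum_comm, sum_congr rfl hS]; simp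
  have hw2 : ((∑ m ∈ range (M + H), ‖w m‖ ^ 2 : ℝ) : ℂ) = ∑ h ∈ range H, ∑ h' ∈ range H,
      ∑ m ∈ range (M + H), y (h + 1 + m) * conj (y (h' + 1 + m)) := by
    push_cast
    rw [sum_congr rfl fun h _ => Finset.sum_comm, Finset.sum_comm]
    refine sum_congr rfl fun m _ => ?_
    rw [← mul_conj', hw]; dsimp only
    rw [map_sum, Finset.sum_mul_sum]
  have hw3 : ∑ m ∈ range (M + H), ‖w m‖ ^ 2 ≤ H * (2 * ∑ l ∈ range H, B l) := by
    have h0 : 0 ≤ ∑ m ∈ range (M + H), ‖w m‖ ^ 2 := Finset.sum_nonneg fun _ _ => sq_nonneg _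
    rw [← Complex.norm_of_nonneg h0, hw2]
    refine (norm_sum_le _ _).trans ?_
    have : ∀ h ∈ range H, ‖∑ h' ∈ range H, ∑ m ∈ range (M + H),
        y (h + 1 + m) * conj (y (h' + 1 + m))‖ ≤ 2 * ∑ l ∈ range H, B l := by
      intro h hh
      rw [mem_range] at hh
      refine (norm_sum_le _ _).trans ((sum_le_sum fun h' hh' => ?_).trans
        (sum_abs_shift_le B H h hh hB0))
      exact hpair' h h' hh (mem_range.mp hh')
    refine (sum_le_sum this).trans ?_
    simp
  have hcs : ‖∑ m ∈ range (M + H), w m‖ ^ 2 ≤ (M + H : ℝ) * ∑ m ∈ range (M + H), ‖w m‖ ^ 2 := by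
    have h1 := norm_sum_le (range (M + H)) w
    have h2 := sq_sum_le_card_mul_sum_sq (s := range (M + H)) (f := fun m => ‖w m‖)
    rw [Finset.card_range] at h2
    push_cast at h2
    exact (pow_le_pow_left₀ (norm_nonneg _) h1 2).trans h2
  rw [hw1, norm_mul, mul_pow, Complex.norm_natCast] at hcs
  have hHM' : (H : ℝ) ≤ M := by exact_mod_cast hHM
  have h5 : (H : ℝ) ^ 2 * ‖∑ n ∈ range M, u n‖ ^ 2 ≤ (M + M : ℝ) * (H * (2 * ∑ l ∈ range H, B l)) :=
    hcs.trans (by gcongr)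
  rw [show 4 * (M : ℝ) / H * ∑ l ∈ range H, B l =
    ((M + M : ℝ) * (H * (2 * ∑ l ∈ range H, B l))) / H ^ 2 by field_simp; ring]
  rw [le_div_iff₀ (by positivity)]
  linarith

lemma log_second_difference {x : ℝ} (hx : 2 ≤ x) :
    1 / x ^ 2 ≤ -(log (x + 1) - 2 * log x + log (x - 1)) ∧
    -(log (x + 1) - 2 * log x + log (x - 1)) ≤ 2 * (1 / x ^ 2) := by
  have h1 : 0 < x - 1 := by linarith
  have h2 : 0 < x + 1 := by linarith
  have e : -(log (x + 1) - 2 * log x + log (x - 1)) = log (x ^ 2 / ((x + 1) * (x - 1))) := by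
    rw [log_div (by positivity) (by positivity), log_mul h2.ne' h1.ne', log_pow]
    push_cast; ring
  rw [e]
  have hp : 0 < x ^ 2 / ((x + 1) * (x - 1)) := by positivity
  constructor
  · have := Real.one_sub_inv_le_log_of_pos hp
    refine le_trans (le_of_eq ?_) this
    field_simp; ring
  · refine (Real.log_le_sub_one_of_pos hp).trans ?_
    rw [div_sub_one (by positivity), mul_one_div, div_le_div_iff₀ (by positivity) (by positivity)]
    nlinarith

lemma log_third_difference {x l : ℝ} (hx : 2 ≤ x) (hl : 0 < l) (hlx : l ≤ x) :
    l / (2 * x ^ 3) ≤ (log (x + l + 1) - 2 * log (x + l) + log (x + l - 1)) -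
      (log (x + 1) - 2 * log x + log (x - 1)) ∧
    (log (x + l + 1) - 2 * log (x + l) + log (x + l - 1)) -
      (log (x + 1) - 2 * log x + log (x - 1)) ≤ 6 * l / x ^ 3 := by
  have h1 : 0 < x - 1 := by linarith
  have h0 : 0 < x := by linarith
  have h3 : 0 < x + l - 1 := by linarith
  set P := (x + l + 1) * (x + l - 1) * x ^ 2 with hP
  set Q := (x + 1) * (x - 1) * (x + l) ^ 2 with hQ
  have hP0 : 0 < P := by positivity
  have hQ0 : 0 < Q := by positivity
  have e : (log (x + l + 1) - 2 * log (x + l) + log (x + l - 1)) -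
      (log (x + 1) - 2 * log x + log (x - 1)) = log (P / Q) := by
    rw [log_div (by positivity) (by positivity), hP, hQ, log_mul (by positivity) (by positivity),
      log_mul (by positivity) (by positivity), log_mul (by positivity) (by positivity),
      log_mul (by positivity) (by positivity), log_pow, log_pow]
    push_cast; ring
  have hPQ : P - Q = l * (2 * x + l) := by rw [hP, hQ]; ring
  rw [e]
  have hp : 0 < P / Q := by positivity
  constructor
  · have := Real.one_sub_inv_le_log_of_pos hp
    refine le_trans ?_ this
    rw [inv_div, one_sub_div hP0.ne', hPQ, div_le_div_iff₀ (by positivity) hP0]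
    have g1 : P ≤ (x + l) ^ 2 * x ^ 2 := by rw [hP]; nlinarith
    have g2 : (x + l) ^ 2 * x ^ 2 ≤ (2 * x + l) * (2 * x ^ 3) := by nlinarith [mul_pos h0 h0, mul_pos h0 hl, mul_pos (mul_pos h0 h0) h0, mul_nonneg (mul_pos h0 h0).le (mul_nonneg hl.le (sub_nonneg.mpr hlx))]
    have := mul_le_mul_of_nonneg_left (g1.trans g2) hl.le
    linarith
  · refine (Real.log_le_sub_one_of_pos hp).trans ?_
    rw [div_sub_one hQ0.ne', hPQ, div_le_div_iff₀ hQ0 (by positivity)]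
    have g1 : x ^ 2 * x ^ 2 ≤ 2 * Q := by
      have : x ^ 2 ≤ (x + l) ^ 2 := by nlinarith
      have h5 : x ^ 2 ≤ 2 * ((x + 1) * (x - 1)) := by nlinarith
      calc x ^ 2 * x ^ 2 ≤ (2 * ((x + 1) * (x - 1))) * (x + l) ^ 2 := by gcongr
        _ = _ := by rw [hQ]; ring
    have g2 : (2 * x + l) * x ^ 3 ≤ 3 * (x ^ 2 * x ^ 2) := by nlinarith [pow_pos h0 3]
    have : (2 * x + l) * x ^ 3 ≤ 6 * Q := by linarith
    nlinarith

/-- The phase of `(n + a) ^ (-it)`. -/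
noncomputable def phase (t a : ℝ) (n : ℕ) : ℝ := -(t / (2 * pi)) * log (n + a)

lemma sqrt_tau {t : ℝ} (ht : 1 ≤ t) : 0 < t / (2 * pi) ∧ t / 9 ≤ t / (2 * pi) ∧
    t / (2 * pi) ≤ t := by
  have h3 := pi_gt_three
  have h5 := Real.pi_lt_d2
  refine ⟨by positivity, ?_, ?_⟩
  · exact div_le_div_of_nonneg_left (by linarith) (by positivity) (by linarith)
  · exact div_le_self (by linarith) (by linarith)

lemma phase_sum_second {t a : ℝ} (ht : 1 ≤ t) (ha0 : 0 < a) (ha1 : a ≤ 1) (N b : ℕ) (hN : 1 ≤ N)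
    (hb : b ≤ 2 * N) :
    ‖∑ n ∈ Ico N b, ee (phase t a n)‖ ≤ 1280 * (√t + N / √t) := by
  obtain ⟨hτ0, hτ1, hτ2⟩ := sqrt_tau ht
  have hN1 : (1 : ℝ) ≤ N := by exact_mod_cast hN
  set l := t / (2 * pi) / (16 * (N : ℝ) ^ 2) with hl
  have hl0 : 0 < l := by positivity
  have h := second_difference_test (phase t a) N b l 32 hl0 (by norm_num) fun n hn hnb => by
    have hx1 : (N : ℝ) ≤ n := by exact_mod_cast hn
    have hx2 : (n : ℝ) + 1 ≤ 2 * N := by exact_mod_cast (by omega : n + 1 ≤ 2 * N)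
    have := log_second_difference (x := n + 1 + a) (by linarith)
    have e : phase t a (n + 2) - 2 * phase t a (n + 1) + phase t a n = t / (2 * pi) *
        -(log (n + 1 + a + 1) - 2 * log (n + 1 + a) + log (n + 1 + a - 1)) := by
      rw [phase, phase, phase]; push_cast
      rw [show (n : ℝ) + 1 + a + 1 = n + 2 + a by ring, show (n : ℝ) + 1 + a - 1 = n + a by ring]
      ring
    rw [e]
    constructor
    · refine le_trans ?_ (mul_le_mul_of_nonneg_left this.1 hτ0.le)
      rw [hl, mul_one_div]
      refine div_le_div_of_nonneg_left hτ0.le (by positivity) ?_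
      nlinarith
    · refine (mul_le_mul_of_nonneg_left this.2 hτ0.le).trans ?_
      rw [hl, show 32 * (t / (2 * pi) / (16 * (N : ℝ) ^ 2)) = t / (2 * pi) * (2 * (1 / (N : ℝ) ^ 2)) by
        field_simp; norm_num]
      gcongr; linarith
  refine h.trans ?_
  have hs0 : 0 < √t := Real.sqrt_pos.mpr (by linarith)
  have s1 : √l ≤ √t / (4 * N) := by
    rw [hl, sqrt_div hτ0.le, show 16 * (N : ℝ) ^ 2 = (4 * N) ^ 2 by ring, sqrt_sq (by positivity)]
    gcongr
  have s2 : √t / (12 * N) ≤ √l := by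
    rw [hl, sqrt_div hτ0.le, show 16 * (N : ℝ) ^ 2 = (4 * N) ^ 2 by ring, sqrt_sq (by positivity)]
    rw [show √t / (12 * N) = √t / 3 / (4 * N) by field_simp; norm_num]
    gcongr
    rw [show √t / 3 = √(t / 9) by rw [sqrt_div (by linarith), show (9 : ℝ) = 3 ^ 2 by norm_num, sqrt_sq (by norm_num)]]
    exact sqrt_le_sqrt hτ1
  have hM : ((b - N : ℕ) : ℝ) ≤ N := by exact_mod_cast (by omega : b - N ≤ N)
  have s3 : 2 / √l ≤ 24 * (N / √t) := by
    have : 2 / √l ≤ 2 / (√t / (12 * N)) := div_le_div_of_nonneg_left (by norm_num) (by positivity) s2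
    refine this.trans (le_of_eq ?_)
    field_simp; norm_num
  have s4 : 32 * √l * ((b - N : ℕ) : ℝ) ≤ 8 * √t := by
    calc 32 * √l * ((b - N : ℕ) : ℝ) ≤ 32 * (√t / (4 * N)) * N := by gcongr
      _ = _ := by field_simp; norm_num
  have : 0 ≤ N / √t := by positivity
  nlinarith

lemma phase_corr {t a : ℝ} (ht : 1 ≤ t) (ha0 : 0 < a) (ha1 : a ≤ 1) (N M l : ℕ) (hN : 1 ≤ N)
    (hM : M ≤ N) (hl1 : 1 ≤ l) (hl : l ≤ N) :
    ‖∑ n ∈ range (M - l), ee (phase t a (N + n)) * conj (ee (phase t a (N + (n + l))))‖ ≤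
      4000 * (√(t * l / N) + √(N ^ 3 / (t * l))) := by
  obtain ⟨hτ0, hτ1, hτ2⟩ := sqrt_tau ht
  have hN1 : (1 : ℝ) ≤ N := by exact_mod_cast hN
  have hN0 : (0 : ℝ) < N := by linarith
  have hl1' : (1 : ℝ) ≤ l := by exact_mod_cast hl1
  have hlN : (l : ℝ) ≤ N := by exact_mod_cast hl
  set lam := t / (2 * pi) * (l / (128 * (N : ℝ) ^ 3)) with hlam
  have hl0 : 0 < lam := by positivity
  set g : ℕ → ℝ := fun n => phase t a (N + n) - phase t a (N + (n + l)) with hg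
  have e0 : ∀ n, ee (phase t a (N + n)) * conj (ee (phase t a (N + (n + l)))) = ee (g n) := by
    intro n
    rw [ee_conj, ← ee_add, hg]; rfl
  rw [sum_congr rfl fun n _ => e0 n, Finset.range_eq_Ico]
  have h := second_difference_test g 0 (M - l) lam 768 hl0 (by norm_num) fun n _ hn => by
    have hx2 : (n : ℝ) + 1 ≤ N := by exact_mod_cast (by omega : n + 1 ≤ N)
    have := log_third_difference (x := N + n + 1 + a) (l := l) (by linarith) (by linarith) (by linarith)
    have e : g (n + 2) - 2 * g (n + 1) + g n = t / (2 * pi) *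
        ((log (N + n + 1 + a + l + 1) - 2 * log (N + n + 1 + a + l) + log (N + n + 1 + a + l - 1)) -
      (log (N + n + 1 + a + 1) - 2 * log (N + n + 1 + a) + log (N + n + 1 + a - 1))) := by
      rw [hg]; simp only [phase]; push_cast
      rw [show (N : ℝ) + n + 1 + a + l + 1 = N + (n + 2 + l) + a by ring,
        show (N : ℝ) + n + 1 + a + l = N + (n + 1 + l) + a by ring,
        show (N : ℝ) + n + 1 + a + 1 = N + (n + 2) + a by ring,
        show (N : ℝ) + n + 1 + a = N + (n + 1) + a by ring,
        show (N : ℝ) + (n + 1 + l) + a - 1 = N + (n + l) + a by ring,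
        show (N : ℝ) + (n + 1) + a - 1 = N + n + a by ring]
      ring
    rw [e]
    constructor
    · refine le_trans ?_ (mul_le_mul_of_nonneg_left this.1 hτ0.le)
      rw [hlam]
      gcongr t / (2 * pi) * ?_
      refine div_le_div_of_nonneg_left (by linarith) (by positivity) ?_
      have : ((N : ℝ) + n + 1 + a) ^ 3 ≤ (4 * N) ^ 3 := by gcongr; linarith
      nlinarith
    · refine (mul_le_mul_of_nonneg_left this.2 hτ0.le).trans ?_
      rw [hlam, show 768 * (t / (2 * pi) * (l / (128 * (N : ℝ) ^ 3))) = t / (2 * pi) * (6 * l / (N : ℝ) ^ 3) by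
        field_simp; norm_num]
      gcongr; linarith
  refine h.trans ?_
  rw [Nat.sub_zero]
  have s1 : √lam * N ≤ √(t * l / N) / 10 := by
    rw [show √lam * N = √(lam * N ^ 2) by rw [sqrt_mul hl0.le, sqrt_sq hN0.le],
      show √(t * l / N) / 10 = √(t * l / N / 10 ^ 2) by
        rw [Real.sqrt_div' _ (by norm_num : (0:ℝ) ≤ 10 ^ 2), sqrt_sq (by norm_num)]]
    apply sqrt_le_sqrt
    rw [hlam, show t / (2 * pi) * (l / (128 * (N : ℝ) ^ 3)) * N ^ 2 = t / (2 * pi) * (l / N) / 128 by field_simp]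
    have : t / (2 * pi) * (l / N) ≤ t * (l / N) := by gcongr
    have h0 : 0 ≤ t * (l / N) := by positivity
    have h1 : t * l / N / 10 ^ 2 = t * (l / N) / 100 := by ring
    linarith
  have s2 : 1 / √lam ≤ 34 * √(N ^ 3 / (t * l)) := by
    rw [show 1 / √lam = √(1 / lam) by rw [sqrt_div zero_le_one, Real.sqrt_one],
      show 34 * √(N ^ 3 / (t * l)) = √(34 ^ 2 * (N ^ 3 / (t * l))) by
        rw [sqrt_mul (by norm_num), sqrt_sq (by norm_num)]]
    apply sqrt_le_sqrt
    have : t / 9 * (l / (128 * (N : ℝ) ^ 3)) ≤ lam := by rw [hlam]; gcongr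
    calc 1 / lam ≤ 1 / (t / 9 * (l / (128 * (N : ℝ) ^ 3))) := one_div_le_one_div_of_le (by positivity) this
      _ = 1152 * (N ^ 3 / (t * l)) := by field_simp; norm_num
      _ ≤ _ := by gcongr; norm_num
  have hMN : ((M - l : ℕ) : ℝ) ≤ N := by exact_mod_cast (by omega : M - l ≤ N)
  have s4 : 768 * √lam * ((M - l : ℕ) : ℝ) ≤ 768 * (√lam * N) := by
    rw [mul_assoc]; gcongr
  have e5 : 2 / √lam = 2 * (1 / √lam) := by ring
  rw [e5]
  have p1 : 0 ≤ √(t * l / N) := Real.sqrt_nonneg _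
  have p2 : 0 ≤ √((N : ℝ) ^ 3 / (t * l)) := Real.sqrt_nonneg _
  linarith

lemma phase_sum_weyl {u a : ℝ} (hu : 1 ≤ u) (ha0 : 0 < a) (ha1 : a ≤ 1) (N b : ℕ) (hN : 1 ≤ N)
    (hNb : N ≤ b) (hb : b ≤ 2 * N) (h1 : u ^ 18 ≤ N) (h2 : (N : ℝ) ≤ u ^ 22) :
    ‖∑ n ∈ Ico N b, ee (phase (u ^ 40) a n)‖ ≤ 200 * (√N * u ^ 9) := by
  have hN1 : (1 : ℝ) ≤ N := by exact_mod_cast hN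
  have hN0 : (0 : ℝ) < N := by linarith
  have hsN : 1 ≤ √N := Real.one_le_sqrt.mpr hN1
  have ht : 1 ≤ u ^ 40 := one_le_pow₀ hu
  obtain ⟨M, rfl⟩ := Nat.exists_eq_add_of_le hNb
  have hMN : M ≤ N := by omega
  have hMN' : (M : ℝ) ≤ N := by exact_mod_cast hMN
  set H := ⌊u ^ 4⌋₊ with hH
  have hH1 : 1 ≤ H := Nat.le_floor (by push_cast; exact one_le_pow₀ hu)
  have hHu : (H : ℝ) ≤ u ^ 4 := Nat.floor_le (by positivity)
  have hHu2 : u ^ 4 ≤ 2 * H := by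
    have h3 := Nat.lt_floor_add_one (u ^ 4)
    have h4 : (1 : ℝ) ≤ H := by exact_mod_cast hH1
    rw [← hH] at h3; linarith
  have hH0 : (0 : ℝ) < H := by exact_mod_cast hH1
  rcases Nat.lt_or_ge M H with hc | hc
  · have h3 := norm_sum_ee_le (phase (u ^ 40) a) (Ico N (N + M))
    rw [Nat.card_Ico, Nat.add_sub_cancel_left] at h3
    have h4 : (M : ℝ) ≤ H := by exact_mod_cast hc.le
    have h5 : u ^ 4 ≤ u ^ 9 := pow_le_pow_right₀ hu (by norm_num)
    have h6 : u ^ 9 ≤ √N * u ^ 9 := le_mul_of_one_le_left (by positivity) hsN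
    linarith
  have hHN : H ≤ N := hc.trans hMN
  rw [Finset.sum_Ico_eq_sum_range, Nat.add_sub_cancel_left]
  set K : ℝ := 4000 * (√(u ^ 40 * H / N) + √(N ^ 3 / u ^ 40)) with hK
  have hK0 : 0 ≤ K := by positivity
  have hw := weyl_van_der_corput (fun n => ee (phase (u ^ 40) a (N + n))) M H hH1 hc
    (fun l => if l = 0 then (N : ℝ) else K) fun l hl => by
      by_cases hl0 : l = 0
      · rw [if_pos hl0]
        refine (norm_sum_le _ _).trans ?_
        rw [sum_congr rfl fun n _ => by rw [norm_mul, RCLike.norm_conj, norm_ee, norm_ee, mul_one]]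
        simp only [sum_const, Finset.card_range, nsmul_eq_mul, mul_one]
        exact_mod_cast (by omega : M - l ≤ N)
      · rw [if_neg hl0]
        have hl1 : 1 ≤ l := Nat.one_le_iff_ne_zero.mpr hl0
        have hl1' : (1 : ℝ) ≤ l := by exact_mod_cast hl1
        refine (phase_corr ht ha0 ha1 N M l hN hMN hl1 (by omega)).trans ?_
        rw [hK]
        gcongr
        exact le_mul_of_one_le_right (by positivity) hl1'
  have hB : ∑ l ∈ range H, (if l = 0 then (N : ℝ) else K) ≤ N + H * K := by
    have : ∀ l ∈ range H, (if l = 0 then (N : ℝ) else K) ≤ (if l = 0 then (N : ℝ) else 0) + K := by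
      intro l _
      split_ifs <;> linarith
    refine (sum_le_sum this).trans ?_
    rw [sum_add_distrib, Finset.sum_ite_eq' (range H) 0 (fun _ => (N : ℝ)),
      if_pos (mem_range.mpr hH1)]
    simp
  have hw2 : ‖∑ n ∈ range M, ee (phase (u ^ 40) a (N + n))‖ ^ 2 ≤ 4 * N / H * (N + H * K) :=
    hw.trans (by gcongr)
  have hK2 : K ≤ 8000 * (N / u ^ 4) := by
    have k1 : √(u ^ 40 * H / N) ≤ N / u ^ 4 := by
      apply sqrt_le_iff.mpr ⟨by positivity, ?_⟩
      rw [div_pow, div_le_div_iff₀ hN0 (by positivity)]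
      calc u ^ 40 * H * (u ^ 4) ^ 2 ≤ u ^ 40 * u ^ 4 * (u ^ 4) ^ 2 := by gcongr
        _ = u ^ 52 := by ring
        _ ≤ u ^ 54 := pow_le_pow_right₀ hu (by norm_num)
        _ = (u ^ 18) ^ 3 := by ring
        _ ≤ N ^ 3 := by gcongr
        _ = _ := by ring
    have k2 : √((N : ℝ) ^ 3 / u ^ 40) ≤ N / u ^ 4 := by
      apply sqrt_le_iff.mpr ⟨by positivity, ?_⟩
      rw [div_pow, div_le_div_iff₀ (by positivity) (by positivity)]
      calc (N : ℝ) ^ 3 * (u ^ 4) ^ 2 = N ^ 2 * (N * u ^ 8) := by ring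
        _ ≤ N ^ 2 * (u ^ 22 * u ^ 8) := by gcongr
        _ = N ^ 2 * u ^ 30 := by ring
        _ ≤ N ^ 2 * u ^ 40 := by gcongr <;> norm_num [hu]
    rw [hK]; linarith
  have hw3 : 4 * N / H * (N + H * K) ≤ (200 * (N / u ^ 2)) ^ 2 := by
    have e : 4 * N / H * (N + H * K) = 4 * N ^ 2 * (1 / H) + 4 * N * K := by field_simp
    have g1 : 1 / (H : ℝ) ≤ 2 / u ^ 4 := by
      rw [div_le_div_iff₀ hH0 (by positivity)]; linarith
    rw [e]
    calc 4 * (N : ℝ) ^ 2 * (1 / H) + 4 * N * K ≤ 4 * (N : ℝ) ^ 2 * (2 / u ^ 4) + 4 * N * (8000 * (N / u ^ 4)) := by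
          gcongr
      _ = 32008 * (N ^ 2 / u ^ 4) := by ring
      _ ≤ 40000 * (N ^ 2 / u ^ 4) := by gcongr; norm_num
      _ = _ := by ring
  have hw4 := (pow_le_pow_iff_left₀ (norm_nonneg _) (by positivity) two_ne_zero).mp (hw2.trans hw3)
  refine hw4.trans ?_
  gcongr
  rw [div_le_iff₀ (by positivity)]
  have : √N ≤ u ^ 11 := by
    apply sqrt_le_iff.mpr ⟨by positivity, ?_⟩
    calc (N : ℝ) ≤ u ^ 22 := h2
      _ = _ := by ring
  calc (N : ℝ) = √N * √N := (mul_self_sqrt hN0.le).symm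
    _ ≤ √N * u ^ 11 := by gcongr
    _ = _ := by ring

lemma phase_sum_le {u a : ℝ} (hu : 1 ≤ u) (ha0 : 0 < a) (ha1 : a ≤ 1) (N b : ℕ) (hN : 1 ≤ N)
    (hNb : N ≤ b) (hb : b ≤ 2 * N) (hNu : (N : ℝ) ≤ 2 * u ^ 56) :
    ‖∑ n ∈ Ico N b, ee (phase (u ^ 40) a n)‖ ≤ 4000 * (√N * u ^ 9) := by
  have hN1 : (1 : ℝ) ≤ N := by exact_mod_cast hN
  have hN0 : (0 : ℝ) < N := by linarith
  have hpos : 0 < √N * u ^ 9 := by positivity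
  have hself : (N : ℝ) = √N * √N := (mul_self_sqrt hN0.le).symm
  rcases le_total (N : ℝ) (u ^ 18) with hc | hc
  · have h3 := norm_sum_ee_le (phase (u ^ 40) a) (Ico N b)
    rw [Nat.card_Ico] at h3
    have h4 : ((b - N : ℕ) : ℝ) ≤ N := by exact_mod_cast (by omega : b - N ≤ N)
    have h5 : √N ≤ u ^ 9 := by
      apply sqrt_le_iff.mpr ⟨by positivity, ?_⟩
      calc (N : ℝ) ≤ u ^ 18 := hc
        _ = _ := by ring
    have : (N : ℝ) ≤ √N * u ^ 9 := by
      nth_rewrite 1 [hself]; gcongr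
    linarith
  rcases le_total (N : ℝ) (u ^ 22) with hd | hd
  · have := phase_sum_weyl hu ha0 ha1 N b hN hNb hb hc hd
    linarith
  · have h3 := phase_sum_second (one_le_pow₀ hu : 1 ≤ u ^ 40) ha0 ha1 N b hN hb
    have hsq : √(u ^ 40) = u ^ 20 := by
      rw [show u ^ 40 = (u ^ 20) ^ 2 by ring, sqrt_sq (by positivity)]
    rw [hsq] at h3
    have h4 : u ^ 20 ≤ √N * u ^ 9 := by
      have : u ^ 11 ≤ √N := by
        apply Real.le_sqrt_of_sq_le
        calc (u ^ 11) ^ 2 = u ^ 22 := by ring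
          _ ≤ (N : ℝ) := hd
      calc u ^ 20 = u ^ 11 * u ^ 9 := by ring
        _ ≤ _ := by gcongr
    have h5 : N / u ^ 20 ≤ 2 * (√N * u ^ 9) := by
      rw [div_le_iff₀ (by positivity)]
      have : √N ≤ 2 * u ^ 28 := by
        apply sqrt_le_iff.mpr ⟨by positivity, ?_⟩
        calc (N : ℝ) ≤ 2 * u ^ 56 := hNu
          _ ≤ 4 * u ^ 56 := by gcongr; norm_num
          _ = _ := by ring
      calc (N : ℝ) = √N * √N := hself
        _ ≤ √N * (2 * u ^ 28) := by gcongr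
        _ ≤ √N * (2 * u ^ 29) := by gcongr <;> norm_num [hu]
        _ = _ := by ring
    linarith

/-- Partial summation with antitone weights. -/
lemma norm_sum_antitone_mul_le (g : ℕ → ℝ) (z : ℕ → ℂ) (a b : ℕ) (K : ℝ) (hab : a ≤ b)
    (hg0 : ∀ n, a ≤ n → 0 ≤ g n) (hg : ∀ n, a ≤ n → g (n + 1) ≤ g n)
    (hz : ∀ c, a ≤ c → c ≤ b → ‖∑ n ∈ Ico a c, z n‖ ≤ K) :
    ‖∑ n ∈ Ico a b, (g n : ℂ) * z n‖ ≤ K * g a := by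
  have key : ∀ k, a + k ≤ b → ‖∑ n ∈ Ico a (a + k), (g n : ℂ) * z n -
      g (a + k) * ∑ n ∈ Ico a (a + k), z n‖ ≤ K * (g a - g (a + k)) := by
    intro k
    induction k with
    | zero => intro _; simp
    | succ k ih =>
      intro hk
      have ih := ih (by omega)
      have h2 := hz (a + k + 1) (by omega) (by omega)
      rw [← add_assoc]
      have h3 := hg (a + k) (by omega)
      have e : ∑ n ∈ Ico a (a + k + 1), (g n : ℂ) * z n -
          g (a + k + 1) * ∑ n ∈ Ico a (a + k + 1), z n =
          (∑ n ∈ Ico a (a + k), (g n : ℂ) * z n - g (a + k) * ∑ n ∈ Ico a (a + k), z n) +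
          ((g (a + k) - g (a + k + 1) : ℝ) : ℂ) * ∑ n ∈ Ico a (a + k + 1), z n := by
        rw [Finset.sum_Ico_succ_top (by omega), Finset.sum_Ico_succ_top (by omega)]
        push_cast; ring
      rw [e]
      refine (norm_add_le _ _).trans ?_
      rw [norm_mul, Complex.norm_of_nonneg (sub_nonneg.mpr h3)]
      have := mul_le_mul_of_nonneg_left h2 (sub_nonneg.mpr h3)
      linarith
  obtain ⟨k, rfl⟩ := Nat.exists_eq_add_of_le hab
  have h1 := key k le_rfl
  have h2 := hz (a + k) hab le_rfl
  have h3 := norm_add_le (∑ n ∈ Ico a (a + k), (g n : ℂ) * z n -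
      g (a + k) * ∑ n ∈ Ico a (a + k), z n) (g (a + k) * ∑ n ∈ Ico a (a + k), z n)
  rw [sub_add_cancel, norm_mul, Complex.norm_of_nonneg (hg0 _ hab)] at h3
  have := mul_le_mul_of_nonneg_left h2 (hg0 _ hab)
  linarith

lemma natCast_add_cpow_eq (t a σ : ℝ) (ha : 0 < a) (n : ℕ) :
    ((n : ℂ) + a) ^ (-(σ + t * I : ℂ)) = (((n + a : ℝ) ^ (-σ) : ℝ) : ℂ) * ee (phase t a n) := by
  have h0 : (0 : ℝ) < n + a := by positivity
  have hne : (((n + a : ℝ)) : ℂ) ≠ 0 := by exact_mod_cast h0.ne'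
  have e : ((n : ℂ) + a) = ((n + a : ℝ) : ℂ) := by push_cast; rfl
  rw [e, neg_add, cpow_add _ _ hne, ofReal_cpow h0.le, ee, phase,
    cpow_def_of_ne_zero hne (-(t * I)), ← ofReal_log h0.le]
  push_cast
  congr 2
  have : (pi : ℂ) ≠ 0 := by exact_mod_cast pi_ne_zero
  field_simp

lemma dyadic_block_le {u a σ : ℝ} (hu : 1 ≤ u) (ha0 : 0 < a) (ha1 : a ≤ 1) (hσ : 1 / 2 ≤ σ) (N : ℕ)
    (hN : 1 ≤ N) (hNu : (N : ℝ) ≤ 2 * u ^ 56) :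
    ‖∑ n ∈ Ico N (2 * N), ((n : ℂ) + a) ^ (-(σ + (u ^ 40 : ℝ) * I : ℂ))‖ ≤ 4000 * u ^ 9 := by
  have hN1 : (1 : ℝ) ≤ N := by exact_mod_cast hN
  rw [sum_congr rfl fun n _ => natCast_add_cpow_eq (u ^ 40) a σ ha0 n]
  have h := norm_sum_antitone_mul_le (fun n => (n + a : ℝ) ^ (-σ)) (fun n => ee (phase (u ^ 40) a n))
    N (2 * N) (4000 * (√N * u ^ 9)) (by omega) (fun n _ => by positivity) (fun n _ => by
      push_cast
      apply rpow_le_rpow_of_nonpos (by positivity) (by linarith) (by linarith))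
      fun c hc hc2 => phase_sum_le hu ha0 ha1 N c hN hc hc2 hNu
  refine h.trans ?_
  have h2 : (N + a : ℝ) ^ (-σ) ≤ (N : ℝ) ^ (-(1 / 2) : ℝ) :=
    (rpow_le_rpow_of_nonpos (by linarith) (by linarith) (by linarith)).trans
      (rpow_le_rpow_of_exponent_le hN1 (by linarith))
  have h3 : √N * (N : ℝ) ^ (-(1 / 2) : ℝ) = 1 := by
    rw [sqrt_eq_rpow, ← rpow_add (by linarith)]; norm_num
  calc 4000 * (√N * u ^ 9) * (N + a : ℝ) ^ (-σ) ≤ 4000 * (√N * u ^ 9) * (N : ℝ) ^ (-(1 / 2) : ℝ) := by gcongr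
    _ = 4000 * u ^ 9 * (√N * (N : ℝ) ^ (-(1 / 2) : ℝ)) := by ring
    _ = _ := by rw [h3, mul_one]

lemma dyadic_sum_le {u a σ : ℝ} (hu : 1 ≤ u) (ha0 : 0 < a) (ha1 : a ≤ 1) (hσ : 1 / 2 ≤ σ) (J : ℕ)
    (hJ : (2 : ℝ) ^ J ≤ 2 * u ^ 56) :
    ‖∑ n ∈ Ico (1 : ℕ) (2 ^ J), ((n : ℂ) + a) ^ (-(σ + (u ^ 40 : ℝ) * I : ℂ))‖ ≤ 4000 * u ^ 9 * J := by
  induction J with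
  | zero => simp
  | succ J ih =>
    have hsub : (2 : ℝ) ^ J ≤ 2 * u ^ 56 := by
      rw [pow_succ] at hJ
      have : (0 : ℝ) < 2 ^ J := by positivity
      linarith
    have h1 := dyadic_block_le hu ha0 ha1 hσ (2 ^ J) Nat.one_le_two_pow (by push_cast; exact hsub)
    rw [← Finset.sum_Ico_consecutive _ (Nat.one_le_two_pow : 1 ≤ 2 ^ J)
      (Nat.pow_le_pow_right two_pos (J.le_add_right 1)), show 2 ^ (J + 1) = 2 * 2 ^ J by ring]
    refine (norm_add_le _ _).trans ?_
    push_cast at h1 ih ⊢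
    linarith [ih hsub]

/-- The trapezoidal error term for `x ↦ (s - 1) x ^ (-s)` on `[n + a, n + 1 + a]`. -/
noncomputable def trapErr (a : ℝ) (s : ℂ) (n : ℕ) : ℂ :=
  (s - 1) / 2 * ((n + a : ℂ) ^ (-s) + (n + 1 + a : ℂ) ^ (-s)) + (n + 1 + a : ℂ) ^ (1 - s) - (n + a : ℂ) ^ (1 - s)

lemma hasDerivAt_add_cpow {x u : ℝ} (h : 0 < x + u) (c : ℂ) :
    HasDerivAt (fun u : ℝ => ((x : ℂ) + u) ^ c) (c * ((x : ℂ) + u) ^ (c - 1)) u := by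
  have h1 : HasDerivAt (fun w : ℂ => ((x : ℂ) + w) ^ c) (c * ((x : ℂ) + u) ^ (c - 1)) (u : ℂ) := by
    have := ((hasDerivAt_id (u : ℂ)).const_add (x : ℂ)).cpow_const (c := c) (by
      left; simpa using h)
    simpa using this
  exact h1.comp_ofReal

lemma norm_add_cpow {x u : ℝ} (h : 0 < x + u) (c : ℂ) : ‖((x : ℂ) + u) ^ c‖ = (x + u) ^ c.re := by
  have : ((x : ℂ) + u) = ((x + u : ℝ) : ℂ) := by push_cast; rfl
  rw [this, norm_cpow_eq_rpow_re_of_pos h]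

lemma norm_trapezoid_le {x : ℝ} (hx : 0 < x) {s : ℂ} (hs : 0 ≤ s.re) :
    ‖(s - 1) / 2 * ((x : ℂ) ^ (-s) + (x + 1 : ℂ) ^ (-s)) + (x + 1 : ℂ) ^ (1 - s) - (x : ℂ) ^ (1 - s)‖ ≤
      ‖s - 1‖ * ‖s‖ * ‖s + 1‖ * x ^ (-(s.re + 2)) := by
  set K := ‖s‖ * ‖s + 1‖ * x ^ (-(s.re + 2)) with hK
  set χ : ℝ → ℂ := fun u => ((x : ℂ) + u) ^ (-s) - (x : ℂ) ^ (-s) + u * s * ((x : ℂ) + u) ^ (-s - 1) with hχ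
  have hχd : ∀ u ∈ Set.Icc (0 : ℝ) 1, HasDerivAt χ (-(u * s * (s + 1) * ((x : ℂ) + u) ^ (-s - 2))) u := by
    intro u hu
    have hxu : 0 < x + u := by linarith [hu.1]
    have d1 := hasDerivAt_add_cpow hxu (-s)
    have d2 := hasDerivAt_add_cpow hxu (-s - 1)
    have d3 : HasDerivAt (fun u : ℝ => (u : ℂ) * s) s u := by
      simpa using (ofRealCLM.hasDerivAt (x := u)).mul_const s
    have : HasDerivAt χ _ u := (d1.sub_const ((x : ℂ) ^ (-s))).add (d3.mul d2)
    refine this.congr_deriv ?_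
    rw [show -s - 1 - 1 = -s - 2 by ring]; ring
  have hχb : ∀ u ∈ Set.Icc (0 : ℝ) 1, ‖χ u‖ ≤ K := by
    intro u hu
    have := norm_image_sub_le_of_norm_deriv_le_segment' (f := χ) (C := K) (a := 0) (b := 1)
      (fun u hu => (hχd u hu).hasDerivWithinAt) (fun v hv => by
        have hxv : 0 < x + v := by linarith [hv.1]
        rw [norm_neg, norm_mul, norm_mul, norm_mul, norm_add_cpow hxv, Complex.norm_of_nonneg hv.1, hK]
        have e : (-s - 2).re = -(s.re + 2) := by simp; ring
        rw [e]
        have h1 : (x + v) ^ (-(s.re + 2)) ≤ x ^ (-(s.re + 2)) :=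
          rpow_le_rpow_of_nonpos hx (by linarith [hv.1]) (by linarith)
        have h2 : v * ‖s‖ ≤ ‖s‖ := mul_le_of_le_one_left (norm_nonneg _) hv.2.le
        gcongr) u hu
    have h0 : χ 0 = 0 := by rw [hχ]; simp
    rw [h0, sub_zero, sub_zero] at this
    have hK0 : 0 ≤ K := by positivity
    exact this.trans (mul_le_of_le_one_right hK0 hu.2)
  set ψ : ℝ → ℂ := fun u => ((x : ℂ) + u) ^ (1 - s) - (x : ℂ) ^ (1 - s) -
    (u : ℂ) / 2 * (1 - s) * ((x : ℂ) ^ (-s) + ((x : ℂ) + u) ^ (-s)) with hψ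
  have hψd : ∀ u ∈ Set.Icc (0 : ℝ) 1, HasDerivAt ψ ((1 - s) / 2 * χ u) u := by
    intro u hu
    have hxu : 0 < x + u := by linarith [hu.1]
    have d1 := hasDerivAt_add_cpow hxu (1 - s)
    have d2 := hasDerivAt_add_cpow hxu (-s)
    have d3 : HasDerivAt (fun u : ℝ => (u : ℂ) / 2 * (1 - s)) (1 / 2 * (1 - s)) u := by
      simpa using ((ofRealCLM.hasDerivAt (x := u)).div_const 2).mul_const (1 - s)
    have : HasDerivAt ψ _ u := (d1.sub_const ((x : ℂ) ^ (1 - s))).sub (d3.mul (d2.const_add ((x : ℂ) ^ (-s))))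
    refine this.congr_deriv ?_
    rw [hχ]; dsimp only
    rw [show 1 - s - 1 = -s by ring]; ring
  have := norm_image_sub_le_of_norm_deriv_le_segment_01' (f := ψ) (C := ‖s - 1‖ * K)
    (fun u hu => (hψd u hu).hasDerivWithinAt) fun u hu => by
      rw [norm_mul, norm_div, norm_sub_rev]
      have := hχb u ⟨hu.1, hu.2.le⟩
      have h2 : ‖s - 1‖ / ‖(2 : ℂ)‖ ≤ ‖s - 1‖ := by
        rw [norm_ofNat]; linarith [norm_nonneg (s - 1)]
      gcongr
  have h0 : ψ 0 = 0 := by rw [hψ]; simp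
  rw [h0, sub_zero] at this
  have e : (s - 1) / 2 * ((x : ℂ) ^ (-s) + (x + 1 : ℂ) ^ (-s)) + (x + 1 : ℂ) ^ (1 - s) - (x : ℂ) ^ (1 - s) = ψ 1 := by
    rw [hψ]; push_cast; ring
  rw [e]
  refine this.trans (le_of_eq ?_)
  rw [hK]; ring

lemma norm_trapErr_le {a : ℝ} (ha : 0 < a) {s : ℂ} (hs : 0 ≤ s.re) (n : ℕ) :
    ‖trapErr a s n‖ ≤ ‖s - 1‖ * ‖s‖ * ‖s + 1‖ * (n + a) ^ (-(s.re + 2)) := by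
  have := norm_trapezoid_le (x := n + a) (by positivity) hs
  rw [trapErr]
  push_cast at this
  rw [show (n : ℂ) + a + 1 = n + 1 + a by ring] at this
  exact this

lemma summable_shift_rpow {a : ℝ} (ha : 0 < a) {q : ℝ} (hq : 1 < q) :
    Summable fun n : ℕ => ((n : ℝ) + a) ^ (-q) := by
  have := (Real.summable_one_div_nat_add_rpow a q).mpr hq
  refine this.congr fun n => ?_
  have h : (0 : ℝ) < n + a := by positivity
  rw [abs_of_pos h, rpow_neg h.le, one_div]

/-- The Euler-Maclaurin expression for `(s - 1) ζ(s, a)`. -/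
noncomputable def hurwitzEM (a : ℝ) (N : ℕ) (s : ℂ) : ℂ :=
  (s - 1) * (∑ n ∈ range N, (n + a : ℂ) ^ (-s) + (N + a : ℂ) ^ (-s) / 2) + (N + a : ℂ) ^ (1 - s) +
    ∑' n : ℕ, trapErr a s (N + n)

lemma summable_trapErr {a : ℝ} (ha : 0 < a) {s : ℂ} (hs : 0 ≤ s.re) (N : ℕ) :
    Summable fun n : ℕ => trapErr a s (N + n) := by
  have h1 : Summable fun n : ℕ => trapErr a s n :=
    Summable.of_norm_bounded ((summable_shift_rpow ha (by linarith : 1 < s.re + 2)).mul_left _)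
      fun n => norm_trapErr_le ha hs n
  exact h1.comp_injective (add_right_injective N)

lemma natCast_add_ne_zero {a : ℝ} (ha : 0 < a) (n : ℕ) : (n : ℂ) + a ≠ 0 := by
  have : (0 : ℝ) < n + a := by positivity
  exact_mod_cast this.ne'

lemma differentiable_cpow_neg {z : ℂ} (hz : z ≠ 0) : Differentiable ℂ fun s : ℂ => z ^ (-s) :=
  fun _ => (differentiableAt_id.neg).const_cpow (Or.inl hz)

lemma differentiable_cpow_one_sub {z : ℂ} (hz : z ≠ 0) : Differentiable ℂ fun s : ℂ => z ^ (1 - s) :=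
  fun _ => ((differentiableAt_const 1).sub differentiableAt_id).const_cpow (Or.inl hz)

lemma differentiable_trapErr {a : ℝ} (ha : 0 < a) (n : ℕ) : Differentiable ℂ fun s => trapErr a s n := by
  have h0 := natCast_add_ne_zero ha n
  have h1 : (n : ℂ) + 1 + a ≠ 0 := by
    have := natCast_add_ne_zero ha (n + 1); push_cast at this; exact this
  unfold trapErr
  exact (((differentiable_id.sub_const 1).div_const 2).mul
    ((differentiable_cpow_neg h0).add (differentiable_cpow_neg h1))).add (differentiable_cpow_one_sub h1) |>.sub
    (differentiable_cpow_one_sub h0)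

/-- A bounded region of the right half-plane. -/
def halfDisk (R : ℝ) : Set ℂ := {s : ℂ | 0 < s.re} ∩ Metric.ball 0 R

lemma isOpen_halfDisk (R : ℝ) : IsOpen (halfDisk R) :=
  (isOpen_lt continuous_const continuous_re).inter Metric.isOpen_ball

lemma differentiableOn_hurwitzEM {a : ℝ} (ha : 0 < a) (N : ℕ) {R : ℝ} (hR : 0 < R) :
    DifferentiableOn ℂ (hurwitzEM a N) (halfDisk R) := by
  have h0 := natCast_add_ne_zero ha N
  unfold hurwitzEM
  refine DifferentiableOn.fun_add ?_ ?_
  · refine Differentiable.differentiableOn (((differentiable_id.sub_const 1).mul (Differentiable.add ?_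
      ((differentiable_cpow_neg h0).div_const 2))).add (differentiable_cpow_one_sub h0))
    exact Differentiable.fun_sum fun n _ => differentiable_cpow_neg (natCast_add_ne_zero ha n)
  · have hsum : Summable fun n : ℕ => (R + 1) * R * (R + 1) *
        ((((N + n : ℕ) : ℝ) + a) ^ (-(2 : ℝ)) + (((N + n : ℕ) : ℝ) + a) ^ (-(R + 2))) :=
      (((summable_shift_rpow ha one_lt_two).add (summable_shift_rpow ha (by linarith : 1 < R + 2))).mul_left
        ((R + 1) * R * (R + 1))).comp_injective (add_right_injective N)
    refine differentiableOn_tsum_of_summable_norm hsum (fun n => (differentiable_trapErr ha _).differentiableOn)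
      (isOpen_halfDisk R) fun n s hs => ?_
    have hs1 : 0 < s.re := hs.1
    have hs2 : ‖s‖ ≤ R := (mem_ball_zero_iff.mp hs.2).le
    have hre : s.re ≤ R := (re_le_norm s).trans hs2
    have hx : (0 : ℝ) < ((N + n : ℕ) : ℝ) + a := by positivity
    have h1 : ‖s - 1‖ ≤ R + 1 := (norm_sub_le _ _).trans (by simpa using hs2)
    have h2 : ‖s + 1‖ ≤ R + 1 := (norm_add_le _ _).trans (by simpa using hs2)
    refine (norm_trapErr_le ha hs1.le _).trans ?_
    have h3 : (((N + n : ℕ) : ℝ) + a) ^ (-(s.re + 2)) ≤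
        (((N + n : ℕ) : ℝ) + a) ^ (-(2 : ℝ)) + (((N + n : ℕ) : ℝ) + a) ^ (-(R + 2)) := by
      rcases le_total 1 (((N + n : ℕ) : ℝ) + a) with h | h
      · exact (rpow_le_rpow_of_exponent_le h (by linarith)).trans (le_add_of_nonneg_right (by positivity))
      · exact (Real.rpow_le_rpow_of_exponent_ge hx h (by linarith)).trans (le_add_of_nonneg_left (by positivity))
    gcongr

lemma tendsto_natCast_add_cpow {a : ℝ} {s : ℂ} (hs : 0 < s.re) (N : ℕ) :
    Tendsto (fun M : ℕ => ((N : ℂ) + M + a) ^ (-s)) atTop (nhds 0) := by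
  rw [tendsto_zero_iff_norm_tendsto_zero]
  have h1 : Tendsto (fun M : ℕ => (M : ℝ) + (N + a)) atTop atTop :=
    tendsto_atTop_add_const_right _ _ tendsto_natCast_atTop_atTop
  have h2 := (tendsto_rpow_neg_atTop hs).comp h1
  refine h2.congr' ?_
  filter_upwards [h1.eventually_gt_atTop 0] with M hM
  have := norm_add_cpow (x := M) (u := N + a) hM (-s)
  rw [Function.comp, show ((N : ℂ) + M + a) = (((M : ℝ) : ℂ) + ((N + a : ℝ) : ℂ)) by push_cast; ring, this]
  simp

lemma sum_trapErr (a : ℝ) (s : ℂ) (N M : ℕ) :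
    ∑ n ∈ range M, trapErr a s (N + n) =
      (s - 1) * (∑ n ∈ range M, ((n + N : ℕ) + a : ℂ) ^ (-s) - ((N : ℂ) + a) ^ (-s) / 2 +
        ((N : ℂ) + M + a) ^ (-s) / 2) + ((N : ℂ) + M + a) ^ (1 - s) - ((N : ℂ) + a) ^ (1 - s) := by
  induction M with
  | zero => simp
  | succ M ih =>
    rw [sum_range_succ, ih, sum_range_succ, trapErr]
    push_cast
    rw [show (N : ℂ) + M + 1 + a = N + (M + 1) + a by ring, show (M : ℂ) + N + a = N + M + a by ring]
    ring

lemma summable_add_cpow {a : ℝ} (ha : 0 < a) {s : ℂ} (hs : 1 < s.re) :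
    Summable fun n : ℕ => ((n : ℂ) + a) ^ (-s) := by
  refine Summable.of_norm_bounded (summable_shift_rpow ha hs) fun n => ?_
  have := norm_add_cpow (x := n) (u := a) (by positivity) (-s)
  rw [ofReal_natCast] at this
  rw [this]; simp

lemma hurwitzEM_eq {a : ℝ} (ha : 0 < a) {s : ℂ} (hs : 1 < s.re) (N : ℕ) :
    hurwitzEM a N s = (s - 1) * ∑' n : ℕ, ((n : ℂ) + a) ^ (-s) := by
  have h1 := (summable_trapErr ha (by linarith : 0 ≤ s.re) N).hasSum.tendsto_sum_nat
  have hsm := summable_add_cpow ha hs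
  have h2 := ((summable_nat_add_iff N).mpr hsm).hasSum.tendsto_sum_nat
  have h3 := tendsto_natCast_add_cpow (a := a) (by linarith : 0 < s.re) N
  have h4 := tendsto_natCast_add_cpow (a := a) (s := s - 1) (by simpa using hs) N
  rw [neg_sub] at h4
  have h5 := ((((h2.sub_const (((N : ℂ) + a) ^ (-s) / 2)).add (h3.div_const 2)).const_mul (s - 1)).add h4).sub_const
    (((N : ℂ) + a) ^ (1 - s))
  have h6 := tendsto_nhds_unique h1 (h5.congr fun M => (sum_trapErr a s N M).symm)
  rw [hurwitzEM, h6, ← hsm.sum_add_tsum_nat_add N]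
  ring

lemma eqOn_halfDisk {f g : ℂ → ℂ} {R : ℝ} (hR : 2 < R) (hf : DifferentiableOn ℂ f (halfDisk R))
    (hg : DifferentiableOn ℂ g (halfDisk R)) (h : ∀ s : ℂ, 1 < s.re → f s = g s) : Set.EqOn f g (halfDisk R) := by
  have hc : Convex ℝ (halfDisk R) := (convex_halfSpace_re_gt 0).inter (convex_ball 0 R)
  have h2 : (2 : ℂ) ∈ halfDisk R := ⟨by simp, by simpa using hR⟩
  refine (hf.analyticOnNhd (isOpen_halfDisk R)).eqOn_of_preconnected_of_eventuallyEq
    (hg.analyticOnNhd (isOpen_halfDisk R)) hc.isPreconnected h2 ?_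
  filter_upwards [(isOpen_lt continuous_const continuous_re).mem_nhds
    (show (1 : ℝ) < (2 : ℂ).re by simp)] with s hs using h s hs

lemma mem_halfDisk {s : ℂ} (hs : 0 < s.re) : s ∈ halfDisk (‖s‖ + 3) :=
  ⟨hs, by rw [mem_ball_zero_iff]; linarith⟩

lemma zz_eq_hurwitzEM {s : ℂ} (hs : 0 < s.re) (N : ℕ) : zz s = hurwitzEM 1 N s := by
  refine eqOn_halfDisk (by linarith [norm_nonneg s]) zz_differentiable.differentiableOn
    (differentiableOn_hurwitzEM one_pos N (by positivity)) (fun w hw => ?_) (mem_halfDisk hs)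
  have hw1 : w ≠ 1 := by rintro rfl; simp at hw
  rw [hurwitzEM_eq one_pos hw, zz_of_ne hw1, zeta_eq_tsum_one_div_nat_add_one_cpow hw]
  congr 1
  refine tsum_congr fun n => ?_
  rw [cpow_neg, one_div]; simp

lemma LL_eq_tsum_sub {s : ℂ} (hs : 1 < s.re) : LL s = (4 : ℂ) ^ (-s) *
    (∑' n : ℕ, ((n : ℂ) + (1 / 4 : ℝ)) ^ (-s) - ∑' n : ℕ, ((n : ℂ) + (3 / 4 : ℝ)) ^ (-s)) := by
  have h1 := (summable_add_cpow (a := 1 / 4) (by norm_num) hs).hasSum.mul_left ((4 : ℂ) ^ (-s))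
  have h2 := ((summable_add_cpow (a := 3 / 4) (by norm_num) hs).hasSum.mul_left ((4 : ℂ) ^ (-s))).neg
  have key : ∀ x : ℝ, 0 ≤ x → (4 : ℂ) ^ (-s) * (x : ℂ) ^ (-s) = ((4 * x : ℝ) : ℂ) ^ (-s) := fun x hx => by
    have := mul_cpow_ofReal_nonneg (a := 4) (b := x) (by norm_num) hx (-s)
    push_cast at this ⊢
    rw [this]
  have h3 : HasSum (fun j : ℕ => (-1 : ℂ) ^ j * (2 * j + 1 : ℂ) ^ (-s)) _ := HasSum.even_add_odd
    (h1.congr_fun fun n => ?_) (h2.congr_fun fun n => ?_)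
  · rw [(LL_hasSum hs).unique h3]; ring
  · have := key (n + (1 / 4 : ℝ)) (by positivity)
    push_cast at this ⊢
    rw [this, pow_mul]; norm_num; ring_nf
  · have := key (n + (3 / 4 : ℝ)) (by positivity)
    push_cast at this ⊢
    rw [this, pow_succ, pow_mul]; norm_num; ring_nf

lemma LL_eq_hurwitzEM {s : ℂ} (hs : 0 < s.re) (N : ℕ) :
    (s - 1) * LL s = (4 : ℂ) ^ (-s) * (hurwitzEM (1 / 4) N s - hurwitzEM (3 / 4) N s) := by
  refine eqOn_halfDisk (f := fun s => (s - 1) * LL s)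
    (g := fun s => (4 : ℂ) ^ (-s) * (hurwitzEM (1 / 4) N s - hurwitzEM (3 / 4) N s))
    (by linarith [norm_nonneg s]) ((differentiable_id.sub_const 1).mul LL_differentiable).differentiableOn
    ((differentiable_cpow_neg (by norm_num)).differentiableOn.mul
      ((differentiableOn_hurwitzEM (by norm_num) N (by positivity)).sub
        (differentiableOn_hurwitzEM (by norm_num) N (by positivity)))) (fun w hw => ?_) (mem_halfDisk hs)
  rw [hurwitzEM_eq (by norm_num) hw, hurwitzEM_eq (by norm_num) hw, LL_eq_tsum_sub hw]
  ring

lemma exists_dyadic_scale {u : ℝ} (hu : 1 ≤ u) :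
    ∃ J : ℕ, u ^ 56 ≤ (2 : ℝ) ^ J ∧ (2 : ℝ) ^ J ≤ 2 * u ^ 56 ∧ (J : ℝ) ≤ 900 * u ^ (1 / 10 : ℝ) := by
  have hu56 : (1 : ℝ) ≤ u ^ 56 := one_le_pow₀ hu
  obtain ⟨n, h1, h2⟩ := exists_nat_pow_near hu56 one_lt_two
  have h3 : (2 : ℝ) ^ (n + 1) ≤ 2 * u ^ 56 := by rw [pow_succ]; linarith
  refine ⟨n + 1, h2.le, h3, ?_⟩
  have h4 : (n : ℝ) * log 2 ≤ 56 * log u := by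
    have := log_le_log (by positivity) h1
    rwa [log_pow, log_pow] at this
  have h5 : log u ≤ u ^ (1 / 10 : ℝ) / (1 / 10) := Real.log_le_rpow_div (by linarith) (by norm_num)
  have h6 := Real.log_two_gt_d9
  have h7 : (1 : ℝ) ≤ u ^ (1 / 10 : ℝ) := one_le_rpow hu (by norm_num)
  have h8 : (n : ℝ) * (69 / 100) ≤ n * log 2 := by gcongr; linarith
  push_cast
  linarith

lemma norm_tsum_trapErr_le {a u : ℝ} (ha0 : 1 / 4 ≤ a) (hu : 1 ≤ u) {s : ℂ} (hs : 1 / 2 ≤ s.re)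
    {N : ℕ} (hN : u ^ 56 ≤ (N : ℝ)) :
    ‖∑' n, trapErr a s (N + n)‖ ≤ ‖s - 1‖ * ‖s‖ * ‖s + 1‖ * (u ^ 72)⁻¹ *
      ∑' n : ℕ, ((n : ℝ) + 1 / 4) ^ (-(17 / 14) : ℝ) := by
  have hq := summable_shift_rpow (a := 1 / 4) (by norm_num) (q := 17 / 14) (by norm_num)
  have hu56 : (1 : ℝ) ≤ u ^ 56 := one_le_pow₀ hu
  rw [← tsum_mul_left]
  refine tsum_of_norm_bounded ((hq.mul_left _).hasSum) fun n => ?_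
  refine (norm_trapErr_le (by linarith) (by linarith) _).trans ?_
  rw [mul_assoc (‖s - 1‖ * ‖s‖ * ‖s + 1‖)]
  gcongr
  push_cast
  calc ((N : ℝ) + n + a) ^ (-(s.re + 2)) ≤ ((N : ℝ) + n + a) ^ (-(9 / 7) + -(17 / 14) : ℝ) :=
        rpow_le_rpow_of_exponent_le (by linarith) (by linarith)
    _ = ((N : ℝ) + n + a) ^ (-(9 / 7) : ℝ) * ((N : ℝ) + n + a) ^ (-(17 / 14) : ℝ) :=
        rpow_add (by linarith) _ _
    _ ≤ (u ^ 56) ^ (-(9 / 7) : ℝ) * ((n : ℝ) + 1 / 4) ^ (-(17 / 14) : ℝ) :=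
        mul_le_mul (rpow_le_rpow_of_nonpos (by positivity) (by linarith) (by norm_num))
          (rpow_le_rpow_of_nonpos (by positivity) (by linarith) (by norm_num))
          (Real.rpow_nonneg (by linarith) _) (by positivity)
    _ = (u ^ 72)⁻¹ * ((n : ℝ) + 1 / 4) ^ (-(17 / 14) : ℝ) := by
        congr 1
        rw [← rpow_natCast u 56, ← rpow_mul (by linarith), ← rpow_natCast u 72,
          ← rpow_neg (by linarith)]
        norm_num

lemma norm_hurwitzEM_le : ∃ C : ℝ, 0 < C ∧ ∀ u σ : ℝ, 1 ≤ u → 1 / 2 ≤ σ → σ ≤ 2 →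
    ∃ N : ℕ, ∀ a ∈ Set.Icc (1 / 4 : ℝ) 1,
      ‖hurwitzEM a N (σ + (u ^ 40 : ℝ) * I)‖ ≤ C * u ^ 40 * (u ^ 9 * u ^ (1 / 10 : ℝ)) := by
  set S := ∑' n : ℕ, ((n : ℝ) + 1 / 4) ^ (-(17 / 14) : ℝ)
  refine ⟨2 * (17 + 3600000) + 2 + 24 * S, by positivity, fun u σ hu hσ hσ2 => ?_⟩
  obtain ⟨J, hJ1, hJ2, hJ3⟩ := exists_dyadic_scale hu
  refine ⟨2 ^ J, fun a ha => ?_⟩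
  obtain ⟨ha0, ha1⟩ := ha
  set s : ℂ := σ + (u ^ 40 : ℝ) * I with hs
  have hre : s.re = σ := by simp [hs, -ofReal_pow]
  have hU : (1 : ℝ) ≤ u ^ 40 := one_le_pow₀ hu
  have hN : (1 : ℝ) ≤ 2 ^ J := one_le_pow₀ one_le_two
  have hb : ∀ c : ℝ, ‖(c : ℂ) + (u ^ 40 : ℝ) * I‖ ≤ |c| + u ^ 40 := fun c => by
    refine (norm_add_le _ _).trans (le_of_eq ?_)
    rw [norm_real, norm_mul, norm_I, Complex.norm_of_nonneg (by positivity), mul_one,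
      norm_eq_abs]
  have n1 : ‖s - 1‖ ≤ 2 * u ^ 40 := by
    have := hb (σ - 1)
    rw [show ((σ - 1 : ℝ) : ℂ) + (u ^ 40 : ℝ) * I = s - 1 by rw [hs]; push_cast; ring] at this
    have h2 : |σ - 1| ≤ 1 := abs_le.mpr ⟨by linarith, by linarith⟩
    linarith
  have n2 : ‖s‖ ≤ 3 * u ^ 40 := by
    have := hb σ
    rw [abs_of_nonneg (by linarith)] at this
    linarith
  have n3 : ‖s + 1‖ ≤ 4 * u ^ 40 := by
    have := hb (σ + 1)
    rw [show ((σ + 1 : ℝ) : ℂ) + (u ^ 40 : ℝ) * I = s + 1 by rw [hs]; push_cast; ring,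
      abs_of_nonneg (by linarith)] at this
    linarith
  set W := u ^ 9 * u ^ (1 / 10 : ℝ) with hW
  have hr : (1 : ℝ) ≤ u ^ (1 / 10 : ℝ) := one_le_rpow hu (by norm_num)
  have hW9 : u ^ 9 ≤ W := le_mul_of_one_le_right (by positivity) hr
  have hW1 : 1 ≤ W := (one_le_pow₀ hu).trans hW9
  have hNa : ((2 ^ J : ℕ) : ℂ) + a = (((2 ^ J : ℝ) + a : ℝ) : ℂ) := by push_cast; ring
  have hpos : (0 : ℝ) < 2 ^ J + a := by linarith
  have b1 : ‖∑ n ∈ range (2 ^ J), ((n : ℂ) + a) ^ (-s)‖ ≤ 16 * W + 3600000 * W := by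
    rw [Finset.range_eq_Ico, Finset.sum_eq_sum_Ico_succ_bot (by positivity)]
    refine (norm_add_le _ _).trans (add_le_add ?_ ?_)
    · have := norm_add_cpow (x := (0 : ℕ)) (u := a) (by simp; linarith) (-s)
      rw [ofReal_natCast] at this
      rw [this, neg_re, hre]
      have h3 : ((0 : ℕ) + a : ℝ) ^ (-σ) ≤ 16 := by
        simp only [Nat.cast_zero, zero_add]
        calc a ^ (-σ) ≤ a ^ (-2 : ℝ) := Real.rpow_le_rpow_of_exponent_ge (by linarith) ha1 (by linarith)
          _ ≤ (1 / 4 : ℝ) ^ (-2 : ℝ) := rpow_le_rpow_of_nonpos (by norm_num) ha0 (by norm_num)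
          _ = 16 := by rw [rpow_neg (by norm_num)]; norm_num
      linarith
    · refine (dyadic_sum_le hu (by linarith) ha1 hσ J hJ2).trans ?_
      calc 4000 * u ^ 9 * J ≤ 4000 * u ^ 9 * (900 * u ^ (1 / 10 : ℝ)) := by gcongr
        _ = 3600000 * W := by rw [hW]; ring
  have b2 : ‖(((2 ^ J : ℕ) : ℂ) + a) ^ (-s) / 2‖ ≤ W := by
    rw [hNa, norm_div, norm_cpow_eq_rpow_re_of_pos hpos, neg_re, hre, norm_ofNat]
    have : ((2 : ℝ) ^ J + a) ^ (-σ) ≤ 1 := Real.rpow_le_one_of_one_le_of_nonpos (by linarith) (by linarith)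
    linarith
  have b3 : ‖(((2 ^ J : ℕ) : ℂ) + a) ^ (1 - s)‖ ≤ 2 * u ^ 40 * W := by
    rw [hNa, norm_cpow_eq_rpow_re_of_pos hpos, sub_re, hre, one_re]
    calc ((2 : ℝ) ^ J + a) ^ (1 - σ) ≤ ((2 : ℝ) ^ J + a) ^ (1 / 2 : ℝ) :=
          rpow_le_rpow_of_exponent_le (by linarith) (by linarith)
      _ = √((2 : ℝ) ^ J + a) := by rw [sqrt_eq_rpow]
      _ ≤ √((2 * u ^ 28) ^ 2) := sqrt_le_sqrt (by
          have : (1 : ℝ) ≤ u ^ 56 := one_le_pow₀ hu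
          rw [mul_pow, ← pow_mul]; norm_num; linarith)
      _ = 2 * u ^ 28 := sqrt_sq (by positivity)
      _ ≤ 2 * u ^ 40 * 1 := by
          rw [mul_one]
          exact mul_le_mul_of_nonneg_left (pow_le_pow_right₀ hu (by norm_num)) (by norm_num)
      _ ≤ 2 * u ^ 40 * W := by gcongr
  have b4 : ‖∑' n, trapErr a s (2 ^ J + n)‖ ≤ 24 * S * u ^ 40 * W := by
    refine (norm_tsum_trapErr_le ha0 hu (by rw [hre]; exact hσ) (by push_cast; exact hJ1)).trans ?_
    calc ‖s - 1‖ * ‖s‖ * ‖s + 1‖ * (u ^ 72)⁻¹ * S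
        ≤ (2 * u ^ 40) * (3 * u ^ 40) * (4 * u ^ 40) * (u ^ 72)⁻¹ * S := by gcongr
      _ = 24 * S * u ^ 40 * u ^ 8 := by
          have : u ≠ 0 := by positivity
          field_simp; ring
      _ ≤ 24 * S * u ^ 40 * W := by
          gcongr
          exact (pow_le_pow_right₀ hu (by norm_num)).trans hW9
  rw [hurwitzEM]
  calc _ ≤ ‖s - 1‖ * ‖∑ n ∈ range (2 ^ J), ((n : ℂ) + a) ^ (-s) + (((2 ^ J : ℕ) : ℂ) + a) ^ (-s) / 2‖ +
        ‖(((2 ^ J : ℕ) : ℂ) + a) ^ (1 - s)‖ + ‖∑' n, trapErr a s (2 ^ J + n)‖ := by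
        refine (norm_add₃_le).trans ?_
        rw [norm_mul]
    _ ≤ 2 * u ^ 40 * (16 * W + 3600000 * W + W) + 2 * u ^ 40 * W + 24 * S * u ^ 40 * W := by
        gcongr
        exact (norm_add_le _ _).trans (add_le_add b1 b2)
    _ = _ := by ring

lemma LL_conj (s : ℂ) : LL (conj s) = conj (LL s) := by
  have hd : Differentiable ℂ fun s => conj (LL (conj s)) := fun z => by
    have := (LL_differentiable (conj z)).conj_conj
    simpa [Function.comp_def] using this
  have key : (fun s => conj (LL (conj s))) = LL := by
    refine AnalyticOnNhd.eq_of_eventuallyEq (z₀ := 2)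
      (hd.differentiableOn.analyticOnNhd isOpen_univ) (LL_differentiable.differentiableOn.analyticOnNhd isOpen_univ) ?_
    filter_upwards [(isOpen_lt continuous_const continuous_re).mem_nhds
      (show (1 : ℝ) < (2 : ℂ).re by simp)] with s hs
    have h1 := (LL_hasSum (s := conj s) (by simpa using hs)).map conj continuous_conj
    refine h1.unique ((LL_hasSum hs).congr_fun fun j => ?_)
    simp only [Function.comp, map_mul, map_pow, map_neg, map_one]
    congr 1
    have e : ((2 * j + 1 : ℂ)) = ((2 * j + 1 : ℝ) : ℂ) := by push_cast; ring
    have hp : (0 : ℝ) < 2 * j + 1 := by positivity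
    rw [e, ← map_neg, ← conj_cpow _ _ (by rw [arg_ofReal_of_nonneg hp.le]; exact pi_pos.ne),
      conj_ofReal]
  rw [← congrFun key (conj s)]
  simp

lemma zK_conj (s : ℂ) : zK (conj s) = conj (zK s) := by
  rw [zK, zK, riemannZeta_conj, LL_conj, map_mul]

lemma norm_zK_neg (σ t : ℝ) : ‖zK (σ + (-t : ℝ) * I)‖ = ‖zK (σ + t * I)‖ := by
  have h : ((σ : ℂ) + (-t : ℝ) * I) = conj (σ + t * I) := by simp
  rw [h, zK_conj, norm_conj]

theorem norm_zK_le : ∃ C : ℝ, 0 < C ∧ ∀ σ t : ℝ, 1 / 2 ≤ σ → σ ≤ 2 → 1 ≤ |t| →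
    ‖zK (σ + t * I)‖ ≤ C * |t| ^ (23 / 50 : ℝ) := by
  obtain ⟨C, hC, h⟩ := norm_hurwitzEM_le
  refine ⟨2 * C ^ 2, by positivity, fun σ t hσ hσ2 ht => ?_⟩
  have habs : ‖zK (σ + t * I)‖ = ‖zK (σ + |t| * I)‖ := by
    rcases abs_choice t with h | h
    · rw [h]
    · rw [h, norm_zK_neg]
  rw [habs]
  generalize |t| = T at ht ⊢
  obtain ⟨u, hu, rfl⟩ : ∃ u : ℝ, 1 ≤ u ∧ u ^ 40 = T :=
    ⟨T ^ (1 / 40 : ℝ), one_le_rpow ht (by norm_num), by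
      rw [← rpow_natCast, ← rpow_mul (by linarith)]; norm_num⟩
  obtain ⟨N, hN⟩ := h u σ hu hσ hσ2
  set W := u ^ 9 * u ^ (1 / 10 : ℝ) with hW
  set s : ℂ := σ + (u ^ 40 : ℝ) * I with hs
  have hre : s.re = σ := by simp [hs, -ofReal_pow]
  have him : s.im = u ^ 40 := by simp [hs, -ofReal_pow]
  have hs1 : u ^ 40 ≤ ‖s - 1‖ := by
    have := abs_im_le_norm (s - 1)
    rw [sub_im, him, one_im, sub_zero, abs_of_nonneg (by linarith)] at this
    exact this
  have hU : (0 : ℝ) < u ^ 40 := by linarith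
  have hne : s ≠ 1 := by rintro h; rw [h] at hs1; simp at hs1; linarith
  have hz : ‖riemannZeta s‖ ≤ C * W := by
    have h1 := hN 1 (by norm_num)
    rw [← zz_eq_hurwitzEM (by rw [hre]; linarith), zz_of_ne hne, norm_mul] at h1
    have : u ^ 40 * ‖riemannZeta s‖ ≤ u ^ 40 * (C * W) := by
      refine (mul_le_mul_of_nonneg_right hs1 (norm_nonneg _)).trans (h1.trans (le_of_eq (by ring)))
    exact le_of_mul_le_mul_left this hU
  have hL : ‖LL s‖ ≤ 2 * C * W := by
    have h1 := hN (1 / 4) (by norm_num)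
    have h2 := hN (3 / 4) (by norm_num)
    have h3 := congrArg norm (LL_eq_hurwitzEM (s := s) (by rw [hre]; linarith) N)
    rw [norm_mul, norm_mul] at h3
    have h4 : ‖(4 : ℂ) ^ (-s)‖ ≤ 1 := by
      rw [show (4 : ℂ) = ((4 : ℝ) : ℂ) by norm_num, norm_cpow_eq_rpow_re_of_pos (by norm_num)]
      exact Real.rpow_le_one_of_one_le_of_nonpos (by norm_num) (by rw [neg_re, hre]; linarith)
    have : u ^ 40 * ‖LL s‖ ≤ u ^ 40 * (2 * C * W) := by
      refine (mul_le_mul_of_nonneg_right hs1 (norm_nonneg _)).trans (h3.le.trans ?_)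
      refine (mul_le_of_le_one_left (norm_nonneg _) h4).trans ((norm_sub_le _ _).trans ?_)
      linarith
    exact le_of_mul_le_mul_left this hU
  rw [zK, norm_mul]
  calc ‖riemannZeta s‖ * ‖LL s‖ ≤ (C * W) * (2 * C * W) := by gcongr
    _ = 2 * C ^ 2 * W ^ 2 := by ring
    _ ≤ 2 * C ^ 2 * (u ^ 40) ^ (23 / 50 : ℝ) := by
      have : W ^ 2 ≤ (u ^ 40) ^ (23 / 50 : ℝ) := by
        have e : W = u ^ (91 / 10 : ℝ) := by
          rw [hW, ← rpow_natCast u 9, ← rpow_add (by linarith)]; norm_num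
        rw [e, ← rpow_natCast, ← rpow_mul (by linarith), ← rpow_natCast u 40,
          ← rpow_mul (by linarith)]
        exact rpow_le_rpow_of_exponent_le hu (by norm_num)
      gcongr

lemma integrable_exp_mul_I {h : ℝ → ℂ} (hh : Integrable h) (t : ℝ) :
    Integrable fun u : ℝ => cexp (-(t * u : ℝ) * I) * h u := by
  refine hh.bdd_mul (c := 1) (by fun_prop) (Eventually.of_forall fun u => ?_)
  rw [← ofReal_neg, norm_exp_ofReal_mul_I]

/-- Gaussian-weighted Plancherel identity. -/
lemma integral_gaussian_normSq_fourier {h : ℝ → ℂ} (hh : Integrable h) {b : ℝ} (hb : 0 < b) :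
    ∫ t : ℝ, cexp (-b * t ^ 2) * ((∫ u : ℝ, cexp (-(t * u : ℝ) * I) * h u) *
        conj (∫ u : ℝ, cexp (-(t * u : ℝ) * I) * h u)) =
      ∫ p : ℝ × ℝ, (√(pi / b) * exp (-(p.1 - p.2) ^ 2 / (4 * b)) : ℝ) * (h p.1 * conj (h p.2)) := by
  have hprod : Integrable fun p : ℝ × ℝ => h p.1 * conj (h p.2) :=
    hh.mul_prod (g := fun v => conj (h v)) (by
      simpa using (conjCLE.toContinuousLinearMap.integrable_comp hh))
  have e1 : ∀ t : ℝ, cexp (-b * t ^ 2) * ((∫ u : ℝ, cexp (-(t * u : ℝ) * I) * h u) *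
        conj (∫ u : ℝ, cexp (-(t * u : ℝ) * I) * h u)) =
      ∫ p : ℝ × ℝ, (cexp (I * (-(p.1 - p.2) : ℝ) * t) * cexp (-b * t ^ 2)) * (h p.1 * conj (h p.2)) := by
    intro t
    rw [← integral_conj, ← integral_prod_mul, ← integral_const_mul]
    refine integral_congr_ae (Eventually.of_forall fun p => ?_)
    simp only [map_mul, ← exp_conj, conj_I, conj_ofReal, map_neg]
    have : cexp (I * (-(p.1 - p.2) : ℝ) * t) = cexp (-(t * p.1 : ℝ) * I) * cexp (-(t * p.2 : ℝ) * -I) := by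
      rw [← Complex.exp_add]; push_cast; ring_nf
    rw [this]; ring
  simp_rw [e1]
  rw [integral_integral_swap]
  · refine integral_congr_ae (Eventually.of_forall fun p => ?_)
    simp only
    rw [integral_mul_const]
    have := fourierIntegral_gaussian (b := b) (by simpa using hb) ((-(p.1 - p.2) : ℝ) : ℂ)
    rw [this]
    congr 1
    rw [sqrt_eq_rpow, ofReal_mul, ofReal_cpow (by positivity), ofReal_exp]
    push_cast
    congr 3
    ring
  · have hg : Integrable fun t : ℝ => cexp (-(b : ℂ) * t ^ 2) := integrable_cexp_neg_mul_sq (by simpa using hb)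
    have h2 : Integrable (fun q : ℝ × (ℝ × ℝ) => cexp (-(b : ℂ) * q.1 ^ 2) * (h q.2.1 * conj (h q.2.2)))
      (volume.prod volume) := hg.mul_prod hprod
    have h3 : Integrable (fun q : ℝ × (ℝ × ℝ) => cexp (I * (-(q.2.1 - q.2.2) : ℝ) * q.1) *
        (cexp (-(b : ℂ) * q.1 ^ 2) * (h q.2.1 * conj (h q.2.2)))) (volume.prod volume) := by
      refine h2.bdd_mul (c := 1) (Continuous.aestronglyMeasurable (by fun_prop)) (Eventually.of_forall fun q => ?_)
      rw [show I * ((-(q.2.1 - q.2.2) : ℝ) : ℂ) * q.1 = ((-(q.2.1 - q.2.2) * q.1 : ℝ) : ℂ) * I by push_cast; ring,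
        norm_exp_ofReal_mul_I]
    refine h3.congr (Eventually.of_forall fun q => ?_)
    simp only [Function.uncurry]
    ring

/-- A Bessel-type inequality for the Fourier transform on `L¹ ∩ L²`. -/
lemma integral_gaussian_normSq_fourier_le {h : ℝ → ℂ} (hh : Integrable h) (hh2 : Integrable fun u => ‖h u‖ ^ 2)
    {b : ℝ} (hb : 0 < b) :
    ‖∫ t : ℝ, cexp (-b * t ^ 2) * ((∫ u : ℝ, cexp (-(t * u : ℝ) * I) * h u) *
        conj (∫ u : ℝ, cexp (-(t * u : ℝ) * I) * h u))‖ ≤ 2 * pi * ∫ u, ‖h u‖ ^ 2 := by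
  rw [integral_gaussian_normSq_fourier hh hb]
  set K : ℝ → ℝ := fun w => √(pi / b) * exp (-w ^ 2 / (4 * b)) with hK
  have hKe : ∀ w, K w = √(pi / b) * exp (-(1 / (4 * b)) * w ^ 2) := fun w => by
    rw [hK]; simp only; congr 2; ring
  have hKi : Integrable K := by
    simp_rw [funext hKe]
    exact (integrable_exp_neg_mul_sq (by positivity)).const_mul _
  have hKint : ∫ w, K w = 2 * pi := by
    simp_rw [hKe]
    rw [integral_const_mul, integral_gaussian, ← sqrt_mul (by positivity)]
    rw [show pi / b * (pi / (1 / (4 * b))) = (2 * pi) ^ 2 by field_simp; ring,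
      sqrt_sq (by positivity)]
  have hK0 : ∀ w, 0 ≤ K w := fun w => by rw [hK]; positivity
  have hKev : ∀ w, K (-w) = K w := fun w => by rw [hK]; simp
  have i2 : Integrable (fun p : ℝ × ℝ => ‖h p.2‖ ^ 2 * K (p.1 - p.2)) :=
    hh2.convolution_integrand (ContinuousLinearMap.mul ℝ ℝ) hKi
  have i1 : Integrable (fun p : ℝ × ℝ => ‖h p.1‖ ^ 2 * K (p.1 - p.2)) := by
    refine i2.swap.congr (Eventually.of_forall fun p => ?_)
    simp only [Function.comp, Prod.fst_swap, Prod.snd_swap]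
    rw [← hKev, neg_sub]
  have v2 : ∫ p : ℝ × ℝ, ‖h p.2‖ ^ 2 * K (p.1 - p.2) = 2 * pi * ∫ u, ‖h u‖ ^ 2 := by
    have := integral_convolution (μ := volume) (ν := volume) (ContinuousLinearMap.mul ℝ ℝ) hh2 hKi
    rw [hKint] at this
    simp only [ContinuousLinearMap.mul_apply'] at this
    rw [mul_comm (2 * pi), ← this, Measure.volume_eq_prod, integral_prod _ i2]
    rfl
  have v1 : ∫ p : ℝ × ℝ, ‖h p.1‖ ^ 2 * K (p.1 - p.2) = 2 * pi * ∫ u, ‖h u‖ ^ 2 := by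
    rw [← v2, Measure.volume_eq_prod, ← integral_prod_swap]
    refine integral_congr_ae (Eventually.of_forall fun p => ?_)
    simp only [Prod.fst_swap, Prod.snd_swap]
    rw [← hKev, neg_sub]
  calc _ ≤ ∫ p : ℝ × ℝ, (1 / 2 * (‖h p.1‖ ^ 2 * K (p.1 - p.2)) + 1 / 2 * (‖h p.2‖ ^ 2 * K (p.1 - p.2))) := by
        refine norm_integral_le_of_norm_le ((i1.const_mul _).add (i2.const_mul _)) (Eventually.of_forall fun p => ?_)
        rw [norm_mul, norm_mul, norm_conj, Complex.norm_of_nonneg (hK0 _)]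
        have := mul_nonneg (hK0 (p.1 - p.2)) (sq_nonneg (‖h p.1‖ - ‖h p.2‖))
        change K (p.1 - p.2) * _ ≤ _
        nlinarith
    _ = 2 * pi * ∫ u, ‖h u‖ ^ 2 := by
        rw [integral_add (i1.const_mul _) (i2.const_mul _), integral_const_mul, integral_const_mul, v1, v2]
        ring

lemma integral_normSq_fourier_le {h : ℝ → ℂ} (hh : Integrable h) (hh2 : Integrable fun u => ‖h u‖ ^ 2)
    {T : ℝ} (hT : 0 < T) :
    ∫ t in T..2 * T, ‖∫ u : ℝ, cexp (-(t * u : ℝ) * I) * h u‖ ^ 2 ≤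
      exp 4 * (2 * pi * ∫ u, ‖h u‖ ^ 2) := by
  set H : ℝ → ℂ := fun t => ∫ u : ℝ, cexp (-(t * u : ℝ) * I) * h u
  have hHc : Continuous H := by
    refine continuous_of_dominated (bound := fun u => ‖h u‖) (fun t => (integrable_exp_mul_I hh t).aestronglyMeasurable)
      (fun t => Eventually.of_forall fun u => ?_) hh.norm (Eventually.of_forall fun u => by fun_prop)
    rw [norm_mul, ← ofReal_neg, norm_exp_ofReal_mul_I, one_mul]
  have hHb : ∀ t, ‖H t‖ ≤ ∫ u, ‖h u‖ := fun t => by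
    refine norm_integral_le_of_norm_le hh.norm (Eventually.of_forall fun u => ?_)
    rw [norm_mul, ← ofReal_neg, norm_exp_ofReal_mul_I, one_mul]
  set b : ℝ := 1 / T ^ 2 with hb
  have hb0 : 0 < b := by positivity
  have hgi : Integrable fun t : ℝ => exp (-b * t ^ 2) * ‖H t‖ ^ 2 := by
    refine (integrable_exp_neg_mul_sq hb0).mul_bdd (c := (∫ u, ‖h u‖) ^ 2) (by fun_prop)
      (Eventually.of_forall fun t => ?_)
    rw [norm_pow, norm_norm]
    exact pow_le_pow_left₀ (norm_nonneg _) (hHb t) 2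
  have hmain := integral_gaussian_normSq_fourier_le hh hh2 hb0
  have e : ∫ t : ℝ, cexp (-b * t ^ 2) * (H t * conj (H t)) =
      ((∫ t : ℝ, exp (-b * t ^ 2) * ‖H t‖ ^ 2 : ℝ) : ℂ) := by
    rw [← integral_complex_ofReal]
    refine integral_congr_ae (Eventually.of_forall fun t => ?_)
    simp only
    rw [mul_conj, normSq_eq_norm_sq]
    push_cast
    rfl
  rw [e, Complex.norm_of_nonneg (integral_nonneg fun t => by positivity)] at hmain
  refine le_trans ?_ (mul_le_mul_of_nonneg_left hmain (exp_pos 4).le)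
  rw [intervalIntegral.integral_of_le (by linarith), ← integral_const_mul]
  refine (setIntegral_mono_on ((hHc.norm.pow 2).integrableOn_Ioc) ((hgi.const_mul _).integrableOn)
    measurableSet_Ioc fun t ht => ?_).trans
    (setIntegral_le_integral (hgi.const_mul _) (Eventually.of_forall fun t => by
      change (0 : ℝ) ≤ exp 4 * (exp (-b * t ^ 2) * ‖H t‖ ^ 2)
      positivity))
  rw [← mul_assoc, ← exp_add]
  refine le_mul_of_one_le_left (sq_nonneg ‖H t‖) (Real.one_le_exp ?_)
  have h2 : t ^ 2 ≤ 4 * T ^ 2 := by nlinarith [ht.1, ht.2]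
  have h3 : b * t ^ 2 ≤ 4 := by
    rw [hb, one_div, inv_mul_le_iff₀ (by positivity)]; linarith
  linarith

/-- The square of the Jacobi theta function, on the right half-plane. -/
noncomputable def thetaSq (z : ℂ) : ℂ := jacobiTheta (I * z) ^ 2

lemma hasSum_thetaSq_gaussianInt {z : ℂ} (hz : 0 < z.re) :
    HasSum (fun w : GaussianInt => cexp (-(pi * w.norm.natAbs * z))) (thetaSq z) := by
  have him : 0 < (I * z).im := by simpa using hz
  have h1 : HasSum (fun n : ℤ => cexp (-(pi * n ^ 2 * z))) (jacobiTheta (I * z)) := by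
    have := hasSum_jacobiTheta₂_term 0 him
    rw [← jacobiTheta_eq_jacobiTheta₂] at this
    refine this.congr_fun fun n => ?_
    rw [jacobiTheta₂_term]
    congr 1
    linear_combination (pi * (n : ℂ) ^ 2 * z) * (-I_sq)
  have h2 := summable_mul_of_summable_norm h1.summable.norm h1.summable.norm
  have h3 := h1.mul h1 h2
  rw [thetaSq, sq]
  let e : GaussianInt ≃ ℤ × ℤ := ⟨fun w => (w.re, w.im), fun q => ⟨q.1, q.2⟩, fun _ => rfl, fun _ => rfl⟩
  have h4 := (e.hasSum_iff).mpr h3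
  refine h4.congr_fun fun w => ?_
  have hn : ((w.norm.natAbs : ℕ) : ℂ) = (w.re : ℂ) ^ 2 + (w.im : ℂ) ^ 2 := by
    have h5 : ((w.norm.natAbs : ℕ) : ℤ) = w.re ^ 2 + w.im ^ 2 := by
      rw [Int.natAbs_of_nonneg (GaussianInt.norm_nonneg w), Zsqrtd.norm_def]; ring
    have h6 := congrArg (fun k : ℤ => (k : ℂ)) h5
    simp only [Int.cast_natCast] at h6
    rw [h6]; push_cast; ring
  simp only [Function.comp, e, Equiv.coe_fn_mk]
  rw [← Complex.exp_add, hn]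
  congr 1; ring

lemma normSet_eq_natAbs (n : ℕ) : GaussianInt.normSet n = {w | w.norm.natAbs = n} := by
  ext w
  simp only [GaussianInt.normSet, mem_ofPred_eq]
  have := GaussianInt.norm_nonneg w
  omega

lemma hasSum_thetaSq {z : ℂ} (hz : 0 < z.re) :
    HasSum (fun n : ℕ => (4 * rr (n + 1) : ℂ) * cexp (-(pi * (n + 1 : ℕ) * z))) (thetaSq z - 1) := by
  have h1 := (Equiv.sigmaFiberEquiv fun w : GaussianInt => w.norm.natAbs).hasSum_iff.mpr (hasSum_thetaSq_gaussianInt hz)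
  have h2 : HasSum (fun n : ℕ => ((GaussianInt.normSet n).ncard : ℂ) * cexp (-(pi * n * z))) (thetaSq z) := by
    refine h1.sigma fun n => ?_
    have hfin : Finite {w : GaussianInt // w.norm.natAbs = n} := by
      have := GaussianInt.finite_normSet n
      rw [normSet_eq_natAbs] at this
      exact this
    have := Fintype.ofFinite {w : GaussianInt // w.norm.natAbs = n}
    have hc : (GaussianInt.normSet n).ncard = Fintype.card {w : GaussianInt // w.norm.natAbs = n} := by
      rw [normSet_eq_natAbs, ← Nat.card_eq_fintype_card]; rfl
    rw [hc]
    have h5 : ∀ w : {w : GaussianInt // w.norm.natAbs = n},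
        cexp (-(pi * (w.1.norm.natAbs : ℕ) * z)) = cexp (-(pi * n * z)) := fun w => by rw [w.2]
    have h6 := hasSum_fintype fun w : {w : GaussianInt // w.norm.natAbs = n} =>
      cexp (-(pi * (w.1.norm.natAbs : ℕ) * z))
    rw [sum_congr rfl fun w _ => h5 w, sum_const, nsmul_eq_mul, Finset.card_univ] at h6
    exact h6
  have h3 := (hasSum_nat_add_iff' 1).mpr h2
  have h0 : (GaussianInt.normSet (0 : ℕ)).ncard = 1 := by
    have : GaussianInt.normSet (0 : ℕ) = {0} := by
      ext w; simp [GaussianInt.normSet, GaussianInt.norm_eq_zero]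
    rw [this, Set.ncard_singleton]
  rw [Finset.sum_range_one, h0] at h3
  simp only [Nat.cast_one, Nat.cast_zero, mul_zero, zero_mul, neg_zero, exp_zero, mul_one] at h3
  refine h3.congr_fun fun n => ?_
  have := GaussianInt.ncard_normSet (n + 1) n.succ_ne_zero
  rw [show ((GaussianInt.normSet ((n + 1 : ℕ) : ℤ)).ncard : ℂ) = (((GaussianInt.normSet ((n + 1 : ℕ) : ℤ)).ncard : ℤ) : ℂ)
    by norm_cast, this]
  push_cast; ring

lemma thetaSq_inv {z : ℂ} (hz : 0 < z.re) : thetaSq z⁻¹ = z * thetaSq z := by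
  have hz0 : z ≠ 0 := by rintro rfl; simp at hz
  set τ : UpperHalfPlane := ⟨I * z, by simpa using hz⟩
  have h := jacobiTheta_S_smul τ
  have hc : (τ : ℂ) = I * z := rfl
  rw [UpperHalfPlane.modular_S_smul] at h
  have h2 : ((UpperHalfPlane.mk (-(τ : ℂ))⁻¹ τ.im_inv_neg_coe_pos : UpperHalfPlane) : ℂ) = I * z⁻¹ := by
    change (-(τ : ℂ))⁻¹ = _
    rw [hc, ← mul_neg, mul_inv, inv_I]; field_simp
  rw [h2, hc, ← mul_assoc, neg_mul, I_mul_I, neg_neg, one_mul] at h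
  rw [thetaSq, h, mul_pow, thetaSq, ← cpow_nat_mul]
  norm_num

lemma continuousAt_thetaSq {z : ℂ} (hz : 0 < z.re) : ContinuousAt thetaSq z := by
  have him : 0 < (I * z).im := by simpa using hz
  exact (ContinuousAt.comp (f := fun z => I * z) (x := z) (continuousAt_jacobiTheta him) (by fun_prop)).pow 2

/-- The real series `∑ rr n exp (- π n x)`. -/
noncomputable def rrExp (x : ℝ) : ℝ := ∑' n : ℕ, (rr (n + 1) : ℝ) * exp (-(pi * (n + 1 : ℕ) * x))

lemma rr_real_nonneg (n : ℕ) : (0 : ℝ) ≤ rr n := by exact_mod_cast rr_nonneg n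

lemma summable_rrExp {x : ℝ} (hx : 0 < x) :
    Summable fun n : ℕ => (rr (n + 1) : ℝ) * exp (-(pi * (n + 1 : ℕ) * x)) := by
  have h := ((hasSum_thetaSq (z := x) (by simpa using hx)).summable.norm).div_const 4
  refine h.congr fun n => ?_
  rw [norm_mul, norm_exp, norm_mul, norm_ofNat, norm_intCast, abs_of_nonneg (rr_real_nonneg _)]
  simp only [neg_re]
  rw [show ((pi : ℂ) * ((n + 1 : ℕ) : ℂ) * x).re = pi * (n + 1 : ℕ) * x by norm_cast]
  ring

lemma norm_rr_term (n : ℕ) (z : ℂ) : ‖(4 * rr (n + 1) : ℂ) * cexp (-(pi * (n + 1 : ℕ) * z))‖ =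
    4 * ((rr (n + 1) : ℝ) * exp (-(pi * (n + 1 : ℕ) * z.re))) := by
  rw [norm_mul, norm_exp, norm_mul, norm_ofNat, norm_intCast, abs_of_nonneg (rr_real_nonneg _)]
  simp only [neg_re]
  rw [show (pi : ℂ) * ((n + 1 : ℕ) : ℂ) * z = ((pi * (n + 1 : ℕ) : ℝ) : ℂ) * z by push_cast; ring,
    re_ofReal_mul]
  ring

lemma norm_thetaSq_sub_one_le {z : ℂ} (hz : 0 < z.re) : ‖thetaSq z - 1‖ ≤ 4 * rrExp z.re := by
  rw [← (hasSum_thetaSq hz).tsum_eq, rrExp, ← tsum_mul_left]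
  exact tsum_of_norm_bounded ((summable_rrExp hz).mul_left 4).hasSum fun n => (norm_rr_term n z).le

lemma thetaSq_real {x : ℝ} (hx : 0 < x) : thetaSq x = ((1 + 4 * rrExp x : ℝ) : ℂ) := by
  have h := (hasSum_thetaSq (z := x) (by simpa using hx)).tsum_eq
  rw [eq_sub_iff_add_eq] at h
  rw [← h, rrExp, ← tsum_mul_left]
  push_cast
  rw [add_comm]
  congr 1
  refine tsum_congr fun n => ?_
  ring

lemma rrExp_nonneg (x : ℝ) : 0 ≤ rrExp x := tsum_nonneg fun _ => mul_nonneg (rr_real_nonneg _) (exp_pos _).le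

lemma rrExp_le_exp_mul {x y : ℝ} (hx : 0 < x) (hxy : x ≤ y) : rrExp y ≤ exp (-(pi * (y - x))) * rrExp x := by
  rw [rrExp, rrExp, ← tsum_mul_left]
  refine Summable.tsum_le_tsum (fun n => ?_) (summable_rrExp (hx.trans_le hxy)) ((summable_rrExp hx).mul_left _)
  rw [mul_left_comm, ← exp_add]
  refine mul_le_mul_of_nonneg_left (exp_le_exp.mpr ?_) (rr_real_nonneg _)
  have h1 : 0 ≤ pi * (n : ℝ) * (y - x) := mul_nonneg (by positivity) (by linarith)
  push_cast
  nlinarith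

lemma rrExp_le : ∃ C : ℝ, 0 < C ∧ ∀ x : ℝ, 0 < x → rrExp x ≤ C / x := by
  refine ⟨1 + 4 * rrExp 1, by linarith [rrExp_nonneg 1], fun x hx => ?_⟩
  have h1 := rrExp_nonneg 1
  rcases le_total x 1 with h | h
  · have hx1 : 1 ≤ x⁻¹ := (one_le_inv₀ hx).mpr h
    have h2 := thetaSq_inv (z := x) (by simpa using hx)
    rw [← ofReal_inv, thetaSq_real hx, thetaSq_real (inv_pos.mpr hx)] at h2
    have h3 : 1 + 4 * rrExp x⁻¹ = x * (1 + 4 * rrExp x) := by exact_mod_cast h2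
    have h4 : rrExp x⁻¹ ≤ rrExp 1 := (rrExp_le_exp_mul one_pos hx1).trans
      (mul_le_of_le_one_left h1 (Real.exp_le_one_iff.mpr (by
        have := mul_nonneg pi_pos.le (sub_nonneg.mpr hx1); linarith)))
    rw [le_div_iff₀ hx]
    nlinarith [rrExp_nonneg x]
  · refine (rrExp_le_exp_mul one_pos h).trans ?_
    rw [le_div_iff₀ hx]
    have h2 : exp (-(pi * (x - 1))) * x ≤ 1 := by
      have h5 : x ≤ exp (x - 1) := by linarith [add_one_le_exp (x - 1)]
      calc exp (-(pi * (x - 1))) * x ≤ exp (-(pi * (x - 1))) * exp (x - 1) := by gcongr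
        _ ≤ 1 := by
          rw [← exp_add, Real.exp_le_one_iff]
          nlinarith [pi_gt_three]
    nlinarith

lemma integrableOn_rpow_mul_exp_neg {σ b : ℝ} (hσ : 0 < σ) (hb : 0 < b) :
    IntegrableOn (fun y : ℝ => y ^ (σ - 1) * exp (-(b * y))) (Ioi 0) := by
  have := integrableOn_rpow_mul_exp_neg_mul_rpow (p := 1) (s := σ - 1) (b := b) (by linarith) one_pos hb
  simpa [neg_mul] using this

/-- The Gamma integral with a complex rate of positive real part. -/
lemma integral_cpow_mul_cexp_neg_mul {s r : ℂ} (hs : 0 < s.re) (hr : 0 < r.re) :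
    ∫ y in Ioi (0 : ℝ), (y : ℂ) ^ (s - 1) * cexp (-(r * y)) = (1 / r) ^ s * Gamma s := by
  set U : Set ℂ := {z | 0 < z.re}
  have hU : IsOpen U := isOpen_lt continuous_const continuous_re
  set I : ℂ → ℂ := fun r => ∫ y in Ioi (0 : ℝ), (y : ℂ) ^ (s - 1) * cexp (-(r * y))
  have hc : ∀ r : ℂ, ∀ a : ℂ, ContinuousOn (fun y : ℝ => (y : ℂ) ^ a * cexp (-(r * y))) (Ioi 0) := fun r a => by
    refine ContinuousOn.mul (fun y hy => ?_) (by fun_prop)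
    exact (continuousAt_ofReal_cpow_const y a (Or.inr (ne_of_gt hy))).continuousWithinAt
  have hn : ∀ r a : ℂ, ∀ y ∈ Ioi (0 : ℝ), ‖(y : ℂ) ^ a * cexp (-(r * y))‖ =
      y ^ a.re * exp (-(r.re * y)) := fun r a y hy => by
    rw [norm_mul, norm_cpow_eq_rpow_re_of_pos hy, norm_exp]
    simp
  have hI : DifferentiableOn ℂ I U := fun r hr => by
    have hr : 0 < r.re := hr
    refine DifferentiableAt.differentiableWithinAt ?_
    refine (hasDerivAt_integral_of_dominated_loc_of_deriv_le (s := {z : ℂ | r.re / 2 < z.re})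
      (F' := fun z y => -((y : ℂ) ^ s * cexp (-(z * y))))
      (bound := fun y => y ^ s.re * exp (-(r.re / 2 * y))) ?_ ?_ ?_ ?_ ?_ ?_ ?_).2.differentiableAt
    · exact (isOpen_lt continuous_const continuous_re).mem_nhds (by change r.re / 2 < r.re; linarith)
    · exact Filter.Eventually.of_forall fun z => (hc z (s - 1)).aestronglyMeasurable measurableSet_Ioi
    · refine Integrable.mono' (integrableOn_rpow_mul_exp_neg hs hr)
        ((hc r (s - 1)).aestronglyMeasurable measurableSet_Ioi) ?_
      filter_upwards [ae_restrict_mem measurableSet_Ioi] with y hy using (hn r (s - 1) y hy).le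
    · exact (hc r s).neg.aestronglyMeasurable measurableSet_Ioi
    · filter_upwards [ae_restrict_mem measurableSet_Ioi] with y hy z hz
      have hy' : 0 < y := hy
      have hz : r.re / 2 < z.re := hz
      rw [norm_neg, hn z s y hy]
      gcongr
    · have := integrableOn_rpow_mul_exp_neg (σ := s.re + 1) (b := r.re / 2) (by linarith) (by linarith)
      simpa [IntegrableOn] using this
    · filter_upwards [ae_restrict_mem measurableSet_Ioi] with y hy z hz
      have hy' : (y : ℂ) ≠ 0 := by exact_mod_cast (ne_of_gt hy)
      have : HasDerivAt (fun z : ℂ => (y : ℂ) ^ (s - 1) * cexp (-(z * y)))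
          ((y : ℂ) ^ (s - 1) * (cexp (-(z * y)) * (-(1 * y)))) z :=
        ((((hasDerivAt_id z).mul_const (y : ℂ)).neg).cexp).const_mul _
      refine this.congr_deriv ?_
      rw [cpow_sub _ _ hy', cpow_one]
      field_simp
  have hJ : DifferentiableOn ℂ (fun r : ℂ => (1 / r) ^ s * Gamma s) U := fun r hr => by
    have hr : 0 < r.re := hr
    have h0 : r ≠ 0 := by rintro rfl; simp at hr
    have h1 : 1 / r ∈ slitPlane := by
      rw [one_div]; left; rw [inv_re]; exact div_pos hr (normSq_pos.mpr h0)
    have : DifferentiableAt ℂ (fun r : ℂ => 1 / r) r := by fun_prop (disch := exact h0)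
    exact ((this.cpow_const h1).mul_const _).differentiableWithinAt
  refine (hI.analyticOnNhd hU).eqOn_of_preconnected_of_frequently_eq (hJ.analyticOnNhd hU)
    (convex_halfSpace_re_gt 0).isPreconnected (z₀ := 1) (by simp [U]) ?_ hr
  have ht : Tendsto (fun n : ℕ => ((1 + 1 / ((n : ℝ) + 1) : ℝ) : ℂ)) atTop (𝓝[≠] 1) := by
    refine tendsto_nhdsWithin_iff.mpr ⟨?_, Filter.Eventually.of_forall fun n => ?_⟩
    · have := (tendsto_one_div_add_atTop_nhds_zero_nat (𝕜 := ℝ)).const_add 1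
      simpa [Function.comp_def] using (continuous_ofReal.tendsto _).comp this
    · have : (1 + 1 / ((n : ℝ) + 1) : ℝ) ≠ 1 := by
        have : 0 < 1 / ((n : ℝ) + 1) := by positivity
        linarith
      simpa using (by exact_mod_cast this : ((1 + 1 / ((n : ℝ) + 1) : ℝ) : ℂ) ≠ 1)
  refine ht.frequently (Filter.Frequently.of_forall fun n => ?_)
  exact integral_cpow_mul_exp_neg_mul_Ioi hs (by positivity)

lemma rr_lseriesHasSum {s : ℂ} (hs : 1 < s.re) : LSeriesHasSum (fun n => (rr n : ℂ)) s (zK s) := by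
  have h1 : LSeriesHasSum 1 s (riemannZeta s) := LSeriesHasSum_one hs
  have h2 : LSeriesHasSum (fun n => chiC n) s (LL s) := by
    rw [LL, DirichletCharacter.LFunction_eq_LSeries _ hs]
    exact (DirichletCharacter.LSeriesSummable_of_one_lt_re chiC hs).LSeriesHasSum
  have h3 := h1.convolution h2
  have e : (fun n => (rr n : ℂ)) = LSeries.convolution 1 (fun n => chiC n) := by
    rw [LSeries.convolution_def]
    funext n
    rw [rr, ArithmeticFunction.mul_apply]
    push_cast
    refine sum_congr rfl fun p hp => ?_
    have h0 : p.1 ≠ 0 := (Nat.pos_of_mem_divisors (Nat.fst_mem_divisors_of_mem_antidiagonal hp)).ne'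
    simp [ArithmeticFunction.natCoe_apply, ArithmeticFunction.zeta_apply, h0, chiArith_apply, chiC_apply]
  rw [e]
  exact h3

lemma rr_hasSum {s : ℂ} (hs : 1 < s.re) : HasSum (fun n : ℕ => (rr (n + 1) : ℂ) * ((n + 1 : ℕ) : ℂ) ^ (-s)) (zK s) := by
  have h := (hasSum_nat_add_iff' 1).mpr (rr_lseriesHasSum hs)
  simp only [Finset.sum_range_one, LSeries.term_zero, sub_zero] at h
  refine h.congr_fun fun n => ?_
  rw [LSeries.term_of_ne_zero n.succ_ne_zero, cpow_neg, div_eq_mul_inv]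

lemma ofReal_mul_cpow {x : ℝ} (hx : 0 < x) {w : ℂ} (hw : w ≠ 0) (s : ℂ) :
    ((x : ℂ) * w) ^ s = (x : ℂ) ^ s * w ^ s := by
  have hx' : (x : ℂ) ≠ 0 := by exact_mod_cast hx.ne'
  rw [cpow_def_of_ne_zero (mul_ne_zero hx' hw), cpow_def_of_ne_zero hx',
    cpow_def_of_ne_zero hw, log_ofReal_mul hx hw, ← Complex.exp_add, ofReal_log hx.le]
  ring_nf

lemma thetaSq_sub_one_isBigO {z : ℂ} (hz : 0 < z.re) (r : ℝ) :
    (fun y : ℝ => thetaSq (y * z) - 1) =O[atTop] fun y => y ^ r := by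
  have h1 : (fun y : ℝ => thetaSq (y * z) - 1) =O[atTop] fun y : ℝ => exp (-(pi * z.re) * y) := by
    refine IsBigO.of_bound (4 * (exp (pi * z.re) * rrExp z.re)) ?_
    filter_upwards [eventually_ge_atTop 1] with y hy
    have e : (y * z : ℂ).re = y * z.re := re_ofReal_mul y z
    have hle : z.re ≤ y * z.re := le_mul_of_one_le_left hz.le hy
    refine (norm_thetaSq_sub_one_le (by rw [e]; positivity)).trans ?_
    rw [e, norm_of_nonneg (exp_pos _).le, mul_assoc]
    refine mul_le_mul_of_nonneg_left ((rrExp_le_exp_mul hz hle).trans (le_of_eq ?_)) (by norm_num)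
    rw [mul_right_comm, ← exp_add]
    congr 2; ring
  exact h1.trans (isLittleO_exp_neg_mul_rpow_atTop (mul_pos pi_pos hz) r).isBigO

lemma continuousOn_thetaSq_mul {z : ℂ} (hz : 0 < z.re) :
    ContinuousOn (fun y : ℝ => thetaSq (y * z)) (Ioi 0) := fun y hy => by
  have e : 0 < (y * z : ℂ).re := by rw [re_ofReal_mul]; exact mul_pos hy hz
  exact (ContinuousAt.comp (g := thetaSq) (f := fun y : ℝ => (y : ℂ) * z) (continuousAt_thetaSq e)
    (by fun_prop)).continuousWithinAt

lemma inv_re_pos {z : ℂ} (hz : 0 < z.re) : 0 < z⁻¹.re := by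
  rw [inv_re]
  exact div_pos hz (normSq_pos.mpr (by rintro rfl; simp at hz))

/-- The functional-equation pair attached to `thetaSq` along the ray through `z`. -/
noncomputable def thetaPair (z : ℂ) (hz : 0 < z.re) : WeakFEPair ℂ where
  f y := thetaSq (y * z)
  g y := thetaSq (y * z⁻¹)
  k := 1
  ε := z⁻¹
  f₀ := 1
  g₀ := 1
  hf_int := (continuousOn_thetaSq_mul hz).locallyIntegrableOn measurableSet_Ioi
  hg_int := (continuousOn_thetaSq_mul (inv_re_pos hz)).locallyIntegrableOn measurableSet_Ioi
  hk := one_pos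
  hε := inv_ne_zero (by rintro rfl; simp at hz)
  h_feq x hx := by
    have hx : 0 < x := hx
    have hz0 : z ≠ 0 := by rintro rfl; simp at hz
    have h := thetaSq_inv (z := x * z⁻¹) (by
      rw [re_ofReal_mul]; exact mul_pos hx (inv_re_pos hz))
    rw [mul_inv, inv_inv] at h
    push_cast
    rw [one_div, h, rpow_one, smul_eq_mul]
    ring
  hf_top := thetaSq_sub_one_isBigO hz
  hg_top := thetaSq_sub_one_isBigO (inv_re_pos hz)

lemma mellin_thetaSq {z : ℂ} (hz : 0 < z.re) {s : ℂ} (hs : 1 < s.re) :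
    mellin (fun y : ℝ => thetaSq (y * z) - 1) s = 4 * (pi : ℂ) ^ (-s) * z⁻¹ ^ s * Gamma s * zK s := by
  have hs0 : 0 < s.re := by linarith
  have hz0 : z ≠ 0 := by rintro rfl; simp at hz
  set F : ℕ → ℝ → ℂ := fun n y => (y : ℂ) ^ (s - 1) * ((4 * rr (n + 1) : ℂ) * cexp (-(pi * (n + 1 : ℕ) * (y * z))))
    with hF
  have hnorm : ∀ n, ∀ y ∈ Ioi (0 : ℝ), ‖F n y‖ =
      4 * (rr (n + 1) : ℝ) * (y ^ (s.re - 1) * exp (-(pi * (n + 1 : ℕ) * z.re * y))) := fun n y hy => by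
    rw [hF]; simp only
    rw [norm_mul, norm_rr_term, re_ofReal_mul, norm_cpow_eq_rpow_re_of_pos hy, sub_re,
      one_re]
    ring_nf
  have hint : ∀ n : ℕ, IntegrableOn (fun y : ℝ => y ^ (s.re - 1) * exp (-(pi * (n + 1 : ℕ) * z.re * y)))
      (Ioi 0) := fun n => by
    have hb : 0 < pi * (n + 1 : ℕ) * z.re := by positivity
    have := integrableOn_rpow_mul_exp_neg_mul_rpow (p := 1) (s := s.re - 1) (b := pi * (n + 1 : ℕ) * z.re)
      (by linarith) one_pos hb
    simpa [neg_mul] using this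
  have hFc : ∀ n, ContinuousOn (F n) (Ioi 0) := fun n => by
    refine ContinuousOn.mul (fun y hy => ?_) (by fun_prop)
    exact (continuousAt_ofReal_cpow_const y (s - 1) (Or.inr (ne_of_gt hy))).continuousWithinAt
  have hFi : ∀ n, IntegrableOn (F n) (Ioi 0) := fun n => by
    refine Integrable.mono' ((hint n).const_mul (4 * (rr (n + 1) : ℝ)))
      ((hFc n).aestronglyMeasurable measurableSet_Ioi) ?_
    filter_upwards [ae_restrict_mem measurableSet_Ioi] with y hy using (hnorm n y hy).le
  have hval : ∀ n : ℕ, ∫ y in Ioi (0 : ℝ), F n y =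
      4 * (pi : ℂ) ^ (-s) * z⁻¹ ^ s * Gamma s * ((rr (n + 1) : ℂ) * ((n + 1 : ℕ) : ℂ) ^ (-s)) := fun n => by
    have hr : 0 < (pi * (n + 1 : ℕ) * z : ℂ).re := by
      have : (pi * (n + 1 : ℕ) * z : ℂ) = ((pi * (n + 1 : ℕ) : ℝ) : ℂ) * z := by push_cast; ring
      rw [this, re_ofReal_mul]; positivity
    have h := integral_cpow_mul_cexp_neg_mul hs0 hr
    have e : ∀ y : ℝ, F n y = (4 * rr (n + 1) : ℂ) *
        ((y : ℂ) ^ (s - 1) * cexp (-(pi * (n + 1 : ℕ) * z * y))) := fun y => by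
      simp only [hF]; ring_nf
    simp_rw [e]
    rw [integral_const_mul, h]
    have hpn : (1 / (pi * (n + 1 : ℕ) * z) : ℂ) = ((pi⁻¹ : ℝ) : ℂ) * ((((n + 1 : ℕ) : ℝ)⁻¹ : ℝ) * z⁻¹) := by
      push_cast; rw [one_div, mul_inv, mul_inv]; ring
    have hn : (0 : ℝ) < ((n + 1 : ℕ) : ℝ)⁻¹ := by positivity
    have hinv : ∀ x : ℝ, 0 < x → ((x⁻¹ : ℝ) : ℂ) ^ s = (x : ℂ) ^ (-s) := fun x hx => by
      rw [cpow_neg, ofReal_inv, inv_cpow _ _ (by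
        rw [arg_ofReal_of_nonneg hx.le]; exact pi_pos.ne)]
    rw [hpn, ofReal_mul_cpow (by positivity) (mul_ne_zero (by exact_mod_cast hn.ne') (inv_ne_zero hz0)),
      ofReal_mul_cpow hn (inv_ne_zero hz0), hinv _ pi_pos, hinv _ (by positivity)]
    push_cast
    ring
  have hnval : ∀ n : ℕ, ∫ y in Ioi (0 : ℝ), ‖F n y‖ =
      4 * (pi * z.re) ^ (-s.re) * Real.Gamma s.re * ‖(rr (n + 1) : ℂ) * ((n + 1 : ℕ) : ℂ) ^ (-s)‖ := fun n => by
    have hb : 0 < pi * (n + 1 : ℕ) * z.re := by positivity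
    rw [setIntegral_congr_fun measurableSet_Ioi (hnorm n), integral_const_mul,
      Real.integral_rpow_mul_exp_neg_mul_Ioi hs0 hb, norm_mul, norm_intCast, abs_of_nonneg (rr_real_nonneg _),
      norm_natCast_cpow_of_pos (by positivity), one_div, Real.inv_rpow hb.le, ← rpow_neg hb.le,
      show pi * (n + 1 : ℕ) * z.re = pi * z.re * (n + 1 : ℕ) by ring,
      mul_rpow (by positivity) (by positivity), neg_re]
    ring
  have hsum := hasSum_integral_of_summable_integral_norm hFi (by
    simp_rw [hnval]
    exact (rr_hasSum hs).summable.norm.mul_left _)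
  simp_rw [hval] at hsum
  have h2 := hsum.unique ((rr_hasSum hs).mul_left _)
  rw [← h2, mellin]
  refine setIntegral_congr_fun measurableSet_Ioi fun y hy => ?_
  have hy0 : 0 < (y * z : ℂ).re := by rw [re_ofReal_mul]; exact mul_pos hy hz
  simp only [smul_eq_mul]
  rw [← (hasSum_thetaSq hy0).tsum_eq, ← tsum_mul_left]

lemma thetaPair_lambda_zero {z : ℂ} (hz : 0 < z.re) {s : ℂ} (hs : 0 < s.re) :
    (s - 1) * (thetaPair z hz).Λ₀ s =
      4 * (pi : ℂ) ^ (-s) * z⁻¹ ^ s * Gamma s * (zz s * LL s) + ((s - 1) / s - z⁻¹) := by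
  have hz0 : z ≠ 0 := by rintro rfl; simp at hz
  have hpi : (pi : ℂ) ≠ 0 := by exact_mod_cast pi_ne_zero
  refine eqOn_halfDisk (f := fun s => (s - 1) * (thetaPair z hz).Λ₀ s) (R := ‖s‖ + 3)
    (g := fun s => 4 * (pi : ℂ) ^ (-s) * z⁻¹ ^ s * Gamma s * (zz s * LL s) + ((s - 1) / s - z⁻¹))
    (by have := norm_nonneg s; linarith) ?_ ?_ ?_ (mem_halfDisk hs)
  · exact (((differentiable_id.sub_const 1).mul (thetaPair z hz).differentiable_Λ₀)).differentiableOn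
  · intro w hw
    have hw0 : 0 < w.re := hw.1
    have hwne : w ≠ 0 := by rintro rfl; simp at hw0
    refine DifferentiableAt.differentiableWithinAt ?_
    have h1 : DifferentiableAt ℂ (fun w : ℂ => (pi : ℂ) ^ (-w)) w :=
      (differentiableAt_id.neg).const_cpow (Or.inl hpi)
    have h2 : DifferentiableAt ℂ (fun w : ℂ => z⁻¹ ^ w) w := differentiableAt_id.const_cpow (Or.inl (inv_ne_zero hz0))
    have h3 : DifferentiableAt ℂ Gamma w := differentiableAt_Gamma w fun m hm => by
      rw [hm] at hw0; simp at hw0; linarith [Nat.cast_nonneg (α := ℝ) m]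
    have h4 := zz_differentiable w
    have h5 := LL_differentiable w
    have h6 : DifferentiableAt ℂ (fun w : ℂ => (w - 1) / w - z⁻¹) w := by fun_prop (disch := exact hwne)
    exact ((((h1.const_mul 4).mul h2).mul h3).mul (h4.mul h5)).add h6
  · intro w hw
    have hw0 : w ≠ 0 := by rintro rfl; simp at hw; linarith
    have hw1 : w ≠ 1 := by rintro rfl; simp at hw
    have h := ((thetaPair z hz).hasMellin (s := w) hw).2
    have e : mellin (fun y => (thetaPair z hz).f y - (thetaPair z hz).f₀) w =
      mellin (fun y : ℝ => thetaSq (y * z) - 1) w := rfl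
    rw [e, mellin_thetaSq hz hw] at h
    have h1w : (1 - w) ≠ 0 := sub_ne_zero.mpr hw1.symm
    rw [WeakFEPair.Λ₀_eq, ← h, zz_of_ne hw1, zK]
    have hk : ((thetaPair z hz).k : ℂ) = 1 := by simp [thetaPair]
    have hf : (thetaPair z hz).f₀ = 1 := rfl
    have hg : (thetaPair z hz).g₀ = 1 := rfl
    have he : (thetaPair z hz).ε = z⁻¹ := rfl
    rw [hk, hf, hg, he, smul_eq_mul, smul_eq_mul]
    field_simp
    ring

lemma norm_Gamma_zK_le {φ : ℝ} (hφ : |φ| < pi / 2) (hz : 0 < (cexp (φ * I)).re) {σ t : ℝ} (hσ : 0 < σ) (ht : 1 ≤ t) :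
    4 * pi ^ (-σ) * exp (φ * t) * ‖Gamma (σ + t * I)‖ * ‖zK (σ + t * I)‖ ≤
      ‖(thetaPair (cexp (φ * I)) hz).Λ₀ (σ + t * I)‖ + 2 := by
  set z := cexp (φ * I)
  set s : ℂ := σ + t * I
  have hsre : s.re = σ := by simp [s]
  have hsim : s.im = t := by simp [s]
  have h := thetaPair_lambda_zero hz (s := s) (by rw [hsre]; exact hσ)
  have hs1 : s - 1 ≠ 0 := fun h => by
    have : (s - 1).im = 0 := by rw [h]; simp
    simp [hsim] at this; linarith
  have hs0 : s ≠ 0 := fun h => by rw [h] at hsim; simp at hsim; linarith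
  have hzn : ‖z‖ = 1 := by simp [z, norm_exp_ofReal_mul_I]
  have e1 : ‖z⁻¹ ^ s‖ = exp (φ * t) := by
    have : z⁻¹ = cexp (-(φ * I)) := by rw [Complex.exp_neg]
    have hab := abs_lt.mp hφ
    rw [this, cpow_def_of_ne_zero (exp_ne_zero _), log_exp, norm_exp]
    · congr 1; simp [s]
    · simp; linarith [pi_pos]
    · simp; linarith [pi_pos]
  have e2 : 4 * (pi : ℂ) ^ (-s) * z⁻¹ ^ s * Gamma s * zK s =
      (thetaPair z hz).Λ₀ s - 1 / s + z⁻¹ / (s - 1) := by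
    rw [zz_of_ne (sub_ne_zero.mp hs1)] at h
    have : (s - 1) * (4 * (pi : ℂ) ^ (-s) * z⁻¹ ^ s * Gamma s * zK s) =
        (s - 1) * ((thetaPair z hz).Λ₀ s - 1 / s + z⁻¹ / (s - 1)) := by
      rw [mul_add, mul_sub, h, zK, mul_div_cancel₀ _ hs1]
      field_simp
      ring
    exact mul_left_cancel₀ hs1 this
  have e3 : ‖4 * (pi : ℂ) ^ (-s) * z⁻¹ ^ s * Gamma s * zK s‖ =
      4 * pi ^ (-σ) * exp (φ * t) * ‖Gamma s‖ * ‖zK s‖ := by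
    rw [norm_mul, norm_mul, norm_mul, norm_mul, e1, norm_cpow_eq_rpow_re_of_pos pi_pos]
    simp [hsre]
  rw [← e3, e2]
  have n1 : ‖1 / s‖ ≤ 1 := by
    rw [norm_div, norm_one, div_le_one (norm_pos_iff.mpr hs0)]
    have := abs_im_le_norm s
    rw [hsim] at this
    exact ht.trans ((le_abs_self t).trans this)
  have n2 : ‖z⁻¹ / (s - 1)‖ ≤ 1 := by
    rw [norm_div, norm_inv, hzn, inv_one, div_le_one (norm_pos_iff.mpr hs1)]
    have := abs_im_le_norm (s - 1)
    rw [sub_im, hsim, one_im, sub_zero] at this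
    exact ht.trans ((le_abs_self t).trans this)
  calc _ ≤ ‖(thetaPair z hz).Λ₀ s - 1 / s‖ + ‖z⁻¹ / (s - 1)‖ := norm_add_le _ _
    _ ≤ ‖(thetaPair z hz).Λ₀ s‖ + ‖1 / s‖ + ‖z⁻¹ / (s - 1)‖ := by gcongr; exact norm_sub_le _ _
    _ ≤ _ := by linarith

lemma norm_Gamma_mul_le {α σ : ℝ} (hα : 0 < α) (hασ : α ≤ σ) (t : ℝ) :
    ‖Gamma (α + t * I)‖ * Real.Gamma σ ≤ ‖Gamma (σ + t * I)‖ * Real.Gamma α := by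
  have hσ : 0 < σ := hα.trans_le hασ
  have l1 := (GammaSeq_tendsto_Gamma (α + t * I)).norm.mul (Real.GammaSeq_tendsto_Gamma σ)
  have l2 := (GammaSeq_tendsto_Gamma (σ + t * I)).norm.mul (Real.GammaSeq_tendsto_Gamma α)
  refine le_of_tendsto_of_tendsto l1 l2 ?_
  filter_upwards [eventually_gt_atTop 0] with n hn
  have e : ∀ β : ℝ, 0 < β → ‖GammaSeq (β + t * I) n‖ =
      (n : ℝ) ^ β * n.factorial / ∏ j ∈ range (n + 1), ‖(β + t * I + j : ℂ)‖ := fun β hβ => by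
    rw [GammaSeq, norm_div, norm_mul, norm_prod, norm_natCast_cpow_of_pos hn, Complex.norm_natCast]
    simp
  have hpos : ∀ β : ℝ, 0 < β → ∀ j : ℕ, 0 < ‖(β + t * I + j : ℂ)‖ := fun β hβ j => by
    refine norm_pos_iff.mpr fun h => ?_
    have : (β + t * I + j : ℂ).re = 0 := by rw [h]; simp
    simp at this
    linarith [Nat.cast_nonneg (α := ℝ) j]
  rw [e α hα, e σ hσ, Real.GammaSeq, Real.GammaSeq, div_mul_div_comm, div_mul_div_comm, mul_comm ((n : ℝ) ^ σ * _)]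
  have p1 : 0 < (∏ j ∈ range (n + 1), ‖(σ + t * I + j : ℂ)‖) * ∏ j ∈ range (n + 1), (α + (j : ℝ)) :=
    mul_pos (Finset.prod_pos fun j _ => hpos σ hσ j) (Finset.prod_pos fun j _ => by positivity)
  refine div_le_div_of_nonneg_left (by positivity) p1 ?_
  rw [← Finset.prod_mul_distrib, ← Finset.prod_mul_distrib]
  refine Finset.prod_le_prod (fun j _ => by have := hpos σ hσ j; positivity) fun j _ => ?_
  have nn : ∀ β : ℝ, ‖(β + t * I + j : ℂ)‖ = √((β + j) ^ 2 + t ^ 2) := fun β => by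
    rw [show (β + t * I + j : ℂ) = ((β + j : ℝ) : ℂ) + t * I by push_cast; ring, norm_add_mul_I]
  rw [nn, nn]
  refine abs_le_of_sq_le_sq' ?_ (by positivity) |>.2
  rw [mul_pow, mul_pow, Real.sq_sqrt (by positivity), Real.sq_sqrt (by positivity)]
  have h2 : (α + j) ^ 2 ≤ (σ + j) ^ 2 := by gcongr
  nlinarith [mul_le_mul_of_nonneg_right h2 (sq_nonneg t)]

lemma norm_Gamma_half_ge {t : ℝ} (ht : 0 ≤ t) :
    exp (-(pi / 2 * t)) ≤ ‖Gamma ((1 / 2 : ℝ) + t * I)‖ := by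
  have h := Gamma_mul_Gamma_one_sub ((1 / 2 : ℝ) + t * I)
  have e1 : (1 - ((1 / 2 : ℝ) + t * I) : ℂ) = conj ((1 / 2 : ℝ) + t * I) := by
    rw [map_add, map_mul, conj_ofReal, conj_ofReal, conj_I]; push_cast; ring
  rw [e1, Gamma_conj, mul_conj, normSq_eq_norm_sq] at h
  have e2 : (pi : ℂ) * ((1 / 2 : ℝ) + t * I) = (pi * t : ℝ) * I + pi / 2 := by push_cast; ring
  rw [e2, sin_add_pi_div_two, cos_mul_I, ← ofReal_cosh, ← ofReal_div] at h
  have h' : ‖Gamma ((1 / 2 : ℝ) + t * I)‖ ^ 2 = pi / Real.cosh (pi * t) := by exact_mod_cast h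
  have hc : Real.cosh (pi * t) ≤ exp (pi * t) := by
    rw [Real.cosh_eq]
    have : exp (-(pi * t)) ≤ exp (pi * t) := by
      gcongr; have := pi_pos; nlinarith [mul_nonneg this.le ht]
    linarith
  refine abs_le_of_sq_le_sq' ?_ (norm_nonneg _) |>.2
  rw [h', ← exp_nat_mul, le_div_iff₀ (Real.cosh_pos _)]
  calc _ ≤ exp ((2 : ℕ) * -(pi / 2 * t)) * exp (pi * t) := by gcongr
    _ = 1 := by rw [← exp_add]; norm_num; ring
    _ ≤ _ := by linarith [pi_gt_three]

lemma norm_Gamma_ge : ∃ c : ℝ, 0 < c ∧ ∀ σ t : ℝ, 1 / 2 ≤ σ → σ ≤ 1 → 0 ≤ t →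
    c * exp (-(pi / 2 * t)) ≤ ‖Gamma (σ + t * I)‖ := by
  have hcont : ContinuousOn Real.Gamma (Set.Icc (1 / 2) 1) := fun x hx => by
    refine (Real.differentiableAt_Gamma fun m hm => ?_).continuousAt.continuousWithinAt
    have := hx.1
    linarith [Nat.cast_nonneg (α := ℝ) m]
  obtain ⟨x, hx, hmin⟩ := isCompact_Icc.exists_isMinOn (Set.nonempty_Icc.mpr (by norm_num)) hcont
  have hx0 : 0 < Real.Gamma x := Real.Gamma_pos_of_pos (by linarith [hx.1])
  have hh : 0 < Real.Gamma (1 / 2) := Real.Gamma_pos_of_pos (by norm_num)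
  refine ⟨Real.Gamma x / Real.Gamma (1 / 2), div_pos hx0 hh, fun σ t h1 h2 ht => ?_⟩
  rw [div_mul_eq_mul_div, div_le_iff₀ hh]
  refine le_trans ?_ (norm_Gamma_mul_le (by norm_num) h1 t)
  rw [mul_comm]
  exact mul_le_mul (norm_Gamma_half_ge ht) (hmin ⟨h1, h2⟩) hx0.le (norm_nonneg _)

lemma rr_sq_prime_pow_le {p : ℕ} (hp : p.Prime) (k : ℕ) : rr (p ^ k) ^ 2 ≤ (rr * rr) (p ^ k) := by
  have hd : (rr * rr) (p ^ k) = ∑ i ∈ range (k + 1), rr (p ^ i) * rr (p ^ (k - i)) := by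
    rw [ArithmeticFunction.mul_apply, Nat.sum_divisorsAntidiagonal (fun a b => rr a * rr b),
      Nat.divisors_prime_pow hp, Finset.sum_map]
    refine sum_congr rfl fun i hi => ?_
    rw [Function.Embedding.coeFn_mk, Nat.pow_div (by simpa [Nat.lt_succ_iff] using hi) hp.pos]
  have h0 : rr (p ^ k) ≤ (rr * rr) (p ^ k) := by
    rw [hd]
    calc rr (p ^ k) = rr (p ^ 0) * rr (p ^ (k - 0)) := by simp [rr_one]
      _ ≤ _ := Finset.single_le_sum (f := fun i => rr (p ^ i) * rr (p ^ (k - i)))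
        (fun i _ => mul_nonneg (rr_nonneg _) (rr_nonneg _)) (by simp)
  rcases ZMod.isQuadratic_χ₄ (p : ZMod 4) with h | h | h
  · have : rr (p ^ k) = 1 := by rw [rr_prime_pow hp, h, Finset.sum_range_succ']; simp
    rw [this] at h0 ⊢; simpa using h0
  · have e : ∀ i : ℕ, rr (p ^ i) = (i : ℤ) + 1 := fun i => by rw [rr_prime_pow hp, h]; simp
    rw [hd]
    calc rr (p ^ k) ^ 2 = ∑ i ∈ range (k + 1), ((k : ℤ) + 1) := by rw [e]; simp; ring
      _ ≤ _ := sum_le_sum fun i hi => by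
        have hi : i ≤ k := by simpa [Nat.lt_succ_iff] using hi
        rw [e, e]; push_cast [hi]
        have : (0 : ℤ) ≤ i * (k - i) := mul_nonneg (by positivity) (by rw [sub_nonneg]; exact_mod_cast hi)
        nlinarith
  · have : rr (p ^ k) ^ 2 = rr (p ^ k) := by
      rw [rr_prime_pow hp, h, neg_one_geom_sum]; split_ifs <;> norm_num
    rw [this]; exact h0

lemma rr_sq_le (n : ℕ) : rr n ^ 2 ≤ (rr * rr) n := by
  rcases eq_or_ne n 0 with rfl | hn
  · simp
  rw [rr_isMultiplicative.multiplicative_factorization _ hn,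
    (rr_isMultiplicative.mul rr_isMultiplicative).multiplicative_factorization _ hn, Finsupp.prod, Finsupp.prod,
    ← Finset.prod_pow]
  refine Finset.prod_le_prod (fun p _ => sq_nonneg _) fun p hp => rr_sq_prime_pow_le ?_ _
  exact Nat.prime_of_mem_primeFactors (by simpa using hp)

lemma sum_rr_sq_mul_le {f : ℕ → ℝ} (hf : ∀ n, 0 ≤ f n) (N : ℕ) :
    ∑ n ∈ Ioc 0 N, (rr n : ℝ) ^ 2 * f n ≤
      ∑ a ∈ Ioc 0 N, (rr a : ℝ) * ∑ b ∈ Ioc 0 N, (rr b : ℝ) * f (a * b) := by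
  set P := Ioc 0 N ×ˢ Ioc 0 N
  have hF : ∀ x : ℕ × ℕ, 0 ≤ (rr x.1 : ℝ) * rr x.2 * f (x.1 * x.2) := fun x =>
    mul_nonneg (mul_nonneg (rr_real_nonneg _) (rr_real_nonneg _)) (hf _)
  calc _ ≤ ∑ n ∈ Ioc 0 N, ∑ x ∈ P with x.1 * x.2 = n, (rr x.1 : ℝ) * rr x.2 * f (x.1 * x.2) := by
        refine sum_le_sum fun n hn => ?_
        have hn := mem_Ioc.mp hn
        have hset : (P.filter fun x => x.1 * x.2 = n) = n.divisorsAntidiagonal := by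
          ext ⟨a, b⟩
          simp only [P, mem_filter, Finset.mem_product, mem_Ioc, Nat.mem_divisorsAntidiagonal]
          refine ⟨fun h => ⟨h.2, by omega⟩, fun h => ⟨?_, h.1⟩⟩
          have ha : a ≠ 0 := by rintro rfl; simp at h; omega
          have hb : b ≠ 0 := by rintro rfl; simp at h; omega
          have h1 : a ≤ n := Nat.le_of_dvd hn.1 ⟨b, h.1.symm⟩
          have h2 : b ≤ n := Nat.le_of_dvd hn.1 ⟨a, by rw [mul_comm, h.1]⟩
          omega
        rw [hset]
        have : (rr n : ℝ) ^ 2 ≤ ∑ x ∈ n.divisorsAntidiagonal, (rr x.1 : ℝ) * rr x.2 := by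
          have := rr_sq_le n
          rw [ArithmeticFunction.mul_apply] at this
          exact_mod_cast this
        calc _ ≤ (∑ x ∈ n.divisorsAntidiagonal, (rr x.1 : ℝ) * rr x.2) * f n :=
              mul_le_mul_of_nonneg_right this (hf n)
          _ = _ := by
              rw [Finset.sum_mul]
              refine sum_congr rfl fun x hx => ?_
              rw [(Nat.mem_divisorsAntidiagonal.mp hx).1]
    _ ≤ ∑ x ∈ P, (rr x.1 : ℝ) * rr x.2 * f (x.1 * x.2) := by
        rw [Finset.sum_fiberwise_eq_sum_filter]
        exact Finset.sum_le_sum_of_subset_of_nonneg (Finset.filter_subset _ _) fun x _ _ => hF x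
    _ = _ := by
        rw [Finset.sum_product]
        refine sum_congr rfl fun a _ => ?_
        rw [mul_sum]
        exact sum_congr rfl fun b _ => by ring

lemma sum_Ioc_zero_eq_sum_range (f : ℕ → ℝ) (N : ℕ) :
    ∑ n ∈ Ioc 0 N, f n = ∑ n ∈ range N, f (n + 1) := by
  induction N with
  | zero => simp
  | succ N ih => rw [Finset.sum_Ioc_succ_top (Nat.zero_le _), ih, sum_range_succ]

lemma sum_rr_rpow_le : ∃ C : ℝ, 0 < C ∧ ∀ ε : ℝ, 0 < ε → ε ≤ 1 → ∀ N : ℕ,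
    ∑ n ∈ Ioc 0 N, (rr n : ℝ) * (n : ℝ) ^ (-(1 + ε)) ≤ C / ε := by
  obtain ⟨C, hC, h⟩ := exists_bound_zz_LL
  refine ⟨C * C, by positivity, fun ε h0 h1 N => ?_⟩
  have hs := (rr_hasSum (s := ((1 + ε : ℝ) : ℂ)) (by simpa using h0))
  have hre := hasSum_re hs
  have e : ∀ n : ℕ, ((rr (n + 1) : ℂ) * ((n + 1 : ℕ) : ℂ) ^ (-((1 + ε : ℝ) : ℂ))).re =
      (rr (n + 1) : ℝ) * ((n + 1 : ℕ) : ℝ) ^ (-(1 + ε)) := fun n => by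
    rw [← ofReal_natCast, ← ofReal_neg, ← ofReal_cpow (by positivity), ← ofReal_intCast,
      ← ofReal_mul, ofReal_re]
  simp_rw [e] at hre
  rw [sum_Ioc_zero_eq_sum_range]
  refine (sum_le_hasSum _ (fun n _ => mul_nonneg (rr_real_nonneg _) (by positivity)) hre).trans ?_
  refine (re_le_norm _).trans ?_
  have hne : ((1 + ε : ℝ) : ℂ) ≠ 1 := by
    intro h; have : (1 + ε : ℝ) = 1 := by exact_mod_cast h
    linarith
  have hz : zK ((1 + ε : ℝ) : ℂ) = zz (1 + ε) * LL (1 + ε) / ε := by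
    have hε : (ε : ℂ) ≠ 0 := by exact_mod_cast h0.ne'
    push_cast at hne ⊢
    rw [zz_of_ne hne, zK, eq_div_iff hε]; ring
  rw [hz, norm_div, norm_mul, Complex.norm_of_nonneg h0.le]
  have := h ε h0.le h1
  gcongr
  · exact this.1
  · exact this.2

lemma rpow_le_exp {x ε : ℝ} (hx : 0 < x) (h0 : 0 ≤ ε) (h1 : ε ≤ 1) : x ^ ε ≤ exp x := by
  rw [rpow_def_of_pos hx]
  refine exp_le_exp.mpr ?_
  have := Real.log_le_sub_one_of_pos hx
  rcases le_total 0 (log x) with h | h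
  · nlinarith
  · nlinarith

lemma one_lt_log {T : ℝ} (hT : 3 ≤ T) : 1 < log T := by
  rw [Real.lt_log_iff_exp_lt (by linarith)]
  linarith [Real.exp_one_lt_d9]

lemma exp_neg_le_rpow {T c x : ℝ} (hT : 3 ≤ T) (hc : 0 < c) (hc1 : c ≤ 1) (hx : 0 < x) :
    exp (-(c * x / T)) ≤ exp 1 / c * x ^ (-(1 / log T)) := by
  have hl := one_lt_log hT
  have hT0 : 0 < T := by linarith
  set ε := 1 / log T
  have he0 : 0 ≤ ε := by positivity
  have he1 : ε ≤ 1 := by rw [div_le_one (by linarith)]; exact hl.le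
  have h1 := rpow_le_exp (x := c * x / T) (by positivity) he0 he1
  have h2 : T ^ ε = exp 1 := by
    rw [rpow_def_of_pos hT0, mul_one_div_cancel (by linarith)]
  have h3 : c ≤ c ^ ε := by
    calc c = c ^ (1 : ℝ) := (rpow_one c).symm
      _ ≤ c ^ ε := Real.rpow_le_rpow_of_exponent_ge hc hc1 he1
  rw [div_rpow (by positivity) hT0.le, mul_rpow hc.le hx.le, h2, div_le_iff₀ (exp_pos _)] at h1
  rw [exp_neg, rpow_neg hx.le, inv_le_comm₀ (exp_pos _) (by positivity), mul_inv, inv_div, inv_inv,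
    div_mul_eq_mul_div, div_le_iff₀ (exp_pos _)]
  calc c * x ^ ε ≤ c ^ ε * x ^ ε := by gcongr
    _ ≤ _ := h1

lemma sum_rr_sq_div_le : ∃ C : ℝ, 0 < C ∧ ∀ T : ℝ, 3 ≤ T → ∀ N : ℕ,
    ∑ n ∈ Ioc 0 N, (rr n : ℝ) ^ 2 * (exp (-(n / T)) / n) ≤ C * log T ^ 2 := by
  obtain ⟨C, hC, h⟩ := sum_rr_rpow_le
  refine ⟨exp 1 * C ^ 2, by positivity, fun T hT N => ?_⟩
  have hl := one_lt_log hT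
  set ε := 1 / log T
  have he0 : 0 < ε := by positivity
  have he1 : ε ≤ 1 := by rw [div_le_one (by linarith)]; exact hl.le
  have hS := h ε he0 he1 N
  have e : C / ε = C * log T := by simp [ε]
  rw [e] at hS
  calc _ ≤ ∑ n ∈ Ioc 0 N, (rr n : ℝ) ^ 2 * (exp 1 * (n : ℝ) ^ (-(1 + ε))) := by
        refine sum_le_sum fun n hn => ?_
        have hn : (0 : ℝ) < n := by exact_mod_cast (mem_Ioc.mp hn).1
        refine mul_le_mul_of_nonneg_left ?_ (sq_nonneg _)
        have := exp_neg_le_rpow hT one_pos le_rfl hn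
        rw [one_mul, div_one] at this
        rw [neg_add, rpow_add hn, rpow_neg_one, div_eq_mul_inv, mul_comm (n : ℝ)⁻¹, ← mul_assoc]
        gcongr
    _ ≤ ∑ a ∈ Ioc 0 N, (rr a : ℝ) * ∑ b ∈ Ioc 0 N, (rr b : ℝ) *
          (exp 1 * ((a * b : ℕ) : ℝ) ^ (-(1 + ε))) :=
        sum_rr_sq_mul_le (f := fun n => exp 1 * (n : ℝ) ^ (-(1 + ε))) (fun n => by positivity) N
    _ = exp 1 * (∑ n ∈ Ioc 0 N, (rr n : ℝ) * (n : ℝ) ^ (-(1 + ε))) ^ 2 := by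
        rw [sq, Finset.sum_mul, mul_sum]
        refine sum_congr rfl fun a _ => ?_
        rw [mul_sum, mul_sum, mul_sum]
        refine sum_congr rfl fun b _ => ?_
        push_cast
        rw [mul_rpow (by positivity) (by positivity)]
        ring
    _ ≤ exp 1 * (C * log T) ^ 2 := by
        gcongr
        exact Finset.sum_nonneg fun n _ => mul_nonneg (rr_real_nonneg _) (by positivity)
    _ = _ := by ring

lemma sum_rr_sq_exp_le : ∃ C : ℝ, 0 < C ∧ ∀ T : ℝ, 3 ≤ T → ∀ N : ℕ,
    ∑ n ∈ Ioc 0 N, (rr n : ℝ) ^ 2 * exp (-(n / (2 * T))) ≤ C * (T * log T) := by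
  obtain ⟨C, hC, h⟩ := sum_rr_rpow_le
  obtain ⟨D, hD, hD'⟩ := rrExp_le
  refine ⟨16 * exp 1 * pi * D * C, by positivity, fun T hT N => ?_⟩
  have hl := one_lt_log hT
  set ε := 1 / log T
  have he0 : 0 < ε := by positivity
  have he1 : ε ≤ 1 := by rw [div_le_one (by linarith)]; exact hl.le
  have hS := h ε he0 he1 N
  have e : C / ε = C * log T := by simp [ε]
  rw [e] at hS
  refine (sum_rr_sq_mul_le (f := fun n => exp (-(n / (2 * T)))) (fun n => by positivity) N).trans ?_
  calc _ ≤ ∑ a ∈ Ioc 0 N, (rr a : ℝ) * (16 * exp 1 * pi * D * T * (a : ℝ) ^ (-(1 + ε))) := by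
        refine sum_le_sum fun a ha => mul_le_mul_of_nonneg_left ?_ (rr_real_nonneg _)
        have ha : (0 : ℝ) < a := by exact_mod_cast (mem_Ioc.mp ha).1
        set x : ℝ := a / (2 * pi * T) with hx
        have hx0 : 0 < x := by positivity
        calc _ = ∑ n ∈ range N, (rr (n + 1) : ℝ) * exp (-(pi * (n + 1 : ℕ) * x)) := by
              rw [sum_Ioc_zero_eq_sum_range]
              refine sum_congr rfl fun n _ => ?_
              rw [hx]; congr 3; push_cast; field_simp
          _ ≤ rrExp x := (summable_rrExp hx0).sum_le_tsum _ fun n _ => mul_nonneg (rr_real_nonneg _) (exp_pos _).le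
          _ ≤ exp (-(pi * (x - x / 2))) * rrExp (x / 2) := rrExp_le_exp_mul (by positivity) (by linarith)
          _ ≤ exp (-(pi * (x - x / 2))) * (D / (x / 2)) := by gcongr; exact hD' _ (by positivity)
          _ = exp (-(1 / 4 * a / T)) * (4 * pi * D * T / a) := by
              have e1 : pi * (x - x / 2) = 1 / 4 * a / T := by rw [hx]; field_simp; ring
              have e2 : D / (x / 2) = 4 * pi * D * T / a := by rw [hx]; field_simp; ring
              rw [e1, e2]
          _ ≤ (exp 1 / (1 / 4) * (a : ℝ) ^ (-ε)) * (4 * pi * D * T / a) := by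
              gcongr
              exact exp_neg_le_rpow hT (by norm_num) (by norm_num) ha
          _ = _ := by
              rw [neg_add, rpow_add ha, rpow_neg_one]
              field_simp; ring
    _ = 16 * exp 1 * pi * D * T * ∑ n ∈ Ioc 0 N, (rr n : ℝ) * (n : ℝ) ^ (-(1 + ε)) := by
        rw [mul_sum]; exact sum_congr rfl fun a _ => by ring
    _ ≤ 16 * exp 1 * pi * D * T * (C * log T) := by gcongr
    _ = _ := by ring

lemma sum_tsub_le_tsum {g : ℕ → ℝ} (hg : ∀ k, 0 ≤ g k) (h0 : g 0 = 0) (hs : Summable g) (s : Finset ℕ) (n : ℕ) :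
    ∑ m ∈ s, (g (n - m) + g (m - n)) ≤ 2 * ∑' k, g k := by
  have key : ∀ f : ℕ → ℕ, (∀ a b, f a ≠ 0 → f a = f b → a = b) → ∑ m ∈ s, g (f m) ≤ ∑' k, g k := fun f hf => by
    have e : ∑ m ∈ s, g (f m) = ∑ m ∈ s.filter (fun m => f m ≠ 0), g (f m) := by
      rw [Finset.sum_filter]
      refine sum_congr rfl fun m _ => ?_
      split_ifs with h
      · rfl
      · rw [not_not.mp h, h0]
    rw [e, ← Finset.sum_image (f := g) (g := f) fun a ha b _ hab => hf a b (mem_filter.mp ha).2 hab]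
    exact hs.sum_le_tsum _ fun k _ => hg k
  rw [sum_add_distrib, two_mul]
  exact add_le_add (key _ fun a b => by omega) (key _ fun a b => by omega)

lemma tsum_exp_div_le {T : ℝ} (hT : 3 ≤ T) :
    Summable (fun k : ℕ => exp (-(k / (2 * T))) / k) ∧ ∑' k : ℕ, exp (-(k / (2 * T))) / k ≤ 3 * log T := by
  have hT0 : 0 < T := by linarith
  have hl := one_lt_log hT
  set y : ℝ := 1 / (2 * T)
  have hy0 : 0 < y := by positivity
  have hy1 : y ≤ 1 := by rw [div_le_one (by positivity)]; linarith
  have hx1 : exp (-y) < 1 := by rw [Real.exp_lt_one_iff]; linarith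
  have h := Real.hasSum_pow_div_log_of_abs_lt_one (x := exp (-y)) (by rwa [abs_of_pos (exp_pos _)])
  have h2 : HasSum (fun k : ℕ => exp (-(k / (2 * T))) / k) (-log (1 - exp (-y))) := by
    rw [← hasSum_nat_add_iff' 1]
    simp only [Finset.sum_range_one, Nat.cast_zero, div_zero, sub_zero]
    refine h.congr_fun fun k => ?_
    rw [← exp_nat_mul]
    push_cast
    congr 2
    simp only [y]; ring
  refine ⟨h2.summable, ?_⟩
  rw [h2.tsum_eq]
  have h3 : y / 2 ≤ 1 - exp (-y) := by
    have := add_one_le_exp y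
    have h4 : exp (-y) ≤ 1 / (1 + y) := by
      rw [exp_neg, ← one_div]
      exact one_div_le_one_div_of_le (by linarith) (by linarith)
    have h5 : 1 / (1 + y) ≤ 1 - y / 2 := by
      rw [div_le_iff₀ (by linarith)]; nlinarith
    linarith
  have h6 : log (y / 2) ≤ log (1 - exp (-y)) := log_le_log (by positivity) h3
  have h7 : log (y / 2) = -(2 * log 2 + log T) := by
    rw [show y / 2 = (2 ^ 2 * T)⁻¹ by simp only [y]; field_simp, Real.log_inv, log_mul (by norm_num) hT0.ne',
      log_pow]
    norm_num
  linarith [Real.log_two_lt_d9]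

/-- The kernel bounding `|∫ e^{-(λ_n + conj λ_m) y}|`. -/
noncomputable def thetaKernel (T : ℝ) (n m : ℕ) : ℝ :=
  exp (-((n + m : ℕ) / T)) * ((if n = m then T / n else 0) + 1 / |(n : ℝ) - m|)

lemma thetaKernel_symm (T : ℝ) (n m : ℕ) : thetaKernel T n m = thetaKernel T m n := by
  rw [thetaKernel, thetaKernel, add_comm n m, abs_sub_comm]
  by_cases h : n = m
  · subst h; rfl
  · rw [if_neg h, if_neg (Ne.symm h)]

lemma thetaKernel_nonneg {T : ℝ} (hT : 0 ≤ T) (n m : ℕ) : 0 ≤ thetaKernel T n m := by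
  rw [thetaKernel]; split_ifs <;> positivity

lemma sum_thetaKernel_le {T : ℝ} (hT : 3 ≤ T) (N : ℕ) {n : ℕ} (hn : n ∈ Ioc 0 N) :
    ∑ m ∈ Ioc 0 N, thetaKernel T n m ≤
      T * (exp (-(n / T)) / n) + 6 * log T * exp (-(n / (2 * T))) := by
  have hT0 : 0 < T := by linarith
  have hn0 : (0 : ℝ) < n := by exact_mod_cast (mem_Ioc.mp hn).1
  obtain ⟨hs, hb⟩ := tsum_exp_div_le hT
  set g : ℕ → ℝ := fun k => exp (-(k / (2 * T))) / k with hg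
  have hsum := sum_tsub_le_tsum (g := g) (fun k => by simp only [hg]; positivity) (by simp [hg]) hs (Ioc 0 N) n
  have hterm : ∀ m ∈ Ioc 0 N, thetaKernel T n m ≤
      (if n = m then T * (exp (-(n / T)) / n) else 0) + exp (-(n / (2 * T))) * (g (n - m) + g (m - n)) := by
    intro m _
    rw [thetaKernel, mul_add]
    refine add_le_add ?_ ?_
    · split_ifs with h
      · have : exp (-((n + m : ℕ) / T)) ≤ exp (-(n / T)) := by
          gcongr; linarith [Nat.cast_nonneg (α := ℝ) m]
        calc _ ≤ exp (-(n / T)) * (T / n) := by gcongr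
          _ = _ := by ring
      · simp
    · have hgen : ∀ a b : ℕ, a ≤ b → exp (-((a + b : ℕ) / T)) * (1 / |(b : ℝ) - a|) ≤
          exp (-(a / (2 * T))) * g (b - a) ∧ exp (-((a + b : ℕ) / T)) * (1 / |(b : ℝ) - a|) ≤
          exp (-(b / (2 * T))) * g (b - a) := fun a b hab => by
        have hab' : (a : ℝ) ≤ b := by exact_mod_cast hab
        have e : exp (-((a + b : ℕ) / T)) ≤ exp (-(b / (2 * T))) * exp (-((b - a : ℕ) / (2 * T))) := by
          rw [← exp_add]
          gcongr
          push_cast [hab]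
          rw [← neg_add, neg_le_neg_iff, ← add_div, div_le_div_iff₀ (by positivity) hT0]
          nlinarith
        have e2 : exp (-((a + b : ℕ) / T)) * (1 / |(b : ℝ) - a|) ≤ exp (-(b / (2 * T))) * g (b - a) := by
          calc _ ≤ (exp (-(b / (2 * T))) * exp (-((b - a : ℕ) / (2 * T)))) * (1 / |(b : ℝ) - a|) := by gcongr
            _ = _ := by simp only [hg]; push_cast [hab]; rw [abs_of_nonneg (by linarith)]; ring
        refine ⟨e2.trans ?_, e2⟩
        have : 0 ≤ g (b - a) := by simp only [hg]; positivity
        gcongr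
      have hg0 : g 0 = 0 := by simp [hg]
      rcases le_total n m with h | h
      · rw [Nat.sub_eq_zero_of_le h, hg0, zero_add, abs_sub_comm]
        exact (hgen n m h).1
      · rw [Nat.sub_eq_zero_of_le h, hg0, add_zero, add_comm n m]
        exact (hgen m n h).2
  refine (sum_le_sum hterm).trans ?_
  rw [sum_add_distrib, Finset.sum_ite_eq, if_pos hn, ← mul_sum]
  have : exp (-(n / (2 * T))) * ∑ m ∈ Ioc 0 N, (g (n - m) + g (m - n)) ≤
      exp (-(n / (2 * T))) * (2 * (3 * log T)) := by gcongr; linarith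
  linarith

lemma sum_rr_thetaKernel_le : ∃ C : ℝ, 0 < C ∧ ∀ T : ℝ, 3 ≤ T → ∀ N : ℕ,
    ∑ n ∈ Ioc 0 N, ∑ m ∈ Ioc 0 N, (rr n : ℝ) * rr m * thetaKernel T n m ≤ C * (T * log T ^ 2) := by
  obtain ⟨C₁, hC₁, h₁⟩ := sum_rr_sq_div_le
  obtain ⟨C₂, hC₂, h₂⟩ := sum_rr_sq_exp_le
  refine ⟨C₁ + 6 * C₂, by positivity, fun T hT N => ?_⟩
  have hT0 : 0 < T := by linarith
  have hl := one_lt_log hT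
  set s := Ioc 0 N
  calc _ ≤ ∑ n ∈ s, ∑ m ∈ s, ((rr n : ℝ) ^ 2 * thetaKernel T n m / 2 + (rr m : ℝ) ^ 2 * thetaKernel T m n / 2) := by
        refine sum_le_sum fun n _ => sum_le_sum fun m _ => ?_
        rw [thetaKernel_symm T m n]
        have := thetaKernel_nonneg hT0.le n m
        nlinarith [mul_nonneg (sq_nonneg ((rr n : ℝ) - rr m)) this]
    _ = ∑ n ∈ s, (rr n : ℝ) ^ 2 * ∑ m ∈ s, thetaKernel T n m := by
        simp_rw [sum_add_distrib]
        rw [Finset.sum_comm (f := fun n m => (rr m : ℝ) ^ 2 * thetaKernel T m n / 2), ← sum_add_distrib]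
        refine sum_congr rfl fun n _ => ?_
        rw [mul_sum, ← sum_add_distrib]
        exact sum_congr rfl fun m _ => by ring
    _ ≤ ∑ n ∈ s, (rr n : ℝ) ^ 2 * (T * (exp (-(n / T)) / n) + 6 * log T * exp (-(n / (2 * T)))) := by
        gcongr with n hn
        exact sum_thetaKernel_le hT N hn
    _ = T * ∑ n ∈ s, (rr n : ℝ) ^ 2 * (exp (-(n / T)) / n) +
          6 * log T * ∑ n ∈ s, (rr n : ℝ) ^ 2 * exp (-(n / (2 * T))) := by
        rw [mul_sum, mul_sum, ← sum_add_distrib]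
        exact sum_congr rfl fun n _ => by ring
    _ ≤ T * (C₁ * log T ^ 2) + 6 * log T * (C₂ * (T * log T)) := by
        gcongr
        · exact h₁ T hT N
        · exact h₂ T hT N
    _ = _ := by ring

/-- Partial sums of `thetaSq (y * w) - 1`, weighted by `e^{y / (2 T)}`. -/
noncomputable def thetaPartial (T : ℝ) (w : ℂ) (N : ℕ) (y : ℝ) : ℂ :=
  ∑ n ∈ Ioc 0 N, (4 * rr n : ℂ) * cexp (-(pi * n * w - (1 / (2 * T) : ℝ)) * y)

lemma norm_integral_exp_mul_conj_le {T : ℝ} (hT : 3 ≤ T) {w : ℂ} (hw : 2 / (pi * T) ≤ w.re) (hw' : 1 / pi ≤ |w.im|)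
    {n m : ℕ} (hn : 0 < n) (hm : 0 < m) :
    IntegrableOn (fun y : ℝ => cexp ((-(pi * n * w - (1 / (2 * T) : ℝ)) +
      conj (-(pi * m * w - (1 / (2 * T) : ℝ)))) * y)) (Ioi 1) ∧
    ‖∫ y in Ioi (1 : ℝ), cexp ((-(pi * n * w - (1 / (2 * T) : ℝ)) +
      conj (-(pi * m * w - (1 / (2 * T) : ℝ)))) * y)‖ ≤ thetaKernel T n m := by
  have hpi := pi_pos
  have hn' : (1 : ℝ) ≤ n := by exact_mod_cast hn
  have hm' : (1 : ℝ) ≤ m := by exact_mod_cast hm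
  set μ : ℂ := -(pi * n * w - (1 / (2 * T) : ℝ)) + conj (-(pi * m * w - (1 / (2 * T) : ℝ))) with hμ
  have hre : μ.re = -(pi * (n + m) * w.re - 1 / T) := by
    rw [hμ]
    simp only [map_neg, map_sub, map_mul, conj_ofReal, conj_natCast, add_re, neg_re,
      sub_re, ofReal_re, mul_re, mul_im, ofReal_im, natCast_re,
      natCast_im, conj_re, conj_im]
    field_simp
    ring
  have him : μ.im = -(pi * (n - m) * w.im) := by
    rw [hμ]
    simp only [map_neg, map_sub, map_mul, conj_ofReal, conj_natCast, add_im, neg_im,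
      sub_im, ofReal_re, mul_re, mul_im, ofReal_im, natCast_re,
      natCast_im, conj_re, conj_im]
    ring
  have hre2 : μ.re ≤ -((n + m) / T) := by
    have h1 : 2 * (n + m) / T ≤ pi * (n + m) * w.re := by
      calc 2 * (n + m) / T = pi * (n + m) * (2 / (pi * T)) := by field_simp
        _ ≤ _ := by gcongr
    have h2 : 1 / T ≤ (n + m) / T := by gcongr; linarith
    have h3 : 2 * ((n : ℝ) + m) / T = (n + m) / T + (n + m) / T := by ring
    rw [hre]; linarith
  have hneg : μ.re < 0 := hre2.trans_lt (by rw [neg_lt_zero]; positivity)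
  refine ⟨integrableOn_exp_mul_complex_Ioi hneg 1, ?_⟩
  rw [integral_exp_mul_complex_Ioi hneg 1, norm_div, norm_neg, norm_exp, thetaKernel, div_eq_mul_one_div]
  have h0 : (0 : ℝ) ≤ (if n = m then T / n else 0) := by split_ifs <;> positivity
  refine mul_le_mul ?_ ?_ (by positivity) (exp_pos _).le
  · rw [ofReal_one, mul_one]
    gcongr; push_cast; exact hre2
  · split_ifs with h
    · subst h
      rw [sub_self, abs_zero, div_zero, add_zero]
      have h1 : (n : ℝ) / T ≤ ‖μ‖ := by
        refine le_trans ?_ (abs_re_le_norm μ)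
        rw [abs_of_neg hneg]
        have : (n : ℝ) / T ≤ (n + n) / T := by gcongr; linarith
        linarith
      calc 1 / ‖μ‖ ≤ 1 / (n / T) := one_div_le_one_div_of_le (by positivity) h1
        _ = T / n := by rw [one_div_div]
    · rw [zero_add]
      have h1 : |(n : ℝ) - m| ≤ ‖μ‖ := by
        refine le_trans ?_ (abs_im_le_norm μ)
        rw [him, abs_neg, abs_mul, abs_mul, abs_of_pos hpi]
        have : 1 ≤ pi * |w.im| := by
          rw [div_le_iff₀ hpi] at hw'; linarith
        nlinarith [abs_nonneg ((n : ℝ) - m)]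
      refine one_div_le_one_div_of_le (abs_pos.mpr (sub_ne_zero.mpr ?_)) h1
      exact_mod_cast h

lemma integral_normSq_thetaPartial_le : ∃ C : ℝ, 0 < C ∧ ∀ T : ℝ, 3 ≤ T → ∀ w : ℂ, 2 / (pi * T) ≤ w.re →
    1 / pi ≤ |w.im| → ∀ N : ℕ, IntegrableOn (fun y => ‖thetaPartial T w N y‖ ^ 2) (Ioi 1) ∧
      ∫ y in Ioi (1 : ℝ), ‖thetaPartial T w N y‖ ^ 2 ≤ C * (T * log T ^ 2) := by
  obtain ⟨C, hC, h⟩ := sum_rr_thetaKernel_le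
  refine ⟨16 * C, by positivity, fun T hT w hw hw' N => ?_⟩
  have e : ∀ y : ℝ, ((‖thetaPartial T w N y‖ ^ 2 : ℝ) : ℂ) = ∑ n ∈ Ioc 0 N, ∑ m ∈ Ioc 0 N,
      (16 * rr n * rr m : ℂ) * cexp ((-(pi * n * w - (1 / (2 * T) : ℝ)) +
        conj (-(pi * m * w - (1 / (2 * T) : ℝ)))) * y) := fun y => by
    rw [← normSq_eq_norm_sq, ← mul_conj, thetaPartial, map_sum, Finset.sum_mul]
    refine sum_congr rfl fun n _ => ?_
    rw [mul_sum]
    refine sum_congr rfl fun m _ => ?_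
    have hc : ∀ u : ℂ, conj ((4 * rr m : ℂ) * cexp (u * y)) = 4 * rr m * cexp (conj u * y) := fun u => by
      rw [map_mul, ← exp_conj, map_mul, map_mul, conj_ofReal, map_intCast, conj_ofNat]
    rw [hc, add_mul, Complex.exp_add]
    ring
  have hi : ∀ n ∈ Ioc 0 N, ∀ m ∈ Ioc 0 N, _ := fun n hn m hm =>
    norm_integral_exp_mul_conj_le hT hw hw' (mem_Ioc.mp hn).1 (mem_Ioc.mp hm).1
  have hint : IntegrableOn (fun y => ((‖thetaPartial T w N y‖ ^ 2 : ℝ) : ℂ)) (Ioi 1) := by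
    simp_rw [e]
    exact integrable_finsetSum _ fun n hn => integrable_finsetSum _ fun m hm => (hi n hn m hm).1.const_mul _
  have hint' : IntegrableOn (fun y => ‖thetaPartial T w N y‖ ^ 2) (Ioi 1) := by
    exact (Integrable.re hint).congr (Filter.Eventually.of_forall fun y => ofReal_re _)
  refine ⟨hint', ?_⟩
  have e3 : ((∫ y in Ioi (1 : ℝ), ‖thetaPartial T w N y‖ ^ 2 : ℝ) : ℂ) = ∑ n ∈ Ioc 0 N, ∑ m ∈ Ioc 0 N,
      (16 * rr n * rr m : ℂ) * ∫ y in Ioi (1 : ℝ), cexp ((-(pi * n * w - (1 / (2 * T) : ℝ)) +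
        conj (-(pi * m * w - (1 / (2 * T) : ℝ)))) * y) := by
    rw [← integral_complex_ofReal]
    simp_rw [e]
    rw [integral_finsetSum _ fun n hn => integrable_finsetSum _ fun m hm => (hi n hn m hm).1.const_mul _]
    refine sum_congr rfl fun n hn => ?_
    rw [integral_finsetSum _ fun m hm => (hi n hn m hm).1.const_mul _]
    exact sum_congr rfl fun m hm => integral_const_mul _ _
  have hnn : 0 ≤ ∫ y in Ioi (1 : ℝ), ‖thetaPartial T w N y‖ ^ 2 := integral_nonneg fun y => by positivity
  rw [← abs_of_nonneg hnn, ← norm_eq_abs, ← norm_real, e3]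
  calc _ ≤ ∑ n ∈ Ioc 0 N, ∑ m ∈ Ioc 0 N, 16 * ((rr n : ℝ) * rr m * thetaKernel T n m) := by
        refine norm_sum_le_of_le _ fun n hn => norm_sum_le_of_le _ fun m hm => ?_
        rw [norm_mul, norm_mul, norm_mul, norm_ofNat, norm_intCast, norm_intCast,
          abs_of_nonneg (rr_real_nonneg _), abs_of_nonneg (rr_real_nonneg _), ← mul_assoc, ← mul_assoc]
        have := rr_real_nonneg n
        have := rr_real_nonneg m
        exact mul_le_mul_of_nonneg_left (hi n hn m hm).2 (by positivity)
    _ = 16 * ∑ n ∈ Ioc 0 N, ∑ m ∈ Ioc 0 N, (rr n : ℝ) * rr m * thetaKernel T n m := by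
        simp_rw [mul_sum]
    _ ≤ _ := by linarith [h T hT N]

lemma tendsto_thetaPartial {T : ℝ} {w : ℂ} (hw : 0 < w.re) {y : ℝ} (hy : 0 < y) :
    Tendsto (fun N => thetaPartial T w N y) atTop (𝓝 (exp (y / (2 * T)) * (thetaSq (y * w) - 1))) := by
  have h := (hasSum_thetaSq (z := y * w) (by rw [re_ofReal_mul]; positivity)).tendsto_sum_nat
  have := h.const_mul (exp (y / (2 * T)) : ℂ)
  refine this.congr fun N => ?_
  rw [thetaPartial, mul_sum]
  induction N with
  | zero => simp
  | succ N ih =>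
    rw [Finset.sum_Ioc_succ_top (Nat.zero_le _), sum_range_succ, ih]
    congr 1
    rw [mul_left_comm, ofReal_exp, ← Complex.exp_add]
    congr 2
    push_cast
    ring

/-- Mean square of the theta series on the ray through `w`. -/
lemma integral_normSq_thetaSq_le : ∃ C : ℝ, 0 < C ∧ ∀ T : ℝ, 3 ≤ T → ∀ w : ℂ, 2 / (pi * T) ≤ w.re →
    1 / pi ≤ |w.im| → ∀ a : ℝ, a ≤ 1 → 
      IntegrableOn (fun y : ℝ => y ^ a * ‖thetaSq (y * w) - 1‖ ^ 2) (Ioi 1) ∧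
      ∀ b : ℝ, a ≤ b → 0 ≤ b → b ≤ 1 →
      ∫ y in Ioi (1 : ℝ), y ^ a * ‖thetaSq (y * w) - 1‖ ^ 2 ≤ C * (T ^ (1 + b) * log T ^ 2) := by
  obtain ⟨C, hC, h⟩ := integral_normSq_thetaPartial_le
  refine ⟨C, hC, fun T hT w hw hw' => ?_⟩
  have hT0 : 0 < T := by linarith
  have hw0 : 0 < w.re := lt_of_lt_of_le (by have := pi_pos; positivity) hw
  set G : ℝ → ℝ := fun y => ‖(exp (y / (2 * T)) : ℂ) * (thetaSq (y * w) - 1)‖ ^ 2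
  set B : ℝ := C * (T * log T ^ 2)
  have hB : 0 ≤ B := by positivity
  have hcont : ContinuousOn (fun y : ℝ => thetaSq (y * w) - 1) (Ioi 1) :=
    ((continuousOn_thetaSq_mul hw0).sub continuousOn_const).mono fun y hy =>
      Set.Ioi_subset_Ioi zero_le_one hy
  have hGc : ContinuousOn G (Ioi 1) := by
    refine ContinuousOn.pow (ContinuousOn.norm (ContinuousOn.mul (by fun_prop) hcont)) 2
  have hl : ∫⁻ y in Ioi (1 : ℝ), ENNReal.ofReal (G y) ≤ ENNReal.ofReal B := by
    have h1 : ∫⁻ y in Ioi (1 : ℝ), ENNReal.ofReal (G y) ≤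
        ∫⁻ y in Ioi (1 : ℝ), liminf (fun N => ENNReal.ofReal (‖thetaPartial T w N y‖ ^ 2)) atTop := by
      refine setLIntegral_mono' measurableSet_Ioi fun y hy => le_of_eq ?_
      have := (tendsto_thetaPartial (T := T) hw0 (zero_lt_one.trans hy)).norm.pow 2
      exact ((ENNReal.continuous_ofReal.tendsto _).comp this).liminf_eq.symm
    refine (h1.trans (lintegral_liminf_le' fun N => ?_)).trans ?_
    · exact ((h T hT w hw hw' N).1.aestronglyMeasurable.aemeasurable).ennreal_ofReal
    · refine liminf_le_of_frequently_le' (Filter.Frequently.of_forall fun N => ?_)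
      rw [← ofReal_integral_eq_lintegral_ofReal (h T hT w hw hw' N).1 (Filter.Eventually.of_forall fun y => by positivity)]
      exact ENNReal.ofReal_le_ofReal (h T hT w hw hw' N).2
  have hGi : IntegrableOn G (Ioi 1) := by
    refine ⟨hGc.aestronglyMeasurable measurableSet_Ioi, ?_⟩
    rw [hasFiniteIntegral_iff_ofReal (Filter.Eventually.of_forall fun y => by positivity)]
    exact hl.trans_lt ENNReal.ofReal_lt_top
  have hGB : ∫ y in Ioi (1 : ℝ), G y ≤ B := by
    rw [← ENNReal.ofReal_le_ofReal_iff hB, ofReal_integral_eq_lintegral_ofReal hGi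
      (Filter.Eventually.of_forall fun y => by positivity)]
    exact hl
  have hpt : ∀ a b : ℝ, a ≤ b → 0 ≤ b → b ≤ 1 → ∀ y ∈ Ioi (1 : ℝ),
      y ^ a * ‖thetaSq (y * w) - 1‖ ^ 2 ≤ T ^ b * G y := fun a b hab hb hb1 y hy => by
    have hy : 1 < y := hy
    have hy0 : 0 < y := by linarith
    have h1 : y ^ a ≤ T ^ b * exp (y / T) := by
      calc y ^ a ≤ y ^ b := rpow_le_rpow_of_exponent_le hy.le hab
        _ = T ^ b * (y / T) ^ b := by rw [← mul_rpow hT0.le (by positivity)]; congr 1; field_simp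
        _ ≤ _ := by gcongr; exact rpow_le_exp (by positivity) hb hb1
    have h2 : G y = exp (y / T) * ‖thetaSq (y * w) - 1‖ ^ 2 := by
      simp only [G]
      rw [norm_mul, mul_pow, Complex.norm_of_nonneg (exp_pos _).le, ← exp_nat_mul]
      congr 2; push_cast; field_simp
    rw [h2, ← mul_assoc]
    gcongr
  intro a ha
  have hi : IntegrableOn (fun y : ℝ => y ^ a * ‖thetaSq (y * w) - 1‖ ^ 2) (Ioi 1) := by
    refine Integrable.mono' (hGi.const_mul (T ^ (1 : ℝ))) ?_ ?_
    · refine ContinuousOn.aestronglyMeasurable ?_ measurableSet_Ioi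
      exact ContinuousOn.mul (fun y hy => (Real.continuousAt_rpow_const y a
        (Or.inl (ne_of_gt (zero_lt_one.trans hy)))).continuousWithinAt) ((hcont.norm).pow 2)
    · filter_upwards [ae_restrict_mem measurableSet_Ioi] with y hy
      have hy0 : 0 < y := zero_lt_one.trans hy
      rw [norm_of_nonneg (by positivity)]
      exact hpt a 1 ha zero_le_one le_rfl y hy
  refine ⟨hi, fun b hab hb hb1 => ?_⟩
  calc _ ≤ ∫ y in Ioi (1 : ℝ), T ^ b * G y :=
        setIntegral_mono_on hi (hGi.const_mul _) measurableSet_Ioi (hpt a b hab hb hb1)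
    _ = T ^ b * ∫ y in Ioi (1 : ℝ), G y := integral_const_mul _ _
    _ ≤ T ^ b * B := by gcongr
    _ = _ := by rw [rpow_add hT0, rpow_one]; ring

lemma integral_Ioi_comp_exp (k : ℝ → ℝ) :
    (IntegrableOn k (Ioi 1) ↔ IntegrableOn (fun u => exp u * k (exp u)) (Ioi 0)) ∧
      ∫ y in Ioi 1, k y = ∫ u in Ioi 0, exp u * k (exp u) := by
  have him : exp '' Ioi 0 = Ioi 1 := by
    ext y
    constructor
    · rintro ⟨u, hu, rfl⟩
      exact Real.one_lt_exp_iff.mpr hu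
    · intro hy
      have hy : 1 < y := hy
      exact ⟨log y, log_pos hy, exp_log (by linarith)⟩
  have hd : ∀ u ∈ Ioi (0 : ℝ), HasDerivWithinAt exp (exp u) (Ioi 0) u :=
    fun u _ => (Real.hasDerivAt_exp u).hasDerivWithinAt
  have h1 := integrableOn_image_iff_integrableOn_abs_deriv_smul measurableSet_Ioi hd Real.exp_injective.injOn k
  have h2 := integral_image_eq_integral_abs_deriv_smul measurableSet_Ioi hd Real.exp_injective.injOn k
  simp only [him, abs_of_pos (exp_pos _), smul_eq_mul] at h1 h2
  exact ⟨h1, h2⟩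

lemma integral_eq_of_Ioi {φ : ℝ → ℝ} (h1 : IntegrableOn φ (Ioi 0))
    (h2 : IntegrableOn (fun u => φ (-u)) (Ioi 0)) :
    Integrable φ ∧ ∫ u, φ u = (∫ u in Ioi 0, φ (-u)) + ∫ u in Ioi 0, φ u := by
  have h3 : IntegrableOn φ (Set.Iic 0) := by
    rw [integrableOn_Iic_iff_integrableOn_Iio]
    rw [← (Measure.measurePreserving_neg (volume : Measure ℝ)).integrableOn_comp_preimage
      (Homeomorph.neg ℝ).measurableEmbedding]
    have : (fun x : ℝ => -x) ⁻¹' Set.Iio 0 = Ioi 0 := by ext; simp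
    rw [this]
    exact h2
  refine ⟨?_, ?_⟩
  · rw [← integrableOn_univ, ← Set.Iic_union_Ioi (a := (0 : ℝ))]
    exact h3.union h1
  · rw [integral_comp_neg_Ioi, neg_zero, intervalIntegral.integral_Iic_add_Ioi h3 h1]

lemma integral_normSq_lambda_zero_le : ∃ C : ℝ, 0 < C ∧ ∀ T : ℝ, 3 ≤ T → ∀ z : ℂ, ∀ hz : 0 < z.re, ‖z‖ = 1 →
    2 / (pi * T) ≤ z.re → 1 / pi ≤ |z.im| → ∀ σ : ℝ, 1 / 2 ≤ σ → σ ≤ 1 →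
      ∫ t in T..2 * T, ‖(thetaPair z hz).Λ₀ (σ + t * I)‖ ^ 2 ≤ C * (T ^ (2 * σ) * log T ^ 2) := by
  obtain ⟨C, hC, h⟩ := integral_normSq_thetaSq_le
  refine ⟨exp 4 * (2 * pi * (2 * C)), by have := pi_pos; positivity,
    fun T hT z hz hz1 hre him σ hσ hσ1 => ?_⟩
  set P := thetaPair z hz
  have hzi : z⁻¹ = conj z := by
    rw [inv_def, normSq_eq_norm_sq, hz1]; simp
  have hre' : 2 / (pi * T) ≤ z⁻¹.re := by rw [hzi, conj_re]; exact hre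
  have him' : 1 / pi ≤ |z⁻¹.im| := by rw [hzi, conj_im, abs_neg]; exact him
  obtain ⟨hFi, hF⟩ := h T hT z hre him (2 * σ - 1) (by linarith)
  obtain ⟨hGi, hG⟩ := h T hT z⁻¹ hre' him' (1 - 2 * σ) (by linarith)
  have hF := hF (2 * σ - 1) le_rfl (by linarith) (by linarith)
  have hG := hG (2 * σ - 1) (by linarith) (by linarith) (by linarith)
  set H : ℝ → ℂ := fun u => exp (-σ * u) • P.f_modif (exp (-u)) with hH
  have hpos : ∀ u ∈ Ioi (0 : ℝ), exp u * (exp u ^ (1 - 2 * σ) * ‖thetaSq (exp u * z⁻¹) - 1‖ ^ 2) =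
      ‖H u‖ ^ 2 := fun u hu => by
    have hu1 : 1 < exp u := Real.one_lt_exp_iff.mpr hu
    have h1 := P.hf_modif_FE (exp u) (exp_pos u)
    have h2 : P.g_modif (exp u) = thetaSq (exp u * z⁻¹) - 1 := by
      rw [WeakFEPair.g_modif, Pi.add_apply, Set.indicator_of_mem (Set.mem_Ioi.mpr hu1),
        indicator_of_notMem (Set.notMem_Ioo_of_ge hu1.le), add_zero]
      rfl
    have hε : P.ε = z⁻¹ := rfl
    have hk : P.k = 1 := rfl
    rw [one_div, ← exp_neg, h2, hε, hk, rpow_one] at h1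
    rw [hH]
    simp only
    rw [h1, norm_smul, norm_smul, norm_mul, norm_inv, hz1, norm_of_nonneg (exp_pos _).le,
      Complex.norm_of_nonneg (exp_pos _).le, ← exp_mul, ← mul_assoc, ← mul_assoc, mul_pow, inv_one, one_mul,
      ← exp_add, ← exp_add, ← exp_nat_mul]
    congr 2
    push_cast; ring
  have hneg : ∀ u ∈ Ioi (0 : ℝ), exp u * (exp u ^ (2 * σ - 1) * ‖thetaSq (exp u * z) - 1‖ ^ 2) =
      ‖H (-u)‖ ^ 2 := fun u hu => by
    have hu1 : 1 < exp u := Real.one_lt_exp_iff.mpr hu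
    have h2 : P.f_modif (exp u) = thetaSq (exp u * z) - 1 := by
      rw [WeakFEPair.f_modif, Pi.add_apply, Set.indicator_of_mem (Set.mem_Ioi.mpr hu1),
        indicator_of_notMem (Set.notMem_Ioo_of_ge hu1.le), add_zero]
      rfl
    rw [hH]
    simp only
    rw [neg_neg, h2, norm_smul, norm_of_nonneg (exp_pos _).le,
      ← exp_mul, ← mul_assoc, mul_pow, ← exp_add, ← exp_nat_mul]
    congr 2
    push_cast; ring
  obtain ⟨f1, f2⟩ := integral_Ioi_comp_exp fun y => y ^ (2 * σ - 1) * ‖thetaSq (y * z) - 1‖ ^ 2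
  obtain ⟨g1, g2⟩ := integral_Ioi_comp_exp fun y => y ^ (1 - 2 * σ) * ‖thetaSq (y * z⁻¹) - 1‖ ^ 2
  have i1 : IntegrableOn (fun u => ‖H u‖ ^ 2) (Ioi 0) := (g1.mp hGi).congr_fun hpos measurableSet_Ioi
  have i2 : IntegrableOn (fun u => ‖H (-u)‖ ^ 2) (Ioi 0) := (f1.mp hFi).congr_fun hneg measurableSet_Ioi
  rw [setIntegral_congr_fun measurableSet_Ioi hpos] at g2
  rw [setIntegral_congr_fun measurableSet_Ioi hneg] at f2
  obtain ⟨hi2, he⟩ := integral_eq_of_Ioi i1 i2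
  have hi1 : Integrable H := by
    have hm := (P.isStrongFEPair_toStrongFEPair.hasMellin σ).1
    have him : (fun u : ℝ => exp (-u)) '' Set.univ = Ioi 0 := by
      ext y
      constructor
      · rintro ⟨u, -, rfl⟩
        exact exp_pos _
      · intro hy
        exact ⟨-log y, Set.mem_univ _, by simp only [neg_neg]; exact exp_log hy⟩
    have hd : ∀ u ∈ Set.univ, HasDerivWithinAt (fun u : ℝ => exp (-u)) (-exp (-u)) Set.univ u := fun u _ =>
      ((hasDerivAt_neg u).exp.congr_deriv (by ring)).hasDerivWithinAt
    have hinj : Set.InjOn (fun u : ℝ => exp (-u)) Set.univ := fun u _ v _ huv => neg_injective (Real.exp_injective huv)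
    rw [MellinConvergent, ← him, integrableOn_image_iff_integrableOn_abs_deriv_smul MeasurableSet.univ hd hinj,
      integrableOn_univ] at hm
    refine hm.congr (Filter.Eventually.of_forall fun u => ?_)
    have e : (exp (-u) : ℂ) ^ ((σ : ℂ) - 1) = ((exp (-u) ^ (σ - 1) : ℝ) : ℂ) := by
      rw [ofReal_cpow (exp_pos _).le]; push_cast; rfl
    change |-exp (-u)| • (exp (-u) : ℂ) ^ ((σ : ℂ) - 1) • P.f_modif (exp (-u)) = _
    rw [e, abs_neg, abs_of_pos (exp_pos _), hH, coe_smul, smul_smul, ← exp_mul, ← exp_add]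
    congr 2
    ring
  have hB : ∫ u, ‖H u‖ ^ 2 ≤ 2 * C * (T ^ (2 * σ) * log T ^ 2) := by
    rw [he, ← f2, ← g2]
    rw [show 1 + (2 * σ - 1) = 2 * σ by ring] at hF hG
    linarith
  have hL : ∀ t : ℝ, P.Λ₀ (σ + t * I) = ∫ u : ℝ, cexp (-(t * u : ℝ) * I) * H u := fun t => by
    have hr : (σ + t * I : ℂ).re = σ := by simp
    have hi : (σ + t * I : ℂ).im = t := by simp
    rw [WeakFEPair.Λ₀, mellin_eq_fourier, Real.fourier_real_eq_integral_exp_smul, hr, hi]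
    refine integral_congr_ae (Filter.Eventually.of_forall fun u => ?_)
    simp only [smul_eq_mul, hH]
    congr 3
    have := pi_ne_zero
    rw [← ofReal_neg]
    congr 1
    field_simp
  simp_rw [hL]
  refine (integral_normSq_fourier_le hi1 hi2 (by linarith)).trans ?_
  have := pi_pos
  calc _ ≤ exp 4 * (2 * pi * (2 * C * (T ^ (2 * σ) * log T ^ 2))) := by gcongr
    _ = _ := by ring

lemma continuousOn_zK_line (σ : ℝ) : ContinuousOn (fun t : ℝ => zK (σ + t * I)) (Ioi 0) := by
  intro t ht
  have ht : 0 < t := ht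
  have h1 : (σ + t * I : ℂ) ≠ 1 := fun h => by
    have := congrArg im h
    simp at this; linarith
  have h2 : ContinuousAt zK (σ + t * I) :=
    ((differentiableAt_riemannZeta h1).mul (LL_differentiable _)).continuousAt
  exact (ContinuousAt.comp (f := fun t : ℝ => (σ + t * I : ℂ)) (x := t) h2 (by fun_prop)).continuousWithinAt

/-- Mean square of the Dedekind zeta function of `ℚ(i)` near the critical line. -/
lemma integral_normSq_zK_le : ∃ C : ℝ, 0 < C ∧ ∀ T : ℝ, 3 ≤ T → ∀ σ : ℝ, 1 / 2 ≤ σ → σ ≤ 1 →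
    ∫ t in T..2 * T, ‖zK (σ + t * I)‖ ^ 2 ≤ C * (T ^ (2 * σ) * log T ^ 2) := by
  obtain ⟨C, hC, h⟩ := integral_normSq_lambda_zero_le
  obtain ⟨c, hc, hΓ⟩ := norm_Gamma_ge
  set K : ℝ := pi * exp 2 / (4 * c) with hK
  have hK0 : 0 < K := by positivity
  refine ⟨2 * K ^ 2 * C + 8 * K ^ 2, by positivity, fun T hT σ hσ hσ1 => ?_⟩
  have hT0 : 0 < T := by linarith
  have hT3 : 1 / T ≤ 1 / 3 := one_div_le_one_div_of_le (by norm_num) hT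
  have hT3' : 0 < 1 / T := by positivity
  have hpi3 := pi_gt_three
  set φ : ℝ := pi / 2 - 1 / T with hφ
  set z := cexp (φ * I) with hz
  have hzre : z.re = Real.sin (1 / T) := by
    rw [hz, exp_ofReal_mul_I_re, hφ, Real.cos_pi_div_two_sub]
  have hzim : z.im = cos (1 / T) := by
    rw [hz, exp_ofReal_mul_I_im, hφ, Real.sin_pi_div_two_sub]
  have h1 : 2 / (pi * T) ≤ z.re := by
    rw [hzre]
    refine le_trans (le_of_eq ?_) (Real.mul_le_sin hT3'.le (by linarith))
    field_simp
  have h2 : 1 / pi ≤ |z.im| := by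
    rw [hzim]
    have h3 := Real.one_sub_sq_div_two_le_cos (x := 1 / T)
    have h4 : 1 / pi ≤ 1 / 3 := one_div_le_one_div_of_le (by norm_num) hpi3.le
    have h5 : (1 / T) ^ 2 ≤ (1 / 3) ^ 2 := by gcongr
    exact le_trans (by linarith) (le_abs_self _)
  have hz0 : 0 < z.re := lt_of_lt_of_le (by positivity) h1
  have hΛ := h T hT z hz0 (norm_exp_ofReal_mul_I φ) h1 h2 σ hσ hσ1
  set L : ℝ → ℂ := fun t => (thetaPair z hz0).Λ₀ (σ + t * I)
  have hLc : Continuous L := (thetaPair z hz0).differentiable_Λ₀.continuous.comp (by fun_prop)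
  have hpt : ∀ t ∈ Set.Icc T (2 * T), ‖zK (σ + t * I)‖ ^ 2 ≤ 2 * K ^ 2 * ‖L t‖ ^ 2 + 8 * K ^ 2 := fun t ht => by
    have ha := norm_Gamma_zK_le (φ := φ) (by rw [abs_of_pos (by linarith)]; linarith) hz0 (σ := σ) (t := t)
      (by linarith) (by linarith [ht.1])
    have hb := hΓ σ t hσ hσ1 (by linarith [ht.1])
    have hp : pi⁻¹ ≤ pi ^ (-σ) := by
      rw [← rpow_neg_one]
      exact rpow_le_rpow_of_exponent_le (by linarith) (by linarith)
    have he : exp (-2) ≤ exp (φ * t) * exp (-(pi / 2 * t)) := by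
      rw [← exp_add]
      gcongr
      have : t / T ≤ 2 := by rw [div_le_iff₀ hT0]; exact ht.2
      rw [hφ]
      calc (-2 : ℝ) ≤ -(t / T) := by linarith
        _ = _ := by ring
    have hkey : K⁻¹ * ‖zK (σ + t * I)‖ ≤ ‖L t‖ + 2 := by
      refine le_trans ?_ ha
      have : K⁻¹ ≤ 4 * pi ^ (-σ) * exp (φ * t) * ‖Gamma (σ + t * I)‖ := by
        calc K⁻¹ = 4 * pi⁻¹ * (exp (-2) * c) := by
              rw [hK, exp_neg]; field_simp
          _ ≤ 4 * pi ^ (-σ) * (exp (φ * t) * exp (-(pi / 2 * t)) * c) := by gcongr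
          _ = 4 * pi ^ (-σ) * exp (φ * t) * (c * exp (-(pi / 2 * t))) := by ring
          _ ≤ _ := by gcongr
      gcongr
    rw [inv_mul_le_iff₀ hK0] at hkey
    calc ‖zK (σ + t * I)‖ ^ 2 ≤ (K * (‖L t‖ + 2)) ^ 2 := by gcongr
      _ ≤ _ := by nlinarith [mul_nonneg (sq_nonneg K) (sq_nonneg (‖L t‖ - 2))]
  have hT2 : T ≤ 2 * T := by linarith
  have hi1 : IntervalIntegrable (fun t => ‖L t‖ ^ 2) volume T (2 * T) := (hLc.norm.pow 2).intervalIntegrable _ _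
  have hi2 : IntervalIntegrable (fun t : ℝ => ‖zK (σ + t * I)‖ ^ 2) volume T (2 * T) := by
    refine ContinuousOn.intervalIntegrable ?_
    rw [Set.uIcc_of_le hT2]
    exact ((continuousOn_zK_line σ).norm.pow 2).mono fun t ht => lt_of_lt_of_le hT0 ht.1
  have hlog := one_lt_log hT
  have hTp : T ≤ T ^ (2 * σ) := by
    conv_lhs => rw [← rpow_one T]
    exact rpow_le_rpow_of_exponent_le (by linarith) (by linarith)
  calc _ ≤ ∫ t in T..2 * T, (2 * K ^ 2 * ‖L t‖ ^ 2 + 8 * K ^ 2) :=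
        intervalIntegral.integral_mono_on hT2 hi2 ((hi1.const_mul _).add intervalIntegrable_const) hpt
    _ = 2 * K ^ 2 * (∫ t in T..2 * T, ‖L t‖ ^ 2) + 8 * K ^ 2 * T := by
        rw [intervalIntegral.integral_add (hi1.const_mul _) intervalIntegrable_const, intervalIntegral.integral_const_mul,
          intervalIntegral.integral_const, smul_eq_mul]
        ring
    _ ≤ 2 * K ^ 2 * (C * (T ^ (2 * σ) * log T ^ 2)) + 8 * K ^ 2 * (T ^ (2 * σ) * log T ^ 2) := by
        gcongr
        exact hTp.trans (le_mul_of_one_le_right (by positivity) (one_le_pow₀ hlog.le))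
    _ = _ := by ring

lemma sum_range_sum_range_symm {g : ℕ → ℕ → ℝ} (hg : ∀ k i, g k i = g i k) (N : ℕ) :
    ∑ k ∈ range N, ∑ i ∈ range N, g k i =
      ∑ k ∈ range N, g k k + 2 * ∑ k ∈ range N, ∑ i ∈ range k, g k i := by
  induction N with
  | zero => simp
  | succ N ih =>
    simp only [sum_range_succ _ N, sum_add_distrib]
    rw [ih, sum_congr rfl fun k _ => hg k N]
    ring

lemma sum_range_inv_le (k : ℕ) : ∑ i ∈ range k, 1 / ((i : ℝ) + 1) ≤ 1 + log (k + 1) := by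
  have h := harmonic_le_one_add_log k
  rw [harmonic] at h
  push_cast at h
  simp_rw [one_div]
  refine h.trans ?_
  rcases Nat.eq_zero_or_pos k with rfl | hk
  · simp
  · have : (0 : ℝ) < k := by exact_mod_cast hk
    gcongr
    linarith

lemma sum_range_rpow_neg_le {δ : ℝ} (hδ : 0 < δ) (hδ1 : δ ≤ 1) (N : ℕ) :
    ∑ k ∈ range N, ((k : ℝ) + 1) ^ (-(1 + δ)) ≤ 2 / δ := by
  have h1 : 1 + 1 / δ ≤ 2 / δ := by
    rw [le_div_iff₀ hδ, add_mul, one_div_mul_cancel hδ.ne']; linarith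
  refine le_trans ?_ h1
  rcases Nat.eq_zero_or_pos N with rfl | hN
  · rw [Finset.sum_range_zero]; positivity
  obtain ⟨N, rfl⟩ : ∃ M, N = M + 1 := ⟨N - 1, by omega⟩
  rw [Finset.sum_range_succ']
  have ha : AntitoneOn (fun x : ℝ => x ^ (-(1 + δ))) (Set.Icc 1 (1 + (N : ℝ))) := fun x hx y hy hxy =>
    rpow_le_rpow_of_nonpos (by linarith [hx.1]) hxy (by linarith)
  have h2 := ha.sum_le_integral
  rw [integral_rpow (Or.inr ⟨by linarith, by
    rw [Set.uIcc_of_le (by linarith [Nat.cast_nonneg (α := ℝ) N])]; intro h; linarith [h.1]⟩), Real.one_rpow] at h2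
  have h3 : ∑ k ∈ range N, (((k + 1 : ℕ) : ℝ) + 1) ^ (-(1 + δ)) ≤ 1 / δ := by
    calc _ = ∑ i ∈ range N, (1 + ((i + 1 : ℕ) : ℝ)) ^ (-(1 + δ)) :=
          sum_congr rfl fun i _ => by rw [add_comm]
      _ ≤ _ := h2
      _ = (1 - (1 + (N : ℝ)) ^ (-δ)) / δ := by
          rw [show -(1 + δ) + 1 = -δ by ring, ← neg_sub, neg_div_neg_eq]
      _ ≤ _ := by
          gcongr
          have : 0 ≤ (1 + (N : ℝ)) ^ (-δ) := by positivity
          linarith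
  have h4 : (((0 : ℕ) : ℝ) + 1) ^ (-(1 + δ)) = 1 := by simp
  rw [h4]; linarith

lemma sum_range_inv_mul_sub_le {δ : ℝ} (hδ : 0 < δ) (hδ1 : δ ≤ 1) (k : ℕ) :
    ∑ i ∈ range k, ((i : ℝ) + 1)⁻¹ * (((k : ℝ) + 1) / (k - i)) ≤ 4 / δ * ((k : ℝ) + 1) ^ δ := by
  have e : ∀ i ∈ range k, ((i : ℝ) + 1)⁻¹ * (((k : ℝ) + 1) / (k - i)) =
      1 / ((i : ℝ) + 1) + 1 / (((k - 1 - i : ℕ) : ℝ) + 1) := fun i hi => by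
    have hi : i < k := mem_range.mp hi
    have h2 : (((k - 1 - i : ℕ) : ℝ) + 1) = k - i := by
      have : k - 1 - i + 1 + i = k := by omega
      have h3 : (((k - 1 - i + 1 + i : ℕ)) : ℝ) = k := by rw [this]
      push_cast at h3; linarith
    have h3 : (0 : ℝ) < k - i := sub_pos.mpr (by exact_mod_cast hi)
    rw [h2]
    field_simp
    ring
  rw [sum_congr rfl e, sum_add_distrib, Finset.sum_range_reflect fun j => 1 / ((j : ℝ) + 1)]
  have h := sum_range_inv_le k
  have h1 : log ((k : ℝ) + 1) ≤ ((k : ℝ) + 1) ^ δ / δ := Real.log_le_rpow_div (by positivity) hδ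
  have h2 : 1 ≤ ((k : ℝ) + 1) ^ δ / δ := by
    rw [le_div_iff₀ hδ, one_mul]
    exact hδ1.trans (one_le_rpow (by linarith [Nat.cast_nonneg (α := ℝ) k]) hδ.le)
  calc _ ≤ 4 * (((k : ℝ) + 1) ^ δ / δ) := by linarith
    _ = _ := by ring

lemma one_div_log_sub_log_le {i k : ℕ} (h : i < k) :
    1 / |log ((k : ℝ) + 1) - log ((i : ℝ) + 1)| ≤ ((k : ℝ) + 1) / (k - i) := by
  have h3 : (0 : ℝ) < k - i := sub_pos.mpr (by exact_mod_cast h)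
  have h1 := Real.one_sub_inv_le_log_of_pos (x := ((k : ℝ) + 1) / ((i : ℝ) + 1)) (by positivity)
  rw [log_div (by positivity) (by positivity), inv_div] at h1
  have h2 : 1 - ((i : ℝ) + 1) / (k + 1) = (k - i) / (k + 1) := by field_simp; ring
  rw [h2] at h1
  rw [← one_div_div ((k : ℝ) - i)]
  refine one_div_le_one_div_of_le (by positivity) (h1.trans (le_abs_self _))

lemma norm_integral_cexp_log_le {T : ℝ} {n m : ℝ} (h : n ≠ m) :
    ‖∫ t in T..2 * T, cexp (-(2 * (n - m)) * I * t)‖ ≤ 1 / |n - m| := by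
  have hne : (-(2 * (n - m)) * I : ℂ) ≠ 0 := by
    refine mul_ne_zero (neg_ne_zero.mpr (mul_ne_zero two_ne_zero ?_)) I_ne_zero
    rw [← ofReal_sub]
    exact_mod_cast sub_ne_zero.mpr h
  have hn : ∀ t : ℝ, ‖cexp (-(2 * (n - m)) * I * t)‖ = 1 := fun t => by
    rw [show (-(2 * (n - m)) * I * t : ℂ) = ((-(2 * (n - m)) * t : ℝ) : ℂ) * I by push_cast; ring,
      norm_exp_ofReal_mul_I]
  rw [integral_exp_mul_complex hne, norm_div]
  have h1 : ‖(-(2 * (n - m)) * I : ℂ)‖ = 2 * |n - m| := by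
    rw [norm_mul, norm_neg, norm_mul, norm_I, mul_one, norm_ofNat, ← ofReal_sub,
      norm_real, norm_eq_abs]
  have hpos : 0 < |n - m| := abs_pos.mpr (sub_ne_zero.mpr h)
  rw [h1, div_le_div_iff₀ (by positivity) hpos]
  have := norm_sub_le (cexp (-(2 * (n - m)) * I * (2 * T : ℝ))) (cexp (-(2 * (n - m)) * I * T))
  rw [hn, hn] at this
  nlinarith

/-- A mean value estimate for Dirichlet polynomials whose coefficients are small. -/
lemma integral_normSq_dirichlet_le {a : ℕ → ℂ} {M δ V T : ℝ} (hδ : 0 < δ) (hδ1 : δ ≤ 1) (hV : 1 ≤ V)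
    (hT : 0 ≤ T) (ha : ∀ k, ‖a k‖ ≤ M * ((k : ℝ) + 1) ^ (-(1 + 2 * δ))) (ha0 : ∀ k : ℕ, a k ≠ 0 → V ≤ k + 1) (N : ℕ) :
    ∫ t in T..2 * T, ‖∑ k ∈ range N, a k * cexp (-(2 * log (k + 1)) * I * t)‖ ^ 2 ≤
      M ^ 2 * (2 * T / V + 16 / δ ^ 2) := by
  have hM : 0 ≤ M := by
    have := (norm_nonneg _).trans (ha 0)
    simpa using this
  set E : ℕ → ℕ → ℝ → ℂ := fun k i t =>
    a k * conj (a i) * cexp (-(2 * ((log (k + 1) : ℝ) - (log (i + 1) : ℝ))) * I * t) with hE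
  have e : ∀ t : ℝ, ((‖∑ k ∈ range N, a k * cexp (-(2 * log (k + 1)) * I * t)‖ ^ 2 : ℝ) : ℂ) =
      ∑ k ∈ range N, ∑ i ∈ range N, E k i t := fun t => by
    rw [← normSq_eq_norm_sq, ← mul_conj, map_sum, Finset.sum_mul]
    refine sum_congr rfl fun k _ => ?_
    rw [mul_sum]
    refine sum_congr rfl fun i _ => ?_
    rw [map_mul, ← exp_conj]
    simp only [map_mul, map_neg, conj_ofReal, conj_ofNat, conj_I, hE]
    rw [mul_mul_mul_comm, ← Complex.exp_add]
    congr 2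
    ring
  set κ : ℕ → ℕ → ℝ := fun k i => if k = i then T else 1 / |log ((k : ℝ) + 1) - log ((i : ℝ) + 1)| with hκ
  have hκs : ∀ k i, κ k i = κ i k := fun k i => by
    simp only [hκ]
    rw [abs_sub_comm]
    simp only [eq_comm]
  have hi : ∀ k i, IntervalIntegrable (E k i) volume T (2 * T) := fun k i =>
    Continuous.intervalIntegrable (by simp only [hE]; fun_prop) _ _
  have hi2 : ∀ k, IntervalIntegrable (fun t => ∑ i ∈ range N, E k i t) volume T (2 * T) := fun k =>
    Continuous.intervalIntegrable (by simp only [hE]; fun_prop) _ _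
  have hb : ∀ k i, ‖∫ t in T..2 * T, E k i t‖ ≤ ‖a k‖ * ‖a i‖ * κ k i := fun k i => by
    simp only [hE]
    rw [intervalIntegral.integral_const_mul, norm_mul, norm_mul, RCLike.norm_conj]
    refine mul_le_mul_of_nonneg_left ?_ (by positivity)
    simp only [hκ]
    split_ifs with h
    · subst h
      simp only [sub_self, mul_zero, neg_zero, zero_mul, exp_zero, intervalIntegral.integral_const]
      rw [norm_smul, norm_one, mul_one, norm_eq_abs, abs_of_nonneg (by linarith)]
      linarith
    · refine norm_integral_cexp_log_le fun hl => h ?_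
      have := Real.log_injOn_pos (Set.mem_Ioi.mpr (by positivity)) (Set.mem_Ioi.mpr (by positivity)) hl
      exact_mod_cast add_right_cancel this
  have hnn : 0 ≤ ∫ t in T..2 * T, ‖∑ k ∈ range N, a k * cexp (-(2 * log (k + 1)) * I * t)‖ ^ 2 :=
    intervalIntegral.integral_nonneg (by linarith) fun t _ => by positivity
  rw [← abs_of_nonneg hnn, ← norm_eq_abs, ← norm_real, ← intervalIntegral.integral_ofReal]
  simp_rw [e]
  rw [intervalIntegral.integral_finsetSum fun k _ => hi2 k]
  have hdiag : ∑ k ∈ range N, ‖a k‖ * ‖a k‖ * κ k k ≤ M ^ 2 * (2 * T / V) := by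
    have h1 : ∀ k ∈ range N, ‖a k‖ * ‖a k‖ * κ k k ≤
        M ^ 2 * T * (if V ≤ k + 1 then (((k + 1 : ℕ) : ℝ) ^ 2)⁻¹ else 0) := fun k _ => by
      simp only [hκ, if_true]
      by_cases h0 : a k = 0
      · rw [h0, norm_zero, zero_mul, zero_mul]; split_ifs <;> positivity
      · rw [if_pos (ha0 k h0)]
        have h2 : ((k : ℝ) + 1) ^ (-(1 + 2 * δ)) ≤ ((k : ℝ) + 1)⁻¹ := by
          rw [← rpow_neg_one]
          exact rpow_le_rpow_of_exponent_le (by linarith [Nat.cast_nonneg (α := ℝ) k]) (by linarith)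
        calc ‖a k‖ * ‖a k‖ * T ≤ (M * ((k : ℝ) + 1)⁻¹) * (M * ((k : ℝ) + 1)⁻¹) * T := by
              gcongr <;> exact (ha k).trans (by gcongr)
          _ = _ := by push_cast; field_simp
    have hV0 : 0 < ⌈V⌉₊ := Nat.ceil_pos.mpr (by linarith)
    have h3 : ∑ k ∈ range N, (if V ≤ k + 1 then (((k + 1 : ℕ) : ℝ) ^ 2)⁻¹ else 0) ≤ 2 / V := by
      calc _ = ∑ k ∈ range N, (if V ≤ ((k + 1 : ℕ) : ℝ) then (((k + 1 : ℕ) : ℝ) ^ 2)⁻¹ else 0) := by push_cast; rfl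
        _ ≤ ∑ i ∈ Finset.Ioo (⌈V⌉₊ - 1) (N + 1), ((i : ℝ) ^ 2)⁻¹ := by
            rw [← Finset.sum_filter]
            have hinj : Set.InjOn (fun k : ℕ => k + 1) ((range N).filter fun k : ℕ => V ≤ ((k + 1 : ℕ) : ℝ)) :=
              fun _ _ _ _ h => Nat.succ_injective h
            rw [← Finset.sum_image (f := fun i : ℕ => ((i : ℝ) ^ 2)⁻¹) hinj]
            refine Finset.sum_le_sum_of_subset_of_nonneg ?_ fun i _ _ => by positivity
            intro i hi
            obtain ⟨k, hk, rfl⟩ := Finset.mem_image.mp hi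
            obtain ⟨hk1, hk2⟩ := mem_filter.mp hk
            have := Nat.ceil_le.mpr hk2
            have := mem_range.mp hk1
            exact Finset.mem_Ioo.mpr ⟨by omega, by omega⟩
        _ ≤ 2 / (((⌈V⌉₊ - 1 : ℕ) : ℝ) + 1) := sum_Ioo_inv_sq_le _ _
        _ = 2 / (⌈V⌉₊ : ℝ) := by
            rw [show (((⌈V⌉₊ - 1 : ℕ) : ℝ) + 1) = ((⌈V⌉₊ - 1 + 1 : ℕ) : ℝ) by push_cast; rfl, Nat.sub_add_cancel hV0]
        _ ≤ _ := by gcongr; exact Nat.le_ceil V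
    calc _ ≤ _ := sum_le_sum h1
      _ = M ^ 2 * T * ∑ k ∈ range N, (if V ≤ k + 1 then (((k + 1 : ℕ) : ℝ) ^ 2)⁻¹ else 0) := by
          rw [mul_sum]
      _ ≤ M ^ 2 * T * (2 / V) := by gcongr
      _ = _ := by ring
  have hoff : ∀ k ∈ range N, ∑ i ∈ range k, ‖a k‖ * ‖a i‖ * κ k i ≤
      M ^ 2 * (4 / δ) * ((k : ℝ) + 1) ^ (-(1 + δ)) := fun k _ => by
    have h1 : ∀ i ∈ range k, ‖a k‖ * ‖a i‖ * κ k i ≤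
        M ^ 2 * ((k : ℝ) + 1) ^ (-(1 + 2 * δ)) * (((i : ℝ) + 1)⁻¹ * (((k : ℝ) + 1) / (k - i))) := fun i hi => by
      have hi : i < k := mem_range.mp hi
      have h3 : (0 : ℝ) < k - i := sub_pos.mpr (by exact_mod_cast hi)
      have h2 : ((i : ℝ) + 1) ^ (-(1 + 2 * δ)) ≤ ((i : ℝ) + 1)⁻¹ := by
        rw [← rpow_neg_one]
        exact rpow_le_rpow_of_exponent_le (by linarith [Nat.cast_nonneg (α := ℝ) i]) (by linarith)
      have h4 := one_div_log_sub_log_le hi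
      simp only [hκ]
      rw [if_neg hi.ne']
      calc _ ≤ (M * ((k : ℝ) + 1) ^ (-(1 + 2 * δ))) * (M * ((i : ℝ) + 1)⁻¹) * (((k : ℝ) + 1) / (k - i)) := by
            gcongr
            · exact ha k
            · exact (ha i).trans (by gcongr)
        _ = _ := by ring
    calc _ ≤ _ := sum_le_sum h1
      _ = M ^ 2 * ((k : ℝ) + 1) ^ (-(1 + 2 * δ)) * ∑ i ∈ range k, ((i : ℝ) + 1)⁻¹ * (((k : ℝ) + 1) / (k - i)) := by
          rw [mul_sum]
      _ ≤ M ^ 2 * ((k : ℝ) + 1) ^ (-(1 + 2 * δ)) * (4 / δ * ((k : ℝ) + 1) ^ δ) := by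
          gcongr; exact sum_range_inv_mul_sub_le hδ hδ1 k
      _ = M ^ 2 * (4 / δ) * (((k : ℝ) + 1) ^ (-(1 + 2 * δ)) * ((k : ℝ) + 1) ^ δ) := by ring
      _ = _ := by rw [← rpow_add (by positivity)]; congr 2; ring
  calc _ ≤ ∑ k ∈ range N, ∑ i ∈ range N, ‖a k‖ * ‖a i‖ * κ k i := by
        refine norm_sum_le_of_le _ fun k _ => ?_
        rw [intervalIntegral.integral_finsetSum fun i _ => hi k i]
        exact norm_sum_le_of_le _ fun i _ => hb k i
    _ = _ := sum_range_sum_range_symm (fun k i => by rw [hκs, mul_comm ‖a k‖]) N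
    _ ≤ M ^ 2 * (2 * T / V) + 2 * ∑ k ∈ range N, M ^ 2 * (4 / δ) * ((k : ℝ) + 1) ^ (-(1 + δ)) := by
        gcongr with k hk
        exact hoff k hk
    _ = M ^ 2 * (2 * T / V) + 8 * M ^ 2 / δ * ∑ k ∈ range N, ((k : ℝ) + 1) ^ (-(1 + δ)) := by
        rw [← mul_sum]; ring
    _ ≤ M ^ 2 * (2 * T / V) + 8 * M ^ 2 / δ * (2 / δ) := by
        gcongr; exact sum_range_rpow_neg_le hδ hδ1 N
    _ = _ := by ring

/-- The prime coefficients `bcoef p`, restricted to primes `p > Y`. -/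
noncomputable def primeTail (Y : ℕ) : ArithmeticFunction ℂ :=
  ⟨fun n => if n.Prime ∧ Y < n then (bcoef n : ℂ) else 0, by simp [Nat.not_prime_zero]⟩

lemma primeTail_apply (Y n : ℕ) :
    primeTail Y n = if n.Prime ∧ Y < n then (bcoef n : ℂ) else 0 := rfl

open ArithmeticFunction.omega ArithmeticFunction.Omega in
lemma card_filter_antidiagonal_prime_le (n : ℕ) :
    ((n.divisorsAntidiagonal).filter fun x => x.2.Prime).card ≤ Ω n := by
  have h1 : ((n.divisorsAntidiagonal).filter fun x => x.2.Prime).card ≤ n.primeFactors.card := by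
    refine Finset.card_le_card_of_injOn Prod.snd ?_ ?_
    · intro x hx
      simp only [Finset.coe_filter, Nat.mem_divisorsAntidiagonal, mem_ofPred_eq] at hx
      simp only [Finset.mem_coe, Nat.mem_primeFactors]
      exact ⟨hx.2, ⟨x.1, by rw [← hx.1.1, mul_comm]⟩, hx.1.2⟩
    · intro x hx y hy hxy
      simp only [Finset.coe_filter, Nat.mem_divisorsAntidiagonal, mem_ofPred_eq] at hx hy
      refine Prod.ext ?_ hxy
      have hpos : 0 < y.2 := hy.2.pos
      have : x.1 * y.2 = y.1 * y.2 := by rw [hy.1.1, ← hx.1.1, hxy]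
      exact Nat.eq_of_mul_eq_mul_right hpos this
  refine h1.trans ?_
  rw [ArithmeticFunction.cardFactors_apply]
  exact List.toFinset_card_le _

open ArithmeticFunction.Omega in
lemma primeTail_pow (Y k : ℕ) : ∀ n : ℕ,
    ‖(primeTail Y ^ k) n‖ ≤ 3 ^ k * (k.factorial : ℝ) ∧
      ((primeTail Y ^ k) n ≠ 0 → n ≠ 0 ∧ Ω n = k ∧ Y ^ k ≤ n) := by
  induction k with
  | zero =>
    intro n
    rw [pow_zero, ArithmeticFunction.one_apply]
    split_ifs with h
    · subst h; simp
    · simp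
  | succ k ih =>
    intro n
    have hsupp : ∀ x ∈ n.divisorsAntidiagonal, (primeTail Y ^ k) x.1 * primeTail Y x.2 ≠ 0 →
        x.2.Prime ∧ Ω n = k + 1 ∧ Y ^ (k + 1) ≤ n := by
      intro x hx hne
      have h1 := (ih x.1).2 (left_ne_zero_of_mul hne)
      have h2 := right_ne_zero_of_mul hne
      rw [primeTail_apply] at h2
      have h3 : x.2.Prime ∧ Y < x.2 := by by_contra h; simp [h] at h2
      rw [Nat.mem_divisorsAntidiagonal] at hx
      refine ⟨h3.1, ?_, ?_⟩
      · rw [← hx.1, ArithmeticFunction.cardFactors_mul h1.1 h3.1.ne_zero, h1.2.1,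
          ArithmeticFunction.cardFactors_apply_prime h3.1]
      · rw [← hx.1, pow_succ]
        exact Nat.mul_le_mul h1.2.2 h3.2.le
    rw [pow_succ, ArithmeticFunction.mul_apply]
    by_cases hΩ : Ω n = k + 1
    · constructor
      · have hb : ∀ x ∈ n.divisorsAntidiagonal, ‖(primeTail Y ^ k) x.1 * primeTail Y x.2‖ ≤
            if x.2.Prime then 3 ^ k * (k.factorial : ℝ) * 3 else 0 := by
          intro x hx
          rw [norm_mul, primeTail_apply]
          by_cases hp : x.2.Prime
          · rw [if_pos hp]
            have hb := bcoef_nonneg hp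
            have : ‖(if x.2.Prime ∧ Y < x.2 then (bcoef x.2 : ℂ) else 0)‖ ≤ 3 := by
              split_ifs
              · rw [norm_real, norm_eq_abs, abs_of_nonneg hb.1]; exact hb.2.2
              · simp
            exact mul_le_mul (ih x.1).1 this (norm_nonneg _) (by positivity)
          · simp [hp]
        refine (norm_sum_le _ _).trans ((sum_le_sum hb).trans ?_)
        rw [← Finset.sum_filter, sum_const, nsmul_eq_mul]
        have hc : (((n.divisorsAntidiagonal).filter fun x => x.2.Prime).card : ℝ) ≤ (k : ℝ) + 1 := by
          have := card_filter_antidiagonal_prime_le n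
          rw [hΩ] at this
          exact_mod_cast this
        rw [Nat.factorial_succ, pow_succ]
        push_cast
        calc _ ≤ ((k : ℝ) + 1) * (3 ^ k * (k.factorial : ℝ) * 3) := by gcongr
          _ = _ := by ring
      · intro hne
        obtain ⟨x, hx, hxne⟩ := Finset.exists_ne_zero_of_sum_ne_zero hne
        have := hsupp x hx hxne
        refine ⟨?_, this.2⟩
        rw [Nat.mem_divisorsAntidiagonal] at hx
        exact hx.2
    · have h0 : ∑ x ∈ n.divisorsAntidiagonal, (primeTail Y ^ k) x.1 * primeTail Y x.2 = 0 := by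
        refine Finset.sum_eq_zero fun x hx => ?_
        by_contra hne
        exact hΩ (hsupp x hx hne).2.1
      rw [h0]
      refine ⟨by rw [norm_zero]; positivity, fun h => absurd rfl h⟩

lemma lseriesSummable_primeTail_pow (Y k : ℕ) {s : ℂ} (hs : 1 < s.re) :
    LSeriesSummable (fun n => (primeTail Y ^ k) n) s :=
  LSeriesSummable_of_bounded_of_one_lt_re (fun n _ => (primeTail_pow Y k n).1) hs

lemma lseries_primeTail_pow (Y k : ℕ) {s : ℂ} (hs : 1 < s.re) :
    LSeries (fun n => (primeTail Y ^ k) n) s = LSeries (fun n => primeTail Y n) s ^ k := by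
  have h1 : LSeriesSummable (fun n => primeTail Y n) s := by
    have := lseriesSummable_primeTail_pow Y 1 hs
    rwa [pow_one] at this
  induction k with
  | zero =>
    rw [pow_zero, pow_zero, ArithmeticFunction.one_eq_delta, LSeries_delta, Pi.one_apply]
  | succ k ih =>
    rw [pow_succ, pow_succ, ArithmeticFunction.LSeries_mul' (lseriesSummable_primeTail_pow Y k hs) h1,
      ih]

lemma norm_PB_sub_le (Y : ℕ) {s : ℂ} (hs : 1 < s.re) :
    ‖PB s - LSeries (fun n => primeTail Y n) s‖ ≤
      ∑ p ∈ (Icc 1 Y).filter Nat.Prime, bcoef p / p := by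
  have h1 : LSeriesSummable (fun n => primeTail Y n) s := by
    have := lseriesSummable_primeTail_pow Y 1 hs
    rwa [pow_one] at this
  have h2 : HasSum (fun n : ℕ => if n.Prime then (bcoef n : ℂ) * (n : ℂ) ^ (-s) else 0) (PB s) := by
    have h := (summable_bcoef hs).hasSum
    have hinj : Function.Injective (fun p : Nat.Primes => (p : ℕ)) := Subtype.val_injective
    refine (Function.Injective.hasSum_iff (f := fun n : ℕ =>
      if n.Prime then (bcoef n : ℂ) * (n : ℂ) ^ (-s) else 0) hinj ?_).1 ?_
    · intro n hn
      rw [if_neg]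
      intro hp
      exact hn ⟨⟨n, hp⟩, rfl⟩
    · refine h.congr_fun fun p => ?_
      have := p.2
      simp only [Function.comp]
      rw [if_pos p.2]
  have h3 := h2.sub h1.hasSum
  have h4 : HasSum (fun n : ℕ => (if n.Prime then (bcoef n : ℂ) * (n : ℂ) ^ (-s) else 0) -
      LSeries.term (fun n => primeTail Y n) s n)
      (∑ p ∈ (Icc 1 Y).filter Nat.Prime, ((if p.Prime then (bcoef p : ℂ) * (p : ℂ) ^ (-s) else 0)
        - LSeries.term (fun n => primeTail Y n) s p)) := by
    refine hasSum_sum_of_ne_finset_zero fun n hn => ?_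
    rw [mem_filter, mem_Icc] at hn
    by_cases hp : n.Prime
    · have hY : Y < n := by
        by_contra h
        exact hn ⟨⟨hp.one_le, not_lt.1 h⟩, hp⟩
      rw [if_pos hp, LSeries.term_of_ne_zero hp.ne_zero, primeTail_apply, if_pos ⟨hp, hY⟩, cpow_neg,
        div_eq_mul_inv, sub_self]
    · rw [if_neg hp, zero_sub, neg_eq_zero, LSeries.term_def, primeTail_apply]
      simp [hp]
  have h5 := h3.unique h4
  change PB s - LSeries (fun n => primeTail Y n) s = _ at h5
  rw [h5]
  refine (norm_sum_le _ _).trans (sum_le_sum fun p hp => ?_)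
  rw [mem_filter, mem_Icc] at hp
  have hb := bcoef_nonneg hp.2
  have hY : ¬ (p.Prime ∧ Y < p) := fun h => by omega
  rw [if_pos hp.2, LSeries.term_of_ne_zero hp.2.ne_zero, primeTail_apply, if_neg hY, zero_div, sub_zero,
    norm_mul, norm_real, norm_eq_abs, abs_of_nonneg hb.1,
    norm_natCast_cpow_of_pos hp.2.pos, div_eq_mul_inv]
  refine mul_le_mul_of_nonneg_left ?_ hb.1
  rw [← rpow_neg_one]
  have : (1 : ℝ) ≤ p := by exact_mod_cast hp.2.one_le
  exact rpow_le_rpow_of_exponent_le this (by rw [neg_re]; linarith)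

lemma norm_HH_le_primeTail : ∃ C > 0, ∀ Y : ℕ, 3 ≤ Y → ∀ s : ℂ, 1 / 2 < s.re →
    ‖HH s‖ ≤ C * log Y ^ 2 * exp ‖LSeries (fun n => primeTail Y n) (2 * s)‖ := by
  obtain ⟨C1, hC1, h1⟩ := norm_HH_le
  obtain ⟨C2, hC2, h2⟩ := sum_bcoef_div_prime_le
  refine ⟨C1 * exp C2, by positivity, fun Y hY s hs => (h1 s hs).trans ?_⟩
  have hs2 : 1 < (2 * s).re := by simp; linarith
  have h3 := (norm_PB_sub_le Y hs2).trans (h2 Y hY)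
  have hlog : 0 < log Y := log_pos (by exact_mod_cast (by omega : 1 < Y))
  have h4 : -(PB (2 * s)).re ≤ 2 * log (log Y) + C2 +
      ‖LSeries (fun n => primeTail Y n) (2 * s)‖ := by
    have h5 := norm_le_norm_sub_add (PB (2 * s)) (LSeries (fun n => primeTail Y n) (2 * s))
    have h6 := abs_re_le_norm (PB (2 * s))
    have := neg_abs_le (PB (2 * s)).re
    linarith
  calc _ ≤ C1 * exp (2 * log (log Y) + C2 +
      ‖LSeries (fun n => primeTail Y n) (2 * s)‖) := by gcongr
    _ = _ := by
      rw [exp_add, exp_add, two_mul, exp_add, exp_log hlog]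
      ring

lemma primeTail_pow_term (Y k : ℕ) (δ t : ℝ) (j : ℕ) :
    LSeries.term (fun n => (primeTail Y ^ k) n) (2 * (((1 / 2 + δ : ℝ) : ℂ) + t * I)) (j + 1) =
      (primeTail Y ^ k) (j + 1) * ((((j : ℝ) + 1) ^ (-(1 + 2 * δ)) : ℝ) : ℂ) *
        cexp (-(2 * ((log (j + 1) : ℝ) : ℂ)) * I * t) := by
  have hj : (0 : ℝ) < (j : ℝ) + 1 := by positivity
  have hjc : ((j + 1 : ℕ) : ℂ) ≠ 0 := by exact_mod_cast Nat.succ_ne_zero j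
  rw [LSeries.term_of_ne_zero (Nat.succ_ne_zero j), div_eq_mul_inv, ← cpow_neg, mul_assoc]
  congr 1
  rw [cpow_def_of_ne_zero hjc, rpow_def_of_pos hj, ofReal_exp, ← Complex.exp_add]
  congr 1
  have : Complex.log ((j + 1 : ℕ) : ℂ) = ((log (j + 1) : ℝ) : ℂ) := by
    rw [ofReal_log hj.le]; push_cast; rfl
  rw [this]
  push_cast
  ring

lemma integral_normSq_primeTail_pow_le (Y k : ℕ) (hY : 1 ≤ Y) {δ T : ℝ} (hδ : 0 < δ) (hδ1 : δ ≤ 1)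
    (hT : 0 ≤ T) :
    ∫ t in T..2 * T, ‖LSeries (fun n => primeTail Y n) (2 * (((1 / 2 + δ : ℝ) : ℂ) + t * I)) ^ k‖ ^ 2 ≤
      (3 ^ k * (k.factorial : ℝ)) ^ 2 * (2 * T / (Y : ℝ) ^ k + 16 / δ ^ 2) := by
  set a : ℕ → ℂ := fun j => (primeTail Y ^ k) (j + 1) * ((((j : ℝ) + 1) ^ (-(1 + 2 * δ)) : ℝ) : ℂ)
    with ha
  set M : ℝ := 3 ^ k * (k.factorial : ℝ)
  have haM : ∀ j, ‖a j‖ ≤ M * ((j : ℝ) + 1) ^ (-(1 + 2 * δ)) := by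
    intro j
    have hj : (0 : ℝ) ≤ ((j : ℝ) + 1) ^ (-(1 + 2 * δ)) := by positivity
    rw [ha, norm_mul, norm_real, norm_eq_abs, abs_of_nonneg hj]
    exact mul_le_mul_of_nonneg_right (primeTail_pow Y k (j + 1)).1 hj
  have ha0 : ∀ j, a j ≠ 0 → ((Y : ℝ) ^ k) ≤ (j : ℝ) + 1 := by
    intro j hj
    have := ((primeTail_pow Y k (j + 1)).2 (left_ne_zero_of_mul hj)).2.2
    exact_mod_cast this
  have hV : (1 : ℝ) ≤ (Y : ℝ) ^ k := one_le_pow₀ (by exact_mod_cast hY)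
  have key := fun N => integral_normSq_dirichlet_le hδ hδ1 hV hT haM ha0 N
  set F : ℕ → ℝ → ℂ := fun N t => ∑ j ∈ range N,
    a j * cexp (-(2 * ((log (j + 1) : ℝ) : ℂ)) * I * t) with hF
  have hsum : Summable fun j : ℕ => M * ((j : ℝ) + 1) ^ (-(1 + 2 * δ)) := by
    have h1 : Summable fun j : ℕ => (j : ℝ) ^ (-(1 + 2 * δ)) :=
      Real.summable_nat_rpow.2 (by linarith)
    have h2 := (summable_nat_add_iff 1).2 h1
    refine (h2.mul_left M).congr fun j => ?_
    push_cast; rfl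
  set B := ∑' j : ℕ, M * ((j : ℝ) + 1) ^ (-(1 + 2 * δ))
  have hFB : ∀ N t, ‖F N t‖ ≤ B := by
    intro N t
    refine (norm_sum_le _ _).trans ?_
    refine le_trans (sum_le_sum fun j _ => ?_)
      (hsum.sum_le_tsum (range N) fun j _ => (norm_nonneg _).trans (haM j))
    rw [norm_mul]
    have : ‖cexp (-(2 * ((log (j + 1) : ℝ) : ℂ)) * I * t)‖ = 1 := by
      rw [norm_exp]; simp
    rw [this, mul_one]
    exact haM j
  have hFlim : ∀ t : ℝ, Tendsto (fun N => F N t) atTop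
      (𝓝 (LSeries (fun n => primeTail Y n) (2 * (((1 / 2 + δ : ℝ) : ℂ) + t * I)) ^ k)) := by
    intro t
    have hs : 1 < (2 * (((1 / 2 + δ : ℝ) : ℂ) + t * I)).re := by
      simp; linarith
    rw [← lseries_primeTail_pow Y k hs]
    have h1 := (lseriesSummable_primeTail_pow Y k hs).hasSum
    have h2 := (hasSum_nat_add_iff' 1).2 h1
    simp only [Finset.sum_range_one, LSeries.term_zero, sub_zero] at h2
    refine h2.tendsto_sum_nat.congr fun N => sum_congr rfl fun j _ => ?_
    rw [primeTail_pow_term]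
  have hcont : ∀ N, Continuous (F N) := by
    intro N
    rw [hF]; fun_prop
  refine le_of_tendsto' (f := fun N => ∫ t in T..2 * T, ‖F N t‖ ^ 2) (x := atTop) ?_ key
  refine intervalIntegral.tendsto_integral_filter_of_dominated_convergence (fun _ => B ^ 2) ?_ ?_ ?_ ?_
  · exact Eventually.of_forall fun N => ((hcont N).norm.pow 2).aestronglyMeasurable
  · refine Eventually.of_forall fun N => Eventually.of_forall fun t _ => ?_
    rw [norm_eq_abs, abs_of_nonneg (by positivity)]
    exact pow_le_pow_left₀ (norm_nonneg _) (hFB N t) 2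
  · exact intervalIntegrable_const
  · refine Eventually.of_forall fun t _ => ?_
    exact ((hFlim t).norm).pow 2

lemma continuous_lseries_primeTail_line (Y : ℕ) {δ : ℝ} (hδ : 0 < δ) :
    Continuous fun t : ℝ => LSeries (fun n => primeTail Y n) (2 * (((1 / 2 + δ : ℝ) : ℂ) + t * I)) := by
  rw [continuous_iff_continuousAt]
  intro t
  have h1 : LSeries.abscissaOfAbsConv (fun n => primeTail Y n) ≤ 1 := by
    refine LSeries.abscissaOfAbsConv_le_of_forall_lt_LSeriesSummable (x := 1) fun y hy => ?_
    have := lseriesSummable_primeTail_pow Y 1 (s := y) (by simpa using hy)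
    rwa [pow_one] at this
  have hs : LSeries.abscissaOfAbsConv (fun n => primeTail Y n) <
      ((2 * (((1 / 2 + δ : ℝ) : ℂ) + t * I)).re : EReal) := by
    refine h1.trans_lt ?_
    have : (1 : ℝ) < (2 * (((1 / 2 + δ : ℝ) : ℂ) + t * I)).re := by simp; linarith
    exact_mod_cast this
  have h2 := (LSeries_analyticOnNhd (fun n => primeTail Y n) _ hs).continuousAt
  exact ContinuousAt.comp (f := fun t : ℝ => 2 * (((1 / 2 + δ : ℝ) : ℂ) + t * I))
    (x := t) h2 (by fun_prop)

lemma continuous_HH_line {σ : ℝ} (hσ : 1 / 2 < σ) : Continuous fun t : ℝ => HH (σ + t * I) := by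
  rw [continuous_iff_continuousAt]
  intro t
  exact ContinuousAt.comp (f := fun t : ℝ => (σ : ℂ) + t * I) (x := t)
    (HH_analyticAt (by simpa using hσ)).continuousAt (by fun_prop)

lemma intervalIntegrable_zK_HH {T σ : ℝ} (hT : 0 < T) (hσ : 1 / 2 < σ) :
    IntervalIntegrable (fun t : ℝ => ‖zK (σ + t * I)‖ ^ 2 * ‖HH (σ + t * I)‖) volume T (2 * T) := by
  refine ContinuousOn.intervalIntegrable ?_
  refine ContinuousOn.mul ?_ (continuous_HH_line hσ).norm.continuousOn
  refine ((continuousOn_zK_line σ).mono ?_).norm.pow 2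
  intro t ht
  rw [Set.uIcc_of_le (by linarith)] at ht
  exact hT.trans_le ht.1

lemma intervalIntegrable_zK {T : ℝ} (σ : ℝ) (hT : 0 < T) :
    IntervalIntegrable (fun t : ℝ => ‖zK (σ + t * I)‖ ^ 2) volume T (2 * T) := by
  refine ContinuousOn.intervalIntegrable ?_
  refine ((continuousOn_zK_line σ).mono ?_).norm.pow 2
  intro t ht
  rw [Set.uIcc_of_le (by linarith)] at ht
  exact hT.trans_le ht.1

lemma integral_normSq_zK_near_le : ∃ C, 0 < C ∧ ∀ l : ℝ, 3 ≤ l → ∀ T, 3 ≤ T → log T ≤ 7 * l →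
    ∫ t in T..2 * T, ‖zK ((1 / 2 + 1 / l : ℝ) + t * I)‖ ^ 2 ≤ C * (T * log T ^ 2) := by
  obtain ⟨C, hC, h⟩ := integral_normSq_zK_le
  refine ⟨C * exp 14, by positivity, fun l hl T hT hTl => ?_⟩
  have hl0 : 0 < l := by linarith
  have hT0 : 0 < T := by linarith
  have h1 : 1 / l ≤ 1 / 2 := by
    apply one_div_le_one_div_of_le <;> linarith
  refine (h T hT (1 / 2 + 1 / l) (by linarith [one_div_pos.2 hl0]) (by linarith)).trans ?_
  have h2 : T ^ (2 * (1 / 2 + 1 / l)) ≤ T * exp 14 := by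
    rw [show 2 * (1 / 2 + 1 / l) = 1 + 2 / l by ring, rpow_add hT0, rpow_one]
    refine mul_le_mul_of_nonneg_left ?_ hT0.le
    rw [rpow_def_of_pos hT0]
    refine exp_le_exp.2 ?_
    rw [← mul_div_assoc, div_le_iff₀ hl0]
    linarith
  calc C * (T ^ (2 * (1 / 2 + 1 / l)) * log T ^ 2) ≤ C * ((T * exp 14) * log T ^ 2) := by
        gcongr
    _ = _ := by ring

lemma norm_HH_near_le : ∃ C, 0 < C ∧ ∀ l : ℝ, 3 ≤ l → ∀ t : ℝ,
    ‖HH ((1 / 2 + 1 / l : ℝ) + t * I)‖ ≤ C * l ^ 2 := by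
  obtain ⟨C, hC, h⟩ := norm_HH_le_trivial
  refine ⟨C, hC, fun l hl t => ?_⟩
  have hl0 : 0 < l := by linarith
  have h1 : 1 / l ≤ 1 / 2 := by
    apply one_div_le_one_div_of_le <;> linarith
  have := h (1 / l) t (one_div_pos.2 hl0) h1
  push_cast at this ⊢
  refine this.trans (le_of_eq ?_)
  field_simp

lemma norm_HH_near_le_primeTail : ∃ C, 0 < C ∧ ∀ l : ℝ, 3 ≤ l → ∀ k : ℕ, ∀ t : ℝ,
    ‖HH ((1 / 2 + 1 / l : ℝ) + t * I)‖ ≤ C * log l ^ 2 + C * l ^ 2 *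
      ‖LSeries (fun n => primeTail ⌈l ^ 200⌉₊ n) (2 * (((1 / 2 + 1 / l : ℝ) : ℂ) + t * I)) ^ k‖ ^ 2 := by
  obtain ⟨C1, hC1, h1⟩ := norm_HH_near_le
  obtain ⟨C2, hC2, h2⟩ := norm_HH_le_primeTail
  refine ⟨max C1 (C2 * 201 ^ 2 * exp 1), lt_max_of_lt_left hC1, fun l hl k t => ?_⟩
  have hl0 : 0 < l := by linarith
  set R := LSeries (fun n => primeTail ⌈l ^ 200⌉₊ n) (2 * (((1 / 2 + 1 / l : ℝ) : ℂ) + t * I))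
  set C := max C1 (C2 * 201 ^ 2 * exp 1)
  rcases le_or_gt ‖R‖ 1 with h | h
  · have h3 : (3 : ℝ) ≤ l ^ 200 := hl.trans (le_self_pow₀ (by linarith) (by norm_num))
    have hY3 : 3 ≤ ⌈l ^ 200⌉₊ := by
      have := h3.trans (Nat.le_ceil (l ^ 200))
      exact_mod_cast this
    have hre : 1 / 2 < (((1 / 2 + 1 / l : ℝ) : ℂ) + t * I).re := by
      have := one_div_pos.2 hl0
      simp only [add_re, ofReal_re, mul_re, I_re, ofReal_im, I_im]
      linarith
    have h4 := h2 _ hY3 _ hre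
    have h5 : log (⌈l ^ 200⌉₊ : ℝ) ≤ 201 * log l := by
      have h6 : (⌈l ^ 200⌉₊ : ℝ) ≤ l ^ 201 := by
        have := (Nat.ceil_lt_add_one (by positivity : (0 : ℝ) ≤ l ^ 200)).le
        calc _ ≤ l ^ 200 + 1 := this
          _ ≤ l ^ 200 * l := by nlinarith
          _ = l ^ 201 := by ring
      have h7 := log_le_log (by positivity) h6
      rwa [log_pow] at h7
    have h9 : ‖HH ((1 / 2 + 1 / l : ℝ) + t * I)‖ ≤ C * log l ^ 2 := by
      calc _ ≤ _ := h4
        _ ≤ C2 * (201 * log l) ^ 2 * exp 1 := by gcongr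
        _ = (C2 * 201 ^ 2 * exp 1) * log l ^ 2 := by ring
        _ ≤ C * log l ^ 2 := by gcongr; exact le_max_right _ _
    have : 0 ≤ C * l ^ 2 * ‖R ^ k‖ ^ 2 := by positivity
    linarith
  · have h9 : ‖HH ((1 / 2 + 1 / l : ℝ) + t * I)‖ ≤ C * l ^ 2 :=
      (h1 l hl t).trans (by gcongr; exact le_max_left _ _)
    have h10 : 1 ≤ ‖R ^ k‖ ^ 2 := by
      rw [norm_pow]
      exact one_le_pow₀ (one_le_pow₀ h.le)
    have : 0 ≤ C * log l ^ 2 := by positivity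
    have : C * l ^ 2 * 1 ≤ C * l ^ 2 * ‖R ^ k‖ ^ 2 := by gcongr
    linarith

lemma primeTail_moment_le {l T : ℝ} (hl : 3 ≤ l) (hT : 3 ≤ T) (h1 : 300 * log l ≤ log T)
    (h2 : log T ≤ 7 * l) : ∃ k : ℕ,
    l ^ 2 * T ^ (23 / 25 : ℝ) * ∫ t in T..2 * T, ‖LSeries (fun n => primeTail ⌈l ^ 200⌉₊ n)
      (2 * (((1 / 2 + 1 / l : ℝ) : ℂ) + t * I)) ^ k‖ ^ 2 ≤ 18 * T := by
  have hl0 : 0 < l := by linarith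
  have hT0 : 0 < T := by linarith
  have hll : 1 < log l := one_lt_log hl
  set L := log T
  set m := log l
  have hTe : exp L = T := exp_log hT0
  have hle : exp m = l := exp_log hl0
  set k := ⌊L / (100 * m)⌋₊
  have hk1 : (k : ℝ) * (100 * m) ≤ L := by
    rw [← le_div_iff₀ (by positivity)]
    exact Nat.floor_le (by apply div_nonneg <;> linarith)
  have hk2 : L < ((k : ℝ) + 1) * (100 * m) := by
    rw [← div_lt_iff₀ (by positivity)]
    exact Nat.lt_floor_add_one _
  have hk3 : 3 * (k : ℝ) ≤ l := by
    have : (k : ℝ) * 100 ≤ k * (100 * m) := by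
      have : (0 : ℝ) ≤ k := by positivity
      nlinarith
    linarith
  have hlpow : ∀ n : ℕ, l ^ n = exp (n * m) := fun n => by rw [exp_nat_mul, hle]
  have hM : (3 : ℝ) ^ k * (k.factorial : ℝ) ≤ l ^ k := by
    have h3 : (k.factorial : ℝ) ≤ (k : ℝ) ^ k := by exact_mod_cast Nat.factorial_le_pow k
    calc (3 : ℝ) ^ k * (k.factorial : ℝ) ≤ 3 ^ k * (k : ℝ) ^ k := by gcongr
      _ = (3 * (k : ℝ)) ^ k := by rw [mul_pow]
      _ ≤ l ^ k := by gcongr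
  have hM2 : ((3 : ℝ) ^ k * (k.factorial : ℝ)) ^ 2 ≤ exp (L / 50) := by
    calc _ ≤ (l ^ k) ^ 2 := by gcongr
      _ = exp (2 * (k * m)) := by
        rw [hlpow k, ← exp_nat_mul]; norm_num
      _ ≤ _ := exp_le_exp.2 (by linarith)
  have hY1 : l ^ 200 ≤ (⌈l ^ 200⌉₊ : ℝ) := Nat.le_ceil _
  have hY : 1 ≤ ⌈l ^ 200⌉₊ := Nat.one_le_ceil_iff.2 (by positivity)
  have hYk : T ≤ (⌈l ^ 200⌉₊ : ℝ) ^ k := by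
    calc T = exp L := hTe.symm
      _ ≤ exp ((200 * k : ℕ) * m) := by
        refine exp_le_exp.2 ?_
        push_cast
        linarith
      _ = (l ^ 200) ^ k := by rw [← hlpow, pow_mul]
      _ ≤ _ := by gcongr
  have h5 : 2 * T / (⌈l ^ 200⌉₊ : ℝ) ^ k ≤ 2 := by
    rw [div_le_iff₀ (by positivity)]; linarith
  have hδ : 1 / l ≤ 1 := by rw [div_le_one hl0]; linarith
  have key := integral_normSq_primeTail_pow_le ⌈l ^ 200⌉₊ k hY (one_div_pos.2 hl0) hδ hT0.le
  refine ⟨k, ?_⟩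
  have h6 : 16 / (1 / l) ^ 2 = 16 * l ^ 2 := by field_simp
  rw [h6] at key
  have h7 : T ^ (23 / 25 : ℝ) = exp (L * (23 / 25)) := by rw [rpow_def_of_pos hT0]
  calc _ ≤ l ^ 2 * T ^ (23 / 25 : ℝ) * (exp (L / 50) * (2 * l ^ 2 + 16 * l ^ 2)) := by
        refine mul_le_mul_of_nonneg_left (key.trans ?_) (by positivity)
        have : 2 ≤ 2 * l ^ 2 := by nlinarith
        gcongr
        linarith
    _ = 18 * (l ^ 4 * T ^ (23 / 25 : ℝ) * exp (L / 50)) := by ring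
    _ = 18 * exp (4 * m + L * (23 / 25) + L / 50) := by
      rw [h7, hlpow 4, ← exp_add, ← exp_add]; norm_num
    _ ≤ 18 * exp L := by
      gcongr
      linarith
    _ = 18 * T := by rw [hTe]

lemma integral_normSq_zK_HH_le : ∃ C, 0 < C ∧ ∀ l : ℝ, 3 ≤ l → ∀ T, 3 ≤ T → log T ≤ 7 * l →
    ∫ t in T..2 * T, ‖zK ((1 / 2 + 1 / l : ℝ) + t * I)‖ ^ 2 * ‖HH ((1 / 2 + 1 / l : ℝ) + t * I)‖ ≤
      C * (T * l ^ 2 * log l ^ 2) := by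
  obtain ⟨C1, hC1, hz2⟩ := integral_normSq_zK_near_le
  obtain ⟨C2, hC2, hH⟩ := norm_HH_near_le
  obtain ⟨C3, hC3, hHR⟩ := norm_HH_near_le_primeTail
  obtain ⟨C4, hC4, hz⟩ := norm_zK_le
  refine ⟨C2 * C1 * 300 ^ 2 + C3 * C1 * 49 + 36 * (C3 * C4 ^ 2), by positivity,
    fun l hl T hT hTl => ?_⟩
  have hl0 : 0 < l := by linarith
  have hT0 : 0 < T := by linarith
  have hll : 1 < log l := one_lt_log hl
  have hL : 1 < log T := one_lt_log hT
  have hσ : (1 : ℝ) / 2 < 1 / 2 + 1 / l := by linarith [one_div_pos.2 hl0]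
  have hT2 : T ≤ 2 * T := by linarith
  have hint := intervalIntegrable_zK_HH hT0 hσ
  have hintz := intervalIntegrable_zK (1 / 2 + 1 / l) hT0
  rcases le_total (300 * log l) (log T) with h | h
  · obtain ⟨k, hk⟩ := primeTail_moment_le hl hT h hTl
    set R : ℝ → ℝ := fun t => ‖LSeries (fun n => primeTail ⌈l ^ 200⌉₊ n)
      (2 * (((1 / 2 + 1 / l : ℝ) : ℂ) + t * I)) ^ k‖ ^ 2 with hR
    have hRc : Continuous R := by
      have := continuous_lseries_primeTail_line ⌈l ^ 200⌉₊ (one_div_pos.2 hl0)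
      exact (this.pow k).norm.pow 2
    have hRi : IntervalIntegrable R volume T (2 * T) := hRc.intervalIntegrable _ _
    have hpt : ∀ t ∈ Set.Icc T (2 * T), ‖zK ((1 / 2 + 1 / l : ℝ) + t * I)‖ ^ 2 *
        ‖HH ((1 / 2 + 1 / l : ℝ) + t * I)‖ ≤
        (C3 * log l ^ 2) * ‖zK ((1 / 2 + 1 / l : ℝ) + t * I)‖ ^ 2 +
          (C3 * l ^ 2 * (C4 ^ 2 * (2 * T ^ (23 / 25 : ℝ)))) * R t := by
      intro t ht
      have ht0 : 0 < t := hT0.trans_le ht.1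
      have h1 := hHR l hl k t
      have h2 : ‖zK ((1 / 2 + 1 / l : ℝ) + t * I)‖ ≤ C4 * |t| ^ (23 / 50 : ℝ) := by
        refine hz _ t hσ.le ?_ ?_
        · have : 1 / l ≤ 1 := by rw [div_le_one hl0]; linarith
          linarith
        · rw [abs_of_pos ht0]; linarith [ht.1]
      have h3 : ‖zK ((1 / 2 + 1 / l : ℝ) + t * I)‖ ^ 2 ≤ C4 ^ 2 * (2 * T ^ (23 / 25 : ℝ)) := by
        calc _ ≤ (C4 * |t| ^ (23 / 50 : ℝ)) ^ 2 := by gcongr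
          _ = C4 ^ 2 * t ^ (23 / 25 : ℝ) := by
            rw [mul_pow, abs_of_pos ht0, ← Real.rpow_mul_natCast ht0.le]; norm_num
          _ ≤ C4 ^ 2 * (2 * T) ^ (23 / 25 : ℝ) := by
            gcongr
            exact ht.2
          _ = C4 ^ 2 * (2 ^ (23 / 25 : ℝ) * T ^ (23 / 25 : ℝ)) := by
            rw [mul_rpow (by norm_num) hT0.le]
          _ ≤ C4 ^ 2 * (2 * T ^ (23 / 25 : ℝ)) := by
            gcongr
            calc (2 : ℝ) ^ (23 / 25 : ℝ) ≤ 2 ^ (1 : ℝ) :=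
                  rpow_le_rpow_of_exponent_le (by norm_num) (by norm_num)
              _ = 2 := rpow_one 2
      calc _ ≤ ‖zK ((1 / 2 + 1 / l : ℝ) + t * I)‖ ^ 2 *
            (C3 * log l ^ 2 + C3 * l ^ 2 * R t) := by gcongr
        _ = (C3 * log l ^ 2) * ‖zK ((1 / 2 + 1 / l : ℝ) + t * I)‖ ^ 2 +
            (C3 * l ^ 2 * R t) * ‖zK ((1 / 2 + 1 / l : ℝ) + t * I)‖ ^ 2 := by ring
        _ ≤ (C3 * log l ^ 2) * ‖zK ((1 / 2 + 1 / l : ℝ) + t * I)‖ ^ 2 +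
            (C3 * l ^ 2 * R t) * (C4 ^ 2 * (2 * T ^ (23 / 25 : ℝ))) := by gcongr
        _ = _ := by ring
    have hmono := intervalIntegral.integral_mono_on hT2 hint
      ((hintz.const_mul _).add (hRi.const_mul _)) hpt
    rw [intervalIntegral.integral_add (hintz.const_mul _) (hRi.const_mul _),
      intervalIntegral.integral_const_mul, intervalIntegral.integral_const_mul] at hmono
    refine hmono.trans ?_
    have e1 := hz2 l hl T hT hTl
    have e2 : C3 * log l ^ 2 * ∫ t in T..2 * T, ‖zK ((1 / 2 + 1 / l : ℝ) + t * I)‖ ^ 2 ≤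
        C3 * C1 * 49 * (T * l ^ 2 * log l ^ 2) := by
      calc _ ≤ C3 * log l ^ 2 * (C1 * (T * (7 * l) ^ 2)) := by
            refine mul_le_mul_of_nonneg_left (e1.trans ?_) (by positivity)
            gcongr
        _ = _ := by ring
    have e3 : C3 * l ^ 2 * (C4 ^ 2 * (2 * T ^ (23 / 25 : ℝ))) * ∫ t in T..2 * T, R t ≤
        36 * (C3 * C4 ^ 2) * (T * l ^ 2 * log l ^ 2) := by
      have h8 : 1 ≤ l ^ 2 * log l ^ 2 := by
        rw [← mul_pow]
        exact one_le_pow₀ (by nlinarith)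
      calc _ = 2 * (C3 * C4 ^ 2) * (l ^ 2 * T ^ (23 / 25 : ℝ) * ∫ t in T..2 * T, R t) := by ring
        _ ≤ 2 * (C3 * C4 ^ 2) * (18 * T) := by gcongr
        _ = 36 * (C3 * C4 ^ 2) * (T * 1) := by ring
        _ ≤ 36 * (C3 * C4 ^ 2) * (T * (l ^ 2 * log l ^ 2)) := by gcongr
        _ = _ := by ring
    have e4 : 0 ≤ C2 * C1 * 300 ^ 2 * (T * l ^ 2 * log l ^ 2) := by positivity
    linarith
  · have hpt : ∀ t ∈ Set.Icc T (2 * T), ‖zK ((1 / 2 + 1 / l : ℝ) + t * I)‖ ^ 2 *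
        ‖HH ((1 / 2 + 1 / l : ℝ) + t * I)‖ ≤
        (C2 * l ^ 2) * ‖zK ((1 / 2 + 1 / l : ℝ) + t * I)‖ ^ 2 := by
      intro t _
      rw [mul_comm]
      gcongr
      exact hH l hl t
    have hmono := intervalIntegral.integral_mono_on hT2 hint (hintz.const_mul _) hpt
    rw [intervalIntegral.integral_const_mul] at hmono
    refine hmono.trans ?_
    have e1 := hz2 l hl T hT hTl
    have e2 : C2 * l ^ 2 * ∫ t in T..2 * T, ‖zK ((1 / 2 + 1 / l : ℝ) + t * I)‖ ^ 2 ≤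
        C2 * C1 * 300 ^ 2 * (T * l ^ 2 * log l ^ 2) := by
      calc _ ≤ C2 * l ^ 2 * (C1 * (T * (300 * log l) ^ 2)) := by
            refine mul_le_mul_of_nonneg_left (e1.trans ?_) (by positivity)
            gcongr
        _ = _ := by ring
    have e4 : 0 ≤ C3 * C1 * 49 * (T * l ^ 2 * log l ^ 2) := by positivity
    have e5 : 0 ≤ 36 * (C3 * C4 ^ 2) * (T * l ^ 2 * log l ^ 2) := by positivity
    linarith

lemma HH_conj (s : ℂ) : HH (conj s) = conj (HH s) := by
  simp only [HH, LSeries]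
  rw [conj_tsum]
  refine tsum_congr fun n => ?_
  rw [LSeries.term_def, LSeries.term_def]
  split_ifs with h
  · simp
  · have h1 : (n : ℂ) ^ (conj s) = conj ((n : ℂ) ^ s) := by
      rw [cpow_conj _ _ (by rw [natCast_arg]; exact pi_pos.ne), conj_natCast]
    rw [h1, map_div₀, map_intCast]

lemma norm_HH_neg (σ t : ℝ) : ‖HH (σ + (-t : ℝ) * I)‖ = ‖HH (σ + t * I)‖ := by
  rw [← norm_conj (HH (σ + t * I)), ← HH_conj]
  simp

lemma norm_HH_le_of_re_ge {σ : ℝ} (hσ : 1 / 2 < σ) : ∃ B, 0 < B ∧ ∀ s : ℂ, σ ≤ s.re → ‖HH s‖ ≤ B := by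
  have h1 : LSeriesSummable (fun n => (hArith n : ℂ)) (σ : ℂ) :=
    lseriesSummable_hArith (by simpa using hσ)
  refine ⟨(∑' n, ‖LSeries.term (fun n => (hArith n : ℂ)) (σ : ℂ) n‖) + 1, by positivity,
    fun s hs => ?_⟩
  refine le_trans (tsum_of_norm_bounded h1.norm.hasSum fun n => ?_) (le_add_of_nonneg_right zero_le_one)
  exact LSeries.norm_term_le_of_re_le_re _ (by simpa using hs) n

/-- `(s - 1)² ζ(s)² L(s)² H(s)`. -/
noncomputable def qq (s : ℂ) : ℂ := zz s ^ 2 * LL s ^ 2 * HH s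

/-- `ζ(s)² L(s)² H(s)` with its polar part at `1` removed. -/
noncomputable def FF : ℂ → ℂ := dslope (dslope qq 1) 1

lemma qq_differentiableOn : DifferentiableOn ℂ qq {s | 1 / 2 < s.re} := fun s hs =>
  (((zz_differentiable s).pow 2).mul ((LL_differentiable s).pow 2)).mul
    (HH_analyticAt hs).differentiableAt |>.differentiableWithinAt

lemma FF_differentiableOn : DifferentiableOn ℂ FF {s | 1 / 2 < s.re} := by
  have ho : IsOpen {s : ℂ | 1 / 2 < s.re} := isOpen_lt continuous_const continuous_re
  have h1 : {s : ℂ | 1 / 2 < s.re} ∈ nhds (1 : ℂ) := ho.mem_nhds (by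
    change (1 : ℝ) / 2 < (1 : ℂ).re
    norm_num)
  exact (differentiableOn_dslope h1).2 ((differentiableOn_dslope h1).2 qq_differentiableOn)

lemma FF_of_ne {s : ℂ} (hs : s ≠ 1) :
    FF s = zK s ^ 2 * HH s - qq 1 / (s - 1) ^ 2 - deriv qq 1 / (s - 1) := by
  have h : s - 1 ≠ 0 := sub_ne_zero.2 hs
  rw [FF, dslope_of_ne _ hs, slope_def_field, dslope_same, dslope_of_ne _ hs, slope_def_field]
  have : qq s = (s - 1) ^ 2 * (zK s ^ 2 * HH s) := by
    rw [qq, zz_of_ne hs, zK]; ring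
  rw [this]
  field_simp

lemma norm_FF_le {s : ℂ} {r : ℝ} (hr : 0 < r) (hrs : r ≤ ‖s - 1‖) :
    ‖FF s‖ ≤ ‖zK s‖ ^ 2 * ‖HH s‖ + (‖qq 1‖ / r ^ 2 + ‖deriv qq 1‖ / r) := by
  have hne : s ≠ 1 := by
    rintro rfl
    rw [sub_self, norm_zero] at hrs
    linarith
  rw [FF_of_ne hne]
  have h1 : ‖qq 1 / (s - 1) ^ 2‖ ≤ ‖qq 1‖ / r ^ 2 := by
    rw [norm_div, norm_pow]; gcongr
  have h2 : ‖deriv qq 1 / (s - 1)‖ ≤ ‖deriv qq 1‖ / r := by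
    rw [norm_div]; gcongr
  have h3 := norm_sub_le (zK s ^ 2 * HH s - qq 1 / (s - 1) ^ 2) (deriv qq 1 / (s - 1))
  have h4 := norm_sub_le (zK s ^ 2 * HH s) (qq 1 / (s - 1) ^ 2)
  rw [norm_mul, norm_pow] at h4
  linarith

lemma norm_sub_one_ge (σ t : ℝ) : |t| ≤ ‖((σ : ℂ) + t * I) - 1‖ := by
  have := abs_im_le_norm (((σ : ℂ) + t * I) - 1)
  simpa using this

lemma norm_FF_strip_le {σ0 : ℝ} (h0 : 1 / 2 < σ0) : ∃ C, 0 < C ∧ ∀ σ t : ℝ, σ0 ≤ σ → σ ≤ 2 → 1 ≤ |t| →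
    ‖FF (σ + t * I)‖ ≤ C * |t| ^ (23 / 25 : ℝ) := by
  obtain ⟨C1, hC1, h1⟩ := norm_zK_le
  obtain ⟨B, hB, h2⟩ := norm_HH_le_of_re_ge h0
  refine ⟨C1 ^ 2 * B + (‖qq 1‖ + ‖deriv qq 1‖), by positivity, fun σ t hσ hσ2 ht => ?_⟩
  have h3 := norm_FF_le (s := σ + t * I) one_pos (ht.trans (norm_sub_one_ge σ t))
  have h4 := h1 σ t (by linarith) hσ2 ht
  have h5 := h2 (σ + t * I) (by simpa using hσ)
  have h6 : (1 : ℝ) ≤ |t| ^ (23 / 25 : ℝ) := one_le_rpow ht (by norm_num)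
  have h7 : (|t| ^ (23 / 50 : ℝ)) ^ 2 = |t| ^ (23 / 25 : ℝ) := by
    rw [← Real.rpow_mul_natCast (abs_nonneg t)]; norm_num
  calc _ ≤ _ := h3
    _ ≤ (C1 * |t| ^ (23 / 50 : ℝ)) ^ 2 * B + (‖qq 1‖ + ‖deriv qq 1‖) * |t| ^ (23 / 25 : ℝ) := by
      have : ‖qq 1‖ / 1 ^ 2 + ‖deriv qq 1‖ / 1 ≤ (‖qq 1‖ + ‖deriv qq 1‖) * |t| ^ (23 / 25 : ℝ) := by
        rw [one_pow, div_one, div_one]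
        exact le_mul_of_one_le_right (by positivity) h6
      gcongr
    _ = _ := by rw [mul_pow, h7]; ring

lemma integrable_of_norm_le_rpow {g : ℝ → ℂ} (hg : Continuous g) {C e : ℝ} (hC : 0 ≤ C) (he : 1 < e)
    (hb : ∀ t, 1 ≤ |t| → ‖g t‖ ≤ C * |t| ^ (-e)) : Integrable g := by
  obtain ⟨B, hB⟩ := (isCompact_Icc (a := (-1 : ℝ)) (b := 1)).exists_bound_of_continuousOn hg.continuousOn
  have hB0 : 0 ≤ B := (norm_nonneg _).trans (hB 0 (by simp))
  have h1 : Integrable (fun t : ℝ => (1 + ‖t‖) ^ (-e)) := integrable_one_add_norm (by simpa using he)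
  refine (h1.const_mul (2 ^ e * (C + B))).mono' hg.aestronglyMeasurable (Eventually.of_forall fun t => ?_)
  have h2 : (0 : ℝ) < 1 + ‖t‖ := by positivity
  rw [norm_eq_abs] at h2
  change ‖g t‖ ≤ 2 ^ e * (C + B) * (1 + |t|) ^ (-e)
  have h3 : 2 ^ e * (C + B) * (1 + |t|) ^ (-e) = (C + B) * ((1 + |t|) / 2) ^ (-e) := by
    rw [div_rpow h2.le (by norm_num), rpow_neg (by norm_num : (0 : ℝ) ≤ 2)]
    field_simp
  rw [h3]
  rcases le_total 1 |t| with ht | ht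
  · have : |t| ^ (-e) ≤ ((1 + |t|) / 2) ^ (-e) :=
      rpow_le_rpow_of_nonpos (by linarith) (by linarith) (by linarith)
    calc _ ≤ C * |t| ^ (-e) := hb t ht
      _ ≤ (C + B) * ((1 + |t|) / 2) ^ (-e) := by gcongr; linarith
  · have : 1 ≤ ((1 + |t|) / 2) ^ (-e) :=
      Real.one_le_rpow_of_pos_of_le_one_of_nonpos (by linarith) (by linarith) (by linarith)
    calc _ ≤ B := hB t (abs_le.1 ht)
      _ ≤ (C + B) * 1 := by linarith
      _ ≤ _ := by gcongr

/-- Moving a vertical line of integration across a strip of holomorphy. -/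
lemma integral_vertical_shift {f : ℂ → ℂ} {a0 a b C e : ℝ} (ha : a0 < a) (hab : a ≤ b) (hC : 0 ≤ C)
    (he : 1 < e) (hf : DifferentiableOn ℂ f {s | a0 < s.re})
    (hb : ∀ σ t : ℝ, a ≤ σ → σ ≤ b → 1 ≤ |t| → ‖f (σ + t * I)‖ ≤ C * |t| ^ (-e)) :
    ∫ t : ℝ, f (a + t * I) = ∫ t : ℝ, f (b + t * I) := by
  have hcont : ∀ σ : ℝ, a ≤ σ → Continuous fun t : ℝ => f (σ + t * I) := by
    intro σ hσ
    refine hf.continuousOn.comp_continuous (by fun_prop) fun t => ?_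
    change a0 < ((σ : ℂ) + t * I).re
    simpa using ha.trans_le hσ
  have hia := integrable_of_norm_le_rpow (hcont a le_rfl) hC he fun t ht => hb a t le_rfl hab ht
  have hib := integrable_of_norm_le_rpow (hcont b hab) hC he fun t ht => hb b t hab le_rfl ht
  have ta := intervalIntegral_tendsto_integral hia tendsto_neg_atTop_atBot tendsto_id
  have tb := intervalIntegral_tendsto_integral hib tendsto_neg_atTop_atBot tendsto_id
  have hz : Tendsto (fun T : ℝ => 2 * (C * T ^ (-e) * |b - a|)) atTop (nhds 0) := by
    have h := tendsto_rpow_neg_atTop (y := e) (by linarith)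
    have := ((h.const_mul C).mul_const |b - a|).const_mul 2
    simpa using this
  have hdiff : Tendsto (fun T : ℝ => (∫ t in -T..id T, f (b + t * I)) - ∫ t in -T..id T, f (a + t * I))
      atTop (nhds 0) := by
    refine squeeze_zero_norm' ?_ hz
    filter_upwards [eventually_ge_atTop (1 : ℝ)] with T hT
    have hrect := integral_boundary_rect_eq_zero_of_differentiableOn f
      ((a : ℂ) + (-T : ℝ) * I) ((b : ℂ) + (T : ℝ) * I) (hf.mono ?_)
    · simp only [add_re, ofReal_re, mul_re, I_re, mul_zero, ofReal_im, I_im, mul_one, sub_self, add_zero,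
        add_im, mul_im, zero_add] at hrect
      have hn : ∀ u : ℝ, |u| = T → ‖∫ x in a..b, f (x + u * I)‖ ≤ C * T ^ (-e) * |b - a| := by
        intro u hu
        refine intervalIntegral.norm_integral_le_of_norm_le_const fun x hx => ?_
        rw [Set.uIoc_of_le hab] at hx
        have := hb x u hx.1.le hx.2 (hu ▸ hT)
        rwa [hu] at this
      have h1 := hn T (abs_of_nonneg (by linarith))
      have h2 := hn (-T) (by rw [abs_neg, abs_of_nonneg (by linarith)])
      have h3 : I * ((∫ t in -T..T, f (b + t * I)) - ∫ t in -T..T, f (a + t * I)) =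
          (∫ x in a..b, f (x + (T : ℝ) * I)) - ∫ x in a..b, f (x + ((-T : ℝ) : ℂ) * I) := by
        simp only [smul_eq_mul] at hrect
        linear_combination hrect
      have h4 : ‖(∫ t in -T..T, f (b + t * I)) - ∫ t in -T..T, f (a + t * I)‖ =
          ‖(∫ x in a..b, f (x + (T : ℝ) * I)) - ∫ x in a..b, f (x + ((-T : ℝ) : ℂ) * I)‖ := by
        rw [← h3, norm_mul, norm_I, one_mul]
      change ‖(∫ t in -T..T, f (b + t * I)) - ∫ t in -T..T, f (a + t * I)‖ ≤ _
      rw [h4]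
      refine (norm_sub_le _ _).trans ?_
      linarith
    · intro s hs
      have h1 := hs.1
      simp only [add_re, ofReal_re, mul_re, I_re, mul_zero, ofReal_im, I_im, mul_one, sub_self, add_zero,
        Set.mem_preimage] at h1
      rw [Set.uIcc_of_le hab] at h1
      exact ha.trans_le h1.1
  have := tendsto_nhds_unique hdiff (tb.sub ta)
  exact (sub_eq_zero.1 this.symm).symm

lemma HasMellin.fun_add {f g : ℝ → ℂ} {s a b : ℂ} (hf : HasMellin f s a) (hg : HasMellin g s b) :
    HasMellin (fun t => f t + g t) s (a + b) := by
  have := hasMellin_add hf.1 hg.1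
  rwa [hf.2, hg.2] at this

lemma HasMellin.fun_const_mul {f : ℝ → ℂ} {s a : ℂ} (hf : HasMellin f s a) (c : ℂ) :
    HasMellin (fun t => c * f t) s (c * a) := by
  have := hasMellin_const_smul hf.1 c
  rwa [hf.2] at this

lemma HasMellin.congr_pos {f g : ℝ → ℂ} {s a : ℂ} (hf : HasMellin f s a)
    (h : ∀ t, 0 < t → f t = g t) : HasMellin g s a := by
  have he : Set.EqOn (fun t : ℝ => (t : ℂ) ^ (s - 1) • f t) (fun t : ℝ => (t : ℂ) ^ (s - 1) • g t)
      (Ioi 0) := fun t ht => by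
    change (t : ℂ) ^ (s - 1) • f t = (t : ℂ) ^ (s - 1) • g t
    rw [h t ht]
  refine ⟨hf.1.congr_fun he measurableSet_Ioi, ?_⟩
  rw [← hf.2, mellin, mellin, setIntegral_congr_fun measurableSet_Ioi he]

lemma hasMellin_log_Ioc {s : ℂ} (hs : 0 < s.re) :
    HasMellin (fun t : ℝ => (log t) • (Set.indicator (Set.Ioc 0 1) (fun _ => 1 : ℝ → ℂ) t)) s
      (-(1 / s ^ 2)) := by
  have hi : Integrable (Set.indicator (Set.Ioc (0 : ℝ) 1) (fun _ => (1 : ℂ))) :=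
    (integrable_indicator_iff measurableSet_Ioc).2 (integrableOn_const (by simp))
  have h := mellin_hasDerivAt_of_isBigO_rpow (a := s.re + 1) (b := 0)
    (f := Set.indicator (Set.Ioc (0 : ℝ) 1) (fun _ => (1 : ℂ))) (s := s)
    (hi.locallyIntegrable.locallyIntegrableOn _) ?_ (by linarith) ?_ hs
  · refine ⟨h.1, ?_⟩
    refine h.2.unique ?_
    have h2 : HasDerivAt (fun z : ℂ => 1 / z) (-(1 / s ^ 2)) s := by
      have hs0 : s ≠ 0 := by rintro rfl; simp at hs
      have := hasDerivAt_inv hs0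
      simp only [one_div]
      exact this
    refine h2.congr_of_eventuallyEq ?_
    have ho : IsOpen {z : ℂ | 0 < z.re} := isOpen_lt continuous_const continuous_re
    filter_upwards [ho.mem_nhds hs] with z hz
    exact (hasMellin_one_Ioc hz).2
  · refine IsBigO.of_bound 1 ?_
    filter_upwards [eventually_gt_atTop (1 : ℝ)] with t ht
    rw [indicator_of_notMem (fun h => absurd h.2 (not_le.2 ht)), norm_zero]
    positivity
  · refine IsBigO.of_bound 1 (Eventually.of_forall fun t => ?_)
    rw [neg_zero, Real.rpow_zero, norm_one, mul_one]
    refine (norm_indicator_le_norm_self _ _).trans ?_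
    simp

/-- The Mellin transform of `log t / t` on `(0, 1]`. -/
lemma hasMellin_log_div_Ioc {s : ℂ} (hs : 1 < s.re) :
    HasMellin (fun t : ℝ => (t : ℂ) ^ (-1 : ℂ) •
      ((log t) • (Set.indicator (Set.Ioc 0 1) (fun _ => 1 : ℝ → ℂ) t))) s (-(1 / (s - 1) ^ 2)) := by
  have h := hasMellin_log_Ioc (s := s + (-1)) (by simp; linarith)
  refine ⟨MellinConvergent.cpow_smul.2 h.1, ?_⟩
  rw [mellin_cpow_smul, h.2, sub_eq_add_neg]

/-- The tent function `max (1 - u) 0`. -/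
lemma hasMellin_tent {s : ℂ} (hs : 0 < s.re) :
    HasMellin (fun u : ℝ => ((max (1 - u) 0 : ℝ) : ℂ)) s (1 / (s * (s + 1))) := by
  have h0 : s ≠ 0 := by rintro rfl; simp at hs
  have h1 : s + 1 ≠ 0 := by
    intro h
    have := congrArg re h
    simp at this
    linarith
  have h := ((hasMellin_cpow_Ioc 0 (s := s) (by simpa using hs)).fun_add
    ((hasMellin_cpow_Ioc 1 (s := s) (by simp; linarith)).fun_const_mul (-1)))
  have h2 : 1 / (s + 0) + -1 * (1 / (s + 1)) = 1 / (s * (s + 1)) := by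
    rw [add_zero]; field_simp; ring
  rw [h2] at h
  refine h.congr_pos fun t ht => ?_
  by_cases h1 : t ≤ 1
  · have hm : t ∈ Set.Ioc (0 : ℝ) 1 := ⟨ht, h1⟩
    rw [Set.indicator_of_mem hm, Set.indicator_of_mem hm, max_eq_left (by linarith), cpow_zero,
      cpow_one]
    push_cast
    ring
  · have h2 : t ∉ Set.Ioc (0 : ℝ) 1 := fun h => h1 h.2
    rw [indicator_of_notMem h2, indicator_of_notMem h2, max_eq_right (by linarith)]
    simp

/-- The function with Mellin transform `K / ((s-1)² s (s+1)) + c / ((s-1) s (s+1))`. -/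
noncomputable def polarTent (K c u : ℝ) : ℝ :=
  if u ≤ 1 then K * (-(u⁻¹ * log u) / 2 - 3 / 4 * u⁻¹ + 1 - u / 4) + c * ((u⁻¹ - 2 + u) / 2) else 0

lemma hasMellin_polarTent (K c : ℝ) {s : ℂ} (hs : 1 < s.re) :
    HasMellin (fun u : ℝ => ((polarTent K c u : ℝ) : ℂ)) s
      ((K / (s - 1) ^ 2 + c / (s - 1)) / (s * (s + 1))) := by
  have h0 : s ≠ 0 := by rintro rfl; simp at hs; linarith
  have h1 : s + 1 ≠ 0 := by
    intro h
    have := congrArg re h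
    simp at this
    linarith
  have h2 : s - 1 ≠ 0 := by
    intro h
    have := congrArg re h
    simp at this
    linarith
  have e1 := hasMellin_cpow_Ioc 0 (s := s) (by simp; linarith)
  have e2 := hasMellin_cpow_Ioc 1 (s := s) (by simp; linarith)
  have e3 := hasMellin_cpow_Ioc (-1) (s := s) (by simp; linarith)
  have e4 := hasMellin_log_div_Ioc hs
  have h := ((e4.fun_const_mul (-(K / 2))).fun_add (e3.fun_const_mul (-(3 / 4) * K + c / 2))).fun_add
    ((e1.fun_const_mul (K - c)).fun_add (e2.fun_const_mul (-(K / 4) + c / 2)))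
  have h3 : -((K : ℂ) / 2) * -(1 / (s - 1) ^ 2) + (-(3 / 4) * (K : ℂ) + c / 2) * (1 / (s + -1)) +
      (((K : ℂ) - c) * (1 / (s + 0)) + (-((K : ℂ) / 4) + c / 2) * (1 / (s + 1))) =
      (K / (s - 1) ^ 2 + c / (s - 1)) / (s * (s + 1)) := by
    rw [← sub_eq_add_neg, add_zero]
    field_simp
    ring
  rw [h3] at h
  refine h.congr_pos fun t ht => ?_
  by_cases h1 : t ≤ 1
  · have hm : t ∈ Set.Ioc (0 : ℝ) 1 := ⟨ht, h1⟩
    rw [Set.indicator_of_mem hm, Set.indicator_of_mem hm, Set.indicator_of_mem hm,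
      Set.indicator_of_mem hm, cpow_zero, cpow_one, cpow_neg_one, polarTent, if_pos h1]
    simp only [smul_eq_mul, real_smul]
    push_cast
    ring
  · have h2 : t ∉ Set.Ioc (0 : ℝ) 1 := fun h => h1 h.2
    rw [indicator_of_notMem h2, indicator_of_notMem h2, indicator_of_notMem h2,
      indicator_of_notMem h2, polarTent, if_neg h1]
    simp

lemma norm_le_line (σ y : ℝ) : |y| ≤ ‖(σ : ℂ) + y * I‖ := by
  have := abs_im_le_norm ((σ : ℂ) + y * I)
  simpa using this

lemma line_ne_zero {σ : ℝ} (hσ : 0 < σ) (y : ℝ) : (σ : ℂ) + y * I ≠ 0 := by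
  intro h
  have := congrArg re h
  simp at this
  linarith

lemma line_add_one_ne_zero {σ : ℝ} (hσ : 0 < σ) (y : ℝ) : (σ : ℂ) + y * I + 1 ≠ 0 := by
  intro h
  have := congrArg re h
  simp at this
  linarith

lemma norm_line_mul_ge (σ y : ℝ) : |y| ^ 2 ≤ ‖((σ : ℂ) + y * I) * ((σ : ℂ) + y * I + 1)‖ := by
  rw [norm_mul, sq]
  have h := norm_le_line (σ + 1) y
  have e : ((σ + 1 : ℝ) : ℂ) + y * I = (σ : ℂ) + y * I + 1 := by push_cast; ring
  rw [e] at h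
  exact mul_le_mul (norm_le_line σ y) h (abs_nonneg _) (norm_nonneg _)

lemma integrable_kernel {σ : ℝ} (hσ : 0 < σ) {g : ℝ → ℂ} (hg : Continuous g) {B : ℝ}
    (hB : ∀ y, ‖g y‖ ≤ B) :
    Integrable fun y : ℝ => g y / (((σ : ℂ) + y * I) * ((σ : ℂ) + y * I + 1)) := by
  have hB0 : 0 ≤ B := (norm_nonneg _).trans (hB 0)
  refine integrable_of_norm_le_rpow (C := B) (e := 2) ?_ hB0 (by norm_num) fun y hy => ?_
  · exact hg.div (by fun_prop) fun y => mul_ne_zero (line_ne_zero hσ y) (line_add_one_ne_zero hσ y)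
  · rw [norm_div, rpow_neg (abs_nonneg y), rpow_two, ← div_eq_mul_inv]
    have : 0 < |y| ^ 2 := by positivity
    exact div_le_div₀ hB0 (hB y) this (norm_line_mul_ge σ y)

lemma tent_inversion {u : ℝ} (hu : 0 < u) :
    ((max (1 - u) 0 : ℝ) : ℂ) = (1 / (2 * pi)) • ∫ y : ℝ, (u : ℂ) ^ (-((2 : ℝ) + y * I : ℂ)) •
      (1 / (((2 : ℝ) + y * I : ℂ) * (((2 : ℝ) + y * I : ℂ) + 1))) := by
  have hm : ∀ y : ℝ, mellin (fun u : ℝ => ((max (1 - u) 0 : ℝ) : ℂ)) ((2 : ℝ) + y * I) =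
      1 / (((2 : ℝ) + y * I : ℂ) * (((2 : ℝ) + y * I : ℂ) + 1)) := fun y =>
    (hasMellin_tent (by simp)).2
  have h := mellinInv_mellin_eq 2 (fun u : ℝ => ((max (1 - u) 0 : ℝ) : ℂ)) hu
    (hasMellin_tent (by simp)).1 ?_ (by fun_prop)
  · rw [← h, mellinInv]
    simp_rw [hm]
  · rw [VerticalIntegrable]
    simp_rw [hm]
    exact integrable_kernel (B := 1) (by norm_num) continuous_const (by simp)

lemma polarTent_continuousAt (K c : ℝ) {u : ℝ} (hu : 0 < u) : ContinuousAt (polarTent K c) u := by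
  have h1 : polarTent K c = (fun v : ℝ => K * (-(v⁻¹ * log v) / 2 - 3 / 4 * v⁻¹ + 1 - v / 4) +
      c * ((v⁻¹ - 2 + v) / 2)) ∘ fun u => min u 1 := by
    funext v
    simp only [polarTent, Function.comp]
    split_ifs with h
    · rw [min_eq_left h]
    · rw [min_eq_right (le_of_not_ge h)]
      norm_num
  rw [h1]
  have hp : (0 : ℝ) < min u 1 := lt_min hu one_pos
  refine ContinuousAt.comp (f := fun u : ℝ => min u 1) (x := u) ?_ (by fun_prop)
  have h2 : ContinuousAt log (min u 1) := Real.continuousAt_log hp.ne'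
  have h3 : ContinuousAt (fun v : ℝ => v⁻¹) (min u 1) := continuousAt_inv₀ hp.ne'
  fun_prop

lemma polarTent_inversion (K c : ℝ) {u : ℝ} (hu : 0 < u) :
    ((polarTent K c u : ℝ) : ℂ) = (1 / (2 * pi)) • ∫ y : ℝ, (u : ℂ) ^ (-((2 : ℝ) + y * I : ℂ)) •
      ((K / (((2 : ℝ) + y * I : ℂ) - 1) ^ 2 + c / (((2 : ℝ) + y * I : ℂ) - 1)) /
        (((2 : ℝ) + y * I : ℂ) * (((2 : ℝ) + y * I : ℂ) + 1))) := by
  have hm : ∀ y : ℝ, mellin (fun u : ℝ => ((polarTent K c u : ℝ) : ℂ)) ((2 : ℝ) + y * I) =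
      ((K / (((2 : ℝ) + y * I : ℂ) - 1) ^ 2 + c / (((2 : ℝ) + y * I : ℂ) - 1)) /
        (((2 : ℝ) + y * I : ℂ) * (((2 : ℝ) + y * I : ℂ) + 1))) := fun y =>
    (hasMellin_polarTent K c (by simp)).2
  have h := mellinInv_mellin_eq 2 (fun u : ℝ => ((polarTent K c u : ℝ) : ℂ)) hu
    (hasMellin_polarTent K c (by simp)).1 ?_
    (continuous_ofReal.continuousAt.comp (polarTent_continuousAt K c hu))
  · rw [← h, mellinInv]
    simp_rw [hm]
  · rw [VerticalIntegrable]
    simp_rw [hm]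
    have e : ∀ y : ℝ, ((2 : ℝ) + y * I : ℂ) - 1 = ((1 : ℝ) : ℂ) + y * I := fun y => by push_cast; ring
    simp_rw [e]
    have hne : ∀ y : ℝ, ((1 : ℝ) : ℂ) + y * I ≠ 0 := line_ne_zero one_pos
    refine integrable_kernel (B := |K| + |c|) (by norm_num) ?_ fun y => ?_
    · exact (continuous_const.div (by fun_prop) fun y => pow_ne_zero 2 (hne y)).add
        (continuous_const.div (by fun_prop) hne)
    · have h1 : 1 ≤ ‖((1 : ℝ) : ℂ) + y * I‖ := by
        have := abs_re_le_norm (((1 : ℝ) : ℂ) + y * I)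
        simpa using this
      refine (norm_add_le _ _).trans ?_
      rw [norm_div, norm_div, norm_pow, norm_real, norm_real, norm_eq_abs,
        norm_eq_abs]
      exact add_le_add (div_le_self (abs_nonneg _) (one_le_pow₀ h1)) (div_le_self (abs_nonneg _) h1)

/-- `∑ aa(n) (X - n)₊`. -/
noncomputable def smoothSum (X : ℝ) : ℝ := ∑' n : ℕ, (aa n : ℝ) * max (X - n) 0

/-- `X^(s+1) / (s (s+1))`. -/
noncomputable def rieszKernel (X : ℝ) (s : ℂ) : ℂ := (X : ℂ) ^ (s + 1) / (s * (s + 1))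

lemma inv_cpow_neg_ofReal {X : ℝ} (hX : 0 < X) (s : ℂ) : ((X⁻¹ : ℝ) : ℂ) ^ (-s) = (X : ℂ) ^ s := by
  rw [ofReal_inv, inv_cpow _ _ (by rw [arg_ofReal_of_nonneg hX.le]; exact pi_pos.ne), cpow_neg,
    inv_inv]

lemma mul_inv_cpow_kernel {X : ℝ} (hX : 0 < X) (s : ℂ) :
    (X : ℂ) * (((X⁻¹ : ℝ) : ℂ) ^ (-s) * (1 / (s * (s + 1)))) = rieszKernel X s := by
  have h : (X : ℂ) ≠ 0 := ofReal_ne_zero.2 hX.ne'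
  rw [inv_cpow_neg_ofReal hX, rieszKernel, cpow_add _ _ h, cpow_one]
  ring

lemma integrable_rieszKernel {σ : ℝ} (hσ : 0 < σ) {X : ℝ} (hX : 0 < X) {g : ℝ → ℂ} (hg : Continuous g)
    {B : ℝ} (hB : ∀ y, ‖g y‖ ≤ B) :
    Integrable fun y : ℝ => g y * rieszKernel X (σ + y * I) := by
  have h : (X : ℂ) ≠ 0 := ofReal_ne_zero.2 hX.ne'
  have hc : Continuous fun y : ℝ => (X : ℂ) ^ ((σ : ℂ) + y * I + 1) :=
    Continuous.const_cpow (by fun_prop) (Or.inl h)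
  have hgc : Continuous fun y : ℝ => g y * (X : ℂ) ^ ((σ : ℂ) + y * I + 1) := hg.mul hc
  refine (integrable_kernel hσ hgc (B := B * X ^ (σ + 1)) fun y => ?_).congr
    (Eventually.of_forall fun y => ?_)
  · rw [norm_mul, norm_cpow_eq_rpow_re_of_pos hX]
    simp only [add_re, ofReal_re, mul_re, I_re, mul_zero, ofReal_im, I_im, mul_one, sub_self, add_zero,
      one_re]
    exact mul_le_mul_of_nonneg_right (hB y) (by positivity)
  · simp only [rieszKernel]
    ring

lemma term_aa_integral {X : ℝ} (hX : 0 < X) (n : ℕ) :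
    (1 / (2 * pi)) • ∫ y : ℝ, LSeries.term (fun n => (aa n : ℂ)) ((2 : ℝ) + y * I) n *
      rieszKernel X ((2 : ℝ) + y * I) = (((aa n : ℝ) * max (X - n) 0 : ℝ) : ℂ) := by
  rcases Nat.eq_zero_or_pos n with rfl | hn
  · simp [LSeries.term_zero]
  · have hn' : (0 : ℝ) < n := by exact_mod_cast hn
    have hu : 0 < (n : ℝ) * X⁻¹ := by positivity
    have h1 : (max (X - n) 0 : ℝ) = X * max (1 - (n : ℝ) * X⁻¹) 0 := by
      rw [mul_max_of_nonneg _ _ hX.le, mul_zero]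
      congr 1
      field_simp
    have h2 : ∀ y : ℝ, LSeries.term (fun n => (aa n : ℂ)) ((2 : ℝ) + y * I) n *
        rieszKernel X ((2 : ℝ) + y * I) = ((aa n : ℂ) * X) *
        ((((n : ℝ) * X⁻¹ : ℝ) : ℂ) ^ (-((2 : ℝ) + y * I : ℂ)) •
          (1 / (((2 : ℝ) + y * I : ℂ) * (((2 : ℝ) + y * I : ℂ) + 1)))) := by
      intro y
      rw [LSeries.term_of_ne_zero hn.ne', ofReal_mul, mul_cpow_ofReal_nonneg hn'.le (by positivity),
        ← mul_inv_cpow_kernel hX, div_eq_mul_inv, ← cpow_neg, smul_eq_mul, ofReal_natCast]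
      ring
    simp_rw [h2]
    rw [integral_const_mul, ← mul_smul_comm, ← tent_inversion hu, h1]
    push_cast
    ring

lemma continuous_lseries_aa_line : Continuous fun y : ℝ => LSeries (fun n => (aa n : ℂ)) ((2 : ℝ) + y * I) := by
  refine continuous_iff_continuousAt.2 fun y => ?_
  have h1 : LSeries.abscissaOfAbsConv (fun n => (aa n : ℂ)) ≤ ((1 : ℝ) : EReal) :=
    LSeries.abscissaOfAbsConv_le_of_forall_lt_LSeriesSummable fun z hz =>
      lseriesSummable_aa (by simpa using hz)
  have hs : LSeries.abscissaOfAbsConv (fun n => (aa n : ℂ)) < (((2 : ℝ) + y * I : ℂ).re : EReal) := by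
    refine h1.trans_lt ?_
    have : (1 : ℝ) < ((2 : ℝ) + y * I : ℂ).re := by simp
    exact_mod_cast this
  have h2 := (LSeries_analyticOnNhd (fun n => (aa n : ℂ)) _ hs).continuousAt
  exact ContinuousAt.comp (f := fun y : ℝ => ((2 : ℝ) : ℂ) + y * I) (x := y) h2 (by fun_prop)

lemma norm_term_aa_line (y : ℝ) (n : ℕ) : ‖LSeries.term (fun n => (aa n : ℂ)) ((2 : ℝ) + y * I) n‖ =
    ‖LSeries.term (fun n => (aa n : ℂ)) ((2 : ℝ) : ℂ) n‖ := by
  rw [LSeries.norm_term_eq, LSeries.norm_term_eq]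
  simp

lemma summable_norm_term_aa : Summable fun n => ‖LSeries.term (fun n => (aa n : ℂ)) ((2 : ℝ) : ℂ) n‖ :=
  (lseriesSummable_aa (s := ((2 : ℝ) : ℂ)) (by simp)).norm

lemma continuous_term_aa (n : ℕ) :
    Continuous fun y : ℝ => LSeries.term (fun n => (aa n : ℂ)) ((2 : ℝ) + y * I) n := by
  rcases Nat.eq_zero_or_pos n with rfl | hn
  · simp only [LSeries.term_zero]; exact continuous_const
  · simp only [LSeries.term_of_ne_zero hn.ne']
    have h : (n : ℂ) ≠ 0 := by exact_mod_cast hn.ne'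
    refine continuous_const.div (Continuous.const_cpow (by fun_prop) (Or.inl h)) fun y => ?_
    exact (cpow_ne_zero_iff_of_exponent_ne_zero (line_ne_zero two_pos y)).2 h

lemma smoothSum_eq_integral {X : ℝ} (hX : 0 < X) :
    Integrable (fun y : ℝ => LSeries (fun n => (aa n : ℂ)) ((2 : ℝ) + y * I) *
      rieszKernel X ((2 : ℝ) + y * I)) ∧
    ((smoothSum X : ℝ) : ℂ) = (1 / (2 * pi)) • ∫ y : ℝ,
      LSeries (fun n => (aa n : ℂ)) ((2 : ℝ) + y * I) * rieszKernel X ((2 : ℝ) + y * I) := by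
  have hB : ∀ y : ℝ, ‖LSeries (fun n => (aa n : ℂ)) ((2 : ℝ) + y * I)‖ ≤
      ∑' n, ‖LSeries.term (fun n => (aa n : ℂ)) ((2 : ℝ) : ℂ) n‖ := fun y =>
    tsum_of_norm_bounded summable_norm_term_aa.hasSum fun n => (norm_term_aa_line y n).le
  have hi : ∀ n, Integrable fun y : ℝ => LSeries.term (fun n => (aa n : ℂ)) ((2 : ℝ) + y * I) n *
      rieszKernel X ((2 : ℝ) + y * I) := fun n =>
    integrable_rieszKernel two_pos hX (continuous_term_aa n) fun y => (norm_term_aa_line y n).le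
  refine ⟨integrable_rieszKernel two_pos hX continuous_lseries_aa_line hB, ?_⟩
  have hs : Summable fun n => ∫ y : ℝ, ‖LSeries.term (fun n => (aa n : ℂ)) ((2 : ℝ) + y * I) n *
      rieszKernel X ((2 : ℝ) + y * I)‖ := by
    refine (summable_norm_term_aa.mul_right (∫ y : ℝ, ‖rieszKernel X ((2 : ℝ) + y * I)‖)).congr
      fun n => ?_
    simp_rw [norm_mul, norm_term_aa_line]
    rw [integral_const_mul]
  have h := (hasSum_integral_of_summable_integral_norm hi hs).const_smul (1 / (2 * pi))
  simp_rw [term_aa_integral hX] at h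
  have h2 : ∀ y : ℝ, ∑' n, LSeries.term (fun n => (aa n : ℂ)) ((2 : ℝ) + y * I) n *
      rieszKernel X ((2 : ℝ) + y * I) = LSeries (fun n => (aa n : ℂ)) ((2 : ℝ) + y * I) *
      rieszKernel X ((2 : ℝ) + y * I) := fun y => tsum_mul_right
  simp_rw [h2] at h
  rw [← h.tsum_eq, smoothSum, ofReal_tsum]

lemma polar_eq_integral (K c : ℝ) {X : ℝ} (hX : 0 < X) :
    ((X * polarTent K c X⁻¹ : ℝ) : ℂ) = (1 / (2 * pi)) • ∫ y : ℝ,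
      (K / (((2 : ℝ) + y * I : ℂ) - 1) ^ 2 + c / (((2 : ℝ) + y * I : ℂ) - 1)) *
        rieszKernel X ((2 : ℝ) + y * I) := by
  rw [ofReal_mul, polarTent_inversion K c (inv_pos.2 hX), mul_smul_comm,
    ← integral_const_mul]
  congr 2
  ext y
  rw [← mul_inv_cpow_kernel hX, smul_eq_mul]
  ring

lemma integrable_polar_line (K c : ℝ) {X : ℝ} (hX : 0 < X) :
    Integrable fun y : ℝ =>
      (K / (((2 : ℝ) + y * I : ℂ) - 1) ^ 2 + c / (((2 : ℝ) + y * I : ℂ) - 1)) *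
        rieszKernel X ((2 : ℝ) + y * I) := by
  have h0 : ∀ y : ℝ, 1 ≤ ‖((2 : ℝ) + y * I : ℂ) - 1‖ := fun y => by
    have := abs_re_le_norm (((2 : ℝ) + y * I : ℂ) - 1)
    norm_num at this
    exact_mod_cast this
  have h1 : ∀ y : ℝ, ((2 : ℝ) + y * I : ℂ) - 1 ≠ 0 := fun y =>
    norm_pos_iff.1 (one_pos.trans_le (h0 y))
  refine integrable_rieszKernel two_pos hX (B := |K| + |c|) ?_ fun y => ?_
  · exact (continuous_const.div (by fun_prop) fun y => pow_ne_zero 2 (h1 y)).add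
      (continuous_const.div (by fun_prop) h1)
  · refine (norm_add_le _ _).trans (add_le_add ?_ ?_)
    · rw [norm_div, norm_pow, norm_real, norm_eq_abs]
      exact div_le_self (abs_nonneg _) (one_le_pow₀ (h0 y))
    · rw [norm_div, norm_real, norm_eq_abs]
      exact div_le_self (abs_nonneg _) (h0 y)

lemma continuous_FF_line {σ : ℝ} (hσ : 1 / 2 < σ) : Continuous fun t : ℝ => FF (σ + t * I) :=
  FF_differentiableOn.continuousOn.comp_continuous (by fun_prop) fun t => by
    change (1 : ℝ) / 2 < ((σ : ℂ) + t * I).re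
    simpa using hσ

lemma norm_ofReal_cpow_line {X : ℝ} (hX : 0 < X) (σ t : ℝ) :
    ‖(X : ℂ) ^ ((σ : ℂ) + t * I + 1)‖ = X ^ (σ + 1) := by
  rw [norm_cpow_eq_rpow_re_of_pos hX]
  simp

lemma norm_FF_mul_rieszKernel_le {σ0 : ℝ} (hσ0 : 1 / 2 < σ0) {X : ℝ} (hX : 0 < X) : ∃ C, 0 ≤ C ∧
    ∀ σ t : ℝ, σ0 ≤ σ → σ ≤ 2 → 1 ≤ |t| →
      ‖FF (σ + t * I) * rieszKernel X (σ + t * I)‖ ≤ C * |t| ^ (-(27 / 25) : ℝ) := by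
  obtain ⟨C, hC, h⟩ := norm_FF_strip_le hσ0
  refine ⟨C * max X 1 ^ (3 : ℝ), by positivity, fun σ t h1 h2 ht => ?_⟩
  have ht0 : 0 < |t| := one_pos.trans_le ht
  have hx : X ^ (σ + 1) ≤ max X 1 ^ (3 : ℝ) :=
    (rpow_le_rpow hX.le (le_max_left X 1) (by linarith)).trans
      (rpow_le_rpow_of_exponent_le (le_max_right X 1) (by linarith))
  rw [norm_mul, rieszKernel, norm_div, norm_ofReal_cpow_line hX]
  have e : |t| ^ (-(27 / 25) : ℝ) = |t| ^ (23 / 25 : ℝ) / |t| ^ 2 := by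
    rw [← rpow_two, ← Real.rpow_sub ht0]; norm_num
  rw [e]
  calc _ ≤ (C * |t| ^ (23 / 25 : ℝ)) * (max X 1 ^ (3 : ℝ) / |t| ^ 2) := by
        refine mul_le_mul (h σ t h1 h2 ht) ?_ (by positivity) (by positivity)
        exact div_le_div₀ (by positivity) hx (by positivity) (norm_line_mul_ge σ t)
    _ = _ := by ring

lemma integrable_FF_mul_rieszKernel {σ : ℝ} (hσ : 1 / 2 < σ) (hσ2 : σ ≤ 2) {X : ℝ} (hX : 0 < X) :
    Integrable fun t : ℝ => FF (σ + t * I) * rieszKernel X (σ + t * I) := by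
  obtain ⟨C, hC, h⟩ := norm_FF_mul_rieszKernel_le hσ hX
  refine integrable_of_norm_le_rpow (e := 27 / 25) ?_ hC (by norm_num) fun t ht => h σ t le_rfl hσ2 ht
  have hσ0 : 0 < σ := by linarith
  refine (continuous_FF_line hσ).mul ((Continuous.const_cpow (by fun_prop)
    (Or.inl (ofReal_ne_zero.2 hX.ne'))).div (by fun_prop) fun y =>
      mul_ne_zero (line_ne_zero hσ0 y) (line_add_one_ne_zero hσ0 y))

/-- The error of the smoothed sum as an integral over any line to the right of `1/2`. -/
lemma smoothSum_sub_polar_eq {K c : ℝ} (hK : (K : ℂ) = qq 1) (hc : (c : ℂ) = deriv qq 1) {σ : ℝ}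
    (hσ : 1 / 2 < σ) (hσ2 : σ ≤ 2) {X : ℝ} (hX : 0 < X) :
    ((smoothSum X - X * polarTent K c X⁻¹ : ℝ) : ℂ) = (1 / (2 * pi)) •
      ∫ t : ℝ, FF (σ + t * I) * rieszKernel X (σ + t * I) := by
  obtain ⟨hi, he⟩ := smoothSum_eq_integral hX
  obtain ⟨C, hC, hb⟩ := norm_FF_mul_rieszKernel_le hσ hX
  rw [integral_vertical_shift (f := fun s => FF s * rieszKernel X s) hσ hσ2 hC
    (by norm_num : (1 : ℝ) < 27 / 25) ?_ hb, ofReal_sub, he, polar_eq_integral K c hX, ← smul_sub,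
    ← integral_sub hi (integrable_polar_line K c hX)]
  · congr 2
    ext y
    have h1 : 1 < ((2 : ℝ) + y * I : ℂ).re := by simp
    have h2 : ((2 : ℝ) + y * I : ℂ) ≠ 1 := fun h => by rw [h] at h1; simp at h1
    rw [← sub_mul, lseries_aa h1, FF_of_ne h2, hK, hc]
    ring
  · refine FF_differentiableOn.mul fun s hs => DifferentiableAt.differentiableWithinAt ?_
    have hs0 : (0 : ℝ) < s.re := lt_trans (by norm_num) (show (1 : ℝ) / 2 < s.re from hs)
    have h1 : s ≠ 0 := fun h => by simp [h] at hs0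
    have h2 : s + 1 ≠ 0 := fun h => by
      have := congrArg re h
      simp at this
      linarith
    exact DifferentiableAt.div (DifferentiableAt.const_cpow (by fun_prop)
      (Or.inl (ofReal_ne_zero.2 hX.ne'))) (by fun_prop) (mul_ne_zero h1 h2)

lemma norm_rieszKernel_sub_le {σ t X h : ℝ} (hσ : 0 < σ) (hX : 0 < X) (hh : 0 ≤ h) :
    ‖rieszKernel (X + h) (σ + t * I) - rieszKernel X (σ + t * I)‖ ≤
      (X + h) ^ σ * h / ‖(σ : ℂ) + t * I‖ := by
  set s : ℂ := σ + t * I with hs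
  have hs1 : s + 1 ≠ 0 := line_add_one_ne_zero hσ t
  have hs0 : s ≠ 0 := line_ne_zero hσ t
  have hn : 0 < ‖s + 1‖ := norm_pos_iff.2 hs1
  have hn0 : 0 < ‖s‖ := norm_pos_iff.2 hs0
  have key := Convex.norm_image_sub_le_of_norm_hasDerivWithin_le (𝕜 := ℝ)
    (f := fun y : ℝ => (y : ℂ) ^ (s + 1)) (f' := fun y : ℝ => (s + 1) * (y : ℂ) ^ (s + 1 - 1))
    (s := Set.Icc X (X + h)) (x := X) (y := X + h) (C := ‖s + 1‖ * (X + h) ^ σ)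
    (fun y hy => (hasDerivAt_ofReal_cpow_const (hX.trans_le hy.1).ne' hs1).hasDerivWithinAt)
    (fun y hy => by
      have hy0 : 0 < y := hX.trans_le hy.1
      rw [norm_mul, add_sub_cancel_right, norm_cpow_eq_rpow_re_of_pos hy0]
      refine mul_le_mul_of_nonneg_left ?_ hn.le
      have : s.re = σ := by simp [hs]
      rw [this]
      exact rpow_le_rpow hy0.le hy.2 hσ.le)
    (convex_Icc _ _) ⟨le_rfl, by linarith⟩ ⟨by linarith, le_rfl⟩
  rw [add_sub_cancel_left, norm_eq_abs, abs_of_nonneg hh] at key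
  rw [rieszKernel, rieszKernel, ← sub_div, norm_div, norm_mul, div_le_div_iff₀ (by positivity) hn0]
  calc _ ≤ ‖s + 1‖ * (X + h) ^ σ * h * ‖s‖ := mul_le_mul_of_nonneg_right key hn0.le
    _ = _ := by ring

lemma norm_rieszKernel_sub_le' {σ t X h : ℝ} (hσ : 0 < σ) (hX : 0 < X) (hh : 0 ≤ h) (ht : t ≠ 0) :
    ‖rieszKernel (X + h) (σ + t * I) - rieszKernel X (σ + t * I)‖ ≤
      2 * (X + h) ^ (σ + 1) / |t| ^ 2 := by
  have ht2 : 0 < |t| ^ 2 := by positivity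
  have h1 : ∀ Y : ℝ, 0 < Y → Y ≤ X + h →
      ‖rieszKernel Y (σ + t * I)‖ ≤ (X + h) ^ (σ + 1) / |t| ^ 2 := by
    intro Y hY hYX
    rw [rieszKernel, norm_div, norm_ofReal_cpow_line hY]
    exact div_le_div₀ (by positivity) (rpow_le_rpow hY.le hYX (by linarith)) ht2
      (norm_line_mul_ge σ t)
  refine (norm_sub_le _ _).trans ?_
  rw [mul_div_assoc, two_mul]
  exact add_le_add (h1 _ (by linarith) le_rfl) (h1 _ hX (by linarith))

lemma two_exp_rpow_le {l Y : ℝ} (hl : 2 ≤ l) (hY : 0 ≤ Y) (hYl : Y ≤ 2 * exp l) :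
    Y ^ (1 / 2 + 1 / l) ≤ 6 * exp (l / 2) := by
  have h1 : 1 / l ≤ 1 / 2 := one_div_le_one_div_of_le two_pos hl
  have h2 : 0 < 1 / l := by positivity
  calc Y ^ (1 / 2 + 1 / l) ≤ (2 * exp l) ^ (1 / 2 + 1 / l) :=
        rpow_le_rpow hY hYl (by positivity)
    _ = 2 ^ (1 / 2 + 1 / l) * (exp 1 * exp (l / 2)) := by
        rw [mul_rpow two_pos.le (exp_pos l).le, ← exp_mul, ← exp_add]
        congr 2
        field_simp
        ring
    _ ≤ 2 ^ (1 : ℝ) * (3 * exp (l / 2)) := by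
        refine mul_le_mul (rpow_le_rpow_of_exponent_le one_le_two (by linarith)) ?_
          (by positivity) (by positivity)
        exact mul_le_mul_of_nonneg_right (by linarith [Real.exp_one_lt_d9]) (exp_pos _).le
    _ = _ := by rw [rpow_one]; ring

/-- A dyadic decomposition against the second moment on the line `1/2 + 1/l`. -/
lemma integral_dyadic_le : ∃ C, 0 < C ∧ ∀ l : ℝ, 3 ≤ l → ∀ (C0 : ℝ) (e : ℝ → ℝ), 0 ≤ C0 →
    IntegrableOn e (Ioi 0) →
    (∀ t, 0 < t → t ≤ 3 → e t ≤ C0 * (exp (l / 2) * l ^ 2)) →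
    (∀ t, 3 ≤ t → e t ≤ C0 * (exp (l / 2) / t *
      (‖zK ((1 / 2 + 1 / l : ℝ) + t * I)‖ ^ 2 * ‖HH ((1 / 2 + 1 / l : ℝ) + t * I)‖ + 1))) →
    (∀ t, 3 ≤ t → e t ≤ C0 * (exp l * l ^ 2 * t ^ (-(27 / 25) : ℝ))) →
    ∫ t in Ioi 0, e t ≤ C * (C0 * (exp (l / 2) * l ^ 3 * log l ^ 2)) := by
  obtain ⟨C, hC, hQ⟩ := integral_normSq_zK_HH_le
  refine ⟨11 * (C + 1) + 16, by positivity, fun l hl C0 e hC0 he h1 h2 h3 => ?_⟩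
  have hl0 : 0 < l := by linarith
  have hσ : 1 / 2 < 1 / 2 + 1 / l := by linarith [one_div_pos.2 hl0]
  have hlog : 1 < log l := one_lt_log hl
  set G : ℝ → ℝ := fun t =>
    ‖zK ((1 / 2 + 1 / l : ℝ) + t * I)‖ ^ 2 * ‖HH ((1 / 2 + 1 / l : ℝ) + t * I)‖
  set R := exp (l / 2)
  have hR0 : 0 < R := exp_pos _
  set N := ⌈13 / 2 * l / log 2⌉₊
  have hlog2 : 0 < log 2 := log_pos one_lt_two
  have hNle : (N : ℝ) ≤ 11 * l := by
    have a1 := Nat.ceil_lt_add_one (a := 13 / 2 * l / log 2) (by positivity)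
    have a2 : 13 / 2 * l / log 2 ≤ 10 * l := by
      rw [div_le_iff₀ hlog2]
      nlinarith [Real.log_two_gt_d9]
    linarith
  have hii : ∀ a b : ℝ, 0 ≤ a → a ≤ b → IntervalIntegrable e volume a b := fun a b ha hab =>
    (intervalIntegrable_iff_integrableOn_Ioc_of_le hab).2
      (he.mono_set fun y hy => lt_of_le_of_lt ha hy.1)
  have hl2 : 1 ≤ l ^ 2 := one_le_pow₀ (by linarith)
  have hlg2 : 1 ≤ log l ^ 2 := one_le_pow₀ hlog.le
  have piece : ∀ j < N, ∫ t in (3 * 2 ^ j : ℝ)..3 * 2 ^ (j + 1), e t ≤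
      C0 * R * ((C + 1) * (l ^ 2 * log l ^ 2)) := by
    intro j hj
    set T : ℝ := 3 * 2 ^ j with hT
    have hT3 : 3 ≤ T := by
      have : (1 : ℝ) ≤ 2 ^ j := one_le_pow₀ one_le_two
      linarith
    have hT0 : 0 < T := by linarith
    have e2 : (3 * 2 ^ (j + 1) : ℝ) = 2 * T := by rw [hT, pow_succ]; ring
    have hlT : log T ≤ 7 * l := by
      rw [hT, log_mul (by norm_num) (by positivity), log_pow]
      have b1 : (j : ℝ) < 13 / 2 * l / log 2 := Nat.lt_ceil.1 hj
      rw [lt_div_iff₀ hlog2] at b1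
      have b2 : log 3 ≤ 3 / 2 := by
        rw [Real.log_le_iff_le_exp (by norm_num)]
        have := add_one_le_exp (3 / 2 - 1 : ℝ)
        have := Real.exp_one_gt_d9
        have e3 : exp (3 / 2) = exp 1 * exp (3 / 2 - 1) := by
          rw [← exp_add]; norm_num
        rw [e3]
        nlinarith
      linarith
    have hq := hQ l hl T hT3 hlT
    have hGi : IntervalIntegrable G volume T (2 * T) := intervalIntegrable_zK_HH hT0 hσ
    rw [e2]
    calc ∫ t in T..2 * T, e t ≤ ∫ t in T..2 * T, C0 * (R / T) * (G t + 1) := by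
          refine intervalIntegral.integral_mono_on (by linarith) (hii _ _ hT0.le (by linarith))
            ((hGi.add intervalIntegrable_const).const_mul _) fun t ht => ?_
          refine (h2 t (hT3.trans ht.1)).trans ?_
          rw [mul_assoc C0]
          refine mul_le_mul_of_nonneg_left (mul_le_mul_of_nonneg_right
            (div_le_div_of_nonneg_left hR0.le hT0 ht.1) ?_) hC0
          positivity
      _ = C0 * (R / T) * ((∫ t in T..2 * T, G t) + T) := by
          rw [intervalIntegral.integral_const_mul, intervalIntegral.integral_add hGi
            intervalIntegrable_const, intervalIntegral.integral_const]
          simp only [smul_eq_mul, mul_one]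
          ring
      _ ≤ C0 * (R / T) * (C * (T * l ^ 2 * log l ^ 2) + T * (l ^ 2 * log l ^ 2)) := by
          refine mul_le_mul_of_nonneg_left (add_le_add hq ?_) (by positivity)
          exact le_mul_of_one_le_right hT0.le (one_le_mul_of_one_le_of_one_le hl2 hlg2)
      _ = _ := by field_simp
  set M : ℝ := 3 * 2 ^ N
  have hM3 : 3 ≤ M := by
    have : (1 : ℝ) ≤ 2 ^ N := one_le_pow₀ one_le_two
    linarith
  have hM0 : 0 < M := by linarith
  have hhead : ∫ t in (0 : ℝ)..3, e t ≤ 3 * (C0 * (R * l ^ 2)) := by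
    have := intervalIntegral.integral_mono_on_of_le_Ioo (by norm_num : (0 : ℝ) ≤ 3)
      (hii 0 3 le_rfl (by norm_num)) (intervalIntegrable_const (c := C0 * (R * l ^ 2)))
      fun t ht => h1 t ht.1 ht.2.le
    rwa [intervalIntegral.integral_const, sub_zero, smul_eq_mul] at this
  have hmid : ∫ t in (3 : ℝ)..M, e t ≤ N * (C0 * R * ((C + 1) * (l ^ 2 * log l ^ 2))) := by
    have := intervalIntegral.sum_integral_adjacent_intervals (f := e) (μ := volume)
      (a := fun j : ℕ => (3 * 2 ^ j : ℝ)) (n := N) fun k _ => hii _ _ (by positivity) (by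
        rw [pow_succ]
        have : (0 : ℝ) < 2 ^ k := by positivity
        linarith)
    simp only [pow_zero, mul_one] at this
    rw [← this]
    have := Finset.sum_le_card_nsmul (range N) _ _ fun j hj => piece j (mem_range.1 hj)
    rwa [Finset.card_range, nsmul_eq_mul] at this
  have htail : ∫ t in Ioi M, e t ≤ 25 / 2 * (C0 * (R * l ^ 2)) := by
    have hint : IntegrableOn (fun t : ℝ => C0 * (exp l * l ^ 2 * t ^ (-(27 / 25) : ℝ)))
        (Ioi M) := ((integrableOn_Ioi_rpow_of_lt (by norm_num) hM0).const_mul _).const_mul _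
    refine (setIntegral_mono_on (he.mono_set (Set.Ioi_subset_Ioi hM0.le)) hint measurableSet_Ioi
      fun t ht => h3 t (hM3.trans (le_of_lt ht))).trans ?_
    rw [integral_const_mul, integral_const_mul, integral_Ioi_rpow_of_lt (by norm_num) hM0]
    have hMl : M ^ (-(27 / 25) + 1 : ℝ) ≤ exp (-(l / 2)) := by
      have c1 : exp (13 / 2 * l) ≤ M := by
        have c2 : 13 / 2 * l ≤ N * log 2 := by
          have := Nat.le_ceil (13 / 2 * l / log 2)
          rwa [div_le_iff₀ hlog2] at this
        calc exp (13 / 2 * l) ≤ exp (N * log 2) := exp_le_exp.2 c2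
          _ = 2 ^ N := by rw [mul_comm, exp_mul, exp_log two_pos, rpow_natCast]
          _ ≤ M := by
            have : (0 : ℝ) ≤ 2 ^ N := by positivity
            linarith
      calc M ^ (-(27 / 25) + 1 : ℝ) ≤ exp (13 / 2 * l) ^ (-(27 / 25) + 1 : ℝ) :=
            rpow_le_rpow_of_nonpos (exp_pos _) c1 (by norm_num)
        _ ≤ _ := by
            rw [← exp_mul, exp_le_exp]
            linarith
    have e1 : exp l * exp (-(l / 2)) = R := by rw [← exp_add]; congr 1; ring
    calc _ = 25 / 2 * (C0 * (exp l * l ^ 2 * M ^ (-(27 / 25) + 1 : ℝ))) := by ring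
      _ ≤ 25 / 2 * (C0 * (exp l * l ^ 2 * exp (-(l / 2)))) := by gcongr
      _ = _ := by rw [← e1]; ring
  have hsplit : ∫ t in Ioi (0 : ℝ), e t =
      (∫ t in (0 : ℝ)..3, e t) + (∫ t in (3 : ℝ)..M, e t) + ∫ t in Ioi M, e t := by
    rw [intervalIntegral.integral_add_adjacent_intervals (hii 0 3 le_rfl (by norm_num))
      (hii 3 M (by norm_num) hM3), intervalIntegral.integral_interval_add_Ioi he
      (he.mono_set (Set.Ioi_subset_Ioi hM0.le))]
  rw [hsplit]
  have hX : 0 ≤ C0 * R * (l ^ 2 * log l ^ 2) := by positivity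
  have hY : C0 * (R * l ^ 2) ≤ C0 * (R * l ^ 3 * log l ^ 2) := by
    refine mul_le_mul_of_nonneg_left ?_ hC0
    rw [mul_assoc]
    refine mul_le_mul_of_nonneg_left ?_ hR0.le
    have : l ^ 2 ≤ l ^ 3 := pow_le_pow_right₀ (by linarith) (by norm_num)
    exact this.trans (le_mul_of_one_le_right (by positivity) hlg2)
  have hZ : N * (C0 * R * ((C + 1) * (l ^ 2 * log l ^ 2))) ≤
      11 * (C + 1) * (C0 * (R * l ^ 3 * log l ^ 2)) := by
    calc _ = N * ((C + 1) * (C0 * R * (l ^ 2 * log l ^ 2))) := by ring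
      _ ≤ (11 * l) * ((C + 1) * (C0 * R * (l ^ 2 * log l ^ 2))) :=
        mul_le_mul_of_nonneg_right hNle (by positivity)
      _ = _ := by ring
  nlinarith

lemma norm_zK_le_of_abs_im_le : ∃ Z, 0 < Z ∧ ∀ σ t : ℝ, 1 / 2 ≤ σ → σ ≤ 3 / 4 → |t| ≤ 3 →
    ‖zK (σ + t * I)‖ ≤ Z := by
  have hc : ContinuousOn (fun p : ℝ × ℝ => zK (p.1 + p.2 * I))
      (Set.Icc (1 / 2) (3 / 4) ×ˢ Set.Icc (-3) 3) := by
    intro p hp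
    refine ContinuousAt.continuousWithinAt (ContinuousAt.comp (g := zK)
      (f := fun p : ℝ × ℝ => (p.1 : ℂ) + p.2 * I) (x := p) ?_ (by fun_prop))
    have h1 : (p.1 : ℂ) + p.2 * I ≠ 1 := fun h => by
      have h2 := congrArg re h
      simp at h2
      linarith [hp.1.2]
    exact ((differentiableAt_riemannZeta h1).mul (LL_differentiable _)).continuousAt
  obtain ⟨B, hB⟩ := (isCompact_Icc.prod isCompact_Icc).exists_bound_of_continuousOn hc
  refine ⟨max B 1, by positivity, fun σ t h1 h2 ht => (hB (σ, t) ⟨⟨h1, h2⟩, ?_⟩).trans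
    (le_max_left _ _)⟩
  exact abs_le.1 ht

/-- Short differences of the smoothed error term. -/
lemma smoothSum_sub_polar_diff_le {K c : ℝ} (hK : (K : ℂ) = qq 1) (hc : (c : ℂ) = deriv qq 1) :
    ∃ C, 0 < C ∧ ∀ l : ℝ, 4 ≤ l → ∀ X : ℝ, 0 < X → X + exp (l / 2) ≤ 2 * exp l →
      |(smoothSum (X + exp (l / 2)) -
          (X + exp (l / 2)) * polarTent K c (X + exp (l / 2))⁻¹) -
        (smoothSum X - X * polarTent K c X⁻¹)| ≤
      exp (l / 2) * (C * (exp (l / 2) * l ^ 3 * log l ^ 2)) := by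
  obtain ⟨CD, hCD, hD⟩ := integral_dyadic_le
  obtain ⟨Z, hZ, hz0⟩ := norm_zK_le_of_abs_im_le
  obtain ⟨C1, hC1, hz⟩ := norm_zK_le
  obtain ⟨C2, hC2, hH⟩ := norm_HH_near_le
  set D := ‖qq 1‖ / (1 / 4) ^ 2 + ‖deriv qq 1‖ / (1 / 4)
  have hD0 : 0 ≤ D := by positivity
  set C0 := 12 * (Z ^ 2 * C2 + D) + 6 * (D + 1) + 24 * (C1 ^ 2 * C2 + D)
  refine ⟨CD * (2 * C0), by positivity, fun l hl X hX hXl => ?_⟩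
  have hl0 : 0 < l := by linarith
  have hl2 : 1 ≤ l ^ 2 := one_le_pow₀ (by linarith)
  set σ : ℝ := 1 / 2 + 1 / l with hσdef
  have hlinv : 1 / l ≤ 1 / 4 := one_div_le_one_div_of_le (by norm_num) hl
  have hσ : 1 / 2 < σ := by linarith [one_div_pos.2 hl0]
  have hσ3 : σ ≤ 3 / 4 := by linarith
  have hσ0 : 0 < σ := by linarith
  set R := exp (l / 2)
  have hR0 : 0 < R := exp_pos _
  have hXR : 0 < X + R := by linarith
  set f : ℝ → ℂ := fun t => FF (σ + t * I) *
    (rieszKernel (X + R) (σ + t * I) - rieszKernel X (σ + t * I)) with hf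
  have hfi1 := integrable_FF_mul_rieszKernel hσ (by linarith) hXR
  have hfi2 := integrable_FF_mul_rieszKernel hσ (by linarith) hX
  have hfi : Integrable f := (hfi1.sub hfi2).congr (Eventually.of_forall fun t => by
    simp only [hf, Pi.sub_apply]
    ring)
  have hpow : (X + R) ^ σ ≤ 6 * R := two_exp_rpow_le (by linarith) hXR.le hXl
  have hker1 : ∀ t : ℝ, ‖rieszKernel (X + R) (σ + t * I) - rieszKernel X (σ + t * I)‖ ≤
      6 * R * R / ‖(σ : ℂ) + t * I‖ := fun t =>
    (norm_rieszKernel_sub_le hσ0 hX hR0.le).trans (by gcongr)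
  have hhalf : ∀ t : ℝ, 1 / 2 ≤ ‖(σ : ℂ) + t * I‖ := fun t => by
    have := abs_re_le_norm ((σ : ℂ) + t * I)
    simp only [add_re, ofReal_re, mul_re, I_re, mul_zero, ofReal_im, I_im, mul_one, sub_self,
      add_zero] at this
    linarith [le_abs_self σ]
  have hquarter : ∀ t : ℝ, 1 / 4 ≤ ‖((σ : ℂ) + t * I) - 1‖ := fun t => by
    have := abs_re_le_norm (((σ : ℂ) + t * I) - 1)
    simp only [sub_re, add_re, ofReal_re, mul_re, I_re, mul_zero, ofReal_im, I_im, mul_one, sub_self,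
      add_zero, one_re] at this
    linarith [neg_abs_le (σ - 1)]
  have hFF : ∀ t : ℝ, ‖FF (σ + t * I)‖ ≤ ‖zK (σ + t * I)‖ ^ 2 * ‖HH (σ + t * I)‖ + D := fun t =>
    norm_FF_le (by norm_num) (hquarter t)
  have hHl : ∀ t : ℝ, ‖HH (σ + t * I)‖ ≤ C2 * l ^ 2 := hH l (by linarith)
  have b1 : ∀ t : ℝ, |t| ≤ 3 → ‖f t‖ ≤ R * C0 * (R * l ^ 2) := by
    intro t ht
    rw [hf, norm_mul]
    have k1 : ‖rieszKernel (X + R) (σ + t * I) - rieszKernel X (σ + t * I)‖ ≤ 12 * R * R := by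
      refine (hker1 t).trans ?_
      rw [div_le_iff₀ (by linarith [hhalf t])]
      nlinarith [hhalf t, mul_pos hR0 hR0]
    have k2 : ‖FF (σ + t * I)‖ ≤ (Z ^ 2 * C2 + D) * l ^ 2 := by
      refine (hFF t).trans ?_
      have k3 : ‖zK (σ + t * I)‖ ^ 2 * ‖HH (σ + t * I)‖ ≤ Z ^ 2 * (C2 * l ^ 2) := by
        have := hz0 σ t hσ.le hσ3 ht
        have := hHl t
        gcongr
      nlinarith
    calc _ ≤ ((Z ^ 2 * C2 + D) * l ^ 2) * (12 * R * R) :=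
          mul_le_mul k2 k1 (norm_nonneg _) (by positivity)
      _ = R * (12 * (Z ^ 2 * C2 + D)) * (R * l ^ 2) := by ring
      _ ≤ _ := by
        refine mul_le_mul_of_nonneg_right (mul_le_mul_of_nonneg_left ?_ hR0.le) (by positivity)
        have : 0 ≤ 6 * (D + 1) + 24 * (C1 ^ 2 * C2 + D) := by positivity
        linarith
  have b2 : ∀ t : ℝ, 3 ≤ |t| → ‖f t‖ ≤ R * C0 * (R / |t| *
      (‖zK (σ + t * I)‖ ^ 2 * ‖HH (σ + t * I)‖ + 1)) := by
    intro t ht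
    have ht0 : 0 < |t| := by linarith
    rw [hf, norm_mul]
    have k1 : ‖rieszKernel (X + R) (σ + t * I) - rieszKernel X (σ + t * I)‖ ≤ 6 * R * R / |t| := by
      refine (hker1 t).trans ?_
      exact div_le_div_of_nonneg_left (by positivity) ht0 (norm_le_line σ t)
    have hG : 0 ≤ ‖zK (σ + t * I)‖ ^ 2 * ‖HH (σ + t * I)‖ := by positivity
    calc _ ≤ ((D + 1) * (‖zK (σ + t * I)‖ ^ 2 * ‖HH (σ + t * I)‖ + 1)) * (6 * R * R / |t|) := by
          refine mul_le_mul ((hFF t).trans ?_) k1 (norm_nonneg _) (by positivity)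
          nlinarith
      _ = R * (6 * (D + 1)) *
          (R / |t| * (‖zK (σ + t * I)‖ ^ 2 * ‖HH (σ + t * I)‖ + 1)) := by ring
      _ ≤ _ := by
        refine mul_le_mul_of_nonneg_right (mul_le_mul_of_nonneg_left ?_ hR0.le) (by positivity)
        have : 0 ≤ 12 * (Z ^ 2 * C2 + D) + 24 * (C1 ^ 2 * C2 + D) := by positivity
        linarith
  have b3 : ∀ t : ℝ, 3 ≤ |t| → ‖f t‖ ≤ R * C0 * (exp l * l ^ 2 * |t| ^ (-(27 / 25) : ℝ)) := by
    intro t ht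
    have ht0 : 0 < |t| := by linarith
    rw [hf, norm_mul]
    have k1 : ‖rieszKernel (X + R) (σ + t * I) - rieszKernel X (σ + t * I)‖ ≤
        24 * R * exp l / |t| ^ 2 := by
      refine (norm_rieszKernel_sub_le' hσ0 hX hR0.le (abs_pos.1 ht0)).trans ?_
      refine div_le_div_of_nonneg_right ?_ (by positivity)
      rw [Real.rpow_add_one hXR.ne']
      have := mul_le_mul hpow hXl hXR.le (by positivity)
      linarith
    have h1t : 1 ≤ |t| ^ (23 / 25 : ℝ) := one_le_rpow (by linarith) (by norm_num)
    have k2 : ‖FF (σ + t * I)‖ ≤ (C1 ^ 2 * C2 + D) * (l ^ 2 * |t| ^ (23 / 25 : ℝ)) := by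
      have k3 : ‖zK (σ + t * I)‖ ^ 2 ≤ C1 ^ 2 * |t| ^ (23 / 25 : ℝ) := by
        have := pow_le_pow_left₀ (norm_nonneg _) (hz σ t hσ.le (by linarith) (by linarith)) 2
        rw [mul_pow, ← rpow_natCast (|t| ^ (23 / 50 : ℝ)), ← rpow_mul ht0.le] at this
        norm_num at this
        exact this
      have k4 : ‖zK (σ + t * I)‖ ^ 2 * ‖HH (σ + t * I)‖ ≤
          C1 ^ 2 * |t| ^ (23 / 25 : ℝ) * (C2 * l ^ 2) :=
        mul_le_mul k3 (hHl t) (norm_nonneg _) (by positivity)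
      have k5 : D ≤ D * (l ^ 2 * |t| ^ (23 / 25 : ℝ)) :=
        le_mul_of_one_le_right hD0 (one_le_mul_of_one_le_of_one_le hl2 h1t)
      linarith [hFF t]
    have e1 : |t| ^ (-(27 / 25) : ℝ) = |t| ^ (23 / 25 : ℝ) / |t| ^ 2 := by
      rw [← rpow_two, ← Real.rpow_sub ht0]; norm_num
    rw [e1]
    calc _ ≤ ((C1 ^ 2 * C2 + D) * (l ^ 2 * |t| ^ (23 / 25 : ℝ))) * (24 * R * exp l / |t| ^ 2) :=
          mul_le_mul k2 k1 (norm_nonneg _) (by positivity)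
      _ = R * (24 * (C1 ^ 2 * C2 + D)) * (exp l * l ^ 2 * (|t| ^ (23 / 25 : ℝ) / |t| ^ 2)) := by
          ring
      _ ≤ _ := by
        refine mul_le_mul_of_nonneg_right (mul_le_mul_of_nonneg_left ?_ hR0.le) (by positivity)
        have : 0 ≤ 12 * (Z ^ 2 * C2 + D) + 6 * (D + 1) := by positivity
        linarith
  have hmain := hD l (by linarith) (R * (2 * C0)) (fun t => ‖f t‖ + ‖f (-t)‖) (by positivity)
    ((hfi.norm.add hfi.norm.comp_neg).integrableOn)
    (fun t h0 h3 => by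
      have ht : |t| ≤ 3 := by rwa [abs_of_pos h0]
      have h5 := b1 t ht
      have h6 := b1 (-t) (by rwa [abs_neg])
      linarith)
    (fun t h3 => by
      have ht : |t| = t := abs_of_pos (by linarith)
      have h5 := b2 t (by rwa [ht])
      have h6 := b2 (-t) (by rwa [abs_neg, ht])
      rw [abs_neg, norm_zK_neg, norm_HH_neg] at h6
      rw [ht] at h5 h6
      linarith)
    (fun t h3 => by
      have ht : |t| = t := abs_of_pos (by linarith)
      have h5 := b3 t (by rwa [ht])
      have h6 := b3 (-t) (by rwa [abs_neg, ht])
      rw [abs_neg] at h6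
      rw [ht] at h5 h6
      linarith)
  have hnorm : ‖∫ t, f t‖ ≤ ∫ t in Ioi 0, (‖f t‖ + ‖f (-t)‖) := by
    refine (norm_integral_le_integral_norm f).trans (le_of_eq ?_)
    rw [integral_add hfi.norm.integrableOn hfi.norm.comp_neg.integrableOn,
      integral_comp_neg_Ioi 0 (fun t => ‖f t‖), neg_zero, add_comm,
      intervalIntegral.integral_Iic_add_Ioi hfi.norm.integrableOn hfi.norm.integrableOn]
  have heq : (((smoothSum (X + R) - (X + R) * polarTent K c (X + R)⁻¹) -
      (smoothSum X - X * polarTent K c X⁻¹) : ℝ) : ℂ) = (1 / (2 * pi)) • ∫ t, f t := by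
    rw [ofReal_sub, smoothSum_sub_polar_eq hK hc hσ (by linarith) hXR,
      smoothSum_sub_polar_eq hK hc hσ (by linarith) hX, ← smul_sub, ← integral_sub hfi1 hfi2]
    congr 2
    ext t
    simp only [hf]
    ring
  rw [← norm_eq_abs, ← norm_real, heq, norm_smul, norm_of_nonneg (by positivity)]
  have hpi : 1 / (2 * pi) ≤ 1 := by
    rw [div_le_one (by positivity)]
    linarith [pi_gt_three]
  calc _ ≤ 1 * ∫ t in Ioi 0, (‖f t‖ + ‖f (-t)‖) :=
        mul_le_mul hpi hnorm (norm_nonneg _) zero_le_one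
    _ ≤ _ := by
      rw [one_mul]
      refine hmain.trans (le_of_eq ?_)
      ring

/-- `∑_{n ≤ X} aa(n)`. -/
noncomputable def summatoryAa (X : ℝ) : ℝ := ∑ n ∈ Icc 1 ⌊X⌋₊, (aa n : ℝ)

lemma smoothSum_eq_sum {X : ℝ} {M : ℕ} (hM : X ≤ M + 1) :
    smoothSum X = ∑ n ∈ Icc 1 M, (aa n : ℝ) * max (X - n) 0 := by
  refine tsum_eq_sum fun n hn => ?_
  rcases Nat.eq_zero_or_pos n with rfl | h0
  · simp
  · have h1 : (M : ℝ) + 1 ≤ n := by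
      rw [mem_Icc] at hn
      exact_mod_cast (show M + 1 ≤ n by omega)
    rw [max_eq_right (by linarith), mul_zero]

lemma summatoryAa_sandwich {X h : ℝ} (hX : 0 ≤ X) (hh : 0 ≤ h) :
    h * summatoryAa X ≤ smoothSum (X + h) - smoothSum X ∧
      smoothSum (X + h) - smoothSum X ≤ h * summatoryAa (X + h) := by
  have ha : ∀ n, (0 : ℝ) ≤ aa n := fun n => by exact_mod_cast aa_nonneg n
  have hf := Nat.lt_floor_add_one (X + h)
  rw [smoothSum_eq_sum (M := ⌊X + h⌋₊) hf.le, smoothSum_eq_sum (M := ⌊X + h⌋₊) (by linarith),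
    ← Finset.sum_sub_distrib]
  simp_rw [← mul_sub]
  constructor
  · have hsub : Icc 1 ⌊X⌋₊ ⊆ Icc 1 ⌊X + h⌋₊ :=
      Finset.Icc_subset_Icc le_rfl (Nat.floor_le_floor (by linarith))
    rw [summatoryAa, mul_sum]
    refine le_trans (sum_le_sum fun n hn => ?_) (Finset.sum_le_sum_of_subset_of_nonneg hsub
      fun n _ _ => mul_nonneg (ha n) (sub_nonneg.2 (max_le_max (by linarith) le_rfl)))
    have hn' : (n : ℝ) ≤ X := (Nat.le_floor_iff hX).1 (mem_Icc.1 hn).2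
    rw [max_eq_left (by linarith), max_eq_left (by linarith)]
    linarith
  · rw [summatoryAa, mul_sum]
    refine sum_le_sum fun n _ => ?_
    rw [mul_comm]
    refine mul_le_mul_of_nonneg_right ?_ (ha n)
    rcases le_total (X - n) 0 with h1 | h1
    · rw [max_eq_right h1, sub_zero]
      exact max_le (by linarith) hh
    · rw [max_eq_left h1, max_eq_left (by linarith)]
      linarith

lemma hasDerivAt_polar_main {K c y : ℝ} (hy : 0 < y) :
    HasDerivAt (fun y : ℝ => K * (y * log y - y + 1) + c * (y - 1)) (K * log y + c) y := by
  have h1 := ((((hasDerivAt_id y).mul (Real.hasDerivAt_log hy.ne')).sub (hasDerivAt_id y)).add_const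
    (1 : ℝ)).const_mul K
  have h2 := ((hasDerivAt_id y).sub_const (1 : ℝ)).const_mul c
  refine (h1.add h2).congr_deriv ?_
  simp only [id_eq]
  field_simp
  ring

lemma hasDerivAt_polar {K c y : ℝ} (hy : 0 < y) :
    HasDerivAt (fun y : ℝ => K * (y ^ 2 * log y / 2 - 3 * y ^ 2 / 4 + y - 1 / 4) +
      c * (y - 1) ^ 2 / 2) (K * (y * log y - y + 1) + c * (y - 1)) y := by
  have h1 := ((((((hasDerivAt_id y).pow 2).mul (Real.hasDerivAt_log hy.ne')).div_const 2).sub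
    ((((hasDerivAt_id y).pow 2).const_mul 3).div_const 4)).add (hasDerivAt_id y)).sub_const
    (1 / 4 : ℝ) |>.const_mul K
  have h2 := ((((hasDerivAt_id y).sub_const (1 : ℝ)).pow 2).const_mul c).div_const 2
  refine (h1.add h2).congr_deriv ?_
  simp only [id_eq, Pi.pow_apply]
  field_simp
  ring

lemma mul_polarTent_inv {K c y : ℝ} (hy : 1 ≤ y) : y * polarTent K c y⁻¹ =
    K * (y ^ 2 * log y / 2 - 3 * y ^ 2 / 4 + y - 1 / 4) + c * (y - 1) ^ 2 / 2 := by
  rw [polarTent, if_pos (inv_le_one_of_one_le₀ hy), Real.log_inv, inv_inv]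
  have : y ≠ 0 := by positivity
  field_simp
  ring

lemma polar_diff_le {K c x h X : ℝ} (hX : 1 ≤ X) (hh : 0 ≤ h) (h1 : X ≤ x) (h2 : x ≤ X + h) :
    |((X + h) * polarTent K c (X + h)⁻¹ - X * polarTent K c X⁻¹) -
      h * (K * (x * log x - x + 1) + c * (x - 1))| ≤
      h * (h * (|K| * log (X + h) + |c|)) := by
  set L := |K| * log (X + h) + |c|
  have hx : x ∈ Set.Icc X (X + h) := ⟨h1, h2⟩
  set P : ℝ → ℝ := fun y => K * (y * log y - y + 1) + c * (y - 1)
  have hL0 : 0 ≤ L := by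
    have := log_nonneg (show (1 : ℝ) ≤ X + h by linarith)
    positivity
  have hPx : ∀ y ∈ Set.Icc X (X + h), ‖P y - P x‖ ≤ h * L := by
    intro y hy
    have := Convex.norm_image_sub_le_of_norm_hasDerivWithin_le (f := P)
      (f' := fun y => K * log y + c) (C := L) (s := Set.Icc X (X + h))
      (fun z hz => (hasDerivAt_polar_main (by linarith [hz.1])).hasDerivWithinAt)
      (fun z hz => by
        have hz1 : 1 ≤ z := hX.trans hz.1
        refine (norm_add_le _ _).trans (add_le_add ?_ le_rfl)
        rw [norm_mul, norm_eq_abs, norm_of_nonneg (log_nonneg hz1)]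
        exact mul_le_mul_of_nonneg_left (log_le_log (by linarith) hz.2) (abs_nonneg _))
      (convex_Icc _ _) hx hy
    refine this.trans ?_
    rw [mul_comm]
    refine mul_le_mul_of_nonneg_right ?_ hL0
    rw [norm_eq_abs, abs_le]
    exact ⟨by linarith [hy.1], by linarith [hy.2]⟩
  have key := Convex.norm_image_sub_le_of_norm_hasDerivWithin_le
    (f := fun y : ℝ => (K * (y ^ 2 * log y / 2 - 3 * y ^ 2 / 4 + y - 1 / 4) +
      c * (y - 1) ^ 2 / 2) - y * P x) (f' := fun y => P y - 1 * P x) (C := h * L)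
    (s := Set.Icc X (X + h))
    (fun z hz => ((hasDerivAt_polar (by linarith [hz.1])).sub
      ((hasDerivAt_id z).mul_const (P x))).hasDerivWithinAt)
    (fun z hz => by rw [one_mul]; exact hPx z hz)
    (convex_Icc _ _) (x := X) (y := X + h) ⟨le_rfl, by linarith⟩ ⟨by linarith, le_rfl⟩
  rw [add_sub_cancel_left, norm_eq_abs, norm_of_nonneg hh, ← mul_polarTent_inv hX,
    ← mul_polarTent_inv (by linarith : 1 ≤ X + h)] at key
  convert key using 1
  · congr 1
    ring
  · ring

lemma summatoryAa_asymptotic {K c : ℝ} (hK : (K : ℂ) = qq 1) (hc : (c : ℂ) = deriv qq 1) :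
    ∃ C, 0 < C ∧ ∀ l : ℝ, 4 ≤ l → |summatoryAa (exp l) -
      (K * (exp l * l - exp l + 1) + c * (exp l - 1))| ≤
      C * (exp (l / 2) * l ^ 3 * log l ^ 2) := by
  obtain ⟨C, hC, hE⟩ := smoothSum_sub_polar_diff_le hK hc
  refine ⟨C + (2 * |K| + |c|), by positivity, fun l hl => ?_⟩
  set R := exp (l / 2) with hR
  have hR2 : exp l = R * R := by rw [hR, ← exp_add]; congr 1; ring
  have hR3 : 3 ≤ R := by
    have := add_one_le_exp (l / 2)
    linarith
  have hR0 : 0 < R := by linarith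
  set x := exp l
  have hxR : 3 * R ≤ x := by rw [hR2]; nlinarith
  have hlx : log x = l := Real.log_exp l
  have hlog : 1 < log l := one_lt_log (by linarith)
  have hw : l ≤ l ^ 3 * log l ^ 2 := by
    have h1 : l ^ 1 ≤ l ^ 3 := pow_le_pow_right₀ (by linarith) (by norm_num)
    rw [pow_one] at h1
    exact h1.trans (le_mul_of_one_le_right (by positivity) (one_le_pow₀ hlog.le))
  set W := l ^ 3 * log l ^ 2 with hW
  set P := K * (x * l - x + 1) + c * (x - 1)
  have hlog2 : log (x + R) ≤ 2 * l := by
    calc log (x + R) ≤ log (2 * x) := log_le_log (by positivity) (by linarith)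
      _ = log 2 + l := by rw [log_mul two_ne_zero (by positivity), hlx]
      _ ≤ 2 * l := by linarith [Real.log_two_lt_d9]
  have hdiff : ∀ X, 1 ≤ X → X ≤ x → x ≤ X + R →
      |(smoothSum (X + R) - smoothSum X) - R * P| ≤ R * ((C + (2 * |K| + |c|)) * (R * W)) := by
    intro X h1 h2 h3
    have hE' := hE l hl X (by linarith) (by linarith)
    have hP' := polar_diff_le (K := K) (c := c) h1 hR0.le h2 h3
    rw [hlx] at hP'
    have hb : |K| * log (X + R) + |c| ≤ (2 * |K| + |c|) * W := by
      have k1 : log (X + R) ≤ 2 * W :=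
        (log_le_log (by linarith) (by linarith)).trans (hlog2.trans (by linarith))
      have k2 : 1 ≤ W := by linarith
      nlinarith [mul_le_mul_of_nonneg_left k1 (abs_nonneg K),
        mul_le_mul_of_nonneg_left k2 (abs_nonneg c)]
    have hb2 := mul_le_mul_of_nonneg_left (mul_le_mul_of_nonneg_left hb hR0.le) hR0.le
    rw [mul_assoc R (l ^ 3), ← hW] at hE'
    calc _ = |((smoothSum (X + R) - (X + R) * polarTent K c (X + R)⁻¹) -
          (smoothSum X - X * polarTent K c X⁻¹)) +
          (((X + R) * polarTent K c (X + R)⁻¹ - X * polarTent K c X⁻¹) - R * P)| := by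
            congr 1; ring
      _ ≤ R * (C * (R * W)) + R * (R * ((2 * |K| + |c|) * W)) :=
          (abs_add_le _ _).trans (add_le_add hE' (hP'.trans hb2))
      _ = _ := by ring
  have hup := (abs_le.1 (hdiff x (by linarith) le_rfl (by linarith))).2
  have hlo := (abs_le.1 (hdiff (x - R) (by linarith) (by linarith) (by linarith))).1
  have hs1 := (summatoryAa_sandwich (X := x) (h := R) (by linarith) hR0.le).1
  have hs2 := (summatoryAa_sandwich (X := x - R) (h := R) (by linarith) hR0.le).2
  rw [sub_add_cancel] at hlo hs2
  rw [mul_assoc R, ← hW, abs_le]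
  constructor
  · refine le_of_mul_le_mul_left ?_ hR0
    linarith
  · refine le_of_mul_le_mul_left ?_ hR0
    linarith

lemma im_deriv_eq_zero {f : ℂ → ℂ} (hf : ∀ s, f (conj s) = conj (f s)) {x : ℂ}
    (hx : conj x = x) : (deriv f x).im = 0 := by
  have h : conj ∘ f ∘ conj = f := by
    ext s
    simp [hf]
  have h2 := congrFun (deriv_conj_conj (f := f)) x
  rw [h] at h2
  simp only [Function.comp_apply, hx] at h2
  exact conj_eq_iff_im.1 h2.symm

lemma qq_one : qq 1 = ((pi / 4 : ℝ) : ℂ) ^ 2 * HH 1 := by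
  rw [qq, zz_one, LL_one, one_pow, one_mul]

lemma deriv_qq_one : deriv qq 1 = qq 1 * (2 * (Real.eulerMascheroniConstant : ℂ) +
    8 * deriv LL 1 / pi + deriv HH 1 / HH 1) := by
  have hH : HH 1 ≠ 0 := GG_one_ne_zero_factors.1
  have hpi : (pi : ℂ) ≠ 0 := ofReal_ne_zero.2 pi_ne_zero
  have h := ((zz_hasDerivAt_one.pow 2).mul ((LL_differentiable 1).hasDerivAt.pow 2)).mul
    (HH_analyticAt (s := 1) (by norm_num)).differentiableAt.hasDerivAt
  have h2 : deriv qq 1 = _ := h.deriv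
  rw [h2, qq_one]
  simp only [Pi.pow_apply, Pi.mul_apply, zz_one, LL_one]
  push_cast
  field_simp
  ring

lemma im_qq_one : (qq 1).im = 0 ∧ (deriv qq 1).im = 0 := by
  have h1 : (HH 1).im = 0 := by
    have h := HH_conj 1
    rw [map_one] at h
    exact conj_eq_iff_im.1 h.symm
  have h2 := im_deriv_eq_zero HH_conj (map_one _)
  have h3 := im_deriv_eq_zero LL_conj (map_one _)
  have e1 : HH 1 = ((HH 1).re : ℂ) := ext (by simp) (by simp [h1])
  have e2 : deriv HH 1 = ((deriv HH 1).re : ℂ) := ext (by simp) (by simp [h2])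
  have e3 : deriv LL 1 = ((deriv LL 1).re : ℂ) := ext (by simp) (by simp [h3])
  have e4 : qq 1 = (((pi / 4) ^ 2 * (HH 1).re : ℝ) : ℂ) := by
    rw [qq_one, e1]
    push_cast
    simp
  have e5 : deriv qq 1 = (((pi / 4) ^ 2 * (HH 1).re * (2 * Real.eulerMascheroniConstant +
      8 * (deriv LL 1).re / pi + (deriv HH 1).re / (HH 1).re) : ℝ) : ℂ) := by
    rw [deriv_qq_one, e4, e1, e2, e3]
    push_cast
    simp
  exact ⟨by rw [e4, ofReal_im], by rw [e5, ofReal_im]⟩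

/-- The number of integer solutions of `u² + v² = w³` with `w ≤ x`, explicitly:
`A x log x + B x + O(x^{1/2} (log x)³ (log log x)²)` with `A = 9 G(1)/(π² Cat)`,
`B = A (8 L′(1,χ₋₄)/π − 1 + 2γ + G′(1)/G(1) − 2 L′(2,χ₋₄)/Cat − 24 ζ′(2)/π²)`,
where `Cat` is Catalan's constant, and `G(1)`, `g = G′(1)/G(1)` are the explicit
Euler products/sums over primes `≡ 1, 3 (mod 4)`. -/
theorem count_sum_two_squares_cubes
    (χ : DirichletCharacter ℂ 4) (hχ : χ ≠ 1)
    (G1 g Cat : ℝ)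
    (hG1 : G1 = 8 / 9 *
      (∏' p : {p : Nat.Primes // p.1 % 4 = 1},
        (p.1.1 : ℝ) ^ 3 * ((p.1.1 : ℝ) + 2) /
          (((p.1.1 : ℝ) - 1) * ((p.1.1 : ℝ) + 1) ^ 3)) *
      (∏' p : {p : Nat.Primes // p.1 % 4 = 3},
        (p.1.1 : ℝ) ^ 4 / ((p.1.1 : ℝ) ^ 4 - 1)))
    (hg : g = -(1 / 3) * Real.log 2
      - 6 * (∑' p : {p : Nat.Primes // p.1 % 4 = 1},
          Real.log (p.1.1 : ℝ) / (((p.1.1 : ℝ) + 1) * ((p.1.1 : ℝ) - 1) * ((p.1.1 : ℝ) + 2)))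
      - 4 * (∑' p : {p : Nat.Primes // p.1 % 4 = 3},
          Real.log (p.1.1 : ℝ) / ((p.1.1 : ℝ) ^ 4 - 1)))
    (hCat : Cat = ∑' j : ℕ, (-1 : ℝ) ^ j / (2 * (j : ℝ) + 1) ^ 2)
    (A B : ℂ)
    (hA : A = 9 * (G1 : ℂ) / ((Real.pi : ℂ) ^ 2 * (Cat : ℂ)))
    (hB : B = A * (8 * deriv (DirichletCharacter.LFunction χ) 1 / (Real.pi : ℂ)
      - 1 + 2 * (Real.eulerMascheroniConstant : ℂ) + (g : ℂ)
      - 2 * deriv (DirichletCharacter.LFunction χ) 2 / (Cat : ℂ)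
      - 24 * deriv riemannZeta 2 / (Real.pi : ℂ) ^ 2)) :
    (fun x : ℝ =>
        (Nat.card {t : ℤ × ℤ × ℤ //
            t.1 ^ 2 + t.2.1 ^ 2 = t.2.2 ^ 3 ∧ (t.2.2 : ℝ) ≤ x} : ℂ)
        - (A * x * Real.log x + B * x)) =O[atTop]
      fun x : ℝ => x ^ ((1 : ℝ) / 2) * Real.log x ^ 3
        * Real.log (Real.log x) ^ 2 := by
  have hpi : (pi : ℂ) ≠ 0 := ofReal_ne_zero.2 pi_ne_zero
  obtain ⟨hH, hL2⟩ := GG_one_ne_zero_factors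
  have hχL : DirichletCharacter.LFunction χ = LL := by rw [dirichletCharacter_four_eq hχ]; rfl
  rw [hχL, show (g : ℂ) = logDeriv GG 1 by rw [logDeriv_GG_one, hg]] at hB
  rw [show (G1 : ℂ) = GG 1 by rw [GG_one, hG1], GG_one_expand] at hA
  rw [show (Cat : ℂ) = LL 2 by rw [LL_two, hCat]] at hA hB
  obtain ⟨hi1, hi2⟩ := im_qq_one
  set K := (qq 1).re with hKdef
  set c := (deriv qq 1).re with hcdef
  have hK : (K : ℂ) = qq 1 := ext (by simp [hKdef]) (by simp [hi1])
  have hc : (c : ℂ) = deriv qq 1 := ext (by simp [hcdef]) (by simp [hi2])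
  have hAK : A = 4 * K := by
    rw [hA, hK, qq_one]
    push_cast
    field_simp
    norm_num
  have hBc : B = 4 * (c - K) := by
    rw [hB, hAK, hc, deriv_qq_one, logDeriv_HH_one, hK]
    ring
  obtain ⟨C, hC, hS⟩ := summatoryAa_asymptotic hK hc
  refine IsBigO.of_bound (4 * C + (1 + 4 * |K| + 4 * |c|)) ?_
  filter_upwards [eventually_ge_atTop (exp 4)] with x hx
  have hx0 : 0 < x := (exp_pos _).trans_le hx
  set l := log x
  have hl4 : 4 ≤ l := (Real.le_log_iff_exp_le hx0).2 hx
  have hxl : x = exp l := (exp_log hx0).symm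
  have hR : x ^ (1 / 2 : ℝ) = exp (l / 2) := by
    rw [rpow_def_of_pos hx0]
    congr 1
    ring
  have hR1 : 1 ≤ exp (l / 2) := Real.one_le_exp (by linarith)
  have hlog : 1 < log l := one_lt_log (by linarith)
  have hcard : (Nat.card {t : ℤ × ℤ × ℤ //
      t.1 ^ 2 + t.2.1 ^ 2 = t.2.2 ^ 3 ∧ (t.2.2 : ℝ) ≤ x} : ℂ) = ((1 + 4 * summatoryAa x : ℝ) : ℂ) := by
    have h := congrArg (Int.cast : ℤ → ℂ) (card_solutions x hx0.le)
    rw [Int.cast_natCast] at h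
    rw [h, summatoryAa]
    push_cast
    rfl
  have hsplit : (Nat.card {t : ℤ × ℤ × ℤ //
      t.1 ^ 2 + t.2.1 ^ 2 = t.2.2 ^ 3 ∧ (t.2.2 : ℝ) ≤ x} : ℂ) - (A * x * l + B * x) =
      ((4 * (summatoryAa x - (K * (x * l - x + 1) + c * (x - 1))) + (1 + 4 * K - 4 * c) : ℝ) : ℂ) := by
    rw [hcard, hAK, hBc]
    push_cast
    ring
  have hb := hS l hl4
  rw [← hxl, mul_assoc (exp (l / 2))] at hb
  have hW : 1 ≤ exp (l / 2) * (l ^ 3 * log l ^ 2) :=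
    one_le_mul_of_one_le_of_one_le hR1 (one_le_mul_of_one_le_of_one_le
      (one_le_pow₀ (by linarith)) (one_le_pow₀ hlog.le))
  rw [hsplit, norm_real, norm_eq_abs, norm_eq_abs, hR, mul_assoc (exp (l / 2)),
    abs_of_nonneg (zero_le_one.trans hW)]
  have h1 : |1 + 4 * K - 4 * c| ≤ 1 + 4 * |K| + 4 * |c| := by
    rw [abs_le]
    constructor <;> linarith [le_abs_self K, neg_abs_le K, le_abs_self c, neg_abs_le c]
  refine (abs_add_le _ _).trans ?_
  rw [abs_mul, abs_of_pos (by norm_num : (0 : ℝ) < 4), add_mul]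
  have h2 := le_mul_of_one_le_right (show 0 ≤ 1 + 4 * |K| + 4 * |c| by positivity) hW
  linarith
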